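/- Let ∂G be piecewise analytic, with the smallest exterior angle λπ, 0 < λ < 2, at the junction points of its analytic arcs. If F ⊂ G is compact, then there is a constant C₁(G,F) > 0, depending only on G and F, such that for every ζ ∈ F and every n ∈ ℕ: ‖K(·,ζ) − Σ_{k=0}^n conj(p_k(ζ))·p_k(·)‖₂ ≤ C₁(G,F) · n^{−λ/(4−2λ)}. -/

import Mathlib

open Complex MeasureTheory Set Filter Metric

noncomputable section

/-- A bounded Jordan domain `G ⊆ ℂ` whose boundary is a rectifiable Jordan curve
of length `l`, given together with a unit-speed (arclength) parametrization `γ`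
of the boundary curve `L = frontier G`. -/
structure JordanDomain where
  /-- the domain -/
  G : Set ℂ
  isOpen : IsOpen G
  nonempty : G.Nonempty
  bounded : Bornology.IsBounded G
  connected : IsConnected G
  simplyConnected : SimplyConnectedSpace ↥G
  /-- the length of the boundary curve -/
  l : ℝ
  l_pos : 0 < l
  /-- arclength parametrization of the boundary curve -/
  γ : ℝ → ℂ
  γ_cont : Continuous γ
  γ_periodic : Function.Periodic γ l
  γ_injOn : InjOn γ (Ico 0 l)
  γ_boundary : γ '' Ico 0 l = frontier G
  /-- `γ` is a unit-speed (arclength) parametrization; in particular the boundary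
  is rectifiable with length `l`. -/
  γ_unitSpeed : ∀ s t : ℝ, s ≤ t → t ≤ s + l →
    eVariationOn γ (Icc s t) = ENNReal.ofReal (t - s)

/-- The `E₂(G)`-norm of (the boundary trace of) a function, computed through the
arclength parametrization of the boundary: `‖g‖₂ = ((1/l) ∫₀^l ‖g(s)‖² ds)^{1/2}`. -/
def JordanDomain.bnorm (D : JordanDomain) (g : ℝ → ℂ) : ℝ :=
  Real.sqrt ((1 / D.l) * ∫ s in (0:ℝ)..D.l, ‖g s‖ ^ 2)

/-- `p` is the sequence of orthonormal polynomials of `E₂(G)` obtained by Gram–Schmidt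
orthonormalization of the monomials `1, z, z², …`: `deg p k = k`, the leading
coefficients are positive reals, and the polynomials are orthonormal with respect to
the arclength inner product `(f,g) = (1/l) ∫_L f conj(g) |dz|`. -/
def JordanDomain.IsONPolys (D : JordanDomain) (p : ℕ → Polynomial ℂ) : Prop :=
  (∀ k, (p k).natDegree = k) ∧
  (∀ k, ∃ c : ℝ, 0 < c ∧ (p k).leadingCoeff = (c : ℂ)) ∧
  (∀ j k, (1 / (D.l : ℂ)) * (∫ s in (0:ℝ)..D.l,
      (p j).eval (D.γ s) * (starRingEnd ℂ) ((p k).eval (D.γ s))) =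
    if j = k then 1 else 0)

/-- The `n`-th partial sum `Σ_{k=0}^n conj(p_k(ζ))·p_k(z)` of the Szegő kernel expansion. -/
def partialSum (p : ℕ → Polynomial ℂ) (ζ : ℂ) (n : ℕ) : ℂ → ℂ := fun z =>
  ∑ k ∈ Finset.range (n + 1), (starRingEnd ℂ) ((p k).eval ζ) * (p k).eval z

/-- The Szegő kernel `K(z,ζ) = Σ_{k=0}^∞ conj(p_k(ζ))·p_k(z)`. -/
def szegoKernel (p : ℕ → Polynomial ℂ) (ζ z : ℂ) : ℂ :=
  ∑' k : ℕ, (starRingEnd ℂ) ((p k).eval ζ) * (p k).eval z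

/-- The approximating polynomials
`J_{2n+1}(z) = (2π/l)·(∫_ζ^z (Σ_{k=0}^n conj(p_k(ζ))p_k(t))² dt) / (Σ_{k=0}^n |p_k(ζ)|²)`;
the (path-independent) integral of the polynomial integrand is written out explicitly,
using `∫_ζ^z t^i dt = (z^{i+1} - ζ^{i+1})/(i+1)`. -/
def Jfun (D : JordanDomain) (p : ℕ → Polynomial ℂ) (ζ : ℂ) (n : ℕ) : ℂ → ℂ := fun z =>
  let S : Polynomial ℂ :=
    (∑ k ∈ Finset.range (n + 1), Polynomial.C ((starRingEnd ℂ) ((p k).eval ζ)) * p k) ^ 2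
  (((2 * Real.pi / D.l : ℝ) : ℂ) / (∑ k ∈ Finset.range (n + 1), ((‖(p k).eval ζ‖ : ℂ)) ^ 2)) *
    ∑ i ∈ Finset.range (S.natDegree + 1),
      S.coeff i * ((z ^ (i + 1) - ζ ^ (i + 1)) / ((i : ℂ) + 1))

/-- `Q_n(z) = ((l/2π)·Σ_{k=0}^n |p_k(ζ)|²)^{-1/2} · Σ_{k=0}^n conj(p_k(ζ))·p_k(z)`,
so that `J'_{2n+1} = Q_n²`. -/
def Qfun (D : JordanDomain) (p : ℕ → Polynomial ℂ) (ζ : ℂ) (n : ℕ) : ℂ → ℂ := fun z =>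
  ((Real.sqrt ((D.l / (2 * Real.pi)) *
      ∑ k ∈ Finset.range (n + 1), ‖(p k).eval ζ‖ ^ 2) : ℝ) : ℂ)⁻¹ * partialSum p ζ n z

/-- The sup norm `⨆_{z ∈ K} ‖f(z)‖` on a set `K ⊆ ℂ`. -/
def supNormOn (K : Set ℂ) (f : ℂ → ℂ) : ℝ := ⨆ z : K, ‖f (z : ℂ)‖

/-- `g` has nontangential limit `v` at the boundary point `w` of `G`:
`g(z) → v` as `z → w` inside every cone `{z ∈ G : ‖z - w‖ ≤ M·dist(z, ∂G)}`. -/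
def NTLim (G : Set ℂ) (g : ℂ → ℂ) (w v : ℂ) : Prop :=
  ∀ M : ℝ, 1 < M →
    Tendsto g (nhdsWithin w {z | z ∈ G ∧ ‖z - w‖ ≤ M * infDist z (frontier G)}) (nhds v)

/-- `φ` is the conformal map of `G` onto the unit disk `D` normalized by
`φ(ζ) = 0` and `φ'(ζ) > 0`. -/
structure ConformalOnto (G : Set ℂ) (φ : ℂ → ℂ) (ζ : ℂ) : Prop where
  differentiable : ∀ z ∈ G, DifferentiableAt ℂ φ z
  bijOn : BijOn φ G (ball (0 : ℂ) 1)
  map_center : φ ζ = 0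
  deriv_center_pos : ∃ c : ℝ, 0 < c ∧ deriv φ ζ = (c : ℂ)

/-- `G` is a Smirnov domain: for any conformal map `ψ` of the unit disk onto `G`,
`log|ψ'|` is represented by the Poisson integral of its (radial) boundary values.
(By the Keldysh–Lavrentiev theorem this is equivalent to polynomials being dense
in the Smirnov classes `E_p(G)`.) -/
def IsSmirnovDomain (G : Set ℂ) : Prop :=
  ∀ ψ : ℂ → ℂ,
    (∀ w ∈ ball (0 : ℂ) 1, DifferentiableAt ℂ ψ w) →
    BijOn ψ (ball (0 : ℂ) 1) G →
    ∃ h : ℝ → ℝ,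
      IntervalIntegrable h volume 0 (2 * Real.pi) ∧
      (∀ᵐ (θ : ℝ) ∂(volume.restrict (Ioc (0 : ℝ) (2 * Real.pi))),
        Tendsto (fun r : ℝ => Real.log ‖deriv ψ ((r : ℂ) * Complex.exp ((θ : ℂ) * Complex.I))‖)
          (nhdsWithin 1 (Iio 1)) (nhds (h θ))) ∧
      (∀ w ∈ ball (0 : ℂ) 1,
        Real.log ‖deriv ψ w‖ =
          (1 / (2 * Real.pi)) * ∫ θ in (0 : ℝ)..(2 * Real.pi),
            ((1 - ‖w‖ ^ 2) / ‖Complex.exp ((θ : ℂ) * Complex.I) - w‖ ^ 2) * h θ)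

/-- The (interior) opening angle of `G` at the boundary point `z₀` equals `a`:
the angular measure of the set of directions in which `G` is seen from `z₀`
at distance `r` tends to `a` as `r → 0⁺`. -/
def HasCornerAngle (G : Set ℂ) (z₀ : ℂ) (a : ℝ) : Prop :=
  Tendsto (fun r : ℝ =>
      (volume {θ : ℝ | θ ∈ Ico 0 (2 * Real.pi) ∧
        z₀ + (r : ℂ) * Complex.exp ((θ : ℂ) * Complex.I) ∈ G}).toReal)
    (nhdsWithin 0 (Ioi 0)) (nhds a)

/-- The boundary of the Jordan domain `D` is piecewise analytic: it is a union of
finitely many analytic arcs `τ i '' [0,1]` (each `τ i` is conformal, i.e. injective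
and holomorphic, on an open neighborhood `U i` of the segment `[0,1]`), consecutive
arcs are joined at the junction points `τ i 1 = τ (i+1) 0`, and at the junction
point `τ i 1` the exterior angle of `G` is `extAngle i · π` (so the interior
opening angle there is `(2 - extAngle i) · π`). -/
structure PiecewiseAnalyticBoundary (D : JordanDomain) where
  /-- number of analytic arcs -/
  m : ℕ
  m_pos : 0 < m
  /-- conformal parametrizations of the arcs -/
  τ : Fin m → ℂ → ℂ
  /-- neighborhoods of the segment `[0,1]` on which the `τ i` are conformal -/
  U : Fin m → Set ℂ
  U_open : ∀ i, IsOpen (U i)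
  seg_sub : ∀ i, (Complex.ofReal '' Icc (0 : ℝ) 1) ⊆ U i
  analytic : ∀ i, DifferentiableOn ℂ (τ i) (U i)
  inj : ∀ i, InjOn (τ i) (U i)
  cover : (⋃ i, τ i '' (Complex.ofReal '' Icc (0 : ℝ) 1)) = frontier D.G
  junction : ∀ i : Fin m,
    τ i 1 = τ (Fin.mk ((i.val + 1) % m) (Nat.mod_lt _ m_pos)) 0
  /-- `extAngle i · π` is the exterior angle at the junction point `τ i 1` -/
  extAngle : Fin m → ℝ
  extAngle_mem : ∀ i, extAngle i ∈ Ioo (0 : ℝ) 2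
  extAngle_spec : ∀ i, HasCornerAngle D.G (τ i 1) ((2 - extAngle i) * Real.pi)

end



open Topology
open scoped Real
local notation "IcU" => Icc (0:ℝ) 1
local notation "IoU" => Ioo (0:ℝ) 1
local notation "IqU" => Ioc (0:ℝ) 1
local notation "voU" => volume.restrict (Icc (0:ℝ) 1)
local notation "nhR" => 𝓝[>] (0:ℝ)
local notation "cosR" => Real.cos
local notation "sinR" => Real.sin
local notation "expR" => Real.exp
local notation "logR" => Real.log
local notation "arctanR" => Real.arctan
local notation "eoR" => ENNReal.ofReal
local notation "qd(" x ")" => x * (1 - x)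
local notation "mhR" => (-(1 / 2) : ℝ)
noncomputable section
namespace SZ
variable {G F X : Set ℂ} {ν : Measure ℂ} {lam : ℝ} {c0 u : ℂ} {b : ℝ} {x r η d : ℝ} {z ω w t : ℂ} {f h : ℂ → ℂ} {O : Set ℂ}
lemma qpos (h : x ∈ IoU) : 0 < x * (1 - x) := mul_pos h.1 (sub_pos.2 h.2)
def lens (η : ℝ) : Set ℂ := {ω | |ω.im| ≤ η * (ω.re * (1 - ω.re))}
def pth (s x : ℝ) : ℂ := ⟨x, s * qd(x)⟩
def dpth (s x : ℝ) : ℂ := ⟨1, s * (1 - 2 * x)⟩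
def PI (s : ℝ) (f : ℂ → ℂ) : ℂ := ∫ x in (0:ℝ)..1, f (pth s x) * dpth s x
lemma pth_eq (s : ℝ) : pth s = fun x : ℝ => (x : ℂ) + ((s * qd(x) : ℝ) : ℂ) * I := by
  funext x; apply Complex.ext <;> simp [pth]
lemma dpth_eq (s : ℝ) : dpth s = fun x : ℝ => (1 : ℂ) + ((s * (1 - 2 * x) : ℝ) : ℂ) * I := by
  funext x; apply Complex.ext <;> simp [dpth]
lemma pth_cont (s : ℝ) : Continuous (pth s) := by rw [pth_eq]; fun_prop
lemma dpth_cont (s : ℝ) : Continuous (dpth s) := by rw [dpth_eq]; fun_prop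
lemma pth_deriv (s x : ℝ) : HasDerivAt (pth s) (dpth s x) x := by
  rw [pth_eq, dpth_eq]
  have h1 : HasDerivAt (fun x : ℝ => s * qd(x)) (s * (1 - 2 * x)) x := by
    have := ((hasDerivAt_id x).mul ((hasDerivAt_id x).const_sub 1)).const_mul s
    refine this.congr_deriv ?_
    simp only [id]; ring
  have h2 := (h1.ofReal_comp).mul_const I
  have h3 := (hasDerivAt_id x).ofReal_comp
  exact (h3.add h2).congr_deriv (by simp)
lemma pth_zero (x : ℝ) : pth 0 x = x := by apply Complex.ext <;> simp [pth]
lemma dpth_zero (x : ℝ) : dpth 0 x = 1 := by apply Complex.ext <;> simp [dpth]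
lemma pth_at0 (s : ℝ) : pth s 0 = 0 := by apply Complex.ext <;> simp [pth]
lemma pth_at1 (s : ℝ) : pth s 1 = 1 := by apply Complex.ext <;> simp [pth]
lemma conj_pth (s x : ℝ) : (starRingEnd ℂ) (pth s x) = pth (-s) x := by
  apply Complex.ext <;> simp [pth]
lemma conj_dpth (s x : ℝ) : (starRingEnd ℂ) (dpth s x) = dpth (-s) x := by
  apply Complex.ext <;> simp [dpth]
lemma pth_mem {s : ℝ} (hs : |s| ≤ η) (hx : x ∈ IcU) : pth s x ∈ lens η := by
  have h : 0 ≤ x * (1 - x) := mul_nonneg hx.1 (by linarith [hx.2])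
  simp only [lens, pth, mem_ofPred_eq, abs_mul s, abs_of_nonneg h]
  gcongr
lemma ofReal_mem_lens (hη : 0 ≤ η) (hx : x ∈ IcU) : (x : ℂ) ∈ lens η := by
  have := pth_mem (s := 0) (η := η) (by simpa using hη) hx
  rwa [pth_zero] at this
lemma conj_mem_lens (h : ω ∈ lens η) : (starRingEnd ℂ) ω ∈ lens η := by
  simpa [lens] using h
lemma lens_re (hη : 0 < η) (h : ω ∈ lens η) : ω.re ∈ IcU := by
  have h1 : 0 ≤ ω.re * (1 - ω.re) := by
    have h' : |ω.im| ≤ η * (ω.re * (1 - ω.re)) := h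
    have := (abs_nonneg _).trans h'
    exact nonneg_of_mul_nonneg_right this hη
  constructor <;> nlinarith
lemma lens_closed (η : ℝ) : IsClosed (lens η) :=
  isClosed_le (by fun_prop) (by fun_prop)
lemma lens_compact (hη : 0 < η) : IsCompact (lens η) := by
  refine Metric.isCompact_of_isClosed_isBounded (lens_closed η) ?_
  refine (Metric.isBounded_closedBall (x := (0:ℂ)) (r := 1 + η)).subset fun ω h => ?_
  have h1 := lens_re hη h
  have h2 : |ω.im| ≤ η * (ω.re * (1 - ω.re)) := h
  have h3 : ω.re * (1 - ω.re) ≤ 1 := by nlinarith [h1.1, h1.2]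
  have h4 := Complex.norm_le_abs_re_add_abs_im ω
  rw [mem_closedBall, dist_zero_right]
  have : |ω.re| ≤ 1 := abs_le.2 ⟨by linarith [h1.1], h1.2⟩
  nlinarith
lemma lens_convex (hη : 0 < η) : Convex ℝ (lens η) := by
  have h1 : ConvexOn ℝ univ (fun ω : ℂ => |ω.im| - η * (ω.re * (1 - ω.re))) := by
    refine ⟨convex_univ, fun x _ y _ a b ha hb hab => ?_⟩
    have h2 : |a * x.im + b * y.im| ≤ a * |x.im| + b * |y.im| := by
      refine (abs_add_le _ _).trans ?_
      rw [abs_mul, abs_mul, abs_of_nonneg ha, abs_of_nonneg hb]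
    simp only [smul_eq_mul, add_re, real_smul, mul_re, ofReal_re, ofReal_im, zero_mul, sub_zero,
      add_im, mul_im, add_zero]
    have hb' : b = 1 - a := by linarith
    subst hb'
    nlinarith [mul_nonneg hη.le (mul_nonneg (mul_nonneg ha hb) (sq_nonneg (x.re - y.re)))]
  have := h1.convex_le 0
  convert this using 1
  ext ω; simp [lens]
lemma exists_convex_nhd {K : Set ℂ} (hK : IsCompact K) (hc : Convex ℝ K) (hO : IsOpen O)
    (h : K ⊆ O) : ∃ V, IsOpen V ∧ Convex ℝ V ∧ K ⊆ V ∧ V ⊆ O := by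
  obtain ⟨δ, hδ, h1⟩ := hK.exists_thickening_subset_open hO h
  exact ⟨thickening δ K, isOpen_thickening, hc.thickening δ, self_subset_thickening hδ K, h1⟩
lemma exists_prim (hO : IsOpen O) (hc : Convex ℝ O)
    (hf : DifferentiableOn ℂ f O) : ∃ g, ∀ z ∈ O, HasDerivAt g (f z) z := by
  obtain ⟨g, hg⟩ := hc.exists_forall_hasDerivWithinAt hf
  exact ⟨g, fun z hz => (hg z hz).hasDerivAt (hO.mem_nhds hz)⟩
lemma PI_of_prim {s : ℝ} {g : ℂ → ℂ}
    (hg : ∀ x ∈ IcU, HasDerivAt g (f (pth s x)) (pth s x))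
    (hf : ContinuousOn (fun x => f (pth s x)) (Icc 0 1)) : PI s f = g 1 - g 0 := by
  rw [PI, intervalIntegral.integral_eq_sub_of_hasDerivAt (f := fun x => g (pth s x))]
  · rw [pth_at0, pth_at1]
  · intro x hx
    rw [uIcc_of_le zero_le_one] at hx
    exact (hg x hx).comp x (pth_deriv s x)
  · apply ContinuousOn.intervalIntegrable
    rw [uIcc_of_le zero_le_one]
    exact hf.mul (dpth_cont s).continuousOn
lemma PI_eq {s : ℝ} (hη : 0 < η) (hs : |s| ≤ η) (hO : IsOpen O) (hl : lens η ⊆ O) (hf : DifferentiableOn ℂ f O) : PI s f = PI 0 f := by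
  obtain ⟨V, hV, hVc, h1, h2⟩ := exists_convex_nhd (lens_compact hη) (lens_convex hη) hO hl
  obtain ⟨g, hg⟩ := exists_prim hV hVc (hf.mono h2)
  have key : ∀ s : ℝ, |s| ≤ η → PI s f = g 1 - g 0 := fun s hs =>
    PI_of_prim (fun x hx => hg _ (h1 (pth_mem hs hx)))
      ((hf.continuousOn).comp (pth_cont s).continuousOn fun x hx => hl (pth_mem hs hx))
  rw [key s hs, key 0 (by simpa using hη.le)]
lemma PI_inv {x0 : ℝ} (hη : 0 < η) (hx : x0 ∈ IoU) :
    PI (-η) (fun ω => (ω - x0)⁻¹) - PI η (fun ω => (ω - x0)⁻¹) = 2 * π * I := by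
  have h1 : ∀ x ∈ IcU, I * (pth (-η) x - x0) ∈ slitPlane := by
    intro x hx'
    rw [mem_slitPlane_iff]
    simp only [pth, mul_re, mul_im, I_re, I_im, sub_re, sub_im, ofReal_re, ofReal_im]
    by_cases h0 : x = x0
    · left; subst h0; nlinarith [qpos hx, mul_pos hη (qpos hx)]
    · right; intro h; apply h0; linarith
  have h2 : PI (-η) (fun ω => (ω - x0)⁻¹) = log (I * (1 - x0)) - log (I * (0 - x0)) := by
    refine PI_of_prim (g := fun ω => log (I * (ω - x0))) (fun x hx' => ?_) ?_
    · have h3 : HasDerivAt (fun ω : ℂ => I * (ω - x0)) I (pth (-η) x) := by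
        simpa using ((hasDerivAt_id (pth (-η) x)).sub_const (x0:ℂ)).const_mul I
      convert h3.clog (h1 x hx') using 1
      rw [div_mul_eq_div_div, div_self I_ne_zero, one_div]
    · refine ContinuousOn.inv₀ (by have := pth_cont (-η); fun_prop) fun x hx' h => ?_
      have := h1 x hx'; rw [h, mul_zero] at this; simp at this
  have h4 : PI η (fun ω => (ω - x0)⁻¹) = (starRingEnd ℂ) (PI (-η) (fun ω => (ω - x0)⁻¹)) := by
    simp only [PI]
    rw [← intervalIntegral.intervalIntegral_conj]
    congr 1; funext x
    simp only [map_mul, map_inv₀, map_sub, conj_pth, conj_dpth, neg_neg, conj_ofReal]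
  rw [h4, Complex.sub_conj, h2]
  have e1 : (log (I * (1 - x0))).im = π / 2 := by
    rw [log_im, mul_comm, show (1 - x0 : ℂ) = ((1 - x0 : ℝ) : ℂ) by push_cast; rfl,
      arg_real_mul I (by linarith [hx.2]), arg_I]
  have e2 : (log (I * (0 - x0))).im = -(π / 2) := by
    rw [log_im, show I * (0 - x0 : ℂ) = (x0 : ℂ) * (-I) by ring, arg_real_mul _ hx.1, arg_neg_I]
  rw [sub_im, e1, e2]; push_cast; ring
def PA (X : Set ℂ) (f : ℂ → ℂ) : Prop :=
  ∀ ε : ℝ, 0 < ε → ∃ P : Polynomial ℂ, ∀ z ∈ X, ‖f z - P.eval z‖ ≤ ε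
def Sec (lam : ℝ) : Set ℂ := {w | w ≠ 0 ∧ |arg w| < lam * π / 2}
def Zl (c0 u : ℂ) (b : ℝ) (w : ℂ) : ℂ := c0 + u * (w / (1 + w / b))
structure Dat (G : Set ℂ) (ν : Measure ℂ) (lam : ℝ) (F : Set ℂ) where
  m : ℕ
  m_pos : 0 < m
  τ : Fin m → ℂ → ℂ
  N : Set ℂ
  η : ℝ
  c : ℝ
  C : ℝ
  G_open : IsOpen G
  G_conn : IsPreconnected G
  G_bdd : Bornology.IsBounded G
  N_open : IsOpen N
  η_pos : 0 < η
  η_le : η ≤ 1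
  c_pos : 0 < c
  C_pos : 0 < C
  lens_sub : lens η ⊆ N
  hol : ∀ j, DifferentiableOn ℂ (τ j) N
  bil : ∀ j, ∀ ω ∈ N, ∀ ω' ∈ N, c * ‖ω - ω'‖ ≤ ‖τ j ω - τ j ω'‖
  dbd : ∀ j, ∀ ω ∈ lens η, ‖deriv (τ j) ω‖ ≤ C
  up : ∀ j, ∀ ω ∈ lens η, 0 < ω.im → τ j ω ∈ G
  lo : ∀ j, ∀ ω ∈ lens η, ω.im < 0 → τ j ω ∉ closure G
  ext : ∀ j, ∀ ω ∈ lens η, ω.im < 0 → PA (closure G) (fun z => (z - τ j ω)⁻¹)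
  sep : ∀ j, ∀ ω ∈ lens η, ∀ t ∈ frontier G, c * |ω.im| ≤ ‖t - τ j ω‖
  onL : ∀ j, ∀ x ∈ IcU, τ j x ∈ frontier G
  disj : ∀ i j, ∀ x ∈ IoU, ∀ y ∈ IcU, τ i x = τ j y → i = j
  meas : ν = ∑ j, Measure.map (fun x : ℝ => τ j x)
    ((voU).withDensity (fun x => ‖deriv (τ j) x‖ₑ))
  chain : ∀ f : ℂ → ℂ, ∑ j, (f (τ j 1) - f (τ j 0)) = 0
  sq : ∀ j, ∀ ω ∈ lens η, 0 < (deriv (τ j) ω * (starRingEnd ℂ) (deriv (τ j) ((starRingEnd ℂ) ω))).re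
  F_sub : F ⊆ G
  F_comp : IsCompact F
  avoid : ∀ j, ∀ ω ∈ lens η, τ j ω ∉ F
  corner : ∀ j, ∀ e : ℝ, (e = 0 ∨ e = 1) → ∃ (u : ℂ) (b : ℝ), ‖u‖ = 1 ∧ 0 < b ∧
    (∀ w ∈ Sec lam, Zl (τ j e) u b w ∉ closure G ∧
      PA (closure G) (fun z => (z - Zl (τ j e) u b w)⁻¹)) ∧
    τ j e + u * b ∉ closure G ∧ PA (closure G) (fun z => (z - (τ j e + u * b))⁻¹) ∧
    ∃ δ c1 C1 x1 : ℝ, 0 < δ ∧ 0 < c1 ∧ 0 < C1 ∧ 0 < x1 ∧ x1 < 1 ∧ ∀ x ∈ Ioo 0 x1, ∃ w : ℂ,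
      c1 * x ≤ ‖w‖ ∧ ‖w‖ ≤ C1 * x ∧ |arg w| ≤ lam * π / 2 - δ ∧
      Zl (τ j e) u b w = τ j (pth (-η) (|e - x|))
namespace Dat
variable (D : Dat G ν lam F) (j : Fin D.m)
lemma real_mem (hx : x ∈ IcU) : (x : ℂ) ∈ D.N :=
  D.lens_sub (ofReal_mem_lens D.η_pos.le hx)
lemma dne {j : Fin D.m} (hω : ω ∈ D.N) : D.c ≤ ‖deriv (D.τ j) ω‖ := by
  have h := ((D.hol j).differentiableAt (D.N_open.mem_nhds hω)).hasDerivAt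
  have h1 := h.tendsto_slope.norm
  refine ge_of_tendsto h1 ?_
  filter_upwards [self_mem_nhdsWithin, nhdsWithin_le_nhds (D.N_open.mem_nhds hω)] with w hw hw'
  have h0 : 0 < ‖w - ω‖ := norm_pos_iff.2 (sub_ne_zero.2 hw)
  rw [slope_def_field, norm_div, le_div_iff₀ h0]
  exact D.bil j w hw' ω hω
lemma inj {j : Fin D.m} {ω' : ℂ} (h : ω ∈ D.N) (h' : ω' ∈ D.N) (he : D.τ j ω = D.τ j ω') :
    ω = ω' := by
  have := D.bil j ω h ω' h'
  rw [he, sub_self, norm_zero] at this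
  have h2 : ‖ω - ω'‖ ≤ 0 := by
    by_contra h3; push Not at h3; nlinarith [D.c_pos]
  exact sub_eq_zero.1 (norm_le_zero_iff.1 h2)
lemma dcont : ContinuousOn (deriv (D.τ j)) D.N :=
  ((D.hol j).deriv D.N_open).continuousOn
lemma cont_real : ContinuousOn (fun x : ℝ => D.τ j x) (Icc 0 1) :=
  (D.hol j).continuousOn.comp continuous_ofReal.continuousOn fun _ hx => D.real_mem hx
lemma dcont_real : ContinuousOn (fun x : ℝ => deriv (D.τ j) x) (Icc 0 1) :=
  (D.dcont j).comp continuous_ofReal.continuousOn fun _ hx => D.real_mem hx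
def μ : Measure ℝ :=
  (voU).withDensity (fun x => ‖deriv (D.τ j) x‖ₑ)
lemma daem :
    AEMeasurable (fun x : ℝ => deriv (D.τ j) x) voU :=
  (D.dcont_real j).aemeasurable measurableSet_Icc
lemma μ_ac : D.μ j ≪ voU := withDensity_absolutelyContinuous _ _
lemma τaem : AEMeasurable (fun x : ℝ => D.τ j x) (D.μ j) :=
  ((D.cont_real j).aemeasurable measurableSet_Icc).mono_ac (D.μ_ac j)
lemma μ_le : D.μ j ≤ eoR D.C • voU := by
  rw [← withDensity_const]
  refine withDensity_mono ?_
  filter_upwards [ae_restrict_mem measurableSet_Icc] with x hx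
  rw [← ofReal_norm]
  exact ENNReal.ofReal_le_ofReal (D.dbd j _ (ofReal_mem_lens D.η_pos.le hx))
lemma le_μ : eoR D.c • voU ≤ D.μ j := by
  rw [← withDensity_const]
  refine withDensity_mono ?_
  filter_upwards [ae_restrict_mem measurableSet_Icc] with x hx
  rw [← ofReal_norm]
  exact ENNReal.ofReal_le_ofReal (D.dne (D.real_mem hx))
lemma ac_μ : voU ≪ D.μ j := by
  refine Measure.AbsolutelyContinuous.mk fun s _ h0 => ?_
  have := (D.le_μ j s).trans h0.le
  simp only [Measure.smul_apply, smul_eq_mul, nonpos_iff_eq_zero, mul_eq_zero,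
    ENNReal.ofReal_eq_zero] at this
  rcases this with h | h
  · linarith [D.c_pos]
  · exact h
lemma μ_fin : IsFiniteMeasure (D.μ j) := by
  refine ⟨(D.μ_le j univ).trans_lt ?_⟩
  simp
lemma ν_fin (D : Dat G ν lam F) : IsFiniteMeasure ν := by
  have h : ∀ j, IsFiniteMeasure (Measure.map (fun x : ℝ => D.τ j x) (D.μ j)) := fun j => by
    have := D.μ_fin j; infer_instance
  rw [D.meas]
  refine ⟨?_⟩
  rw [Measure.finsetSum_apply]
  exact ENNReal.sum_lt_top.2 fun j _ => (h j).measure_univ_lt_top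
lemma map_le : Measure.map (fun x : ℝ => D.τ j x) (D.μ j) ≤ ν := by
  refine le_of_le_of_eq ?_ D.meas.symm
  exact Finset.single_le_sum (f := fun j => Measure.map (fun x : ℝ => D.τ j x) (D.μ j))
    (fun _ _ => Measure.zero_le _) (Finset.mem_univ j)
lemma ae_of_real {p : ℂ → Prop} (hp : MeasurableSet {t | p t})
    (h : ∀ j, ∀ᵐ x : ℝ ∂voU, p (D.τ j x)) : ∀ᵐ t ∂ν, p t := by
  rw [D.meas, ae_iff, Measure.finsetSum_apply, Finset.sum_eq_zero_iff]
  intro j _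
  have := (ae_map_iff (D.τaem j) hp).2 ((D.μ_ac j).ae_le (h j))
  exact this
lemma lint {f : ℂ → ENNReal} (hf : AEMeasurable f ν) :
    ∫⁻ t, f t ∂ν = ∑ j, ∫⁻ x in IcU, ‖deriv (D.τ j) x‖ₑ * f (D.τ j x) := by
  have h0 : ∀ j, AEMeasurable f (Measure.map (fun x : ℝ => D.τ j x) (D.μ j)) := fun j =>
    hf.mono_measure (D.map_le j)
  conv_lhs => rw [D.meas]
  rw [lintegral_finsetSum_measure]
  refine Finset.sum_congr rfl fun j _ => ?_
  have h1 := lintegral_map' (h0 j) (D.τaem j)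
  rw [Dat.μ] at h1
  rw [h1, lintegral_withDensity_eq_lintegral_mul₀ (D.daem j).enorm]
  · rfl
  · exact ((h0 j).comp_aemeasurable (D.τaem j)).mono_ac (D.ac_μ j)
lemma int_piece (hf : Integrable f ν) (j : Fin D.m) :
    IntegrableOn (fun x : ℝ => (‖deriv (D.τ j) x‖ : ℂ) * f (D.τ j x)) IcU := by
  have h1 : Integrable f (Measure.map (fun x : ℝ => D.τ j x) (D.μ j)) := hf.mono_measure (D.map_le j)
  have h2 := (integrable_map_measure h1.1 (D.τaem j)).1 h1
  rw [Dat.μ] at h2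
  have h3 := (integrable_withDensity_iff_integrable_smul₀' (D.daem j).enorm
    (by simp)).1 h2
  simpa [IntegrableOn] using h3
lemma int_eq (hf : Integrable f ν) :
    ∫ t, f t ∂ν = ∑ j, ∫ x in (0:ℝ)..1, (‖deriv (D.τ j) x‖ : ℂ) * f (D.τ j x) := by
  have h1 : ∀ j, Integrable f (Measure.map (fun x : ℝ => D.τ j x) (D.μ j)) := fun j =>
    hf.mono_measure (D.map_le j)
  conv_lhs => rw [D.meas]
  rw [integral_finsetSum_measure (by exact fun j _ => h1 j)]
  refine Finset.sum_congr rfl fun j _ => ?_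
  have h2 := integral_map (D.τaem j) (h1 j).1
  rw [Dat.μ] at h2
  rw [h2, integral_withDensity_eq_integral_toReal_smul₀ (D.daem j).enorm (by simp),
    intervalIntegral.integral_of_le zero_le_one, integral_Icc_eq_integral_Ioc]
  simp
lemma ae_L (D : Dat G ν lam F) : ∀ᵐ t ∂ν, t ∈ frontier G := by
  refine D.ae_of_real isClosed_frontier.measurableSet fun j => ?_
  filter_upwards [ae_restrict_mem measurableSet_Icc] with x hx using D.onL j x hx
lemma ae_nc : ∀ᵐ t ∂ν, ∃ j, ∃ x ∈ IoU, t = D.τ j x := by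
  have hm : MeasurableSet {t | ∃ j, ∃ x ∈ IoU, t = D.τ j x} := by
    have : {t | ∃ j, ∃ x ∈ IoU, t = D.τ j x} = ⋃ j, (fun x : ℝ => D.τ j x) '' (Ioo 0 1) := by
      ext t; simp only [mem_iUnion, mem_image, mem_ofPred_eq]
      constructor
      · rintro ⟨j, x, hx, h⟩; exact ⟨j, x, hx, h.symm⟩
      · rintro ⟨j, x, hx, h⟩; exact ⟨j, x, hx, h.symm⟩
    rw [this]
    refine MeasurableSet.iUnion fun j => ?_
    refine measurableSet_Ioo.image_of_continuousOn_injOn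
      ((D.cont_real j).mono Ioo_subset_Icc_self) fun x hx y hy h => ?_
    exact_mod_cast D.inj (D.real_mem (Ioo_subset_Icc_self hx)) (D.real_mem (Ioo_subset_Icc_self hy)) h
  refine D.ae_of_real hm fun j => ?_
  have : voU = volume.restrict IoU :=
    Measure.restrict_congr_set Ioo_ae_eq_Icc.symm
  rw [this]
  filter_upwards [ae_restrict_mem measurableSet_Ioo] with x hx using ⟨j, x, hx, rfl⟩
end Dat
def nrm {α : Type*} [MeasurableSpace α] (μ : Measure α) (h : α → ℂ) : ℝ := √(∫ t, ‖h t‖ ^ 2 ∂μ)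
lemma nrm_nonneg {α : Type*} [MeasurableSpace α] (μ : Measure α) (h : α → ℂ) : 0 ≤ nrm μ h := Real.sqrt_nonneg _
lemma CS {α : Type*} [MeasurableSpace α] {μ : Measure α} {h g : α → ℂ} (hh : MemLp h 2 μ) (hg : MemLp g 2 μ) :
    Integrable (fun t => h t * g t) μ ∧ ∫ t, ‖h t * g t‖ ∂μ ≤ nrm μ h * nrm μ g := by
  refine ⟨MemLp.integrable_mul hh hg, ?_⟩
  have := integral_mul_norm_le_Lp_mul_Lq (μ := μ) (f := h) (g := g) (p := 2) (q := 2)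
    (by constructor <;> norm_num) (by simpa using hh) (by simpa using hg)
  simp only [nrm, norm_mul, Real.sqrt_eq_rpow]
  convert this using 5 <;> norm_cast
lemma CSn {α : Type*} [MeasurableSpace α] {μ : Measure α} {h g : α → ℂ} (hh : MemLp h 2 μ) (hg : MemLp g 2 μ) :
    ‖∫ t, h t * g t ∂μ‖ ≤ nrm μ h * nrm μ g :=
  (norm_integral_le_integral_norm _).trans (CS hh hg).2
lemma lint_inv {a x0 : ℝ} (hd : 0 < d) (ha : 0 < a) :
    ∫⁻ x : ℝ, eoR (2 * (d ^ 2 + (a * (x - x0)) ^ 2)⁻¹) ≤ eoR (2 * π / (a * d)) := by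
  have e : ∀ x : ℝ, 2 * (d ^ 2 + (a * (x - x0)) ^ 2)⁻¹ = 2 / d ^ 2 * (1 + ((a / d) * (x - x0)) ^ 2)⁻¹ := by
    intro x
    field_simp
  simp_rw [e]
  have i1 : Integrable (fun x : ℝ => (1 + ((a / d) * (x - x0)) ^ 2)⁻¹) := by
    have := (integrable_inv_one_add_sq.comp_mul_left' (R := a / d) (by positivity)).comp_sub_right x0
    exact this
  rw [← ofReal_integral_eq_lintegral_ofReal (i1.const_mul _) (ae_of_all _ fun x => by positivity)]
  apply ENNReal.ofReal_le_ofReal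
  rw [integral_const_mul, integral_sub_right_eq_self (fun x : ℝ => (1 + ((a / d) * x) ^ 2)⁻¹) x0,
    Measure.integral_comp_mul_left (fun x : ℝ => (1 + x ^ 2)⁻¹) (a / d), integral_univ_inv_one_add_sq,
    abs_of_pos (by positivity), smul_eq_mul]
  apply le_of_eq
  field_simp
namespace Dat
variable (D : Dat G ν lam F) (j : Fin D.m)
def A : ℝ := D.m * (D.C * (2 * π / (D.c / 2)))
lemma A_nonneg : 0 ≤ D.A := by
  have := D.C_pos; have := D.c_pos; unfold A; positivity
lemma ahlfors (hd : 0 < d) (hz : ∀ t ∈ frontier G, d ≤ ‖t - z‖) :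
    MemLp (fun t => (t - z)⁻¹) 2 ν ∧ nrm ν (fun t => (t - z)⁻¹) ≤ √(D.A / d) := by
  have := D.ν_fin
  have hm : Measurable fun t : ℂ => (t - z)⁻¹ := by fun_prop
  refine ⟨MemLp.of_bound hm.aestronglyMeasurable d⁻¹ ?_, ?_⟩
  · filter_upwards [D.ae_L] with t ht
    rw [norm_inv]; exact inv_anti₀ hd (hz t ht)
  apply Real.sqrt_le_sqrt
  rw [integral_eq_lintegral_of_nonneg_ae (ae_of_all _ fun t => by positivity) (by fun_prop)]
  refine ENNReal.toReal_le_of_le_ofReal (div_nonneg D.A_nonneg hd.le) ?_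
  rw [D.lint (by fun_prop)]
  have key : ∀ j ∈ Finset.univ, ∫⁻ x in IcU, ‖deriv (D.τ j) x‖ₑ * eoR (‖(D.τ j x - z)⁻¹‖ ^ 2)
      ≤ eoR (D.C * (2 * π / (D.c / 2)) / d) := by
    intro j _
    obtain ⟨x0, hx0, hmin⟩ := isCompact_Icc.exists_isMinOn (nonempty_Icc.2 zero_le_one)
      (((D.cont_real j).sub continuousOn_const).norm (f := fun x : ℝ => D.τ j x - z))
    have hb : ∀ x ∈ IcU, ‖deriv (D.τ j) x‖ₑ * eoR (‖(D.τ j x - z)⁻¹‖ ^ 2) ≤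
        eoR D.C * eoR (2 * (d ^ 2 + (D.c / 2 * (x - x0)) ^ 2)⁻¹) := by
      intro x hx
      gcongr
      · rw [← ofReal_norm]
        exact ENNReal.ofReal_le_ofReal (D.dbd j _ (ofReal_mem_lens D.η_pos.le hx))
      · have h1 := hz _ (D.onL j x hx)
        have h2 : ‖D.τ j x0 - z‖ ≤ ‖D.τ j x - z‖ := hmin hx
        have h3 := D.bil j x (D.real_mem hx) x0 (D.real_mem hx0)
        have h4 : ‖D.τ j x - D.τ j x0‖ ≤ ‖D.τ j x - z‖ + ‖D.τ j x0 - z‖ := by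
          have := norm_sub_le (D.τ j x - z) (D.τ j x0 - z)
          simpa using this
        have h5 : ‖(x:ℂ) - x0‖ = |x - x0| := by rw [← ofReal_sub, norm_real, Real.norm_eq_abs]
        rw [h5] at h3
        have h6 : D.c / 2 * |x - x0| ≤ ‖D.τ j x - z‖ := by linarith
        have h7 : (D.c / 2 * (x - x0)) ^ 2 ≤ ‖D.τ j x - z‖ ^ 2 := by
          rw [← sq_abs (D.c / 2 * (x - x0)), abs_mul, abs_of_pos (by linarith [D.c_pos] : 0 < D.c / 2)]
          have := D.c_pos
          gcongr
        have h8 : d ^ 2 ≤ ‖D.τ j x - z‖ ^ 2 := by gcongr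
        rw [norm_inv, inv_pow, ← div_eq_mul_inv]
        have h9 : 0 < ‖D.τ j x - z‖ := hd.trans_le h1
        rw [inv_eq_one_div, div_le_div_iff₀ (by positivity) (by positivity)]
        linarith
    calc _ ≤ ∫⁻ x in IcU, eoR D.C * eoR (2 * (d ^ 2 + (D.c / 2 * (x - x0)) ^ 2)⁻¹) :=
          setLIntegral_mono' measurableSet_Icc hb
      _ ≤ ∫⁻ x : ℝ, eoR D.C * eoR (2 * (d ^ 2 + (D.c / 2 * (x - x0)) ^ 2)⁻¹) :=
          setLIntegral_le_lintegral _ _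
      _ = eoR D.C * ∫⁻ x : ℝ, eoR (2 * (d ^ 2 + (D.c / 2 * (x - x0)) ^ 2)⁻¹) := by
          rw [lintegral_const_mul _ (by fun_prop)]
      _ ≤ eoR D.C * eoR (2 * π / (D.c / 2 * d)) := by
          gcongr
          exact lint_inv hd (by linarith [D.c_pos])
      _ = _ := by
          rw [← ENNReal.ofReal_mul D.C_pos.le]
          congr 1
          have := D.c_pos
          field_simp
  refine (Finset.sum_le_sum key).trans ?_
  rw [Finset.sum_const, Finset.card_univ, Fintype.card_fin, nsmul_eq_mul, ← ENNReal.ofReal_natCast,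
    ← ENNReal.ofReal_mul (by positivity)]
  apply le_of_eq
  congr 1
  unfold A; ring
lemma cau_bd (hh : MemLp h 2 ν) (hd : 0 < d)
    (hz : ∀ t ∈ frontier G, d ≤ ‖t - z‖) :
    Integrable (fun t => h t * (t - z)⁻¹) ν ∧
      ∫ t, ‖h t * (t - z)⁻¹‖ ∂ν ≤ nrm ν h * √(D.A / d) := by
  obtain ⟨h1, h2⟩ := D.ahlfors hd hz
  obtain ⟨h3, h4⟩ := CS hh h1
  exact ⟨h3, h4.trans (mul_le_mul_of_nonneg_left h2 (nrm_nonneg _ _))⟩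
lemma loop_on (hO : IsOpen O) (hl : lens D.η ⊆ O) (hf : DifferentiableOn ℂ f O)
    (j : Fin D.m) {x0 : ℝ} (hx : x0 ∈ IoU) :
    PI (-D.η) (fun ω => f ω * deriv (D.τ j) ω * (D.τ j x0 - D.τ j ω)⁻¹) -
      PI D.η (fun ω => f ω * deriv (D.τ j) ω * (D.τ j x0 - D.τ j ω)⁻¹) =
    - (2 * π * I) * f x0 := by
  have hη := D.η_pos
  have hab : |D.η| ≤ D.η := (abs_of_pos hη).le
  have hab' : |-D.η| ≤ D.η := by rw [abs_neg]; exact hab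
  have hON : IsOpen (O ∩ D.N) := hO.inter D.N_open
  have hfd : DifferentiableOn ℂ (fun ω => f ω * deriv (D.τ j) ω) (O ∩ D.N) :=
    (hf.mono inter_subset_left).mul (((D.hol j).deriv D.N_open).mono inter_subset_right)
  have hxN : (x0 : ℂ) ∈ D.N := D.real_mem (Ioo_subset_Icc_self hx)
  have hxO : (x0 : ℂ) ∈ O ∩ D.N := ⟨hl (ofReal_mem_lens hη.le (Ioo_subset_Icc_self hx)), hxN⟩
  set q := dslope (D.τ j) x0 with hq
  have hqd : DifferentiableOn ℂ q (O ∩ D.N) :=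
    ((Complex.differentiableOn_dslope (D.N_open.mem_nhds hxN)).2 (D.hol j)).mono inter_subset_right
  have hq0 : ∀ ω ∈ O ∩ D.N, q ω ≠ 0 := by
    intro ω hω h0
    by_cases he : ω = x0
    · rw [hq, he, dslope_same] at h0
      have := D.dne (j := j) hxN
      rw [h0, norm_zero] at this; linarith [D.c_pos]
    · rw [hq, dslope_of_ne _ he, slope_def_field, div_eq_zero_iff] at h0
      rcases h0 with h0 | h0
      · exact he (D.inj hω.2 hxN (sub_eq_zero.1 h0))
      · exact he (sub_eq_zero.1 h0)
  set g : ℂ → ℂ := fun ω => f ω * deriv (D.τ j) ω / q ω with hg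
  have hgd : DifferentiableOn ℂ g (O ∩ D.N) := hfd.div hqd hq0
  have hgx : g x0 = f x0 := by
    have := hq0 _ hxO
    rw [hq, dslope_same] at this
    simp only [hg, hq, dslope_same]; field_simp
  have hdg : DifferentiableOn ℂ (dslope g x0) (O ∩ D.N) :=
    (Complex.differentiableOn_dslope (hON.mem_nhds hxO)).2 hgd
  have hpne : ∀ s : ℝ, s ≠ 0 → ∀ x ∈ IcU, pth s x ≠ x0 := by
    intro s hs x hx' he
    have h1 : x = x0 := by simpa [pth] using congrArg Complex.re he
    have h2 : s * qd(x) = 0 := by simpa [pth] using congrArg Complex.im he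
    subst h1
    rcases mul_eq_zero.1 h2 with h2 | h2
    · exact hs h2
    · nlinarith [hx.1, hx.2, qpos hx]
  have hdec : ∀ s : ℝ, |s| ≤ D.η → s ≠ 0 → PI s (fun ω => f ω * deriv (D.τ j) ω * (D.τ j x0 - D.τ j ω)⁻¹) =
      -(PI s (dslope g x0) + f x0 * PI s (fun ω => (ω - x0)⁻¹)) := by
    intro s hs hs0
    have hm : ∀ x ∈ IcU, pth s x ∈ O ∩ D.N := fun x hx' =>
      ⟨hl (pth_mem hs hx'), D.lens_sub (pth_mem hs hx')⟩
    simp only [PI]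
    rw [← intervalIntegral.integral_const_mul, ← intervalIntegral.integral_add, ← intervalIntegral.integral_neg]
    · refine intervalIntegral.integral_congr fun x hx' => ?_
      rw [uIcc_of_le zero_le_one] at hx'
      have hne := hpne s hs0 x hx'
      have hne' : pth s x - x0 ≠ 0 := sub_ne_zero.2 hne
      have hnt : D.τ j (pth s x) - D.τ j x0 ≠ 0 := fun h0 =>
        hne (D.inj (hm x hx').2 hxN (sub_eq_zero.1 h0))
      rw [dslope_of_ne _ hne, slope_def_field, hgx]
      have e : g (pth s x) = f (pth s x) * deriv (D.τ j) (pth s x) * ((pth s x - x0) / (D.τ j (pth s x) - D.τ j x0)) := by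
        simp only [hg, hq, dslope_of_ne _ hne, slope_def_field]
        field_simp
      rw [e]
      rw [← neg_sub (D.τ j (pth s x)) (D.τ j x0), inv_neg]
      field_simp
      ring
    · apply ContinuousOn.intervalIntegrable
      rw [uIcc_of_le zero_le_one]
      exact (hdg.continuousOn.comp (pth_cont s).continuousOn hm).mul (dpth_cont s).continuousOn
    · apply ContinuousOn.intervalIntegrable
      rw [uIcc_of_le zero_le_one]
      refine continuousOn_const.mul (ContinuousOn.mul (ContinuousOn.inv₀ (by have := pth_cont s; fun_prop) ?_) (dpth_cont s).continuousOn)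
      intro x hx'
      exact sub_ne_zero.2 (hpne s hs0 x hx')
  rw [hdec _ hab hη.ne', hdec _ hab' (by linarith), PI_eq hη hab hON (fun ω h => ⟨hl h, D.lens_sub h⟩) hdg,
    PI_eq hη hab' hON (fun ω h => ⟨hl h, D.lens_sub h⟩) hdg]
  linear_combination (- f x0) * PI_inv hη hx
lemma loop_off (hO : IsOpen O) (hl : lens D.η ⊆ O) (hf : DifferentiableOn ℂ f O)
    {i j : Fin D.m} (hij : i ≠ j) (hx : x ∈ IoU) (hxt : t = D.τ i x) :
    PI (-D.η) (fun ω => f ω * deriv (D.τ j) ω * (t - D.τ j ω)⁻¹) -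
      PI D.η (fun ω => f ω * deriv (D.τ j) ω * (t - D.τ j ω)⁻¹) = 0 := by
  have hη := D.η_pos
  have hab : |D.η| ≤ D.η := (abs_of_pos hη).le
  have hab' : |-D.η| ≤ D.η := by rw [abs_neg]; exact hab
  have hfd : DifferentiableOn ℂ (fun ω => f ω * deriv (D.τ j) ω) (O ∩ D.N) :=
    (hf.mono inter_subset_left).mul (((D.hol j).deriv D.N_open).mono inter_subset_right)
  have hO' : IsOpen ((O ∩ D.N) ∩ D.τ j ⁻¹' {t}ᶜ ) := by
    rw [inter_assoc]
    exact hO.inter ((D.hol j).continuousOn.isOpen_inter_preimage D.N_open isOpen_compl_singleton)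
  have hsub : lens D.η ⊆ (O ∩ D.N) ∩ D.τ j ⁻¹' {t}ᶜ := by
    intro ω hω
    refine ⟨⟨hl hω, D.lens_sub hω⟩, fun he => ?_⟩
    have he : D.τ j ω = t := he
    have h1 := D.sep j ω hω t (hxt ▸ D.onL i x (Ioo_subset_Icc_self hx))
    rw [he, sub_self, norm_zero] at h1
    have h2 : ω.im = 0 := by
      rw [← abs_eq_zero]
      exact le_antisymm (by nlinarith [D.c_pos]) (abs_nonneg _)
    have h3 : ω = (ω.re : ℂ) := by apply Complex.ext <;> simp [h2]
    have h4 := lens_re hη hω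
    have h5 := D.disj i j x hx ω.re h4 (by rw [← h3, ← hxt, he])
    exact hij h5
  have hd : DifferentiableOn ℂ (fun ω => f ω * deriv (D.τ j) ω * (t - D.τ j ω)⁻¹) ((O ∩ D.N) ∩ D.τ j ⁻¹' {t}ᶜ) := by
    refine (hfd.mono inter_subset_left).mul (DifferentiableOn.inv ?_ ?_)
    · exact (differentiableOn_const _).sub ((D.hol j).mono fun ω h => h.1.2)
    · intro ω hω h0; exact hω.2 (sub_eq_zero.1 h0).symm
  rw [PI_eq hη hab hO' hsub hd, PI_eq hη hab' hO' hsub hd]; simp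
end Dat
def Cau (ν : Measure ℂ) (h : ℂ → ℂ) (z : ℂ) : ℂ := ∫ t, h t * (t - z)⁻¹ ∂ν
lemma int_half : IntegrableOn (fun x : ℝ => (√qd(x))⁻¹) (Ioc 0 1) := by
  have h1 : IntegrableOn (fun x : ℝ => x ^ mhR) (Ioc 0 1) := by
    have := (intervalIntegral.intervalIntegrable_rpow' (a := 0) (b := 1) (r := -(1/2)) (by norm_num))
    rwa [intervalIntegrable_iff_integrableOn_Ioc_of_le zero_le_one] at this
  have h2 : IntegrableOn (fun x : ℝ => (1 - x) ^ mhR) (Ioc 0 1) := by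
    have := (intervalIntegral.intervalIntegrable_rpow' (a := 1) (b := 0) (r := -(1/2)) (by norm_num)).comp_sub_left 1
    simp only [sub_self, sub_zero] at this
    rwa [intervalIntegrable_iff_integrableOn_Ioc_of_le zero_le_one] at this
  refine ((h1.add h2).const_mul 2).mono' (by fun_prop) ?_
  have : ∀ᵐ x : ℝ, x ≠ 1 := by simp [ae_iff, measure_singleton]
  filter_upwards [ae_restrict_mem measurableSet_Ioc, ae_restrict_of_ae this] with x hx hx1
  have hx0 : 0 < x := hx.1
  have hx2 : 0 < 1 - x := sub_pos.2 (lt_of_le_of_ne hx.2 hx1)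
  have e : ∀ y : ℝ, 0 < y → y ^ mhR = (√y)⁻¹ := fun y hy => by
    rw [Real.rpow_neg hy.le, Real.sqrt_eq_rpow]
  simp only [Pi.add_apply]
  rw [e x hx0, e _ hx2, Real.norm_of_nonneg (by positivity), Real.sqrt_mul hx0.le]
  have hs := Real.sqrt_pos.2 hx0
  have hs' := Real.sqrt_pos.2 hx2
  have : (1:ℝ) ≤ 2 * (√x + √(1 - x)) := by
    by_contra hcon; push Not at hcon
    nlinarith [Real.sq_sqrt hx0.le, Real.sq_sqrt hx2.le]
  rw [inv_eq_one_div, div_le_iff₀ (by positivity)]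
  have : 2 * ((√x)⁻¹ + (√(1 - x))⁻¹) * (√x * √(1 - x)) =
      2 * (√x + √(1 - x)) := by field_simp; ring
  linarith
namespace Dat
variable (D : Dat G ν lam F) (j : Fin D.m)
lemma cau_norm (hh : MemLp h 2 ν) (hd : 0 < d)
    (hz : ∀ t ∈ frontier G, d ≤ ‖t - z‖) : ‖Cau ν h z‖ ≤ nrm ν h * √(D.A / d) :=
  (norm_integral_le_integral_norm _).trans (D.cau_bd hh hd hz).2
lemma fub (hh : MemLp h 2 ν) {a z : ℝ → ℂ} {d : ℝ → ℝ}
    (ha : AEStronglyMeasurable a (volume.restrict IqU))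
    (hz : AEMeasurable z (volume.restrict IqU))
    (hd : ∀ᵐ x ∂(volume.restrict IqU), 0 < d x ∧ ∀ t ∈ frontier G, d x ≤ ‖t - z x‖)
    (hi : IntegrableOn (fun x => ‖a x‖ * √(D.A / d x)) (Ioc 0 1)) :
    Integrable (fun t => h t * ∫ x in IqU, a x * (t - z x)⁻¹) ν ∧
    ∫ t, h t * (∫ x in IqU, a x * (t - z x)⁻¹) ∂ν = ∫ x in IqU, a x * Cau ν h (z x) := by
  have := D.ν_fin
  have hm : AEStronglyMeasurable (fun q : ℂ × ℝ => h q.1 * (a q.2 * (q.1 - z q.2)⁻¹))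
      (ν.prod (volume.restrict IqU)) := by
    refine (hh.1.comp_fst).mul ((ha.comp_snd).mul ?_)
    have hz' : AEMeasurable (fun q : ℂ × ℝ => z q.2) (ν.prod (volume.restrict IqU)) := hz.comp_snd
    exact (((measurable_fst.aemeasurable).sub hz').inv).aestronglyMeasurable
  have hI : Integrable (fun q : ℂ × ℝ => h q.1 * (a q.2 * (q.1 - z q.2)⁻¹))
      (ν.prod (volume.restrict IqU)) := by
    rw [integrable_prod_iff' hm]
    constructor
    · filter_upwards [hd] with x hx
      have := (D.cau_bd hh hx.1 hx.2).1.const_mul (a x)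
      exact this.congr (ae_of_all _ fun t => by ring)
    · refine (hi.const_mul (nrm ν h)).mono' hm.norm.prod_swap.integral_prod_right' ?_
      filter_upwards [hd] with x hx
      rw [Real.norm_of_nonneg (integral_nonneg fun t => norm_nonneg _)]
      have e : ∀ t, ‖h t * (a x * (t - z x)⁻¹)‖ = ‖a x‖ * ‖h t * (t - z x)⁻¹‖ := fun t => by
        simp only [norm_mul]; ring
      simp only [e]
      rw [integral_const_mul]
      have := mul_le_mul_of_nonneg_left (D.cau_bd hh hx.1 hx.2).2 (norm_nonneg (a x))
      linarith
  have h1 := hI.integral_prod_left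
  simp only [integral_const_mul] at h1
  refine ⟨h1, ?_⟩
  have h2 := integral_integral_swap (f := fun t x => h t * (a x * (t - z x)⁻¹)) hI
  simp only [integral_const_mul] at h2
  rw [h2]
  refine integral_congr_ae (ae_of_all _ fun x => ?_)
  simp only [Cau]
  rw [← integral_const_mul]
  congr 1; funext t; ring
lemma im_pth {s : ℝ} (hs : |s| = D.η) (hx : x ∈ IoU) : |(pth s x).im| = D.η * qd(x) := by
  simp only [pth, abs_mul s, hs]
  rw [abs_of_pos (qpos hx)]
lemma sep_pth {s : ℝ} (hs : |s| = D.η) (hx : x ∈ IoU) :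
    ∀ t ∈ frontier G, D.c * D.η * qd(x) ≤ ‖t - D.τ j (pth s x)‖ := by
  intro t ht
  have := D.sep j _ (pth_mem hs.le (Ioo_subset_Icc_self hx)) t ht
  rw [D.im_pth hs hx] at this
  linarith
lemma contOn_pth (hf : ContinuousOn f O) (hl : lens D.η ⊆ O) {s : ℝ} (hs : |s| = D.η) :
    ContinuousOn (fun x => f (pth s x)) (Icc 0 1) :=
  hf.comp (pth_cont s).continuousOn fun x hx => hl (pth_mem hs.le hx)
lemma ae_Ioo : ∀ᵐ x : ℝ ∂(volume.restrict IqU), x ∈ IoU := by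
  have : ∀ᵐ x : ℝ, x ≠ 1 := by simp [ae_iff, measure_singleton]
  filter_upwards [ae_restrict_mem measurableSet_Ioc, ae_restrict_of_ae this] with x hx hx1
  exact ⟨hx.1, lt_of_le_of_ne hx.2 hx1⟩
lemma piece (hh : MemLp h 2 ν) (hO : IsOpen O) (hl : lens D.η ⊆ O)
    (hf : DifferentiableOn ℂ f O) (j : Fin D.m) :
    2 * π * I * ∫ x in (0:ℝ)..1, (‖deriv (D.τ j) x‖ : ℂ) * (h (D.τ j x) * f x) =
    PI D.η (fun ω => f ω * deriv (D.τ j) ω * Cau ν h (D.τ j ω)) -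
      PI (-D.η) (fun ω => f ω * deriv (D.τ j) ω * Cau ν h (D.τ j ω)) := by
  have hη := D.η_pos
  have hc := D.c_pos
  have key : ∀ s : ℝ, |s| = D.η →
      Integrable (fun t => h t * PI s (fun ω => f ω * deriv (D.τ j) ω * (t - D.τ j ω)⁻¹)) ν ∧
      ∫ t, h t * PI s (fun ω => f ω * deriv (D.τ j) ω * (t - D.τ j ω)⁻¹) ∂ν =
        PI s (fun ω => f ω * deriv (D.τ j) ω * Cau ν h (D.τ j ω)) := by
    intro s hs
    have hac : ContinuousOn (fun x => f (pth s x) * deriv (D.τ j) (pth s x) * dpth s x) (Icc 0 1) :=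
      ((D.contOn_pth hf.continuousOn hl hs).mul (D.contOn_pth (D.dcont j) D.lens_sub hs)).mul
        (dpth_cont s).continuousOn
    have hzc := D.contOn_pth (D.hol j).continuousOn D.lens_sub hs
    obtain ⟨M, hM⟩ := isCompact_Icc.exists_bound_of_continuousOn hac
    have hF := D.fub hh (a := fun x => f (pth s x) * deriv (D.τ j) (pth s x) * dpth s x)
      (z := fun x => D.τ j (pth s x)) (d := fun x => D.c * D.η * qd(x))
      ((hac.mono Ioc_subset_Icc_self).aestronglyMeasurable measurableSet_Ioc)
      ((hzc.mono Ioc_subset_Icc_self).aemeasurable measurableSet_Ioc)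
      (by
        filter_upwards [ae_Ioo] with x hx
        exact ⟨by have := qpos hx; positivity, D.sep_pth j hs hx⟩)
      (by
        refine (int_half.const_mul (M * √(D.A / (D.c * D.η)))).mono'
          (AEStronglyMeasurable.mul ((hac.mono Ioc_subset_Icc_self).aestronglyMeasurable measurableSet_Ioc).norm (Measurable.aestronglyMeasurable (by measurability))) ?_
        filter_upwards [ae_Ioo] with x hx
        have hx' := qpos hx
        have h1 := hM x (Ioo_subset_Icc_self hx)
        rw [Real.norm_of_nonneg (by positivity), ← div_div, Real.sqrt_div' _ hx'.le, div_eq_mul_inv (√_), ← mul_assoc]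
        exact mul_le_mul_of_nonneg_right (mul_le_mul_of_nonneg_right h1 (by positivity)) (by positivity))
    have e : ∀ g : ℂ → ℂ, PI s (fun ω => f ω * deriv (D.τ j) ω * g ω) =
        ∫ x in IqU, (f (pth s x) * deriv (D.τ j) (pth s x) * dpth s x) * g (pth s x) := by
      intro g
      rw [PI, intervalIntegral.integral_of_le zero_le_one]
      congr 1; funext x; ring
    simp only [e]
    exact hF
  obtain ⟨i1, e1⟩ := key D.η (abs_of_pos hη)
  obtain ⟨i2, e2⟩ := key (-D.η) (by rw [abs_neg, abs_of_pos hη])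
  have i3 := D.int_eq (i1.sub i2)
  simp only [Pi.sub_apply] at i3
  rw [← e1, ← e2, ← integral_sub i1 i2, i3]
  rw [Finset.sum_eq_single j]
  · rw [← intervalIntegral.integral_const_mul, intervalIntegral.integral_of_le zero_le_one,
      intervalIntegral.integral_of_le zero_le_one]
    refine integral_congr_ae ?_
    filter_upwards [ae_Ioo] with x hx
    have := D.loop_on hO hl hf j hx
    linear_combination ((‖deriv (D.τ j) x‖ : ℂ) * h (D.τ j x)) * this
  · intro i _ hij
    rw [intervalIntegral.integral_of_le zero_le_one]
    refine integral_eq_zero_of_ae ?_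
    filter_upwards [ae_Ioo] with x hx
    have := D.loop_off hO hl hf hij hx rfl
    simp only [Pi.zero_apply]
    linear_combination (-(‖deriv (D.τ i) x‖ : ℂ) * h (D.τ i x)) * this
  · simp
end Dat
lemma cauchy_diff {α : Type*} [MeasurableSpace α] {μ : Measure α} {h b : α → ℂ} (hh : Integrable h μ)
    (hb : AEStronglyMeasurable b μ) {z0 : ℂ} (hd : 0 < d) (hz : ∀ᵐ x ∂μ, d ≤ ‖b x - z0‖) :
    HasDerivAt (fun z => ∫ x, h x * (b x - z)⁻¹ ∂μ) (∫ x, h x * ((b x - z0)⁻¹) ^ 2 ∂μ) z0 := by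
  have hm : ∀ z, AEStronglyMeasurable (fun x => (b x - z)⁻¹) μ := fun z =>
    ((hb.sub aestronglyMeasurable_const).aemeasurable.inv).aestronglyMeasurable
  refine (hasDerivAt_integral_of_dominated_loc_of_deriv_le (F := fun z x => h x * (b x - z)⁻¹)
    (F' := fun z x => h x * ((b x - z)⁻¹) ^ 2)
    (bound := fun x => ‖h x‖ * (2 / d) ^ 2) (ball_mem_nhds z0 (half_pos hd))
    (Eventually.of_forall fun z => hh.1.mul (hm z)) ?_ (hh.1.mul ((hm z0).pow 2)) ?_ (hh.norm.mul_const _) ?_).2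
  · refine (hh.norm.mul_const (1 / d)).mono' (hh.1.mul (hm z0)) ?_
    filter_upwards [hz] with x hx
    rw [norm_mul, norm_inv, ← one_div]
    gcongr
  · filter_upwards [hz] with x hx z hz'
    rw [norm_mul, norm_pow, norm_inv]
    have h1 : d / 2 ≤ ‖b x - z‖ := by
      have h2 : ‖z - z0‖ < d / 2 := by simpa [dist_eq_norm] using hz'
      have h3 : ‖b x - z0‖ ≤ ‖b x - z‖ + ‖z - z0‖ := by
        simpa using norm_add_le (b x - z) (z - z0)
      linarith
    have h4 : ‖b x - z‖⁻¹ ≤ 2 / d := by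
      rw [show 2 / d = (d / 2)⁻¹ by field_simp]; exact inv_anti₀ (by positivity) h1
    gcongr
  · filter_upwards [hz] with x hx z hz'
    have h2 : ‖z - z0‖ < d / 2 := by simpa [dist_eq_norm] using hz'
    have h1 : b x - z ≠ 0 := by
      intro h0
      have h3 : ‖b x - z0‖ ≤ ‖b x - z‖ + ‖z - z0‖ := by
        simpa using norm_add_le (b x - z) (z - z0)
      rw [h0, norm_zero] at h3; linarith
    have := (((hasDerivAt_id z).const_sub (b x)).inv h1).const_mul (h x)
    exact this.congr_deriv (by simp [div_eq_mul_inv])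
section PA
variable {X : Set ℂ} {f g : ℂ → ℂ}
lemma PA.congr (hf : PA X f) (h : ∀ z ∈ X, f z = g z) : PA X g := fun ε hε => by
  obtain ⟨P, hP⟩ := hf ε hε
  exact ⟨P, fun z hz => by rw [← h z hz]; exact hP z hz⟩
lemma PA.poly (P : Polynomial ℂ) : PA X (fun z => P.eval z) := fun ε hε => ⟨P, fun z _ => by simpa using hε.le⟩
lemma PA.const (c : ℂ) : PA X (fun _ => c) := (PA.poly (Polynomial.C c)).congr (by simp)
lemma PA.lim (h : ∀ ε : ℝ, 0 < ε → ∃ g, PA X g ∧ ∀ z ∈ X, ‖f z - g z‖ ≤ ε) : PA X f := fun ε hε => by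
  obtain ⟨g, hg, h1⟩ := h (ε / 2) (by positivity)
  obtain ⟨P, hP⟩ := hg (ε / 2) (by positivity)
  refine ⟨P, fun z hz => ?_⟩
  have := norm_add_le (f z - g z) (g z - P.eval z)
  rw [sub_add_sub_cancel] at this
  linarith [h1 z hz, hP z hz]
lemma PA.add (hf : PA X f) (hg : PA X g) : PA X (fun z => f z + g z) := fun ε hε => by
  obtain ⟨P, hP⟩ := hf (ε / 2) (by positivity)
  obtain ⟨Q, hQ⟩ := hg (ε / 2) (by positivity)
  refine ⟨P + Q, fun z hz => ?_⟩
  have := norm_add_le (f z - P.eval z) (g z - Q.eval z)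
  rw [Polynomial.eval_add, show f z + g z - (P.eval z + Q.eval z) = (f z - P.eval z) + (g z - Q.eval z) by ring]
  linarith [hP z hz, hQ z hz]
lemma PA.bdd (hX : Bornology.IsBounded X) (hf : PA X f) : ∃ M : ℝ, 0 < M ∧ ∀ z ∈ X, ‖f z‖ ≤ M := by
  obtain ⟨P, hP⟩ := hf 1 one_pos
  obtain ⟨M, hM⟩ := (hX.isCompact_closure).exists_bound_of_continuousOn (P.continuous.continuousOn (s := closure X))
  refine ⟨max M 0 + 1, by positivity, fun z hz => ?_⟩
  have := norm_add_le (f z - P.eval z) (P.eval z)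
  rw [sub_add_cancel] at this
  linarith [hP z hz, hM z (subset_closure hz), le_max_left M 0]
lemma PA.mul (hX : Bornology.IsBounded X) (hf : PA X f) (hg : PA X g) : PA X (fun z => f z * g z) := by
  obtain ⟨M, hM, hfM⟩ := hf.bdd hX
  refine PA.lim fun ε hε => ?_
  obtain ⟨Q, hQ⟩ := hg (ε / M) (by positivity)
  obtain ⟨M', hM', hfM'⟩ := (PA.poly (X := X) Q).bdd hX
  refine ⟨fun z => f z * Q.eval z, fun ε hε => ?_, fun z hz => ?_⟩
  · obtain ⟨P, hP⟩ := hf (ε / M') (by positivity)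
    refine ⟨P * Q, fun z hz => ?_⟩
    rw [Polynomial.eval_mul, ← sub_mul, norm_mul]
    calc _ ≤ ε / M' * M' := mul_le_mul (hP z hz) (hfM' z hz) (norm_nonneg _) (by positivity)
      _ = ε := by field_simp
  · rw [← mul_sub, norm_mul]
    calc _ ≤ M * (ε / M) := mul_le_mul (hfM z hz) (hQ z hz) (norm_nonneg _) (by positivity)
      _ = ε := by field_simp
lemma PA.pow (hX : Bornology.IsBounded X) (hf : PA X f) (n : ℕ) : PA X (fun z => f z ^ n) := by
  induction n with
  | zero => simpa using PA.const 1
  | succ n ih => simpa only [pow_succ] using ih.mul hX hf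
lemma PA.sum {ι : Type*} (s : Finset ι) {f : ι → ℂ → ℂ} (hf : ∀ i ∈ s, PA X (f i)) :
    PA X (fun z => ∑ i ∈ s, f i z) := by
  classical
  induction s using Finset.induction_on with
  | empty => simpa using PA.const 0
  | insert a s ha ih =>
    simp only [Finset.sum_insert ha]
    exact (hf a (by simp)).add (ih fun i hi => hf i (by simp [hi]))
lemma PA.comp (hX : Bornology.IsBounded X) (hg : PA X g) (h2 : ∀ z ∈ X, ‖g z‖ ≤ 1 / 2) {φ : ℂ → ℂ}
    (hφ : DifferentiableOn ℂ φ (ball 0 1)) : PA X (fun z => φ (g z)) := by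
  have h34 : DifferentiableOn ℂ φ (closedBall 0 ((3/4 : NNReal) : ℝ)) := hφ.mono
    (closedBall_subset_ball (by norm_num))
  have hp := h34.hasFPowerSeriesOnBall (by positivity)
  have ht := hp.tendstoUniformlyOn' (r' := (5/8 : NNReal)) (by
    rw [ENNReal.coe_lt_coe, ← NNReal.coe_lt_coe]; norm_num)
  refine PA.lim fun ε hε => ?_
  obtain ⟨n, hn⟩ := ((Metric.tendstoUniformlyOn_iff.1 ht) ε hε).exists
  refine ⟨fun z => (cauchyPowerSeries φ 0 (3/4 : NNReal)).partialSum n (g z - 0), ?_, fun z hz => ?_⟩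
  · simp only [FormalMultilinearSeries.partialSum, sub_zero]
    refine PA.sum _ fun i _ => ?_
    have := (PA.pow hX hg i).mul hX (PA.const (X := X) ((cauchyPowerSeries φ 0 (3/4 : NNReal)).coeff i))
    refine this.congr fun z _ => ?_
    rw [FormalMultilinearSeries.apply_eq_pow_smul_coeff, smul_eq_mul]
  · have := hn (g z) (by
      simp only [mem_ball, dist_zero_right]
      refine lt_of_le_of_lt (h2 z hz) ?_
      push_cast; norm_num)
    rw [dist_eq_norm] at this
    exact this.le
end PA
namespace Dat
variable (D : Dat G ν lam F) (j : Fin D.m)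
lemma L_sub : frontier G ⊆ closure G := frontier_subset_closure
lemma X_bdd (D : Dat G ν lam F) : Bornology.IsBounded (closure G) := D.G_bdd.closure
lemma pa_lim (D : Dat G ν lam F) (hf : PA (closure G) f) :
    ∃ P : ℕ → Polynomial ℂ, (∀ n, ∀ z ∈ closure G, ‖f z - (P n).eval z‖ ≤ 1 / ((n : ℝ) + 1)) ∧
    ∀ z ∈ closure G, Tendsto (fun n => (P n).eval z) atTop (𝓝 (f z)) := by
  choose P hP using fun n : ℕ => hf (1 / ((n : ℝ) + 1)) (by positivity)
  refine ⟨P, hP, fun z hz => ?_⟩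
  rw [tendsto_iff_norm_sub_tendsto_zero]
  refine squeeze_zero (fun _ => norm_nonneg _) (fun n => ?_) tendsto_one_div_add_atTop_nhds_zero_nat
  rw [norm_sub_rev]; exact hP n z hz
lemma pa_aesm (D : Dat G ν lam F) (hf : PA (closure G) f) : AEStronglyMeasurable f ν := by
  obtain ⟨P, -, h⟩ := D.pa_lim hf
  refine aestronglyMeasurable_of_tendsto_ae atTop (fun n => (P n).continuous.aestronglyMeasurable) ?_
  filter_upwards [D.ae_L] with t ht using h t (L_sub ht)
lemma pa_memLp (D : Dat G ν lam F) (hf : PA (closure G) f) {p : ENNReal} (hh : MemLp h p ν) :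
    MemLp (fun t => f t * h t) p ν := by
  obtain ⟨M, _, hM⟩ := hf.bdd D.X_bdd
  refine (hh.const_mul (M : ℂ)).mono ((D.pa_aesm hf).mul hh.1) ?_
  filter_upwards [D.ae_L] with t ht
  rw [norm_mul, norm_mul]
  have := hM t (L_sub ht)
  gcongr
  exact this.trans (by rw [norm_real]; exact le_abs_self M)
lemma pa_memLp' (D : Dat G ν lam F) (hf : PA (closure G) f) {p : ENNReal} : MemLp f p ν := by
  have := D.ν_fin
  simpa using D.pa_memLp hf (memLp_const (1:ℂ))
lemma pa_int (D : Dat G ν lam F) (hh : Integrable h ν) {c ζ : ℂ} (hζ : ζ ∈ closure G)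
    (h1 : ∀ P : Polynomial ℂ, ∫ t, P.eval t * h t ∂ν = c * P.eval ζ) (hf : PA (closure G) f) :
    ∫ t, f t * h t ∂ν = c * f ζ := by
  obtain ⟨P, hP, hl⟩ := D.pa_lim hf
  obtain ⟨M, hM, hfM⟩ := hf.bdd D.X_bdd
  have t1 : Tendsto (fun n => ∫ t, (P n).eval t * h t ∂ν) atTop (𝓝 (∫ t, f t * h t ∂ν)) := by
    refine tendsto_integral_of_dominated_convergence (fun t => (M + 1) * ‖h t‖)
      (fun n => (P n).continuous.aestronglyMeasurable.mul hh.1) (hh.norm.const_mul _) (fun n => ?_) ?_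
    · filter_upwards [D.ae_L] with t ht
      rw [norm_mul]
      gcongr
      have h2 := hP n t (L_sub ht)
      have h3 : 1 / ((n : ℝ) + 1) ≤ 1 := by
        rw [div_le_one (by positivity)]; linarith [(Nat.cast_nonneg n : (0:ℝ) ≤ n)]
      have h4 := norm_sub_norm_le ((P n).eval t) (f t)
      rw [norm_sub_rev] at h4
      linarith [hfM t (L_sub ht)]
    · filter_upwards [D.ae_L] with t ht
      exact (hl t (L_sub ht)).mul_const _
  refine tendsto_nhds_unique t1 ?_
  simp only [h1]
  exact (hl ζ hζ).const_mul c
lemma exists_sig : ∃ σ : ℂ → ℂ, Measurable σ ∧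
    ∀ j, ∀ x ∈ IoU, σ (D.τ j x) * ‖deriv (D.τ j) x‖ = deriv (D.τ j) x := by
  classical
  have h1 : ∀ j, ∃ s : ℂ → ℂ, Measurable s ∧ (∀ x ∈ IoU, s (D.τ j x) * ‖deriv (D.τ j) x‖ = deriv (D.τ j) x) ∧
      ∀ t, (¬ ∃ x ∈ IcU, t = D.τ j x) → s t = 0 := by
    intro j
    set T : ℝ → ℂ := fun x => D.τ j x
    have hinj : InjOn T (Icc 0 1) := fun x hx y hy h => by
      exact_mod_cast D.inj (D.real_mem hx) (D.real_mem hy) h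
    set g := Function.invFunOn T (Icc 0 1)
    have hg : ∀ x ∈ IcU, g (T x) = x := fun x hx => hinj.leftInvOn_invFunOn hx
    have hK : IsCompact (T '' Icc 0 1) := isCompact_Icc.image_of_continuousOn (D.cont_real j)
    have hgc : ContinuousOn g (T '' Icc 0 1) := by
      have : LipschitzOnWith ((Real.toNNReal D.c)⁻¹) g (T '' Icc 0 1) := by
        refine LipschitzOnWith.of_dist_le_mul ?_
        rintro _ ⟨x, hx, rfl⟩ _ ⟨y, hy, rfl⟩
        rw [hg x hx, hg y hy, dist_eq_norm, dist_eq_norm, NNReal.coe_inv, Real.coe_toNNReal _ D.c_pos.le,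
          inv_mul_eq_div, le_div_iff₀ D.c_pos]
        have := D.bil j x (D.real_mem hx) y (D.real_mem hy)
        rw [← ofReal_sub, norm_real] at this
        rw [mul_comm]; exact this
      exact this.continuousOn
    have hmaps : MapsTo g (T '' Icc 0 1) (Icc 0 1) := by
      rintro _ ⟨x, hx, rfl⟩; rw [hg x hx]; exact hx
    have hc : ContinuousOn (fun t => deriv (D.τ j) (g t) / ‖deriv (D.τ j) (g t)‖) (T '' Icc 0 1) := by
      have h2 := (D.dcont_real j).comp hgc hmaps
      refine h2.div (continuous_ofReal.comp_continuousOn h2.norm) fun t ht => ?_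
      have := D.dne (j := j) (D.real_mem (hmaps ht))
      have hc := D.c_pos
      simp only [Function.comp, ne_eq, ofReal_eq_zero, norm_eq_zero]
      intro h0; rw [h0, norm_zero] at this; linarith
    refine ⟨(T '' Icc 0 1).piecewise (fun t => deriv (D.τ j) (g t) / ‖deriv (D.τ j) (g t)‖) 0,
      hc.measurable_piecewise continuousOn_const hK.isClosed.measurableSet, fun x hx => ?_, fun t ht => ?_⟩
    · have hx' := Ioo_subset_Icc_self hx
      rw [piecewise_eq_of_mem _ _ _ (mem_image_of_mem T hx')]
      have := hg x hx'
      simp only [T] at this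
      rw [this]
      have := D.dne (j := j) (D.real_mem hx')
      have hc := D.c_pos
      rw [div_mul_cancel₀]
      simp only [ne_eq, ofReal_eq_zero, norm_eq_zero]
      intro h0; rw [h0, norm_zero] at this; linarith
    · rw [piecewise_eq_of_notMem]
      · rfl
      · rintro ⟨x, hx, rfl⟩; exact ht ⟨x, hx, rfl⟩
  choose s hs1 hs2 hs3 using h1
  refine ⟨fun t => ∑ j, s j t, Finset.measurable_sum _ fun j _ => hs1 j, fun j x hx => ?_⟩
  show (∑ i, s i (D.τ j x)) * _ = _
  rw [Finset.sum_eq_single j, hs2 j x hx]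
  · intro i _ hij
    refine hs3 i _ ?_
    rintro ⟨y, hy, h⟩
    exact hij (D.disj j i x hx y hy h).symm
  · simp
def σ : ℂ → ℂ := D.exists_sig.choose
lemma σ_meas : Measurable D.σ := D.exists_sig.choose_spec.1
lemma σ_spec (hx : x ∈ IoU) : D.σ (D.τ j x) * ‖deriv (D.τ j) x‖ = deriv (D.τ j) x :=
  D.exists_sig.choose_spec.2 j x hx
lemma dpos (hx : x ∈ IcU) : 0 < ‖deriv (D.τ j) x‖ :=
  D.c_pos.trans_le (D.dne (D.real_mem hx))
lemma σ_norm : ∀ᵐ t ∂ν, ‖D.σ t‖ = 1 := by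
  filter_upwards [D.ae_nc] with t ht
  obtain ⟨j, x, hx, rfl⟩ := ht
  have h := congrArg norm (D.σ_spec j hx)
  have h1 := D.dpos j (Ioo_subset_Icc_self hx)
  rw [norm_mul, norm_real, norm_norm] at h
  field_simp at h
  exact h
lemma σ_memLp {p : ENNReal} (hh : MemLp h p ν) : MemLp (fun t => h t * D.σ t) p ν := by
  refine hh.mono (hh.1.mul D.σ_meas.aestronglyMeasurable) ?_
  filter_upwards [D.σ_norm] with t ht
  rw [norm_mul, ht, mul_one]
lemma nrm_σ (h : ℂ → ℂ) : nrm ν (fun t => h t * D.σ t) = nrm ν h := by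
  unfold nrm
  congr 1
  refine integral_congr_ae ?_
  filter_upwards [D.σ_norm] with t ht
  rw [norm_mul, ht, mul_one]
lemma int_σ (hf : Integrable f ν) :
    ∫ t, f t * D.σ t ∂ν = ∑ j, ∫ x in (0:ℝ)..1, deriv (D.τ j) x * f (D.τ j x) := by
  have h1 : Integrable (fun t => f t * D.σ t) ν :=
    memLp_one_iff_integrable.1 (D.σ_memLp (memLp_one_iff_integrable.2 hf))
  rw [D.int_eq h1]
  refine Finset.sum_congr rfl fun j _ => ?_
  rw [intervalIntegral.integral_of_le zero_le_one, intervalIntegral.integral_of_le zero_le_one]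
  refine integral_congr_ae ?_
  filter_upwards [ae_Ioo] with x hx
  have := D.σ_spec j hx
  linear_combination (f (D.τ j x)) * this
lemma int_exact {g : ℂ → ℂ} (hf : Integrable f ν) (hg : ∀ t ∈ frontier G, HasDerivAt g (f t) t)
    (hc : ContinuousOn f (frontier G)) : ∫ t, f t * D.σ t ∂ν = 0 := by
  rw [D.int_σ hf, ← D.chain g]
  refine Finset.sum_congr rfl fun j _ => ?_
  rw [intervalIntegral.integral_eq_sub_of_hasDerivAt (f := fun x : ℝ => g (D.τ j x))]
  · simp
  · intro x hx
    rw [uIcc_of_le zero_le_one] at hx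
    have h1 := ((D.hol j).differentiableAt (D.N_open.mem_nhds (D.real_mem hx))).hasDerivAt
    have h2 := ((hg _ (D.onL j x hx)).comp (x : ℂ) h1).comp_ofReal
    simpa [mul_comm, Function.comp_def] using h2
  · apply ContinuousOn.intervalIntegrable
    rw [uIcc_of_le zero_le_one]
    exact (D.dcont_real j).mul (hc.comp (D.cont_real j) fun x hx => D.onL j x hx)
lemma poly_prim (P : Polynomial ℂ) : ∃ Q : Polynomial ℂ, ∀ z, HasDerivAt (fun z => Q.eval z) (P.eval z) z := by
  induction P using Polynomial.induction_on' with
  | add p q hp hq =>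
    obtain ⟨P, hP⟩ := hp; obtain ⟨Q, hQ⟩ := hq
    refine ⟨P + Q, fun z => ?_⟩
    simp only [Polynomial.eval_add]
    exact (hP z).add (hQ z)
  | monomial n a =>
    refine ⟨Polynomial.monomial (n + 1) (a / (n + 1)), fun z => ?_⟩
    have := (Polynomial.monomial (n + 1) (a / ((n : ℂ) + 1))).hasDerivAt z
    refine this.congr_deriv ?_
    rw [Polynomial.derivative_monomial]
    have : (n : ℂ) + 1 ≠ 0 := Nat.cast_add_one_ne_zero n
    simp; field_simp; simp
lemma int_polyσ (P : Polynomial ℂ) : ∫ t, P.eval t * D.σ t ∂ν = 0 := by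
  obtain ⟨Q, hQ⟩ := poly_prim P
  exact D.int_exact (memLp_one_iff_integrable.1 (D.pa_memLp' (PA.poly P))) (fun t _ => hQ t) P.continuous.continuousOn
lemma dist_pos (D : Dat G ν lam F) (hz : z ∉ frontier G) : ∃ d > 0, ∀ t ∈ frontier G, d ≤ ‖t - z‖ := by
  obtain ⟨d, hd, h⟩ := Metric.isOpen_iff.1 isClosed_frontier.isOpen_compl z hz
  refine ⟨d, hd, fun t ht => ?_⟩
  by_contra hcon; push Not at hcon
  exact h (by simpa [dist_eq_norm] using hcon) ht
lemma G_notL (D : Dat G ν lam F) (hz : z ∈ G) : z ∉ frontier G := by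
  rw [D.G_open.frontier_eq]; exact fun h => h.2 hz
lemma cau_diff (D : Dat G ν lam F) (hh : Integrable h ν) (hz : z ∉ frontier G) :
    HasDerivAt (Cau ν h) (∫ t, h t * ((t - z)⁻¹) ^ 2 ∂ν) z := by
  obtain ⟨d, hd, h1⟩ := D.dist_pos hz
  refine cauchy_diff hh aestronglyMeasurable_id hd ?_
  filter_upwards [D.ae_L] with t ht using h1 t ht
lemma inv_int (D : Dat G ν lam F) (hz : z ∉ frontier G) : MemLp (fun t => (t - z)⁻¹) 2 ν := by
  obtain ⟨d, hd, h1⟩ := D.dist_pos hz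
  exact (D.ahlfors hd h1).1
lemma one_memLp (D : Dat G ν lam F) {p : ENNReal} : MemLp (fun _ : ℂ => (1:ℂ)) p ν := D.pa_memLp' (PA.const 1)
lemma σ2 : MemLp D.σ 2 ν := by simpa using D.σ_memLp D.one_memLp
lemma σ1 : Integrable D.σ ν := by simpa using memLp_one_iff_integrable.1 (D.σ_memLp D.one_memLp)
lemma W_out (hω : ω ∈ lens D.η) (him : ω.im < 0) (hh : Integrable h ν) (h0 : ∀ P : Polynomial ℂ, ∫ t, P.eval t * h t ∂ν = 0) : Cau ν h (D.τ j ω) = 0 := by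
  have := D.pa_int hh (c := 0) (L_sub (D.onL j 0 (by simp))) (by simpa using h0) (D.ext j ω hω him)
  rw [zero_mul] at this
  rw [← this, Cau]
  congr 1; funext t; ring
lemma W_in (hz : z ∈ G) : Cau ν D.σ z = 2 * π * I := by
  have hd : ∀ z ∈ G, HasDerivAt (Cau ν D.σ) 0 z := by
    intro z hz
    have h1 := D.cau_diff D.σ1 (D.G_notL hz)
    have hi := D.inv_int (D.G_notL hz)
    have h2 := D.int_exact (f := fun t => ((t - z)⁻¹) ^ 2) (g := fun t => - (t - z)⁻¹)
      ((CS hi hi).1.congr (ae_of_all _ fun t => (pow_two _).symm)) (fun t ht => by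
        have hne : t - z ≠ 0 := fun h => D.G_notL hz (by rw [← sub_eq_zero.1 h]; exact ht)
        have := (((hasDerivAt_id t).sub_const z).inv hne).neg
        exact this.congr_deriv (by simp [div_eq_mul_inv])) (by
        refine ContinuousOn.pow (ContinuousOn.inv₀ (by fun_prop) fun t ht h => ?_) 2
        exact D.G_notL hz (by rw [← sub_eq_zero.1 h]; exact ht))
    rw [show (∫ t, D.σ t * ((t - z)⁻¹) ^ 2 ∂ν) = 0 by rw [← h2]; congr 1; funext t; ring] at h1
    exact h1
  have hconst : ∀ z' ∈ G, Cau ν D.σ z' = Cau ν D.σ z := fun z' hz' =>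
    D.G_open.is_const_of_deriv_eq_zero D.G_conn (fun w hw => (hd w hw).differentiableAt.differentiableWithinAt)
      (fun w hw => (hd w hw).deriv) hz' hz
  set j : Fin D.m := ⟨0, D.m_pos⟩
  have hp := D.piece D.σ2 D.N_open D.lens_sub (f := fun _ => 1) (differentiableOn_const _) j
  have hη := D.η_pos
  have e1 : ∀ s : ℝ, |s| = D.η → ∀ a : ℂ, (∀ x ∈ IoU, Cau ν D.σ (D.τ j (pth s x)) = a) →
      PI s (fun ω => 1 * deriv (D.τ j) ω * Cau ν D.σ (D.τ j ω)) = (D.τ j 1 - D.τ j 0) * a := by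
    intro s hs a ha
    have : PI s (deriv (D.τ j)) = D.τ j 1 - D.τ j 0 := PI_of_prim (fun x hx =>
      ((D.hol j).differentiableAt (D.N_open.mem_nhds (D.lens_sub (pth_mem hs.le hx)))).hasDerivAt)
      (D.contOn_pth (D.dcont j) D.lens_sub hs)
    rw [← this, PI, PI, ← intervalIntegral.integral_mul_const, intervalIntegral.integral_of_le zero_le_one,
      intervalIntegral.integral_of_le zero_le_one]
    refine integral_congr_ae ?_
    filter_upwards [ae_Ioo] with x hx
    rw [ha x hx]; ring
  have him : ∀ {s x : ℝ}, (pth s x).im = s * qd(x) := fun {s x} => rfl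
  rw [e1 D.η (abs_of_pos hη) (Cau ν D.σ z) (fun x hx => hconst _ (D.up j _
      (pth_mem (abs_of_pos hη).le (Ioo_subset_Icc_self hx)) (by
        rw [him]; exact mul_pos hη (qpos hx)))),
    e1 (-D.η) (by rw [abs_neg, abs_of_pos hη]) 0 (fun x hx => D.W_out j
      (pth_mem (by rw [abs_neg, abs_of_pos hη]) (Ioo_subset_Icc_self hx)) (by
        rw [him]; have := mul_pos hη (qpos hx); linarith) D.σ1 D.int_polyσ)] at hp
  have e2 : ∫ x in (0:ℝ)..1, (‖deriv (D.τ j) x‖ : ℂ) * (D.σ (D.τ j x) * 1) = D.τ j 1 - D.τ j 0 := by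
    have : PI 0 (deriv (D.τ j)) = D.τ j 1 - D.τ j 0 := PI_of_prim (fun x hx =>
      ((D.hol j).differentiableAt (D.N_open.mem_nhds (D.lens_sub (pth_mem (by simpa using hη.le) hx)))).hasDerivAt)
      (by simpa only [pth_zero] using D.dcont_real j)
    rw [← this, PI, intervalIntegral.integral_of_le zero_le_one, intervalIntegral.integral_of_le zero_le_one]
    refine integral_congr_ae ?_
    filter_upwards [ae_Ioo] with x hx
    rw [pth_zero, dpth_zero]; linear_combination D.σ_spec j hx
  rw [e2] at hp
  have hne : D.τ j 1 - D.τ j 0 ≠ 0 := by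
    intro h
    have h0 : ((1:ℝ):ℂ) ∈ D.N := D.real_mem (by simp)
    have h1 : ((0:ℝ):ℂ) ∈ D.N := D.real_mem (by simp)
    have := D.inj (j := j) h0 h1 (by simpa using sub_eq_zero.1 h)
    simp at this
  have : (D.τ j 1 - D.τ j 0) * (Cau ν D.σ z - 2 * π * I) = 0 := by linear_combination -hp
  rcases mul_eq_zero.1 this with h | h
  · exact absurd h hne
  · exact sub_eq_zero.1 h
lemma cauchy_poly (P : Polynomial ℂ) (hz : z ∈ G) :
    Cau ν (fun t => P.eval t * D.σ t) z = 2 * π * I * P.eval z := by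
  obtain ⟨Q, hQ⟩ := Polynomial.X_sub_C_dvd_sub_C_eval (p := P) (a := z)
  have hQ' : ∀ t, P.eval t = P.eval z + (t - z) * Q.eval t := fun t => by
    have := congrArg (Polynomial.eval t) hQ
    simp at this; linear_combination this
  have hi := D.inv_int (D.G_notL hz)
  have i1 := (CS D.σ2 hi).1
  have i2 : Integrable (fun t => Q.eval t * D.σ t) ν :=
    memLp_one_iff_integrable.1 (D.σ_memLp (D.pa_memLp' (PA.poly Q)))
  have : Cau ν (fun t => P.eval t * D.σ t) z = ∫ t, (P.eval z * (D.σ t * (t - z)⁻¹) + Q.eval t * D.σ t) ∂ν := by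
    refine integral_congr_ae ?_
    filter_upwards [D.ae_L] with t ht
    have hne : t - z ≠ 0 := fun h => D.G_notL hz (by rw [← sub_eq_zero.1 h]; exact ht)
    rw [hQ' t]; field_simp
  rw [this, integral_add (i1.const_mul _) i2, D.int_polyσ, integral_const_mul]
  have := D.W_in hz
  simp only [Cau] at this
  rw [this]; ring
lemma poly_bd (P : Polynomial ℂ) (hz : z ∈ G) (hd : 0 < d) (h : ∀ t ∈ frontier G, d ≤ ‖t - z‖) :
    ‖P.eval z‖ ≤ nrm ν (fun t => P.eval t) * √(D.A / d) := by
  have h1 := D.cauchy_poly P hz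
  have h2 := D.cau_norm (D.σ_memLp (D.pa_memLp' (PA.poly P))) hd h
  rw [h1, D.nrm_σ, norm_mul] at h2
  have h3 : (1:ℝ) ≤ ‖2 * (π : ℂ) * I‖ := by
    simp [abs_of_pos Real.pi_pos]; linarith [Real.pi_gt_three]
  nlinarith [norm_nonneg (P.eval z)]
end Dat
local notation "cj" => starRingEnd ℂ
lemma memLp_conj {p : ENNReal} (hh : MemLp h p ν) : MemLp (fun t => cj (h t)) p ν :=
  hh.mono (continuous_conj.comp_aestronglyMeasurable hh.1) (ae_of_all _ fun t => by simp)
lemma nrm_conj (h : ℂ → ℂ) : nrm ν (fun t => cj (h t)) = nrm ν h := by simp [nrm]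
lemma nrm_sq : ((nrm ν h ^ 2 : ℝ) : ℂ) = ∫ t, h t * cj (h t) ∂ν := by
  rw [nrm, Real.sq_sqrt (integral_nonneg fun t => by positivity), ← integral_complex_ofReal]
  congr 1; funext t; rw [mul_conj, normSq_eq_norm_sq]
lemma nrm_Lp (hh : MemLp h 2 ν) : ‖hh.toLp h‖ = nrm ν h := by
  rw [Lp.norm_toLp, hh.eLpNorm_eq_integral_rpow_norm (by norm_num) (by norm_num),
    ENNReal.toReal_ofReal (by positivity), nrm, Real.sqrt_eq_rpow]
  norm_num
structure ON (ν : Measure ℂ) (φ : ℕ → Polynomial ℂ) : Prop where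
  deg : ∀ k, (φ k).natDegree = k
  orth : ∀ j k, ∫ t, (φ j).eval t * cj ((φ k).eval t) ∂ν = if j = k then 1 else 0
def SN (φ : ℕ → Polynomial ℂ) (ζ : ℂ) (n : ℕ) : Polynomial ℂ :=
  ∑ k ∈ Finset.range (n + 1), Polynomial.C (cj ((φ k).eval ζ)) * φ k
lemma SN_eval (φ : ℕ → Polynomial ℂ) (ζ : ℂ) (n : ℕ) (t : ℂ) :
    (SN φ ζ n).eval t = ∑ k ∈ Finset.range (n + 1), cj ((φ k).eval ζ) * (φ k).eval t := by
  simp [SN, Polynomial.eval_finsetSum]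
lemma ON.ne {φ : ℕ → Polynomial ℂ} (h : ON ν φ) (k : ℕ) : φ k ≠ 0 := by
  intro h0
  have := h.orth k k
  simp [h0] at this
lemma SN_deg {φ : ℕ → Polynomial ℂ} (h : ON ν φ) (ζ : ℂ) (n : ℕ) : (SN φ ζ n).degree < (n + 1 : ℕ) := by
  refine lt_of_le_of_lt (Polynomial.degree_sum_le _ _) ?_
  rw [Finset.sup_lt_iff (by exact WithBot.bot_lt_coe _)]
  intro k hk
  rw [Polynomial.degree_lt_iff_coeff_zero]
  intro m hm
  rw [Polynomial.coeff_C_mul, Polynomial.coeff_eq_zero_of_natDegree_lt (by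
    rw [h.deg]; exact lt_of_lt_of_le (Finset.mem_range.1 hk) hm), mul_zero]
namespace Dat
variable (D : Dat G ν lam F) (j : Fin D.m) {φ : ℕ → Polynomial ℂ}
lemma pL (D : Dat G ν lam F) (P : Polynomial ℂ) : MemLp (fun t => P.eval t) 2 ν := D.pa_memLp' (PA.poly P)
lemma pq_int (D : Dat G ν lam F) (P Q : Polynomial ℂ) : Integrable (fun t => P.eval t * cj (Q.eval t)) ν :=
  (CS (D.pL P) (memLp_conj (D.pL Q))).1
lemma rep (D : Dat G ν lam F) (h : ON ν φ) (ζ : ℂ) {N : ℕ} {P : Polynomial ℂ} (hP : P.degree < (N + 1 : ℕ)) :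
    ∫ t, P.eval t * cj ((SN φ ζ N).eval t) ∂ν = P.eval ζ := by
  have base : ∀ j ≤ N, ∫ t, (φ j).eval t * cj ((SN φ ζ N).eval t) ∂ν = (φ j).eval ζ := by
    intro j hj
    have e : ∀ t, (φ j).eval t * cj ((SN φ ζ N).eval t) =
        ∑ k ∈ Finset.range (N + 1), (φ k).eval ζ * ((φ j).eval t * cj ((φ k).eval t)) := by
      intro t
      rw [SN_eval, map_sum, Finset.mul_sum]
      refine Finset.sum_congr rfl fun k _ => ?_
      simp; ring
    simp only [e]
    rw [integral_finsetSum _ fun k _ => (D.pq_int _ _).const_mul _]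
    simp only [integral_const_mul, h.orth]
    simp [Nat.lt_succ_of_le hj]
  have key : ∀ n : ℕ, n ≤ N + 1 → ∀ P : Polynomial ℂ, P.degree < n →
      ∫ t, P.eval t * cj ((SN φ ζ N).eval t) ∂ν = P.eval ζ := by
    intro n
    induction n with
    | zero =>
      intro _ P hP
      have : P = 0 := by simpa using hP
      simp [this]
    | succ n ih =>
      intro hn P hP
      set c := P.coeff n / (φ n).coeff n
      have hc : (φ n).coeff n ≠ 0 := by
        have := Polynomial.leadingCoeff_ne_zero.2 (h.ne n)
        rwa [Polynomial.leadingCoeff, h.deg n] at this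
      have h1 : (P - Polynomial.C c * φ n).degree < n := by
        rw [Polynomial.degree_lt_iff_coeff_zero]
        intro m hm
        rw [Polynomial.coeff_sub, Polynomial.coeff_C_mul]
        rcases hm.eq_or_lt with rfl | hm
        · simp only [c]; field_simp; ring
        · rw [(Polynomial.degree_lt_iff_coeff_zero _ _).1 hP m hm,
            Polynomial.coeff_eq_zero_of_natDegree_lt (by rw [h.deg]; exact hm)]; simp
      have h2 := ih (by omega) _ h1
      have e : ∀ t, P.eval t * cj ((SN φ ζ N).eval t) = (P - Polynomial.C c * φ n).eval t * cj ((SN φ ζ N).eval t) +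
          c * ((φ n).eval t * cj ((SN φ ζ N).eval t)) := fun t => by simp; ring
      simp only [e]
      rw [integral_add (D.pq_int _ _) ((D.pq_int _ _).const_mul _), h2, integral_const_mul, base n (by omega)]
      simp
  exact key _ le_rfl P hP
lemma SN_self (D : Dat G ν lam F) (h : ON ν φ) (ζ : ℂ) (N : ℕ) :
    ((nrm ν (fun t => (SN φ ζ N).eval t) ^ 2 : ℝ) : ℂ) = (SN φ ζ N).eval ζ := by
  rw [nrm_sq, D.rep h ζ (SN_deg h ζ N)]
lemma SN_sum (D : Dat G ν lam F) (h : ON ν φ) (ζ : ℂ) (N : ℕ) :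
    nrm ν (fun t => (SN φ ζ N).eval t) ^ 2 = ∑ k ∈ Finset.range (N + 1), ‖(φ k).eval ζ‖ ^ 2 := by
  have := D.SN_self h ζ N
  rw [SN_eval] at this
  have e : ∀ k, cj ((φ k).eval ζ) * (φ k).eval ζ = ((‖(φ k).eval ζ‖ ^ 2 : ℝ) : ℂ) := fun k => by
    rw [conj_mul']; norm_cast
  simp only [e] at this
  exact_mod_cast this
lemma SN_bd (h : ON ν φ) {ζ : ℂ} (hz : ζ ∈ G) (hd : 0 < d) (hdd : ∀ t ∈ frontier G, d ≤ ‖t - ζ‖) (N : ℕ) :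
    nrm ν (fun t => (SN φ ζ N).eval t) ^ 2 ≤ D.A / d := by
  have h1 := D.poly_bd (SN φ ζ N) hz hd hdd
  rw [← D.SN_self h, norm_real, Real.norm_of_nonneg (by positivity)] at h1
  have h0 := nrm_nonneg ν (fun t => (SN φ ζ N).eval t)
  have h2 : 0 ≤ D.A / d := div_nonneg D.A_nonneg hd.le
  rcases h0.eq_or_lt with h3 | h3
  · rw [← h3]; simpa using h2
  have h4 : nrm ν (fun t => (SN φ ζ N).eval t) ≤ √(D.A / d) := by nlinarith
  calc _ ≤ √(D.A / d) ^ 2 := by gcongr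
    _ = _ := Real.sq_sqrt h2
lemma sum_sq (D : Dat G ν lam F) (h : ON ν φ) {ζ : ℂ} (hz : ζ ∈ G) : Summable fun k => ‖(φ k).eval ζ‖ ^ 2 := by
  obtain ⟨d, hd, hdd⟩ := D.dist_pos (D.G_notL hz)
  refine summable_of_sum_range_le (c := D.A / d) (fun k => by positivity) fun n => ?_
  refine le_trans ?_ (D.SN_bd h hz hd hdd n)
  rw [D.SN_sum h, Finset.sum_range_succ]
  exact le_add_of_nonneg_right (by positivity)
structure IsK (D : Dat G ν lam F) (φ : ℕ → Polynomial ℂ) (ζ : ℂ) (k : ℂ → ℂ) : Prop where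
  mem : MemLp k 2 ν
  lim : Tendsto (fun N => nrm ν (fun t => k t - (SN φ ζ N).eval t)) atTop (𝓝 0)
lemma exists_K (h : ON ν φ) {ζ : ℂ} (hz : ζ ∈ G) : ∃ k, D.IsK φ ζ k := by
  set v : ℕ → Lp ℂ 2 ν := fun k => (D.pL (φ k)).toLp _
  have hv : Orthonormal ℂ v := by
    rw [orthonormal_iff_ite]
    intro i j
    rw [L2.inner_def]
    have := h.orth j i
    rw [show (if i = j then (1:ℂ) else 0) = if j = i then 1 else 0 by simp [eq_comm], ← this]
    refine integral_congr_ae ?_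
    filter_upwards [(D.pL (φ i)).coeFn_toLp, (D.pL (φ j)).coeFn_toLp] with t h1 h2
    rw [h1, h2]; simp
  have hs : Summable fun k => cj ((φ k).eval ζ) • v k := by
    have := (hv.orthogonalFamily.summable_iff_norm_sq_summable (fun k => cj ((φ k).eval ζ))).2
      (by simpa using D.sum_sq h hz)
    simpa using this
  set s := ∑' k, cj ((φ k).eval ζ) • v k
  refine ⟨s, Lp.memLp s, ?_⟩
  have ht := (hs.hasSum.tendsto_sum_nat.comp (tendsto_add_atTop_nat 1))
  have ht' := (tendsto_iff_norm_sub_tendsto_zero.1 ht)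
  refine ht'.congr fun N => ?_
  have hm : MemLp (fun t => s t - (SN φ ζ N).eval t) 2 ν := (Lp.memLp s).sub (D.pL _)
  rw [← nrm_Lp hm, norm_sub_rev]
  congr 1
  have e : ∑ k ∈ Finset.range (N + 1), cj ((φ k).eval ζ) • v k = (D.pL (SN φ ζ N)).toLp _ := by
    have : ∀ n : ℕ, ∑ k ∈ Finset.range n, cj ((φ k).eval ζ) • v k =
      (D.pL (∑ k ∈ Finset.range n, Polynomial.C (cj ((φ k).eval ζ)) * φ k)).toLp _ := by
      intro n
      induction n with
      | zero => 
        rw [Finset.sum_range_zero, ← MemLp.toLp_zero (MemLp.zero (p := 2) (μ := ν) (ε := ℂ))]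
        refine MemLp.toLp_congr _ _ (ae_of_all _ fun t => ?_)
        simp
      | succ n ih =>
        rw [Finset.sum_range_succ, ih]
        simp only [v]
        rw [← MemLp.toLp_const_smul, ← MemLp.toLp_add]
        refine MemLp.toLp_congr _ _ (ae_of_all _ fun t => ?_)
        simp [Finset.sum_range_succ]
    exact this _
  simp only [Function.comp]
  rw [e]
  change s - _ = _
  have e2 := Lp.toLp_coeFn s (Lp.memLp s)
  calc s - (D.pL (SN φ ζ N)).toLp _ = (Lp.memLp s).toLp _ - (D.pL (SN φ ζ N)).toLp _ := by rw [e2]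
    _ = _ := by rw [← MemLp.toLp_sub]; rfl
variable {ζ : ℂ} {k : ℂ → ℂ}
lemma tend_int {u : ℂ → ℂ} {v : ℕ → ℂ → ℂ} {g : ℂ → ℂ} (hu : MemLp u 2 ν) (hv : ∀ n, MemLp (v n) 2 ν)
    (hg : MemLp g 2 ν) (hl : Tendsto (fun n => nrm ν (fun t => u t - v n t)) atTop (𝓝 0)) :
    Tendsto (fun n => ∫ t, v n t * g t ∂ν) atTop (𝓝 (∫ t, u t * g t ∂ν)) := by
  rw [tendsto_iff_norm_sub_tendsto_zero]
  refine squeeze_zero (fun _ => norm_nonneg _) (fun n => ?_) (by simpa using hl.mul_const (nrm ν g))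
  rw [norm_sub_rev, ← integral_sub (CS hu hg).1 (CS (hv n) hg).1]
  refine le_trans (le_of_eq ?_) (CSn (hu.sub (hv n)) hg)
  congr 2; funext t; ring
lemma K1 (hφ : ON ν φ) (hk : D.IsK φ ζ k) (P : Polynomial ℂ) : ∫ t, P.eval t * cj (k t) ∂ν = P.eval ζ := by
  have h1 := tend_int (u := fun t => cj (k t)) (v := fun N t => cj ((SN φ ζ N).eval t)) (g := fun t => P.eval t)
    (memLp_conj hk.mem) (fun N => memLp_conj (D.pL _)) (D.pL P) (by
      refine hk.lim.congr fun N => ?_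
      rw [← nrm_conj]; simp only [map_sub])
  simp only [mul_comm _ (P.eval _)] at h1
  refine tendsto_nhds_unique h1 (tendsto_const_nhds.congr' ?_)
  filter_upwards [eventually_ge_atTop P.natDegree] with N hN
  refine (D.rep hφ ζ ?_).symm
  refine lt_of_le_of_lt Polynomial.degree_le_natDegree ?_
  exact_mod_cast Nat.lt_succ_of_le hN
lemma K2 (hφ : ON ν φ) (hk : D.IsK φ ζ k) (P : Polynomial ℂ) :
    ∫ t, P.eval t * (k t * cj (k t)) ∂ν = ((nrm ν k ^ 2 : ℝ) : ℂ) * P.eval ζ := by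
  have h1 : ∀ P : Polynomial ℂ, Tendsto (fun N => P.eval ζ * (SN φ ζ N).eval ζ) atTop (𝓝 (∫ t, P.eval t * (k t * cj (k t)) ∂ν)) := by
    intro P
    have h1 := tend_int (u := k) (v := fun N t => (SN φ ζ N).eval t) (g := fun t => P.eval t * cj (k t))
      hk.mem (fun N => D.pL _) (D.pa_memLp (PA.poly P) (memLp_conj hk.mem)) hk.lim
    rw [show (∫ t, P.eval t * (k t * cj (k t)) ∂ν) = ∫ t, k t * (P.eval t * cj (k t)) ∂ν by congr 1; funext t; ring]
    refine h1.congr fun N => ?_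
    have := D.K1 hφ hk (P * SN φ ζ N)
    rw [Polynomial.eval_mul] at this
    rw [← this]
    congr 1; funext t; rw [Polynomial.eval_mul]; ring
  have h2 := h1 1
  simp only [Polynomial.eval_one, one_mul] at h2
  rw [← nrm_sq] at h2
  rw [mul_comm]
  exact tendsto_nhds_unique (h1 P) (h2.const_mul _)
lemma K_bd (hφ : ON ν φ) (hk : D.IsK φ ζ k) (hz : ζ ∈ G) (hd : 0 < d)
    (hdd : ∀ t ∈ frontier G, d ≤ ‖t - ζ‖) : nrm ν k ^ 2 ≤ D.A / d := by
  have h1 := tend_int (u := k) (v := fun N t => (SN φ ζ N).eval t) (g := fun t => cj (k t))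
      hk.mem (fun N => D.pL _) (memLp_conj hk.mem) hk.lim
  rw [← nrm_sq] at h1
  have h2 := h1.norm
  rw [norm_real, Real.norm_of_nonneg (by positivity)] at h2
  refine le_of_tendsto' h2 fun N => ?_
  rw [D.K1 hφ hk, ← D.SN_self hφ, norm_real, Real.norm_of_nonneg (by positivity)]
  exact D.SN_bd hφ hz hd hdd N
lemma cau_k (hk : D.IsK φ ζ k) (hz : z ∈ G) :
    Tendsto (fun N => (SN φ ζ N).eval z) atTop (𝓝 ((2 * π * I)⁻¹ * Cau ν (fun t => k t * D.σ t) z)) := by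
  have hi := D.inv_int (D.G_notL hz)
  have h1 := tend_int (u := k) (v := fun N t => (SN φ ζ N).eval t) (g := fun t => (t - z)⁻¹ * D.σ t)
      hk.mem (fun N => D.pL _) (D.σ_memLp hi) hk.lim
  have h2 := h1.const_mul (2 * π * I)⁻¹
  have e : ∀ f : ℂ → ℂ, ∫ t, f t * ((t - z)⁻¹ * D.σ t) ∂ν = Cau ν (fun t => f t * D.σ t) z := fun f => by
    rw [Cau]; congr 1; funext t; ring
  simp only [e, D.cauchy_poly _ hz] at h2
  have h0 : 2 * (π : ℂ) * I ≠ 0 := by simp [Real.pi_ne_zero]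
  refine h2.congr fun N => ?_
  rw [inv_mul_cancel_left₀ h0]
lemma tsum_k (hφ : ON ν φ) (hk : D.IsK φ ζ k) (hζ : ζ ∈ G) (hz : z ∈ G) :
    ∑' k, cj ((φ k).eval ζ) * (φ k).eval z = (2 * π * I)⁻¹ * Cau ν (fun t => k t * D.σ t) z := by
  have hs : Summable fun k => cj ((φ k).eval ζ) * (φ k).eval z := by
    refine Summable.of_norm_bounded ((D.sum_sq hφ hζ).add (D.sum_sq hφ hz)) fun k => ?_
    rw [norm_mul, RCLike.norm_conj]
    nlinarith [sq_nonneg (‖(φ k).eval ζ‖ - ‖(φ k).eval z‖), sq_nonneg ‖(φ k).eval ζ‖, sq_nonneg ‖(φ k).eval z‖]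
  refine tendsto_nhds_unique (hs.hasSum.tendsto_sum_nat.comp (tendsto_add_atTop_nat 1)) ?_
  refine (D.cau_k hk hz).congr fun N => ?_
  rw [SN_eval]; rfl
lemma err_orth (hφ : ON ν φ) (hk : D.IsK φ ζ k) {n : ℕ} {P : Polynomial ℂ} (hP : P.degree < (n + 1 : ℕ)) :
    ∫ t, P.eval t * cj (k t - (SN φ ζ n).eval t) ∂ν = 0 := by
  simp only [map_sub, mul_sub]
  rw [integral_sub (CS (D.pL P) (memLp_conj hk.mem)).1 (D.pq_int _ _), D.K1 hφ hk, D.rep hφ ζ hP, sub_self]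
lemma err_sq (hφ : ON ν φ) (hk : D.IsK φ ζ k) (n : ℕ) :
    ((nrm ν (fun t => k t - (SN φ ζ n).eval t) ^ 2 : ℝ) : ℂ) = ∫ t, k t * cj (k t - (SN φ ζ n).eval t) ∂ν := by
  have he : MemLp (fun t => k t - (SN φ ζ n).eval t) 2 ν := hk.mem.sub (D.pL _)
  have h0 := D.err_orth hφ hk (SN_deg hφ ζ n)
  rw [nrm_sq, ← sub_zero (∫ t, k t * _ ∂ν), ← h0,
    ← integral_sub (CS hk.mem (memLp_conj he)).1 (CS (D.pL _) (memLp_conj he)).1]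
  congr 1; funext t; ring
end Dat
structure Cor (X : Set ℂ) (lam : ℝ) (c0 u : ℂ) (b : ℝ) : Prop where
  l0 : 0 < lam
  l2 : lam < 2
  bd : Bornology.IsBounded X
  u1 : ‖u‖ = 1
  b0 : 0 < b
  sec : ∀ w ∈ Sec lam, Zl c0 u b w ∉ X ∧ PA X (fun z => (z - Zl c0 u b w)⁻¹)
  pb : c0 + u * b ∉ X
  pbA : PA X (fun z => (z - (c0 + u * b))⁻¹)
def vv (c0 u : ℂ) (b : ℝ) (z : ℂ) : ℂ := b + b ^ 2 * u * (z - (c0 + u * b))⁻¹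
def bet (lam : ℝ) : ℝ := π - lam * π / 2
lemma arg_lt {a : ℝ} (ha : a ∈ Icc 0 π) (h : ‖w‖ * cosR a < w.re) : w ≠ 0 ∧ |arg w| < a := by
  have h0 : w ≠ 0 := by rintro rfl; simp at h
  refine ⟨h0, ?_⟩
  have hn : 0 < ‖w‖ := norm_pos_iff.2 h0
  refine (Real.strictAntiOn_cos.lt_iff_gt ha ⟨abs_nonneg _, abs_arg_le_pi w⟩).1 ?_
  rw [Real.cos_abs, cos_arg h0, lt_div_iff₀ hn]; linarith
lemma arg_le {a : ℝ} (ha : a ∈ Icc 0 π) (h0 : w ≠ 0) (h : ‖w‖ * cosR a ≤ w.re) : |arg w| ≤ a := by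
  have hn : 0 < ‖w‖ := norm_pos_iff.2 h0
  refine (Real.strictAntiOn_cos.le_iff_ge ha ⟨abs_nonneg _, abs_arg_le_pi w⟩).1 ?_
  rw [Real.cos_abs, cos_arg h0, le_div_iff₀ hn]; linarith
namespace Cor
lemma u0 (H : Cor X lam c0 u b) : u ≠ 0 := by
  have := H.u1; intro h; simp [h] at this
lemma bet0 (H : Cor X lam c0 u b) : 0 < bet lam := by
  have := H.l2; have := Real.pi_pos; unfold bet; nlinarith
lemma betpi (H : Cor X lam c0 u b) : bet lam < π := by
  have := H.l0; have := Real.pi_pos; unfold bet; nlinarith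
lemma betI (H : Cor X lam c0 u b) : bet lam ∈ Icc 0 π := ⟨H.bet0.le, H.betpi.le⟩
lemma sinpos (H : Cor X lam c0 u b) : 0 < sinR (bet lam) := Real.sin_pos_of_pos_of_lt_pi H.bet0 H.betpi
lemma cosgt (H : Cor X lam c0 u b) : -1 < cosR (bet lam) := by
  rw [← Real.cos_pi]
  exact Real.strictAntiOn_cos H.betI ⟨Real.pi_pos.le, le_rfl⟩ H.betpi
lemma zne (H : Cor X lam c0 u b) (hz : z ∈ X) : z - (c0 + u * b) ≠ 0 := fun h => H.pb (by rw [← sub_eq_zero.1 h]; exact hz)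
lemma vv_sec (H : Cor X lam c0 u b) (hz : z ∈ X) : ‖vv c0 u b z‖ * cosR (bet lam) ≤ (vv c0 u b z).re := by
  by_contra h; push Not at h
  have h1 : ‖-vv c0 u b z‖ * cosR (lam * π / 2) < (-vv c0 u b z).re := by
    rw [norm_neg, neg_re]
    have : cosR (bet lam) = - cosR (lam * π / 2) := Real.cos_pi_sub _
    rw [this] at h; linarith
  have h2 := arg_lt ⟨by have := H.l0; positivity, by have := H.l2; nlinarith [Real.pi_pos]⟩ h1
  refine (H.sec _ h2).1 ?_
  have hb : (b : ℂ) ≠ 0 := by exact_mod_cast H.b0.ne'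
  have hu := H.u0
  have hzz := H.zne hz
  have : Zl c0 u b (-vv c0 u b z) = z := by
    unfold Zl vv
    set q := z - (c0 + u * b) with hq
    have e : 1 + -(b + b ^ 2 * u * q⁻¹) / (b:ℂ) = - (b * u * q⁻¹) := by field_simp; ring
    rw [e]
    have e2 : z = q + (c0 + u * b) := by rw [hq]; ring
    rw [e2]
    field_simp
    ring
  rwa [this]
lemma cβ (H : Cor X lam c0 u b) : 0 < √((1 + cosR (bet lam)) / 2) := Real.sqrt_pos.2 (by have := H.cosgt; linarith)
lemma low (H : Cor X lam c0 u b) {v : ℂ} (hr : 0 < r) (hv : ‖v‖ * cosR (bet lam) ≤ v.re) :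
    √((1 + cosR (bet lam)) / 2) * (‖v‖ + r) ≤ ‖v + r‖ := by
  have h1 := H.cosgt
  rw [← abs_of_nonneg (by positivity : 0 ≤ ‖v‖ + r), ← Real.sqrt_sq_eq_abs, ← Real.sqrt_mul (by linarith)]
  rw [Real.sqrt_le_left (norm_nonneg _), ← normSq_eq_norm_sq, normSq_apply]
  have h2 : ‖v‖ ^ 2 = v.re * v.re + v.im * v.im := by rw [← normSq_eq_norm_sq, normSq_apply]
  simp only [add_re, ofReal_re, add_im, ofReal_im, add_zero]
  nlinarith [mul_nonneg (sub_nonneg.2 (Real.cos_le_one (bet lam))) (sq_nonneg (‖v‖ - r)), mul_le_mul_of_nonneg_left hv hr.le]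
lemma vr_ne (H : Cor X lam c0 u b) {v : ℂ} (hr : 0 < r) (hv : ‖v‖ * cosR (bet lam) ≤ v.re) : v + r ≠ 0 := by
  have := H.low hr hv
  have h2 := H.cβ
  rw [← norm_pos_iff]
  refine lt_of_lt_of_le ?_ this
  positivity
lemma vr_arg (H : Cor X lam c0 u b) {v : ℂ} (hr : 0 < r) (hv : ‖v‖ * cosR (bet lam) ≤ v.re) : |arg (v + r)| ≤ bet lam := by
  refine arg_le H.betI (H.vr_ne hr hv) ?_
  simp only [add_re, ofReal_re]
  have hn : ‖(r:ℂ)‖ = r := by rw [norm_real, Real.norm_of_nonneg hr.le]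
  have h1 : ‖v + r‖ ≤ ‖v‖ + r := (norm_add_le _ _).trans (by rw [hn])
  have h2 : ‖v‖ ≤ ‖v + r‖ + r := by
    have := norm_sub_le (v + r) (r:ℂ); rw [hn] at this; simpa using this
  have h3 := Real.cos_le_one (bet lam)
  have h4 := H.cosgt
  rcases le_or_gt 0 (cosR (bet lam)) with h | h
  · nlinarith
  · nlinarith
lemma sin_low (H : Cor X lam c0 u b) {v : ℂ} (hr : 0 < r) (hv : ‖v‖ * cosR (bet lam) ≤ v.re) :
    r * sinR (bet lam) ≤ ‖v + r‖ * sinR (bet lam - |arg (v + r)|) := by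
  have hpol : ∀ y : ℂ, ‖y‖ * sinR (bet lam - |arg y|) = sinR (bet lam) * y.re - cosR (bet lam) * |y.im| := by
    intro y
    rw [Real.sin_sub, Real.cos_abs, ← norm_mul_cos_arg y]
    have : |y.im| = ‖y‖ * sinR |arg y| := by
      rw [← norm_mul_sin_arg y, abs_mul, abs_norm]
      rw [Real.abs_sin_eq_sin_abs_of_abs_le_pi (abs_arg_le_pi y)]
    rw [this, norm_mul_cos_arg, ← norm_mul_cos_arg y]; ring
  have h1 : 0 ≤ sinR (bet lam) * v.re - cosR (bet lam) * |v.im| := by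
    rw [← hpol]
    refine mul_nonneg (norm_nonneg _) ?_
    by_cases h0 : v = 0
    · simp [h0]; exact H.sinpos.le
    have := arg_le H.betI h0 hv
    exact Real.sin_nonneg_of_nonneg_of_le_pi (by linarith) (by linarith [H.betpi, abs_nonneg (arg v)])
  rw [hpol]
  simp only [add_re, ofReal_re, add_im, ofReal_im, add_zero]
  nlinarith
lemma vvA (H : Cor X lam c0 u b) : PA X (vv c0 u b) := by
  refine (PA.add (PA.const (b:ℂ)) (PA.mul H.bd (PA.const (b ^ 2 * u)) H.pbA)).congr fun z _ => rfl
lemma ofr_sec (H : Cor X lam c0 u b) (hr : 0 < r) : (r : ℂ) ∈ Sec lam := by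
  refine ⟨by exact_mod_cast hr.ne', ?_⟩
  rw [arg_ofReal_of_nonneg hr.le, abs_zero]
  have := H.l0; positivity
lemma inv_eq (H : Cor X lam c0 u b) (hr : 0 < r) (hz : z ∈ X) : (vv c0 u b z + r)⁻¹ =
    1 / (r + b) + -(b ^ 2 / (r + b) ^ 2 * u) * (z - Zl c0 u b r)⁻¹ := by
  have hzz := H.zne hz
  have hne := H.vr_ne hr (H.vv_sec hz)
  have hb : (b : ℂ) ≠ 0 := by exact_mod_cast H.b0.ne'
  have hrb : (r : ℂ) + b ≠ 0 := by have := H.b0; exact_mod_cast (by positivity : r + b ≠ 0)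
  have h2 : z - Zl c0 u b r ≠ 0 := fun h => (H.sec _ (H.ofr_sec hr)).1 (by rw [← sub_eq_zero.1 h]; exact hz)
  have e : Zl c0 u b r = c0 + u * (r * b / (r + b)) := by
    unfold Zl; congr 2; 
    have : 1 + (r:ℂ) / b ≠ 0 := by
      have : 1 + (r:ℂ) / b = (r + b) / b := by field_simp; ring
      rw [this]; exact div_ne_zero hrb hb
    rw [div_eq_div_iff this hrb]; field_simp; ring
  rw [e] at h2 ⊢
  unfold vv at hne ⊢
  set q := z - (c0 + u * b) with hq
  have e3 : z - (c0 + u * (r * b / (r + b))) = q + u * b ^ 2 / (r + b) := by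
    rw [hq]; field_simp; ring
  rw [e3] at h2 ⊢
  have e4 : (b + b ^ 2 * u * q⁻¹ + r : ℂ) = (r + b) * (q + u * b ^ 2 / (r + b)) / q := by field_simp; ring
  rw [e4]
  have e5 : (r + b) * q + u * b ^ 2 ≠ (0:ℂ) := by
    have : (r + b) * q + u * b ^ 2 = (r + b) * (q + u * b ^ 2 / (r + b)) := by field_simp
    rw [this]; exact mul_ne_zero hrb h2
  have e6 : q + u * b ^ 2 / (r + b) = ((r + b) * q + u * b ^ 2) / (r + b) := by field_simp
  rw [e6]
  generalize hS : (r + b) * q + u * b ^ 2 = S at *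
  generalize (r : ℂ) + b = R at *
  have hS2 : (b:ℂ) ^ 2 / R ^ 2 * u = (S - R * q) / R ^ 2 := by rw [← hS]; ring
  rw [hS2]
  field_simp
  ring
lemma invA (H : Cor X lam c0 u b) (hr : 0 < r) : PA X (fun z => (vv c0 u b z + r)⁻¹) :=
  (PA.add (PA.const (1 / (r + b) : ℂ)) (PA.mul H.bd (PA.const (-(b ^ 2 / (r + b) ^ 2 * u)))
    (H.sec _ (H.ofr_sec hr)).2)).congr fun z hz => (H.inv_eq hr hz).symm
lemma dq (H : Cor X lam c0 u b) (hr : 0 < r) (M : ℕ) (hz : z ∈ X) : ∃ q, PA X q ∧ ∀ t ∈ X,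
    ((vv c0 u b t + r)⁻¹) ^ M - ((vv c0 u b z + r)⁻¹) ^ M = q t * (t - z) := by
  obtain ⟨q1, h1, h1'⟩ : ∃ q, PA X q ∧ ∀ t ∈ X, (vv c0 u b t + r)⁻¹ - (vv c0 u b z + r)⁻¹ = q t * (t - z) := by
    refine ⟨_, PA.mul H.bd (PA.const ((b ^ 2 / (r + b) ^ 2 * u) * (z - Zl c0 u b r)⁻¹)) (H.sec _ (H.ofr_sec hr)).2,
      fun t ht => ?_⟩
    rw [H.inv_eq hr ht, H.inv_eq hr hz]
    have h2 : ∀ z ∈ X, z - Zl c0 u b r ≠ 0 := fun z hz h => (H.sec _ (H.ofr_sec hr)).1 (by rw [← sub_eq_zero.1 h]; exact hz)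
    have h3 := h2 z hz
    have h4 := h2 t ht
    have : (z - Zl c0 u b r)⁻¹ - (t - Zl c0 u b r)⁻¹ = (z - Zl c0 u b r)⁻¹ * (t - Zl c0 u b r)⁻¹ * (t - z) := by
      field_simp; ring
    calc _ = (b ^ 2 / (r + b) ^ 2 * u) * ((z - Zl c0 u b r)⁻¹ - (t - Zl c0 u b r)⁻¹) := by ring
      _ = _ := by rw [this]; ring
  induction M with
  | zero => exact ⟨_, PA.const 0, fun t _ => by simp⟩
  | succ M ih =>
    obtain ⟨q, h2, h2'⟩ := ih
    refine ⟨_, PA.add (PA.mul H.bd (H.invA hr) h2) (PA.mul H.bd (PA.const (((vv c0 u b z + r)⁻¹) ^ M)) h1), fun t ht => ?_⟩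
    calc _ = (vv c0 u b t + r)⁻¹ * (((vv c0 u b t + r)⁻¹) ^ M - ((vv c0 u b z + r)⁻¹) ^ M) +
        ((vv c0 u b z + r)⁻¹) ^ M * ((vv c0 u b t + r)⁻¹ - (vv c0 u b z + r)⁻¹) := by ring
      _ = _ := by rw [h1' t ht, h2' t ht]; ring
lemma expA (H : Cor X lam c0 u b) {s : ℝ} : ∀ r : ℝ, 0 < r → PA X (fun z => exp (-s * log (vv c0 u b z + r))) := by
  obtain ⟨ε, hε, hε1⟩ : ∃ ε > 0, ∀ w : ℂ, ‖w‖ < ε → |arg (1 + w)| < π - bet lam := by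
    have hc : ContinuousAt (fun w : ℂ => |arg (1 + w)|) 0 := by
      refine ContinuousAt.abs (ContinuousAt.comp (g := arg) (continuousAt_arg ?_) (by fun_prop))
      simp
    have h2 : ∀ᶠ w : ℂ in 𝓝 0, |arg (1 + w)| < π - bet lam := by
      refine hc.eventually_lt continuousAt_const ?_
      simp; exact H.betpi
    obtain ⟨ε, hε, h⟩ := Metric.eventually_nhds_iff.1 h2
    exact ⟨ε, hε, fun w hw => h (by simpa using hw)⟩
  have hφ : DifferentiableOn ℂ (fun w => exp (-s * log (1 + w))) (ball 0 1) := by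
    intro w hw
    refine DifferentiableAt.differentiableWithinAt ?_
    refine DifferentiableAt.cexp (DifferentiableAt.const_mul (DifferentiableAt.clog (by fun_prop) ?_) _)
    exact mem_slitPlane_of_norm_lt_one (by simpa using hw)
  have step : ∀ (r r' : ℝ), 0 < r → r ≤ r' → r' - r ≤ r' * (min (1/4) (ε/2) * √((1 + cosR (bet lam)) / 2)) →
      PA X (fun z => exp (-s * log (vv c0 u b z + r'))) → PA X (fun z => exp (-s * log (vv c0 u b z + r))) := by
    intro r r' hr hrr h1 h2
    have hr' : 0 < r' := hr.trans_le hrr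
    have hg : PA X (fun z => ((r - r' : ℝ) : ℂ) * (vv c0 u b z + r')⁻¹) := PA.mul H.bd (PA.const _) (H.invA hr')
    have hb : ∀ z ∈ X, ‖((r - r' : ℝ) : ℂ) * (vv c0 u b z + r')⁻¹‖ ≤ min (1/4) (ε/2) := by
      intro z hz
      have h3 := H.low hr' (H.vv_sec hz)
      have h4 := norm_pos_iff.2 (H.vr_ne hr' (H.vv_sec hz))
      rw [norm_mul, norm_inv, norm_real, Real.norm_eq_abs, abs_sub_comm, abs_of_nonneg (by linarith), ← div_eq_mul_inv,
        div_le_iff₀ h4]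
      have h5 := H.cβ
      calc _ ≤ _ := h1
        _ = min (1/4) (ε/2) * (√((1 + cosR (bet lam)) / 2) * r') := by ring
        _ ≤ min (1/4) (ε/2) * (√((1 + cosR (bet lam)) / 2) * (‖vv c0 u b z‖ + r')) := by
          gcongr; linarith [norm_nonneg (vv c0 u b z)]
        _ ≤ _ := by gcongr
    refine (PA.mul H.bd h2 (PA.comp H.bd hg (fun z hz => (hb z hz).trans ((min_le_left _ _).trans (by norm_num))) hφ)).congr
      fun z hz => ?_
    rw [← exp_add, ← mul_add]
    congr 2
    have h4 := H.vr_ne hr' (H.vv_sec hz)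
    have e : vv c0 u b z + r = (vv c0 u b z + r') * (1 + ((r - r' : ℝ) : ℂ) * (vv c0 u b z + r')⁻¹) := by
      field_simp; push_cast; ring
    have h7 : 1 + ((r - r' : ℝ) : ℂ) * (vv c0 u b z + r')⁻¹ ≠ 0 := by
      intro h0; rw [h0, mul_zero] at e; exact H.vr_ne hr (H.vv_sec hz) e
    rw [e, eq_comm, log_mul_eq_add_log_iff h4 h7]
    have h8 := hε1 _ (lt_of_le_of_lt (hb z hz) (lt_of_le_of_lt (min_le_right _ _) (by linarith)))
    have h9 := H.vr_arg hr' (H.vv_sec hz)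
    have := abs_le.1 h9
    have := abs_lt.1 h8
    constructor <;> linarith
  have large : ∃ T : ℝ, 0 < T ∧ ∀ r : ℝ, T ≤ r → PA X (fun z => exp (-s * log (vv c0 u b z + r))) := by
    obtain ⟨Mv, hM, hM'⟩ := PA.bdd H.bd H.vvA
    refine ⟨2 * Mv, by positivity, fun r hr => ?_⟩
    have hr0 : 0 < r := by linarith
    have hg : PA X (fun z => ((r⁻¹ : ℝ) : ℂ) * vv c0 u b z) := PA.mul H.bd (PA.const _) H.vvA
    have hr1 : (r:ℂ) ≠ 0 := by exact_mod_cast hr0.ne'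
    have hb2 : ∀ z ∈ X, ‖((r⁻¹ : ℝ) : ℂ) * vv c0 u b z‖ ≤ 1 / 2 := by
      intro z hz
      rw [norm_mul, norm_real, Real.norm_of_nonneg (by positivity), inv_mul_le_iff₀ hr0]
      linarith [hM' z hz]
    refine (PA.mul H.bd (PA.const (exp (-s * logR r))) (PA.comp H.bd hg hb2 hφ)).congr
      fun z hz => ?_
    rw [← exp_add, ← mul_add]
    congr 2
    have e : vv c0 u b z + r = (r:ℂ) * (1 + ((r⁻¹ : ℝ) : ℂ) * vv c0 u b z) := by
      push_cast; field_simp; ring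
    rw [e, log_ofReal_mul hr0]
    intro h0; rw [h0, mul_zero] at e; exact H.vr_ne hr0 (H.vv_sec hz) e
  obtain ⟨T, hT, hTl⟩ := large
  intro r hr
  set q := min (1/4) (ε/2) * √((1 + cosR (bet lam)) / 2)
  have hq0 : 0 < q := mul_pos (by positivity) H.cβ
  have hq1 : q < 1 := by
    have : √((1 + cosR (bet lam)) / 2) ≤ 1 := by
      rw [Real.sqrt_le_one]; linarith [Real.cos_le_one (bet lam)]
    have h2 : min (1/4) (ε/2) ≤ 1/4 := min_le_left _ _
    have h3 : 0 < min (1/4) (ε/2) := by positivity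
    nlinarith [H.cβ]
  have ind : ∀ N : ℕ, ∀ r > 0, T * (1 - q) ^ N ≤ r → PA X (fun z => exp (-s * log (vv c0 u b z + r))) := by
    intro N
    induction N with
    | zero => intro r hr h; exact hTl r (by simpa using h)
    | succ N ih =>
      intro r hr h
      have h1 : 0 < 1 - q := by linarith
      have h2 : r ≤ r / (1 - q) := by rw [le_div_iff₀ h1]; nlinarith
      have h3 : r / (1 - q) * (1 - q) = r := by field_simp
      refine step r (r / (1 - q)) hr h2 ?_ (ih _ (by positivity) ?_)
      · nlinarith
      · rw [le_div_iff₀ h1]; rw [pow_succ] at h; linarith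
  obtain ⟨N, hN⟩ := exists_pow_lt_of_lt_one (show 0 < r / T by positivity) (show 1 - q < 1 by linarith)
  refine ind N r hr ?_
  rw [lt_div_iff₀ hT] at hN; linarith
end Cor
lemma Cor.s0 (H : Cor X lam c0 u b) : 0 < 1 / (2 - lam) := by have := H.l2; exact one_div_pos.2 (by linarith)
lemma Cor.re_low (H : Cor X lam c0 u b) {M : ℕ} (hM : 1 / (2 - lam) + 1 ≤ 2 * M) : ∃ C0 : ℝ, 0 < C0 ∧ ∀ (v : ℂ) (r : ℝ), 0 < r →
    ‖v‖ * cosR (bet lam) ≤ v.re →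
    (r * ‖v + r‖⁻¹) ^ (2 * M) ≤ C0 * r ^ (1 / (2 - lam)) * (exp (-(1 / (2 - lam) : ℝ) * log (v + r))).re := by
  set s := 1 / (2 - lam) with hs
  have hs0 : 0 < s := H.s0
  have hsb : s * bet lam = π / 2 := by
    have : 2 - lam ≠ 0 := by have := H.l2; linarith
    rw [hs, bet]; field_simp
  set cb := √((1 + cosR (bet lam)) / 2)
  have hcb : 0 < cb := H.cβ
  set c := 2 / π * s * sinR (bet lam) with hc
  have hc0 : 0 < c := by have := H.sinpos; positivity
  refine ⟨c⁻¹ * (cb⁻¹) ^ (2 * M - (s + 1)), by positivity, fun v r hr hv => ?_⟩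
  have hne := H.vr_ne hr hv
  have hn := norm_pos_iff.2 hne
  have harg := H.vr_arg hr hv
  have hsin := H.sin_low hr hv
  have hlow := H.low hr hv
  set y := v + r
  set ρ := r * ‖y‖⁻¹ with hρ
  have hρ0 : 0 < ρ := by positivity
  have hρ1 : ρ ≤ cb⁻¹ := by
    rw [hρ, ← div_eq_mul_inv, div_le_iff₀ hn, inv_mul_eq_div, le_div_iff₀ hcb]
    have : cb * r ≤ cb * (‖v‖ + r) := by gcongr; linarith [norm_nonneg v]
    linarith
  have hre : (exp (-(s : ℝ) * log y)).re = ‖y‖ ^ (-s) * cosR (s * |arg y|) := by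
    rw [exp_re]
    have e1 : (-(s:ℂ) * log y).re = logR ‖y‖ * (-s) := by
      simp [log_re, mul_comm]
    have e2 : (-(s:ℂ) * log y).im = -(s * arg y) := by simp [log_im]
    rw [e1, e2, Real.rpow_def_of_pos hn, Real.cos_neg, ← Real.cos_abs, abs_mul, abs_of_pos hs0]
  have hcos : c * ρ ≤ cosR (s * |arg y|) := by
    have e : cosR (s * |arg y|) = sinR (s * (bet lam - |arg y|)) := by
      rw [mul_sub, hsb, Real.sin_pi_div_two_sub]
    have h0 : 0 ≤ bet lam - |arg y| := by linarith
    have h1 := Real.mul_le_sin (x := s * (bet lam - |arg y|)) (by positivity) (by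
      rw [mul_sub, hsb]; have : 0 ≤ s * |arg y| := by positivity
      linarith)
    have h2 := Real.sin_le h0
    have h3 : ρ * sinR (bet lam) ≤ sinR (bet lam - |arg y|) := by
      rw [hρ, mul_assoc, mul_comm ‖y‖⁻¹, ← mul_assoc, ← div_eq_mul_inv, div_le_iff₀ hn]; linarith
    rw [e]
    refine le_trans ?_ h1
    calc c * ρ = 2 / π * (s * (ρ * sinR (bet lam))) := by rw [hc]; ring
      _ ≤ _ := by gcongr; exact h3.trans h2
  have hρs : r ^ s * ‖y‖ ^ (-s) = ρ ^ s := by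
    rw [hρ, Real.mul_rpow hr.le (by positivity), Real.inv_rpow hn.le, Real.rpow_neg hn.le]
  have hpow : ρ ^ (2 * M) ≤ ρ ^ (s + 1) * (cb⁻¹) ^ (2 * M - (s + 1)) := by
    have e : ρ ^ (2 * M) = ρ ^ (s + 1) * ρ ^ (2 * M - (s + 1)) := by
      rw [← Real.rpow_add hρ0, ← Real.rpow_natCast]; congr 1; push_cast; ring
    rw [e]
    gcongr
  rw [hre]
  calc _ ≤ _ := hpow
    _ = c⁻¹ * cb⁻¹ ^ (2 * M - (s + 1)) * ρ ^ s * (c * ρ) := by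
      rw [Real.rpow_add hρ0, Real.rpow_one]; field_simp
    _ ≤ c⁻¹ * cb⁻¹ ^ (2 * M - (s + 1)) * ρ ^ s * cosR (s * |arg y|) := by gcongr
    _ = _ := by rw [← hρs]; ring
lemma Cor.exp_norm (H : Cor X lam c0 u b) {v : ℂ} {s : ℝ} (hr : 0 < r) (hv : ‖v‖ * cosR (bet lam) ≤ v.re) :
    ‖exp (-(s : ℝ) * log (v + r))‖ = ‖v + r‖ ^ (-s) := by
  rw [norm_exp, Real.rpow_def_of_pos (norm_pos_iff.2 (H.vr_ne hr hv))]
  simp [log_re, mul_comm]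
lemma Cor.vv_eq (H : Cor X lam c0 u b) (hz : z ∈ X) : vv c0 u b z = b * (z - c0) * (z - (c0 + u * b))⁻¹ := by
  have h0 := H.zne hz
  unfold vv
  rw [eq_mul_inv_iff_mul_eq₀ (by simpa using h0)]
  generalize hq : z - (c0 + u * b) = q at *
  have e : z - c0 = q + u * b := by rw [← hq]; ring
  rw [e]; field_simp; try ring
lemma exists_sep {K L : Set ℂ} (hK : IsCompact K) (hL : IsClosed L) (h : Disjoint K L) :
    ∃ d > 0, ∀ a ∈ K, ∀ t ∈ L, d ≤ ‖t - a‖ := by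
  obtain ⟨δ, hδ, h1⟩ := hK.exists_cthickening_subset_open hL.isOpen_compl (by
    intro a ha hL'; exact disjoint_left.1 h ha hL')
  refine ⟨δ, hδ, fun a ha t ht => ?_⟩
  by_contra hc; push Not at hc
  refine h1 (mem_cthickening_of_dist_le t a δ K ha ?_) ht
  rw [dist_eq_norm]; exact hc.le
namespace Dat
variable (D : Dat G ν lam F) (j : Fin D.m) {φ : ℕ → Polynomial ℂ} {ζ : ℂ} {k : ℂ → ℂ}
lemma exists_dF : ∃ d > 0, ∀ ζ ∈ F, (∀ t ∈ frontier G, d ≤ ‖t - ζ‖) ∧ ∀ j, ∀ ω ∈ lens D.η, d ≤ ‖ζ - D.τ j ω‖ := by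
  have hcl : IsClosed (frontier G ∪ ⋃ j, D.τ j '' lens D.η) := by
    refine isClosed_frontier.union (isClosed_iUnion_of_finite fun j => ?_)
    exact ((lens_compact D.η_pos).image_of_continuousOn ((D.hol j).continuousOn.mono D.lens_sub)).isClosed
  obtain ⟨d, hd, h⟩ := exists_sep D.F_comp hcl (by
    rw [disjoint_left]; intro a ha h
    rcases h with h | h
    · exact D.G_notL (D.F_sub ha) h
    · obtain ⟨j, ω, hω, rfl⟩ := mem_iUnion.1 h
      exact D.avoid j ω hω ha)
  refine ⟨d, hd, fun ζ hζ => ⟨fun t ht => h ζ hζ t (Or.inl ht), fun j ω hω => ?_⟩⟩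
  rw [norm_sub_rev]
  exact h ζ hζ _ (Or.inr (mem_iUnion.2 ⟨j, ω, hω, rfl⟩))
def dF : ℝ := D.exists_dF.choose
lemma dF_pos : 0 < D.dF := D.exists_dF.choose_spec.1
lemma dF_L (hζ : ζ ∈ F) : ∀ t ∈ frontier G, D.dF ≤ ‖t - ζ‖ := (D.exists_dF.choose_spec.2 ζ hζ).1
lemma dF_τ (hζ : ζ ∈ F) (j : Fin D.m) (hω : ω ∈ lens D.η) : D.dF ≤ ‖ζ - D.τ j ω‖ :=
  (D.exists_dF.choose_spec.2 ζ hζ).2 j ω hω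
def BK : ℝ := √(D.A / D.dF)
lemma BK_nonneg : 0 ≤ D.BK := Real.sqrt_nonneg _
lemma nrm_K (hφ : ON ν φ) (hk : D.IsK φ ζ k) (hζ : ζ ∈ F) : nrm ν k ≤ D.BK := by
  refine Real.le_sqrt_of_sq_le (D.K_bd hφ hk (D.F_sub hζ) D.dF_pos (D.dF_L hζ))
lemma wt (H : Cor (closure G) lam c0 u b) {M : ℕ} (hM : 1 / (2 - lam) + 1 ≤ 2 * M) : ∃ C0 : ℝ, 0 < C0 ∧
    ∀ φ, ON ν φ → ∀ ζ ∈ G, ∀ k, D.IsK φ ζ k → ∀ r : ℝ, 0 < r →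
    r ^ (2 * M) * nrm ν (fun t => ((vv c0 u b t + r)⁻¹) ^ M * cj (k t)) ^ 2 ≤
      C0 * r ^ (1 / (2 - lam)) * (nrm ν k ^ 2 * ‖vv c0 u b ζ + r‖ ^ (-(1 / (2 - lam)))) := by
  obtain ⟨C0, hC0, hC⟩ := H.re_low hM
  refine ⟨C0, hC0, fun φ hφ ζ hζ k hk r hr => ?_⟩
  set s := 1 / (2 - lam)
  set E : ℂ → ℂ := fun z => exp (-(s : ℝ) * log (vv c0 u b z + r)) with hE
  have hEA : PA (closure G) E := H.expA r hr
  have hkk : Integrable (fun t => k t * cj (k t)) ν := (CS hk.mem (memLp_conj hk.mem)).1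
  have h1 := D.pa_int hkk (subset_closure hζ) (fun P => D.K2 hφ hk P) hEA
  have h2 : Integrable (fun t => E t * (k t * cj (k t))) ν :=
    memLp_one_iff_integrable.1 (D.pa_memLp hEA (memLp_one_iff_integrable.2 hkk))
  have hW : MemLp (fun t => ((vv c0 u b t + r)⁻¹) ^ M * cj (k t)) 2 ν :=
    D.pa_memLp (PA.pow H.bd (H.invA hr) M) (memLp_conj hk.mem)
  have h3 : nrm ν (fun t => ((vv c0 u b t + r)⁻¹) ^ M * cj (k t)) ^ 2 =
      ∫ t, ‖((vv c0 u b t + r)⁻¹) ^ M * cj (k t)‖ ^ 2 ∂ν := Real.sq_sqrt (integral_nonneg fun t => by positivity)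
  rw [h3, ← integral_const_mul]
  have h4 : ∫ t, (E t * (k t * cj (k t))).re ∂ν = (((nrm ν k ^ 2 : ℝ) : ℂ) * E ζ).re := by
    rw [← h1]; exact integral_re h2
  have hi := (hW.integrable_norm_pow (by norm_num : (2:ℕ) ≠ 0))
  calc _ ≤ ∫ t, C0 * r ^ s * (E t * (k t * cj (k t))).re ∂ν := by
        refine integral_mono_ae (hi.const_mul _) (h2.re.const_mul _) ?_
        filter_upwards [D.ae_L] with t ht
        have h5 := hC _ r hr (H.vv_sec (L_sub ht))
        have e1 : (E t * (k t * cj (k t))).re = (E t).re * ‖k t‖ ^ 2 := by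
          rw [mul_conj, normSq_eq_norm_sq, re_mul_ofReal]
        have e2 : r ^ (2 * M) * ‖(vv c0 u b t + r)⁻¹ ^ M * cj (k t)‖ ^ 2 = (r * ‖vv c0 u b t + r‖⁻¹) ^ (2 * M) * ‖k t‖ ^ 2 := by
          rw [norm_mul, norm_pow, norm_inv, RCLike.norm_conj]; ring
        rw [e1, e2, ← mul_assoc]
        gcongr
    _ = C0 * r ^ s * (((nrm ν k ^ 2 : ℝ) : ℂ) * E ζ).re := by rw [integral_const_mul, h4]
    _ ≤ _ := by
        gcongr
        refine (re_le_norm _).trans ?_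
        rw [norm_mul, norm_real, Real.norm_of_nonneg (by positivity), H.exp_norm hr (H.vv_sec (subset_closure hζ))]
def Hk (ν : Measure ℂ) (k : ℂ → ℂ) (ζ z : ℂ) : ℂ := Cau ν (fun t => cj (k t)) z - (ζ - z)⁻¹
lemma Hk_mul (H : Cor (closure G) lam c0 u b) (hφ : ON ν φ) (hk : D.IsK φ ζ k) (hζ : ζ ∈ G) (hz : z ∈ G)
    (hne : ζ ≠ z) (hr : 0 < r) (M : ℕ) :
    ((vv c0 u b z + r)⁻¹) ^ M * Hk ν k ζ z =
      Cau ν (fun t => ((vv c0 u b t + r)⁻¹) ^ M * cj (k t)) z - ((vv c0 u b ζ + r)⁻¹) ^ M * (ζ - z)⁻¹ := by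
  obtain ⟨q, hq, hqq⟩ := H.dq hr M (subset_closure hz)
  have hck := memLp_conj hk.mem
  have := D.ν_fin
  have hi := D.inv_int (D.G_notL hz)
  have h1 := D.pa_int (hck.integrable (by norm_num)) (c := 1) (subset_closure hζ)
    (fun P => by rw [D.K1 hφ hk, one_mul]) hq
  rw [one_mul] at h1
  have h2 := hqq ζ (subset_closure hζ)
  have h3 : ζ - z ≠ 0 := sub_ne_zero.2 hne
  have h4 : q ζ = (((vv c0 u b ζ + r)⁻¹) ^ M - ((vv c0 u b z + r)⁻¹) ^ M) * (ζ - z)⁻¹ := by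
    rw [h2]; field_simp
  have h5 : ((vv c0 u b z + r)⁻¹) ^ M * Cau ν (fun t => cj (k t)) z =
      Cau ν (fun t => ((vv c0 u b t + r)⁻¹) ^ M * cj (k t)) z - q ζ := by
    rw [← h1, Cau, Cau, ← integral_const_mul, ← integral_sub]
    · refine integral_congr_ae ?_
      filter_upwards [D.ae_L] with t ht
      have h6 := hqq t (L_sub ht)
      have h7 : t - z ≠ 0 := sub_ne_zero.2 (by rintro rfl; exact D.G_notL hz ht)
      have h8 : q t = (((vv c0 u b t + r)⁻¹) ^ M - ((vv c0 u b z + r)⁻¹) ^ M) * (t - z)⁻¹ := by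
        rw [h6]; field_simp
      rw [h8]; ring
    · exact (CS (D.pa_memLp (PA.pow H.bd (H.invA hr) M) hck) hi).1
    · exact memLp_one_iff_integrable.1 (D.pa_memLp hq (memLp_one_iff_integrable.2 (hck.integrable (by norm_num))))
  rw [Hk, mul_sub, h5, h4]; ring
lemma lens_lip {ω' : ℂ} (h : ω ∈ lens D.η) (h' : ω' ∈ lens D.η) :
    ‖D.τ j ω - D.τ j ω'‖ ≤ D.C * ‖ω - ω'‖ :=
  (lens_convex D.η_pos).norm_image_sub_le_of_norm_deriv_le
    (fun x hx => (D.hol j).differentiableAt (D.N_open.mem_nhds (D.lens_sub hx))) (D.dbd j) h' h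
lemma Hmid : ∃ C1 > 0, ∀ φ, ON ν φ → ∀ ζ ∈ F, ∀ k, D.IsK φ ζ k → ∀ j, ∀ x ∈ IoU,
    ‖Hk ν k ζ (D.τ j (pth D.η x))‖ ≤ C1 * (√qd(x))⁻¹ := by
  have hη := D.η_pos
  have hc := D.c_pos
  have hd := D.dF_pos
  have hB := D.BK_nonneg
  refine ⟨D.BK * √(D.A / (D.c * D.η)) + D.dF⁻¹, by positivity, fun φ hφ ζ hζ k hk j x hx => ?_⟩
  have hxx : 0 < x * (1 - x) := qpos hx
  have hs : |D.η| = D.η := abs_of_pos hη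
  have h1 := D.cau_norm (memLp_conj hk.mem) (by positivity) (D.sep_pth j hs hx)
  have h2 := D.dF_τ hζ j (pth_mem hs.le (Ioo_subset_Icc_self hx))
  rw [nrm_conj] at h1
  have h3 : √(D.A / (D.c * D.η * qd(x))) = √(D.A / (D.c * D.η)) * (√qd(x))⁻¹ := by
    rw [← Real.sqrt_inv, ← Real.sqrt_mul (div_nonneg D.A_nonneg (by positivity))]; congr 1; field_simp
  rw [h3] at h1
  have h4 : 1 ≤ (√qd(x))⁻¹ := by
    rw [one_le_inv₀ (Real.sqrt_pos.2 hxx), Real.sqrt_le_one]; nlinarith [hx.1, hx.2]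
  have h5 := D.nrm_K hφ hk hζ
  refine (norm_sub_le _ _).trans ?_
  rw [norm_inv, add_mul]
  refine add_le_add (h1.trans ?_) ?_
  · rw [← mul_assoc]; gcongr
  · calc _ ≤ D.dF⁻¹ := by gcongr
      _ ≤ _ := le_mul_of_one_le_right (by positivity) h4
lemma Hcor (H : Cor (closure G) lam c0 u b) (j : Fin D.m) {e : ℝ} (he : e = 0 ∨ e = 1) (hc0 : c0 = D.τ j e) :
    ∃ C1 > 0, ∀ φ, ON ν φ → ∀ ζ ∈ F, ∀ k, D.IsK φ ζ k → ∀ x ∈ Ioo (0:ℝ) (1/2),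
    ‖Hk ν k ζ (D.τ j (pth D.η |e - x|))‖ ≤ C1 * x ^ ((1 / (2 - lam)) / 2 - 1 / 2) := by
  set s := 1 / (2 - lam) with hs
  have hs0 : 0 < s := H.s0
  obtain ⟨M, hM⟩ := exists_nat_ge (s + 1)
  obtain ⟨C0, hC0, hwt⟩ := D.wt H (M := M) (by linarith)
  obtain ⟨Mp, hMp0, hMp⟩ := PA.bdd H.bd H.pbA
  obtain ⟨R, hR0, hR⟩ : ∃ R > 0, ∀ z ∈ closure G, ‖z - (c0 + u * b)‖ ≤ R := by
    obtain ⟨R, h⟩ := H.bd.exists_norm_le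
    refine ⟨|R| + ‖c0 + u * b‖ + 1, by positivity, fun z hz => (norm_sub_le _ _).trans ?_⟩
    linarith [h z hz, le_abs_self R]
  have hη := D.η_pos
  have hc := D.c_pos
  have hCp := D.C_pos
  have hd := D.dF_pos
  have hb := H.b0
  have hcb := H.cβ
  set cb := √((1 + cosR (bet lam)) / 2)
  set K := b * (D.C * 2) * Mp with hK
  have hK0 : 0 < K := by positivity
  set vz := cb * (b * D.dF * R⁻¹) with hvz
  have hvz0 : 0 < vz := by positivity
  set A1 := √(D.A / (D.c * D.η / 2)) with hA1
  refine ⟨(K + 1) ^ M * (√(C0 * (D.BK ^ 2 * vz ^ (-s))) * A1 + (vz⁻¹) ^ M * D.dF⁻¹), by positivity, ?_⟩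
  intro φ hφ ζ hζ k hk x hx
  obtain ⟨hx0, hx1⟩ := hx
  have hx1' : x < 1 := by linarith
  have hxe : |e - x| ∈ IoU := by
    rcases he with rfl | rfl
    · rw [zero_sub, abs_neg, abs_of_pos hx0]; exact ⟨hx0, hx1'⟩
    · rw [abs_of_pos (by linarith)]; constructor <;> linarith
  have hxq : |e - x| * (1 - |e - x|) = x * (1 - x) := by
    rcases he with rfl | rfl
    · rw [zero_sub, abs_neg, abs_of_pos hx0]
    · rw [abs_of_pos (by linarith)]; ring
  have hse : |D.η| = D.η := abs_of_pos hη
  have hmem := pth_mem hse.le (Ioo_subset_Icc_self hxe)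
  have heI : e ∈ IcU := by rcases he with rfl | rfl <;> simp
  set z := D.τ j (pth D.η |e - x|) with hz
  have hzG : z ∈ G := D.up j _ hmem (by
    simp only [pth]; rw [hxq]; exact mul_pos hη (mul_pos hx0 (by linarith)))
  have hζz : D.dF ≤ ‖ζ - z‖ := D.dF_τ hζ j hmem
  have hne : ζ ≠ z := by rintro h; rw [h, sub_self, norm_zero] at hζz; linarith
  have hzc : ‖z - c0‖ ≤ D.C * (2 * x) := by
    rw [hc0]
    refine (D.lens_lip j hmem (ofReal_mem_lens hη.le heI)).trans ?_
    gcongr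
    refine (norm_le_abs_re_add_abs_im _).trans ?_
    simp only [pth, sub_re, sub_im, ofReal_re, ofReal_im, sub_zero]
    rw [hxq, abs_of_pos (mul_pos hη (mul_pos hx0 (by linarith)))]
    have h1 : |(|e - x| - e)| = x := by
      rcases he with rfl | rfl
      · rw [zero_sub, abs_neg, sub_zero, abs_abs, abs_of_pos hx0]
      · rw [abs_of_pos (by linarith : 0 < 1 - x), show 1 - x - 1 = -x by ring, abs_neg, abs_of_pos hx0]
    rw [h1]
    have h2 : D.η * qd(x) ≤ 1 * (x * 1) := by
      have := D.η_le
      gcongr <;> linarith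
    linarith
  have hvz1 : ‖vv c0 u b z‖ ≤ K * x := by
    rw [H.vv_eq (subset_closure hzG), norm_mul, norm_mul, norm_real, Real.norm_of_nonneg hb.le]
    calc _ ≤ b * (D.C * (2 * x)) * Mp := by gcongr; exact hMp z (subset_closure hzG)
      _ = _ := by rw [hK]; ring
  have hζG : ζ ∈ closure G := subset_closure (D.F_sub hζ)
  have hvζ : vz ≤ ‖vv c0 u b ζ + x‖ := by
    refine le_trans ?_ (H.low hx0 (H.vv_sec hζG))
    rw [hvz]
    gcongr
    refine le_trans ?_ (le_add_of_nonneg_right hx0.le)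
    rw [H.vv_eq hζG, norm_mul, norm_mul, norm_real, Real.norm_of_nonneg hb.le, norm_inv]
    gcongr
    · have := D.dF_L hζ _ (D.onL j e heI)
      rwa [← hc0, norm_sub_rev] at this
    · exact norm_pos_iff.2 (H.zne hζG)
    · exact hR ζ hζG
  have hW0 : ((K + 1) * x)⁻¹ ^ M ≤ ‖((vv c0 u b z + x)⁻¹) ^ M‖ := by
    rw [norm_pow, norm_inv]
    have h0 := norm_pos_iff.2 (H.vr_ne hx0 (H.vv_sec (subset_closure hzG)))
    gcongr
    refine (norm_add_le _ _).trans ?_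
    rw [norm_real, Real.norm_of_nonneg hx0.le]; linarith
  have hmain := D.Hk_mul H hφ hk (D.F_sub hζ) hzG hne hx0 M
  have hWm : MemLp (fun t => ((vv c0 u b t + x)⁻¹) ^ M * cj (k t)) 2 ν :=
    D.pa_memLp (PA.pow H.bd (H.invA hx0) M) (memLp_conj hk.mem)
  have hdd : ∀ t ∈ frontier G, D.c * D.η / 2 * x ≤ ‖t - z‖ := by
    intro t ht
    refine le_trans ?_ (D.sep_pth j hse hxe t ht)
    rw [hxq]
    have : x / 2 ≤ x * (1 - x) := by nlinarith
    calc D.c * D.η / 2 * x = D.c * D.η * (x / 2) := by ring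
      _ ≤ _ := by gcongr
  have h1 := D.cau_norm hWm (by positivity) hdd
  have h2 := hwt φ hφ ζ (D.F_sub hζ) k hk x hx0
  have h3 : x ^ M * nrm ν (fun t => ((vv c0 u b t + x)⁻¹) ^ M * cj (k t)) ≤
      √(C0 * (D.BK ^ 2 * vz ^ (-s))) * x ^ (s / 2) := by
    have e1 : x ^ (s / 2) = √(x ^ s) := by
      rw [Real.sqrt_eq_rpow, ← Real.rpow_mul hx0.le]; congr 1; ring
    rw [e1, ← Real.sqrt_mul (by positivity)]
    refine Real.le_sqrt_of_sq_le ?_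
    have e2 : (x ^ M * nrm ν (fun t => ((vv c0 u b t + x)⁻¹) ^ M * cj (k t))) ^ 2 =
      x ^ (2 * M) * nrm ν (fun t => ((vv c0 u b t + x)⁻¹) ^ M * cj (k t)) ^ 2 := by ring
    rw [e2]
    refine h2.trans ?_
    have h5 := D.nrm_K hφ hk hζ
    have h6 := nrm_nonneg ν k
    have h7 : ‖vv c0 u b ζ + x‖ ^ (-s) ≤ vz ^ (-s) := Real.rpow_le_rpow_of_nonpos hvz0 hvζ (by linarith)
    calc _ ≤ C0 * x ^ s * (D.BK ^ 2 * vz ^ (-s)) := by gcongr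
      _ = _ := by ring
  have h4 : √(D.A / (D.c * D.η / 2 * x)) = A1 * x ^ mhR := by
    rw [Real.rpow_neg hx0.le, ← Real.sqrt_eq_rpow, ← Real.sqrt_inv, hA1, ← Real.sqrt_mul (div_nonneg D.A_nonneg (by positivity))]
    congr 1; field_simp
  have h5 : ‖((vv c0 u b z + x)⁻¹) ^ M‖ * ‖Hk ν k ζ z‖ ≤
      nrm ν (fun t => ((vv c0 u b t + x)⁻¹) ^ M * cj (k t)) * (A1 * x ^ mhR) + (vz⁻¹) ^ M * D.dF⁻¹ := by
    rw [← norm_mul, hmain]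
    refine (norm_sub_le _ _).trans (add_le_add (by rw [← h4]; exact h1) ?_)
    rw [norm_mul, norm_pow, norm_inv, norm_inv]
    gcongr
  have h6 : ((K + 1) * x)⁻¹ ^ M * ‖Hk ν k ζ z‖ ≤ _ := (mul_le_mul_of_nonneg_right hW0 (norm_nonneg _)).trans h5
  have h7 : ‖Hk ν k ζ z‖ = (K + 1) ^ M * x ^ M * (((K + 1) * x)⁻¹ ^ M * ‖Hk ν k ζ z‖) := by
    rw [inv_pow, mul_pow]; field_simp
  rw [h7]
  have h8 : x ^ (s / 2 - 1 / 2) = x ^ (s / 2) * x ^ mhR := by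
    rw [← Real.rpow_add hx0]; congr 1
  have h9 : x ^ M ≤ x ^ (s / 2 - 1 / 2) := by
    rw [← Real.rpow_natCast]
    exact Real.rpow_le_rpow_of_exponent_ge hx0 hx1'.le (by linarith)
  calc _ ≤ (K + 1) ^ M * x ^ M * (nrm ν (fun t => ((vv c0 u b t + x)⁻¹) ^ M * cj (k t)) * (A1 * x ^ mhR) + (vz⁻¹) ^ M * D.dF⁻¹) := by
        gcongr
    _ = (K + 1) ^ M * ((x ^ M * nrm ν (fun t => ((vv c0 u b t + x)⁻¹) ^ M * cj (k t))) * (A1 * x ^ mhR) + (vz⁻¹) ^ M * D.dF⁻¹ * x ^ M) := by ring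
    _ ≤ (K + 1) ^ M * ((√(C0 * (D.BK ^ 2 * vz ^ (-s))) * x ^ (s / 2)) * (A1 * x ^ mhR) + (vz⁻¹) ^ M * D.dF⁻¹ * x ^ (s / 2 - 1 / 2)) := by
        gcongr
    _ = _ := by rw [h8]; ring
end Dat
lemma int_beta {p : ℝ} (hp : -1 < p) : IntegrableOn (fun x : ℝ => qd(x) ^ p) (Ioc 0 1) := by
  have h := Complex.betaIntegral_convergent (u := ((p + 1 : ℝ) : ℂ)) (v := ((p + 1 : ℝ) : ℂ))
    (by rw [ofReal_re]; linarith) (by rw [ofReal_re]; linarith)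
  rw [intervalIntegrable_iff_integrableOn_Ioc_of_le zero_le_one] at h
  refine h.norm.congr ?_
  filter_upwards [Dat.ae_Ioo] with x hx
  have h1 : 0 < 1 - x := sub_pos.2 hx.2
  have e : ((1:ℂ) - x) = ((1 - x : ℝ) : ℂ) := by push_cast; rfl
  rw [norm_mul, e, norm_cpow_eq_rpow_re_of_pos hx.1, norm_cpow_eq_rpow_re_of_pos h1, Real.mul_rpow hx.1.le h1.le]
  simp
lemma moment_zero {g : ℝ → ℂ} (hg : IntegrableOn g IcU)
    (h : ∀ P : Polynomial ℂ, ∫ x in (0:ℝ)..1, g x * P.eval (x : ℂ) = 0) :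
    ∀ᵐ x ∂voU, g x = 0 := by
  have h0 : ∀ᵐ x : ℝ, x ∈ IoU → g x = 0 := by
    refine IsOpen.ae_eq_zero_of_integral_contDiff_smul_eq_zero isOpen_Ioo
      ((hg.mono_set Ioo_subset_Icc_self).locallyIntegrableOn) fun f hf _ hs => ?_
    have e1 : ∫ x, f x • g x = ∫ x in IqU, f x • g x := by
      rw [setIntegral_eq_integral_of_forall_compl_eq_zero]
      intro x hx
      have : x ∉ tsupport f := fun h => hx (Ioo_subset_Ioc_self (hs h))
      rw [image_eq_zero_of_notMem_tsupport this, zero_smul]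
    rw [e1]
    have hg' : IntegrableOn g IqU := hg.mono_set Ioc_subset_Icc_self
    set J := ∫ x in IqU, ‖g x‖ with hJ
    by_contra hne
    have hpos := norm_pos_iff.2 hne
    obtain ⟨p, hp⟩ := exists_polynomial_near_of_continuousOn 0 1 f hf.continuous.continuousOn
      (‖∫ x in IqU, f x • g x‖ / (J + 1) / 2) (by positivity)
    have h2 := h (p.map (algebraMap ℝ ℂ))
    rw [intervalIntegral.integral_of_le zero_le_one] at h2
    have e3 : ∀ x : ℝ, (p.map (algebraMap ℝ ℂ)).eval (x : ℂ) = ((p.eval x : ℝ) : ℂ) := by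
      intro x
      have := Polynomial.eval_map_algebraMap p (x : ℂ)
      rw [this]; exact Polynomial.aeval_algebraMap_apply_eq_algebraMap_eval x p
    have bd : ∀ {q : ℝ → ℝ}, Continuous q → IntegrableOn (fun x => q x • g x) IqU := by
      intro q hq
      obtain ⟨M, hM⟩ := (isCompact_Icc (a := (0:ℝ)) (b := 1)).exists_bound_of_continuousOn hq.continuousOn
      refine Integrable.bdd_smul hg' M hq.aestronglyMeasurable ?_
      filter_upwards [ae_restrict_mem measurableSet_Ioc] with x hx
      exact hM x (Ioc_subset_Icc_self hx)
    have i1 := bd hf.continuous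
    have i2 := bd p.continuous
    have e4 : ∫ x in IqU, f x • g x = ∫ x in IqU, (f x • g x - p.eval x • g x) := by
      rw [integral_sub i1 i2]
      have : ∫ x in IqU, p.eval x • g x = 0 := by
        rw [← h2]; congr 1; funext x; rw [e3, real_smul, mul_comm]
      rw [this, sub_zero]
    have h5 : ‖∫ x in IqU, f x • g x‖ ≤ (‖∫ x in IqU, f x • g x‖ / (J + 1) / 2) * J := by
      conv_lhs => rw [e4]
      rw [hJ, ← integral_const_mul]
      refine norm_integral_le_of_norm_le (hg'.norm.const_mul _) ?_
      filter_upwards [ae_restrict_mem measurableSet_Ioc] with x hx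
      rw [← sub_smul, norm_smul]
      have := (hp x (Ioc_subset_Icc_self hx)).le
      rw [abs_sub_comm] at this
      exact mul_le_mul_of_nonneg_right this (norm_nonneg _)
    have h6 : (‖∫ x in IqU, f x • g x‖ / (J + 1) / 2) * J ≤ ‖∫ x in IqU, f x • g x‖ / 2 := by
      have : J / (J + 1) ≤ 1 := by rw [div_le_one (by positivity)]; linarith
      calc _ = ‖∫ x in IqU, f x • g x‖ / 2 * (J / (J + 1)) := by ring
        _ ≤ ‖∫ x in IqU, f x • g x‖ / 2 * 1 := by gcongr
        _ = _ := mul_one _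
    linarith
  rw [← restrict_Ioo_eq_restrict_Icc]
  rw [ae_restrict_iff' measurableSet_Ioo]; exact h0
lemma memLp_dual {α : Type*} [MeasurableSpace α] {μ : Measure α} [IsFiniteMeasure μ] {R : α → ℂ} {B : ℝ}
    (hR : AEStronglyMeasurable R μ) (h : ∀ f : α → ℂ, MemLp f 2 μ → ‖∫ t, f t * R t ∂μ‖ ≤ B * nrm μ f) :
    MemLp R 2 μ := by
  obtain ⟨R', hR', hRR⟩ := hR
  have hB : ∀ n : ℕ, eLpNorm ({t | ‖R' t‖ ≤ n}.indicator R') 2 μ ≤ eoR B := by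
    intro n
    have hms : MeasurableSet {t | ‖R' t‖ ≤ n} := measurableSet_le hR'.measurable.norm measurable_const
    set f := {t | ‖R' t‖ ≤ n}.indicator R' with hf
    have hfm : MemLp f 2 μ := MemLp.of_bound (hR'.indicator hms).aestronglyMeasurable n (ae_of_all _ fun t => by
      by_cases ht : ‖R' t‖ ≤ n
      · rw [hf, indicator_of_mem (by exact ht)]; exact ht
      · rw [hf, indicator_of_notMem (by exact ht)]; simp)
    have h1 := h (fun t => cj (f t)) (by exact hfm.star)
    have e1 : ∫ t, cj (f t) * R t ∂μ = ((nrm μ f ^ 2 : ℝ) : ℂ) := by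
      rw [nrm, Real.sq_sqrt (integral_nonneg fun _ => by positivity), ← integral_complex_ofReal]
      refine integral_congr_ae ?_
      filter_upwards [hRR] with t ht
      rw [ht]
      by_cases h : ‖R' t‖ ≤ n
      · rw [hf, indicator_of_mem (by exact h), mul_comm, mul_conj, normSq_eq_norm_sq]
      · rw [hf, indicator_of_notMem (by exact h)]; simp
    have e2 : nrm μ (fun t => cj (f t)) = nrm μ f := by simp [nrm]
    rw [e1, e2, norm_real, Real.norm_of_nonneg (by positivity)] at h1
    have h3 : nrm μ f ≤ B ∨ nrm μ f = 0 := by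
      rcases (nrm_nonneg μ f).eq_or_lt with h | h
      · exact Or.inr h.symm
      · left; nlinarith
    have e4 : eLpNorm f 2 μ = eoR (nrm μ f) := by
      rw [hfm.eLpNorm_eq_integral_rpow_norm (by norm_num) (by norm_num), nrm, Real.sqrt_eq_rpow]
      congr 1; norm_num
    rw [e4]
    rcases h3 with h | h
    · exact ENNReal.ofReal_le_ofReal h
    · rw [h]; simp
  refine MemLp.ae_eq hRR.symm ⟨hR'.aestronglyMeasurable, ?_⟩
  refine lt_of_le_of_lt (Lp.eLpNorm_lim_le_liminf_eLpNorm (f := fun n : ℕ => {t | ‖R' t‖ ≤ n}.indicator R') ?_ R' ?_) (lt_of_le_of_lt ?_ (ENNReal.ofReal_lt_top (r := B)))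
  · intro n
    exact (hR'.indicator (measurableSet_le hR'.measurable.norm measurable_const)).aestronglyMeasurable
  · refine ae_of_all _ fun t => ?_
    obtain ⟨N, hN⟩ := exists_nat_ge ‖R' t‖
    refine tendsto_const_nhds.congr' ?_
    filter_upwards [eventually_ge_atTop N] with n hn
    rw [indicator_of_mem]
    exact hN.trans (by exact_mod_cast hn)
  · refine (liminf_le_liminf (Eventually.of_forall hB)).trans ?_
    simp
namespace Dat
variable (D : Dat G ν lam F) (j : Fin D.m)
lemma mkCor (hl0 : 0 < lam) (hl2 : lam < 2) (j : Fin D.m) {e : ℝ} (he : e = 0 ∨ e = 1) :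
    ∃ u b, Cor (closure G) lam (D.τ j e) u b := by
  obtain ⟨u, b, h1, h2, h3, h4, h5, _⟩ := D.corner j e he
  exact ⟨u, b, hl0, hl2, D.X_bdd, h1, h2, h3, h4, h5⟩
lemma Hbd (hl0 : 0 < lam) (hl2 : lam < 2) : ∃ C1 > 0, ∀ φ, ON ν φ → ∀ ζ ∈ F, ∀ k, D.IsK φ ζ k → ∀ j,
    ∀ x ∈ IoU,
    ‖Hk ν k ζ (D.τ j (pth D.η x))‖ ≤ C1 * qd(x) ^ ((1 / (2 - lam)) / 2 - 1 / 2) := by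
  set p := (1 / (2 - lam)) / 2 - 1 / 2 with hp
  obtain ⟨Cm, hCm0, hCm⟩ := D.Hmid
  have key : ∀ j : Fin D.m, ∀ e : ℝ, (e = 0 ∨ e = 1) → ∃ C1 > 0, ∀ φ, ON ν φ → ∀ ζ ∈ F, ∀ k, D.IsK φ ζ k →
      ∀ x ∈ Ioo (0:ℝ) (1/2), ‖Hk ν k ζ (D.τ j (pth D.η |e - x|))‖ ≤ C1 * x ^ p := by
    intro j e he
    obtain ⟨u, b, H⟩ := D.mkCor hl0 hl2 j he
    exact D.Hcor H j he rfl
  choose! C0 hC0 hC using fun j => key j 0 (Or.inl rfl)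
  choose! C1 hC1 hC' using fun j => key j 1 (Or.inr rfl)
  set Q := (1/2 : ℝ) ^ (-|p|) with hQ
  have hlow : ∀ x ∈ Ioo (0:ℝ) (1/2), x ^ p ≤ Q * qd(x) ^ p := by
    intro x hx
    have h1 : (1/2 : ℝ) ≤ 1 - x := by linarith [hx.2]
    have h2 : 1 - x ≤ 1 := by linarith [hx.1]
    rw [Real.mul_rpow hx.1.le (by linarith)]
    have h3 : 1 ≤ Q * (1 - x) ^ p := by
      have h4 : (1/2 : ℝ) ^ |p| ≤ (1 - x) ^ |p| := by gcongr
      have h5 : (1 - x) ^ |p| ≤ (1 - x) ^ p := Real.rpow_le_rpow_of_exponent_ge (by linarith) h2 (le_abs_self p)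
      rw [hQ, Real.rpow_neg (by norm_num), ← div_eq_inv_mul, le_div_iff₀ (by positivity)]
      linarith
    calc x ^ p = x ^ p * 1 := (mul_one _).symm
      _ ≤ x ^ p * (Q * (1 - x) ^ p) := by gcongr; exact Real.rpow_nonneg hx.1.le _
      _ = _ := by ring
  have hs0 : 0 ≤ ∑ j, C0 j := Finset.sum_nonneg fun j _ => (hC0 j).le
  have hs1 : 0 ≤ ∑ j, C1 j := Finset.sum_nonneg fun j _ => (hC1 j).le
  have hl0' : ∀ j, C0 j ≤ ∑ j, C0 j := fun j => Finset.single_le_sum (fun j _ => (hC0 j).le) (Finset.mem_univ j)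
  have hl1' : ∀ j, C1 j ≤ ∑ j, C1 j := fun j => Finset.single_le_sum (fun j _ => (hC1 j).le) (Finset.mem_univ j)
  set K := Cm * (√(1/2 * (1 - 1/2)))⁻¹ * (((1:ℝ)/2 * (1 - 1/2)) ^ p)⁻¹ with hK
  refine ⟨(∑ j, C0 j) * Q + (∑ j, C1 j) * Q + K, by positivity, fun φ hφ ζ hζ k hk j x hx => ?_⟩
  have hxx : 0 < x * (1 - x) := qpos hx
  have hxp : 0 < qd(x) ^ p := by positivity
  rw [add_mul, add_mul]
  rcases lt_trichotomy x (1/2) with h | h | h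
  · have h1 := hC j φ hφ ζ hζ k hk x ⟨hx.1, h⟩
    rw [zero_sub, abs_neg, abs_of_pos hx.1] at h1
    have h2 : C0 j * x ^ p ≤ (∑ j, C0 j) * Q * qd(x) ^ p := by
      rw [mul_assoc]
      exact mul_le_mul (hl0' j) (hlow x ⟨hx.1, h⟩) (Real.rpow_nonneg hx.1.le _) hs0
    have : 0 ≤ (∑ j, C1 j) * Q * qd(x) ^ p := by positivity
    have : 0 ≤ K * qd(x) ^ p := by positivity
    linarith
  · have h1 := hCm φ hφ ζ hζ k hk j x hx
    have h2 : Cm * (√qd(x))⁻¹ = K * qd(x) ^ p := by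
      rw [hK, ← h, mul_assoc, inv_mul_cancel₀ hxp.ne', mul_one]
    have : 0 ≤ (∑ j, C1 j) * Q * qd(x) ^ p := by positivity
    have : 0 ≤ (∑ j, C0 j) * Q * qd(x) ^ p := by positivity
    linarith
  · have hx' : 1 - x ∈ Ioo (0:ℝ) (1/2) := ⟨sub_pos.2 hx.2, by linarith⟩
    have h1 := hC' j φ hφ ζ hζ k hk (1 - x) hx'
    have e : |1 - (1 - x)| = x := by rw [sub_sub_cancel, abs_of_pos hx.1]
    rw [e] at h1
    have h2 : C1 j * (1 - x) ^ p ≤ (∑ j, C1 j) * Q * qd(x) ^ p := by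
      have h3 := hlow _ hx'
      rw [sub_sub_cancel, mul_comm (1 - x) x] at h3
      rw [mul_assoc]
      exact mul_le_mul (hl1' j) h3 (Real.rpow_nonneg hx'.1.le _) hs1
    have : 0 ≤ (∑ j, C0 j) * Q * qd(x) ^ p := by positivity
    have : 0 ≤ K * qd(x) ^ p := by positivity
    linarith
end Dat
namespace Dat
variable (D : Dat G ν lam F) (j : Fin D.m)
def pr (ω : ℂ) : ℂ := deriv (D.τ j) ω * cj (deriv (D.τ j) (cj ω))
def f1 (ω : ℂ) : ℂ :=
  cj (deriv (D.τ j) (cj ω)) * exp (-(1/2 : ℂ) * log (D.pr j ω))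
def Oj : Set ℂ := {ω | (ω ∈ D.N ∧ cj ω ∈ D.N) ∧ 0 < (D.pr j ω).re}
lemma prA_open : IsOpen {ω | ω ∈ D.N ∧ cj ω ∈ D.N} :=
  D.N_open.inter (D.N_open.preimage continuous_conj)
lemma cjd (h : cj ω ∈ D.N) : DifferentiableAt ℂ (fun ω => cj (deriv (D.τ j) (cj ω))) ω := by
  have h1 := ((D.hol j).deriv D.N_open).differentiableAt (D.N_open.mem_nhds h)
  have := h1.conj_conj
  rwa [conj_conj] at this
lemma cjτ (h : cj ω ∈ D.N) : DifferentiableAt ℂ (fun ω => cj (D.τ j (cj ω))) ω := by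
  have h1 := (D.hol j).differentiableAt (D.N_open.mem_nhds h)
  have := h1.conj_conj
  rwa [conj_conj] at this
lemma pr_diff (h : ω ∈ D.N) (h' : cj ω ∈ D.N) : DifferentiableAt ℂ (D.pr j) ω :=
  (((D.hol j).deriv D.N_open).differentiableAt (D.N_open.mem_nhds h)).mul (D.cjd j h')
lemma Oj_open : IsOpen (D.Oj j) := by
  have hc : ContinuousOn (fun ω => (D.pr j ω).re) {ω | ω ∈ D.N ∧ cj ω ∈ D.N} := fun ω hω =>
    (continuous_re.continuousAt.comp (D.pr_diff j hω.1 hω.2).continuousAt).continuousWithinAt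
  exact hc.isOpen_inter_preimage D.prA_open (isOpen_Ioi (a := (0:ℝ)))
lemma lens_Oj : lens D.η ⊆ D.Oj j := fun ω hω =>
  ⟨⟨D.lens_sub hω, D.lens_sub (conj_mem_lens hω)⟩, D.sq j ω hω⟩
lemma f1_diff : DifferentiableOn ℂ (D.f1 j) (D.Oj j) := by
  intro ω hω
  refine DifferentiableAt.differentiableWithinAt ?_
  have h1 : DifferentiableAt ℂ (fun ω => log (D.pr j ω)) ω := (D.pr_diff j hω.1.1 hω.1.2).clog (Or.inl hω.2)
  exact (D.cjd j hω.1.2).mul ((h1.const_mul _).cexp)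
lemma f1_real (hx : x ∈ IcU) :
    D.f1 j x * ‖deriv (D.τ j) x‖ = cj (deriv (D.τ j) x) := by
  have hp := D.dpos j hx
  have e : D.pr j x = ((‖deriv (D.τ j) x‖ ^ 2 : ℝ) : ℂ) := by
    unfold pr; rw [conj_ofReal, mul_conj, normSq_eq_norm_sq]
  rw [f1, e, ← ofReal_log (by positivity), conj_ofReal]
  have e2 : (-(1/2:ℂ) * ((logR (‖deriv (D.τ j) x‖ ^ 2) : ℝ) : ℂ)) = ((-logR ‖deriv (D.τ j) x‖ : ℝ) : ℂ) := by
    rw [Real.log_pow]; push_cast; ring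
  rw [e2, ← ofReal_exp, Real.exp_neg, Real.exp_log hp]
  push_cast
  rw [mul_assoc, inv_mul_cancel₀ (by exact_mod_cast hp.ne'), mul_one]
lemma f1_norm (hω : ω ∈ lens D.η) : ‖D.f1 j ω‖ ≤ D.C * D.c⁻¹ := by
  have hω' := conj_mem_lens hω
  have h1 := D.dbd j _ hω'
  have h2 := D.dne (j := j) (D.lens_sub hω)
  have h3 := D.dne (j := j) (D.lens_sub hω')
  have hc := D.c_pos
  rw [f1, norm_mul, RCLike.norm_conj]
  refine mul_le_mul h1 ?_ (norm_nonneg _) D.C_pos.le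
  rw [norm_exp]
  have e : (-(1/2:ℂ) * log (D.pr j ω)).re = -(1/2) * logR ‖D.pr j ω‖ := by
    have : (-(1/2:ℂ)) = (mhR : ℂ) := by push_cast; rfl
    rw [this, re_ofReal_mul, log_re]
  have h4 : D.c ^ 2 ≤ ‖D.pr j ω‖ := by
    rw [pr, norm_mul, RCLike.norm_conj, pow_two]; gcongr
  have h5 := Real.log_le_log (by positivity) h4
  rw [Real.log_pow] at h5; push_cast at h5
  rw [e, ← Real.exp_log (inv_pos.2 hc), Real.log_inv]
  refine Real.exp_le_exp.2 ?_
  linarith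
variable {φ : ℕ → Polynomial ℂ} {ζ : ℂ} {k : ℂ → ℂ}
def hh (k : ℂ → ℂ) (ζ : ℂ) (j : Fin D.m) (x : ℝ) : ℂ :=
  (4 * π ^ 2 : ℂ)⁻¹ * cj (D.f1 j (pth D.η x) * deriv (D.τ j) (pth D.η x) * Hk ν k ζ (D.τ j (pth D.η x)) * dpth D.η x)
def bb (x : ℝ) : ℂ := D.τ j (pth (-D.η) x)
def RR (k : ℂ → ℂ) (ζ z : ℂ) : ℂ :=
  ∑ j, ∫ x in IqU, D.hh k ζ j x * (D.bb j x - z)⁻¹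
lemma etan : |D.η| = D.η := abs_of_pos D.η_pos
lemma etan' : |-D.η| = D.η := by rw [abs_neg, D.etan]
lemma pth_up (hx : x ∈ IoU) : 0 < (pth D.η x).im := by
  have := mul_pos D.η_pos (qpos hx); simpa [pth] using this
lemma pth_lo (hx : x ∈ IoU) : (pth (-D.η) x).im < 0 := by
  have := mul_pos D.η_pos (qpos hx); simpa [pth] using this
lemma up_mem (hx : x ∈ IoU) : D.τ j (pth D.η x) ∈ G :=
  D.up j _ (pth_mem D.etan.le (Ioo_subset_Icc_self hx)) (D.pth_up hx)
lemma lo_mem (hx : x ∈ IoU) : D.bb j x ∉ closure G :=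
  D.lo j _ (pth_mem D.etan'.le (Ioo_subset_Icc_self hx)) (D.pth_lo hx)
lemma Hk_cont (hk : D.IsK φ ζ k) (hζ : ζ ∈ F) (j : Fin D.m) :
    ContinuousOn (fun x => Hk ν k ζ (D.τ j (pth D.η x))) (Ioo 0 1) := by
  intro x hx
  have := D.ν_fin
  have hG := D.up_mem j hx
  have hl := pth_mem D.etan.le (Ioo_subset_Icc_self hx)
  refine ContinuousAt.continuousWithinAt ?_
  have hi : Integrable (fun t => cj (k t)) ν := (memLp_conj hk.mem).integrable (by norm_num)
  have h1 : ContinuousAt (Hk ν k ζ) (D.τ j (pth D.η x)) := by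
    refine (D.cau_diff hi (D.G_notL hG)).continuousAt.sub ?_
    refine ContinuousAt.inv₀ (by fun_prop) ?_
    have := D.dF_τ hζ j hl
    exact norm_pos_iff.1 (D.dF_pos.trans_le this)
  have h2 : ContinuousAt (D.τ j) (pth D.η x) := ((D.hol j).differentiableAt (D.N_open.mem_nhds (D.lens_sub hl))).continuousAt
  exact ContinuousAt.comp (f := fun x => D.τ j (pth D.η x)) h1 (ContinuousAt.comp h2 (pth_cont _).continuousAt)
lemma hh_aesm (hk : D.IsK φ ζ k) (hζ : ζ ∈ F) (j : Fin D.m) :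
    AEStronglyMeasurable (D.hh k ζ j) (volume.restrict IqU) := by
  rw [← restrict_Ioo_eq_restrict_Ioc]
  refine ContinuousOn.aestronglyMeasurable ?_ measurableSet_Ioo
  refine continuousOn_const.mul (continuous_conj.comp_continuousOn ?_)
  exact ((((D.contOn_pth (D.f1_diff j).continuousOn (D.lens_Oj j) D.etan).mul
    (D.contOn_pth (D.dcont j) D.lens_sub D.etan)).mono Ioo_subset_Icc_self).mul (D.Hk_cont hk hζ j)).mul (dpth_cont _).continuousOn
lemma bb_cont : ContinuousOn (D.bb j) (Icc 0 1) :=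
  D.contOn_pth (D.hol j).continuousOn D.lens_sub D.etan'
lemma hh_bd (hl0 : 0 < lam) (hl2 : lam < 2) : ∃ C1 > 0, ∀ φ, ON ν φ → ∀ ζ ∈ F, ∀ k, D.IsK φ ζ k → ∀ j,
    ∀ x ∈ IoU,
    ‖D.hh k ζ j x‖ ≤ C1 * qd(x) ^ ((1 / (2 - lam)) / 2 - 1 / 2) := by
  obtain ⟨C1, hC1, h⟩ := D.Hbd hl0 hl2
  have hC := D.C_pos
  have hc := D.c_pos
  refine ⟨D.C * D.c⁻¹ * D.C * C1 * 2, by positivity, fun φ hφ ζ hζ k hk j x hx => ?_⟩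
  have h1 := h φ hφ ζ hζ k hk j x hx
  have hl := pth_mem D.etan.le (Ioo_subset_Icc_self hx)
  have h2 := D.f1_norm j hl
  have h3 := D.dbd j _ hl
  have h4 : ‖dpth D.η x‖ ≤ 2 := by
    refine (norm_le_abs_re_add_abs_im _).trans ?_
    simp only [dpth, abs_one, abs_mul, D.etan]
    have : |1 - 2 * x| ≤ 1 := by rw [abs_le]; constructor <;> linarith [hx.1, hx.2]
    nlinarith [D.η_le, D.η_pos, abs_nonneg (1 - 2 * x)]
  have h5 : ‖(4 * π ^ 2 : ℂ)⁻¹‖ ≤ 1 := by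
    rw [norm_inv]
    refine inv_le_one_of_one_le₀ ?_
    have : ‖(4 * π ^ 2 : ℂ)‖ = 4 * π ^ 2 := by simp [abs_of_pos Real.pi_pos]
    rw [this]; nlinarith [Real.pi_gt_three]
  have hp : 0 ≤ qd(x) ^ ((1 / (2 - lam)) / 2 - 1 / 2) := by
    have := qpos hx; positivity
  rw [hh, norm_mul, RCLike.norm_conj, norm_mul, norm_mul, norm_mul]
  calc _ ≤ 1 * (D.C * D.c⁻¹ * D.C * (C1 * qd(x) ^ ((1 / (2 - lam)) / 2 - 1 / 2)) * 2) := by gcongr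
    _ = _ := by ring
lemma hh_hi (hl0 : 0 < lam) (hl2 : lam < 2) (hφ : ON ν φ) (hk : D.IsK φ ζ k) (hζ : ζ ∈ F) (j : Fin D.m) :
    IntegrableOn (fun x => ‖D.hh k ζ j x‖ * √(D.A / (D.c * D.η * qd(x)))) (Ioc 0 1) := by
  obtain ⟨C1, hC1, h⟩ := D.hh_bd hl0 hl2
  have hs : 0 < 1 / (2 - lam) := by have : 0 < 2 - lam := by linarith
                                    positivity
  have hc := D.c_pos
  have hη := D.η_pos
  refine ((int_beta (p := (1 / (2 - lam)) / 2 - 1) (by linarith)).const_mul (C1 * √(D.A / (D.c * D.η)))).mono' ?_ ?_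
  · refine (D.hh_aesm hk hζ j).norm.mul ?_
    refine Measurable.aestronglyMeasurable ?_
    fun_prop
  · filter_upwards [ae_Ioo] with x hx
    have hxx : 0 < x * (1 - x) := qpos hx
    have h3 : √(D.A / (D.c * D.η * qd(x))) = √(D.A / (D.c * D.η)) * qd(x) ^ mhR := by
      rw [Real.rpow_neg hxx.le, ← Real.sqrt_eq_rpow, ← Real.sqrt_inv, ← Real.sqrt_mul (div_nonneg D.A_nonneg (by positivity))]; congr 1; field_simp
    rw [Real.norm_of_nonneg (by positivity), h3]
    calc _ ≤ (C1 * qd(x) ^ ((1 / (2 - lam)) / 2 - 1 / 2)) * (√(D.A / (D.c * D.η)) * qd(x) ^ mhR) := by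
          gcongr; exact h φ hφ ζ hζ k hk j x hx
      _ = C1 * √(D.A / (D.c * D.η)) * (qd(x) ^ ((1 / (2 - lam)) / 2 - 1 / 2) * qd(x) ^ mhR) := by ring
      _ = _ := by rw [← Real.rpow_add hxx]; congr 2; ring
lemma hh_int (hl0 : 0 < lam) (hl2 : lam < 2) (hφ : ON ν φ) (hk : D.IsK φ ζ k) (hζ : ζ ∈ F) (j : Fin D.m) :
    IntegrableOn (D.hh k ζ j) (Ioc 0 1) := by
  obtain ⟨C1, hC1, h⟩ := D.hh_bd hl0 hl2
  have hs : 0 < 1 / (2 - lam) := by have : 0 < 2 - lam := by linarith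
                                    positivity
  refine ((int_beta (p := (1 / (2 - lam)) / 2 - 1/2) (by linarith)).const_mul C1).mono' (D.hh_aesm hk hζ j) ?_
  filter_upwards [ae_Ioo] with x hx
  exact h φ hφ ζ hζ k hk j x hx
lemma Hk_low (hφ : ON ν φ) (hk : D.IsK φ ζ k) (hζ : ζ ∈ F) (j : Fin D.m) (hω : ω ∈ lens D.η) (him : ω.im < 0) :
    Cau ν (fun t => cj (k t)) (D.τ j ω) = (ζ - D.τ j ω)⁻¹ := by
  have := D.ν_fin
  have hi : Integrable (fun t => cj (k t)) ν := (memLp_conj hk.mem).integrable (by norm_num)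
  have := D.pa_int hi (c := 1) (ζ := ζ) (subset_closure (D.F_sub hζ)) (by simpa using D.K1 hφ hk) (D.ext j ω hω him)
  rw [one_mul] at this
  rw [← this, Cau]
  congr 1; funext t; ring
lemma K_off (hl0 : 0 < lam) (hl2 : lam < 2) (hφ : ON ν φ) (hk : D.IsK φ ζ k) (hζ : ζ ∈ F) (hz : z ∈ G)
    (hoff : ∀ j, ∀ ω ∈ lens D.η, D.τ j ω ≠ z) : Cau ν (fun t => k t * D.σ t) z = 2 * π * I * D.RR k ζ z := by
  have hπ : (2 * π * I : ℂ) ≠ 0 := by simp [Real.pi_ne_zero]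
  have hck := memLp_conj hk.mem
  set f : Fin D.m → ℂ → ℂ := fun j ω => D.f1 j ω * (cj (D.τ j (cj ω)) - cj z)⁻¹ with hf
  set O : Fin D.m → Set ℂ := fun j => {ω | ω ∈ D.Oj j ∧ (ω ∈ D.N ∧ cj (D.τ j (cj ω)) - cj z ≠ 0 ∧ ζ - D.τ j ω ≠ 0)} with hO
  have hOo : ∀ j, IsOpen (O j) := by
    intro j
    have c1 : ContinuousOn (fun ω => cj (D.τ j (cj ω)) - cj z) (D.Oj j) := fun ω hω =>
      ((D.cjτ j hω.1.2).continuousAt.sub continuousAt_const).continuousWithinAt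
    have c2 : ContinuousOn (fun ω => ζ - D.τ j ω) (D.Oj j) := fun ω hω =>
      (continuousAt_const.sub ((D.hol j).differentiableAt (D.N_open.mem_nhds hω.1.1)).continuousAt).continuousWithinAt
    have o1 := c1.isOpen_inter_preimage (D.Oj_open j) (isOpen_ne (x := (0:ℂ)))
    have o2 := c2.isOpen_inter_preimage (D.Oj_open j) (isOpen_ne (x := (0:ℂ)))
    convert o1.inter o2 using 1
    ext ω
    simp only [hO, mem_ofPred_eq, mem_inter_iff, mem_preimage]
    constructor
    · rintro ⟨a, b, c, d⟩; exact ⟨⟨a, c⟩, a, d⟩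
    · rintro ⟨⟨a, c⟩, _, d⟩; exact ⟨a, a.1.1, c, d⟩
  have hOl : ∀ j, lens D.η ⊆ O j := fun j ω hω => ⟨D.lens_Oj j hω, D.lens_sub hω, by
    rw [← map_sub, Ne, map_eq_zero, sub_eq_zero]; exact hoff j _ (conj_mem_lens hω),
    norm_pos_iff.1 (D.dF_pos.trans_le (D.dF_τ hζ j hω))⟩
  have hfd : ∀ j, DifferentiableOn ℂ (f j) (O j) := by
    intro j ω hω
    refine DifferentiableAt.differentiableWithinAt ?_
    exact ((D.f1_diff j).differentiableAt ((D.Oj_open j).mem_nhds hω.1)).mul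
      (((D.cjτ j hω.1.1.2).sub_const _).inv hω.2.2.1)
  have hP : ∀ j, 2 * π * I * ∫ x in (0:ℝ)..1, (‖deriv (D.τ j) x‖ : ℂ) * (cj (k (D.τ j x)) * f j x) =
      cj (4 * π ^ 2 * ∫ x in IqU, D.hh k ζ j x * (D.bb j x - z)⁻¹) := by
    intro j
    have h1 := D.piece hck (hOo j) (hOl j) (hfd j) j
    have hgd : DifferentiableOn ℂ (fun ω => f j ω * deriv (D.τ j) ω * (ζ - D.τ j ω)⁻¹) (O j) := by
      intro ω hω
      refine DifferentiableAt.differentiableWithinAt ?_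
      exact (((hfd j).differentiableAt ((hOo j).mem_nhds hω)).mul
        (((D.hol j).deriv D.N_open).differentiableAt (D.N_open.mem_nhds hω.2.1))).mul
        (DifferentiableAt.inv ((differentiableAt_const _).sub ((D.hol j).differentiableAt (D.N_open.mem_nhds hω.2.1))) hω.2.2.2)
    have h2 := PI_eq D.η_pos D.etan'.le (hOo j) (hOl j) hgd
    have h3 := PI_eq D.η_pos D.etan.le (hOo j) (hOl j) hgd
    have h4 : PI (-D.η) (fun ω => f j ω * deriv (D.τ j) ω * Cau ν (fun t => cj (k t)) (D.τ j ω)) =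
        PI (-D.η) (fun ω => f j ω * deriv (D.τ j) ω * (ζ - D.τ j ω)⁻¹) := by
      unfold PI
      rw [intervalIntegral.integral_of_le zero_le_one, intervalIntegral.integral_of_le zero_le_one]
      refine integral_congr_ae ?_
      filter_upwards [ae_Ioo] with x hx
      rw [D.Hk_low hφ hk hζ j (pth_mem D.etan'.le (Ioo_subset_Icc_self hx)) (D.pth_lo hx)]
    have h5 : (∫ x in IqU, cj (4 * π ^ 2 * (D.hh k ζ j x * (D.bb j x - z)⁻¹))) =
        PI D.η (fun ω => f j ω * deriv (D.τ j) ω * Cau ν (fun t => cj (k t)) (D.τ j ω)) -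
        PI D.η (fun ω => f j ω * deriv (D.τ j) ω * (ζ - D.τ j ω)⁻¹) := by
      have hi1 : IntegrableOn (fun x => cj (4 * π ^ 2 * (D.hh k ζ j x * (D.bb j x - z)⁻¹))) IqU := by
        have hb : IntegrableOn (fun x => D.hh k ζ j x * (D.bb j x - z)⁻¹) IqU := by
          have hc : ContinuousOn (fun x => (D.bb j x - z)⁻¹) (Icc 0 1) := by
            refine ((D.bb_cont j).sub continuousOn_const).inv₀ fun x hx => sub_ne_zero.2 (hoff j _ (pth_mem D.etan'.le hx))
          obtain ⟨M, hM⟩ := isCompact_Icc.exists_bound_of_continuousOn hc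
          refine (D.hh_int hl0 hl2 hφ hk hζ j).mul_bdd (c := M) ((hc.mono Ioc_subset_Icc_self).aestronglyMeasurable measurableSet_Ioc) ?_
          filter_upwards [ae_restrict_mem measurableSet_Ioc] with x hx
          exact hM x (Ioc_subset_Icc_self hx)
        have h := hb.const_mul (4 * π ^ 2 : ℂ)
        exact h.mono (continuous_conj.comp_aestronglyMeasurable h.1) (ae_of_all _ fun x => (RCLike.norm_conj _).le)
      have hi2 : IntegrableOn (fun x => f j (pth D.η x) * deriv (D.τ j) (pth D.η x) * (ζ - D.τ j (pth D.η x))⁻¹ * dpth D.η x) (Ioc 0 1) :=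
        ((((D.contOn_pth hgd.continuousOn (hOl j) D.etan).mul (dpth_cont _).continuousOn)).integrableOn_Icc).mono_set Ioc_subset_Icc_self
      rw [eq_sub_iff_add_eq]
      unfold PI
      rw [intervalIntegral.integral_of_le zero_le_one, intervalIntegral.integral_of_le zero_le_one, ← integral_add hi1 hi2]
      congr 1; funext x
      have e4 : (4 * π ^ 2 : ℂ) ≠ 0 := by simp [Real.pi_ne_zero]
      have e1 : (4 * π ^ 2 : ℂ) * (D.hh k ζ j x * (D.bb j x - z)⁻¹) =
          cj (D.f1 j (pth D.η x) * deriv (D.τ j) (pth D.η x) * Hk ν k ζ (D.τ j (pth D.η x)) * dpth D.η x) * (D.bb j x - z)⁻¹ := by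
        rw [hh, ← mul_assoc, ← mul_assoc, mul_inv_cancel₀ e4, one_mul]
      have e2 : cj ((D.bb j x - z)⁻¹) = (cj (D.τ j (cj (pth D.η x))) - cj z)⁻¹ := by
        rw [conj_pth, map_inv₀, map_sub]; rfl
      rw [e1, map_mul, conj_conj, e2, Hk]
      simp only [hf]
      ring
    rw [h1, h4, h2, ← h3, ← h5, integral_conj]
    congr 1
    exact integral_const_mul _ _
  have hI : Integrable (fun t => k t * D.σ t * (t - z)⁻¹) ν := (CS (D.σ_memLp hk.mem) (D.inv_int (D.G_notL hz))).1
  have hI' : Integrable (fun t => cj (k t * D.σ t * (t - z)⁻¹)) ν :=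
    hI.mono (continuous_conj.comp_aestronglyMeasurable hI.1) (ae_of_all _ fun x => (RCLike.norm_conj _).le)
  have e1 : cj (Cau ν (fun t => k t * D.σ t) z) = ∑ j, ∫ x in (0:ℝ)..1, (‖deriv (D.τ j) x‖ : ℂ) * (cj (k (D.τ j x)) * f j x) := by
    rw [Cau, ← integral_conj, D.int_eq hI']
    refine Finset.sum_congr rfl fun j _ => ?_
    rw [intervalIntegral.integral_of_le zero_le_one, intervalIntegral.integral_of_le zero_le_one]
    refine integral_congr_ae ?_
    filter_upwards [ae_Ioo] with x hx
    have e2 := D.f1_real j (Ioo_subset_Icc_self hx)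
    have e2' := congrArg cj (D.σ_spec j hx)
    rw [map_mul, conj_ofReal] at e2'
    have e3 := mul_right_cancel₀ (ofReal_ne_zero.2 (D.dpos j (Ioo_subset_Icc_self hx)).ne') (e2.trans e2'.symm)
    simp only [hf, e3, map_mul, map_inv₀, map_sub, conj_ofReal]
    ring
  have e2 : cj (Cau ν (fun t => k t * D.σ t) z) * (2 * π * I) = cj (4 * π ^ 2 * D.RR k ζ z) := by
    rw [e1, Finset.sum_mul, RR, Finset.mul_sum, map_sum]
    refine Finset.sum_congr rfl fun j _ => ?_
    rw [← hP j]; ring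
  have e3 := congrArg cj e2
  rw [map_mul, conj_conj, conj_conj] at e3
  have e4 : cj (2 * π * I) = -(2 * π * I) := by
    rw [map_mul, map_mul, conj_ofReal, conj_I, show cj (2:ℂ) = 2 from map_ofNat _ 2]; ring
  rw [e4] at e3
  refine mul_right_cancel₀ (neg_ne_zero.2 hπ) ?_
  rw [e3]
  linear_combination (4 * π ^ 2 * D.RR k ζ z) * I_sq
lemma RR_diff (hl0 : 0 < lam) (hl2 : lam < 2) (hφ : ON ν φ) (hk : D.IsK φ ζ k) (hζ : ζ ∈ F)
    (h : ∀ j, ∀ x ∈ IcU, D.bb j x ≠ z) : DifferentiableAt ℂ (D.RR k ζ) z := by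
  have : ∀ j, DifferentiableAt ℂ (fun z => ∫ x in IqU, D.hh k ζ j x * (D.bb j x - z)⁻¹) z := by
    intro j
    obtain ⟨d, hd, h2⟩ := exists_sep (K := {z}) (L := D.bb j '' Icc 0 1) isCompact_singleton
      (isCompact_Icc.image_of_continuousOn (D.bb_cont j)).isClosed (by
        rw [disjoint_singleton_left]; rintro ⟨x, hx, e⟩; exact h j x hx e)
    refine (cauchy_diff (D.hh_int hl0 hl2 hφ hk hζ j) (((D.bb_cont j).mono Ioc_subset_Icc_self).aestronglyMeasurable measurableSet_Ioc) hd ?_).differentiableAt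
    filter_upwards [ae_restrict_mem measurableSet_Ioc] with x hx
    exact h2 z rfl _ ⟨x, Ioc_subset_Icc_self hx, rfl⟩
  exact DifferentiableAt.fun_sum fun j _ => this j
lemma bb_ends (hx : x ∈ IcU) :
    D.bb j x ∉ closure G ∨ (D.bb j x ∈ frontier G ∧ (D.bb j x = D.τ j 0 ∨ D.bb j x = D.τ j 1)) := by
  rcases hx.1.eq_or_lt with h | h
  · right
    have e : D.bb j x = D.τ j 0 := by rw [bb, ← h, pth_at0]
    exact ⟨by rw [e]; simpa using D.onL j 0 (by simp), Or.inl e⟩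
  rcases hx.2.eq_or_lt with h' | h'
  · right
    have e : D.bb j x = D.τ j 1 := by rw [bb, h', pth_at1]
    exact ⟨by rw [e]; simpa using D.onL j 1 (by simp), Or.inr e⟩
  · exact Or.inl (D.lo_mem j ⟨h, h'⟩)
lemma K_eq (hl0 : 0 < lam) (hl2 : lam < 2) (hφ : ON ν φ) (hk : D.IsK φ ζ k) (hζ : ζ ∈ F) (hz : z ∈ G) :
    Cau ν (fun t => k t * D.σ t) z = 2 * π * I * D.RR k ζ z := by
  have := D.ν_fin
  have hI : Integrable (fun t => k t * D.σ t) ν := (D.σ_memLp hk.mem).integrable (by norm_num)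
  have a1 : AnalyticOnNhd ℂ (Cau ν (fun t => k t * D.σ t)) G :=
    DifferentiableOn.analyticOnNhd (fun z hz => (D.cau_diff hI (D.G_notL hz)).differentiableAt.differentiableWithinAt) D.G_open
  have a2 : AnalyticOnNhd ℂ (fun z => 2 * π * I * D.RR k ζ z) G := by
    refine DifferentiableOn.analyticOnNhd (fun z hz => ?_) D.G_open
    refine ((D.RR_diff hl0 hl2 hφ hk hζ fun j x hx => ?_).const_mul _).differentiableWithinAt
    rintro rfl
    rcases D.bb_ends j hx with h | h
    · exact h (subset_closure hz)
    · exact D.G_notL hz h.1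
  refine a1.eqOn_of_preconnected_of_eventuallyEq a2 D.G_conn (D.F_sub hζ) ?_ hz
  have hcl : IsClosed (⋃ j, D.τ j '' lens D.η) := isClosed_iUnion_of_finite fun j =>
    ((lens_compact D.η_pos).image_of_continuousOn ((D.hol j).continuousOn.mono D.lens_sub)).isClosed
  have hn : ζ ∈ (⋃ j, D.τ j '' lens D.η)ᶜ := by
    intro h
    obtain ⟨j, ω, hω, e⟩ := mem_iUnion.1 h
    exact D.avoid j ω hω (e ▸ hζ)
  filter_upwards [hcl.isOpen_compl.mem_nhds hn, D.G_open.mem_nhds (D.F_sub hζ)] with w hw hwG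
  exact D.K_off hl0 hl2 hφ hk hζ hwG fun j ω hω e => hw (mem_iUnion.2 ⟨j, ω, hω, e⟩)
end Dat
namespace Dat
variable (D : Dat G ν lam F) (j : Fin D.m) {φ : ℕ → Polynomial ℂ} {ζ : ℂ} {k : ℂ → ℂ}
lemma bb_sep : ∀ᵐ x ∂(volume.restrict IqU), 0 < D.c * D.η * qd(x) ∧
    ∀ t ∈ frontier G, D.c * D.η * qd(x) ≤ ‖t - D.bb j x‖ := by
  filter_upwards [ae_Ioo] with x hx
  exact ⟨mul_pos (mul_pos D.c_pos D.η_pos) (qpos hx), D.sep_pth j D.etan' hx⟩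
lemma RR_eq (k : ℂ → ℂ) (ζ z : ℂ) : D.RR k ζ z = -∑ j, ∫ x in IqU, D.hh k ζ j x * (z - D.bb j x)⁻¹ := by
  rw [RR, ← Finset.sum_neg_distrib]
  refine Finset.sum_congr rfl fun j _ => ?_
  rw [← integral_neg]
  congr 1; funext x
  rw [← neg_sub, inv_neg]; ring
lemma RR_fub (hl0 : 0 < lam) (hl2 : lam < 2) (hφ : ON ν φ) (hk : D.IsK φ ζ k) (hζ : ζ ∈ F)
    (hh : MemLp h 2 ν) : Integrable (fun t => h t * D.RR k ζ t) ν ∧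
    ∫ t, h t * D.RR k ζ t ∂ν = -∑ j, ∫ x in IqU, D.hh k ζ j x * Cau ν h (D.bb j x) := by
  have := fun j => D.fub hh (D.hh_aesm hk hζ j) (((D.bb_cont j).mono Ioc_subset_Icc_self).aemeasurable measurableSet_Ioc)
    (D.bb_sep j) (D.hh_hi hl0 hl2 hφ hk hζ j)
  have e : (fun t => h t * D.RR k ζ t) = fun t => -∑ j, h t * ∫ x in IqU, D.hh k ζ j x * (t - D.bb j x)⁻¹ := by
    funext t; rw [RR_eq, mul_neg, Finset.mul_sum]
  rw [e]
  refine ⟨(integrable_finsetSum _ fun j _ => (this j).1).neg, ?_⟩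
  rw [integral_neg, integral_finsetSum _ fun j _ => (this j).1]
  congr 1
  exact Finset.sum_congr rfl fun j _ => (this j).2
lemma RR_memLp (hl0 : 0 < lam) (hl2 : lam < 2) (hφ : ON ν φ) (hk : D.IsK φ ζ k) (hζ : ζ ∈ F) :
    MemLp (D.RR k ζ) 2 ν := by
  have := D.ν_fin
  have h1 := (D.RR_fub hl0 hl2 hφ hk hζ (D.one_memLp)).1
  simp only [one_mul] at h1
  refine memLp_dual (B := ∑ j, ∫ x in IqU, ‖D.hh k ζ j x‖ * √(D.A / (D.c * D.η * qd(x)))) h1.1 fun f hf => ?_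
  rw [(D.RR_fub hl0 hl2 hφ hk hζ hf).2, norm_neg, Finset.sum_mul]
  refine (norm_sum_le _ _).trans (Finset.sum_le_sum fun j _ => ?_)
  rw [← integral_mul_const]
  refine norm_integral_le_of_norm_le ((D.hh_hi hl0 hl2 hφ hk hζ j).mul_const _) ?_
  filter_upwards [D.bb_sep j] with x hx
  rw [norm_mul, mul_assoc]
  refine mul_le_mul_of_nonneg_left ?_ (norm_nonneg _)
  rw [mul_comm]
  exact D.cau_norm hf hx.1 hx.2
lemma Cau_RR (hl0 : 0 < lam) (hl2 : lam < 2) (hφ : ON ν φ) (hk : D.IsK φ ζ k) (hζ : ζ ∈ F) (hz : z ∈ G) :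
    Cau ν (fun t => D.RR k ζ t * D.σ t) z = 2 * π * I * D.RR k ζ z := by
  have hL := D.G_notL hz
  obtain ⟨d, hd, hd2⟩ := D.dist_pos hL
  have hm : MemLp (fun t => (t - z)⁻¹ * D.σ t) 2 ν := D.σ_memLp (D.inv_int hL)
  have h := (D.RR_fub hl0 hl2 hφ hk hζ hm).2
  have e : Cau ν (fun t => D.RR k ζ t * D.σ t) z = ∫ t, (t - z)⁻¹ * D.σ t * D.RR k ζ t ∂ν := by
    rw [Cau]; congr 1; funext t; ring
  rw [e, h, RR, Finset.mul_sum, ← Finset.sum_neg_distrib]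
  refine Finset.sum_congr rfl fun j _ => ?_
  rw [← integral_neg, ← integral_const_mul]
  refine integral_congr_ae ?_
  filter_upwards [D.bb_sep j, ae_Ioo] with x hx hx'
  have hb : D.bb j x ∉ frontier G := fun h => D.lo_mem j hx' (frontier_subset_closure h)
  have hzb : z - D.bb j x ≠ 0 := sub_ne_zero.2 fun h => D.lo_mem j hx' (subset_closure (h ▸ hz))
  have e2 : Cau ν (fun t => (t - z)⁻¹ * D.σ t) (D.bb j x) = (z - D.bb j x)⁻¹ * (Cau ν D.σ z - Cau ν D.σ (D.bb j x)) := by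
    rw [Cau, Cau, Cau, ← integral_sub (CS D.σ2 (D.inv_int hL)).1 (CS D.σ2 (D.inv_int hb)).1, ← integral_const_mul]
    refine integral_congr_ae ?_
    filter_upwards [D.ae_L] with t ht
    have h1 : t - z ≠ 0 := sub_ne_zero.2 fun h => hL (h ▸ ht)
    have h2 : t - D.bb j x ≠ 0 := sub_ne_zero.2 fun h => hb (h ▸ ht)
    field_simp
    ring
  have e3 : Cau ν D.σ (D.bb j x) = 0 := D.W_out j (pth_mem D.etan'.le (Ioo_subset_Icc_self hx')) (D.pth_lo hx') D.σ1 D.int_polyσ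
  rw [e2, e3, D.W_in hz, ← neg_sub z, inv_neg]
  ring
lemma K_ae (hl0 : 0 < lam) (hl2 : lam < 2) (hφ : ON ν φ) (hk : D.IsK φ ζ k) (hζ : ζ ∈ F) :
    ∀ᵐ t ∂ν, k t = D.RR k ζ t := by
  have := D.ν_fin
  have hR := D.RR_memLp hl0 hl2 hφ hk hζ
  have hkσ := D.σ_memLp hk.mem
  have hRσ := D.σ_memLp hR
  set g : ℂ → ℂ := fun t => k t * D.σ t - D.RR k ζ t * D.σ t with hg
  have hgm : MemLp g 2 ν := hkσ.sub hRσ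
  have hsub : ∀ z, z ∉ frontier G → Cau ν g z = Cau ν (fun t => k t * D.σ t) z - Cau ν (fun t => D.RR k ζ t * D.σ t) z := by
    intro z hz
    rw [Cau, Cau, Cau, ← integral_sub (CS hkσ (D.inv_int hz)).1 (CS hRσ (D.inv_int hz)).1]
    congr 1; funext t; simp only [hg]; ring
  have hup : ∀ j, ∀ x ∈ IoU, Cau ν g (D.τ j (pth D.η x)) = 0 := by
    intro j x hx
    have := D.up_mem j hx
    rw [hsub _ (D.G_notL this), D.K_eq hl0 hl2 hφ hk hζ this, D.Cau_RR hl0 hl2 hφ hk hζ this, sub_self]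
  have hpk : ∀ P : Polynomial ℂ, ∫ t, P.eval t * (k t * D.σ t) ∂ν = 0 := by
    intro P
    have hP : MemLp (fun t => P.eval t * D.σ t) 2 ν := D.σ_memLp (D.pL P)
    have h1 := tend_int (v := fun N t => (SN φ ζ N).eval t) hk.mem (fun N => D.pL _) hP hk.lim
    have h2 : ∀ N, ∫ t, (SN φ ζ N).eval t * (P.eval t * D.σ t) ∂ν = 0 := by
      intro N
      rw [← D.int_polyσ (SN φ ζ N * P)]
      congr 1; funext t; rw [Polynomial.eval_mul]; ring
    simp only [h2] at h1
    rw [tendsto_nhds_unique (tendsto_const_nhds (x := (0:ℂ))) h1]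
    congr 1; funext t; ring
  have hpR : ∀ P : Polynomial ℂ, ∫ t, P.eval t * (D.RR k ζ t * D.σ t) ∂ν = 0 := by
    intro P
    have hP : MemLp (fun t => P.eval t * D.σ t) 2 ν := D.σ_memLp (D.pL P)
    have h := (D.RR_fub hl0 hl2 hφ hk hζ hP).2
    have e : (∫ t, P.eval t * (D.RR k ζ t * D.σ t) ∂ν) = ∫ t, P.eval t * D.σ t * D.RR k ζ t ∂ν := by
      congr 1; funext t; ring
    rw [e, h, neg_eq_zero]
    refine Finset.sum_eq_zero fun j _ => ?_
    refine integral_eq_zero_of_ae ?_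
    filter_upwards [ae_Ioo] with x hx
    have := D.W_out j (pth_mem D.etan'.le (Ioo_subset_Icc_self hx)) (D.pth_lo hx) (hP.integrable (by norm_num)) (fun Q => by
      rw [← D.int_polyσ (Q * P)]
      congr 1; funext t; rw [Polynomial.eval_mul]; ring)
    change _ * Cau ν _ (D.τ j (pth (-D.η) x)) = 0
    rw [this, mul_zero]
  have hlo : ∀ j, ∀ x ∈ IoU, Cau ν g (D.τ j (pth (-D.η) x)) = 0 := by
    intro j x hx
    have h1 : D.τ j (pth (-D.η) x) ∉ closure G := D.lo_mem j hx
    have hm := pth_mem D.etan'.le (Ioo_subset_Icc_self hx)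
    rw [hsub _ (fun h => h1 (frontier_subset_closure h)), D.W_out j hm (D.pth_lo hx) (hkσ.integrable (by norm_num)) hpk,
      D.W_out j hm (D.pth_lo hx) (hRσ.integrable (by norm_num)) hpR, sub_self]
  have hz : ∀ j, ∀ᵐ x : ℝ ∂voU, (‖deriv (D.τ j) x‖ : ℂ) * g (D.τ j x) = 0 := by
    intro j
    refine moment_zero (D.int_piece (hgm.integrable (by norm_num)) j) fun P => ?_
    have h := D.piece hgm isOpen_univ (subset_univ _) (f := fun ω => P.eval ω) P.differentiable.differentiableOn j
    have p0 : ∀ s : ℝ, (∀ x ∈ IoU, Cau ν g (D.τ j (pth s x)) = 0) →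
        PI s (fun ω => P.eval ω * deriv (D.τ j) ω * Cau ν g (D.τ j ω)) = 0 := by
      intro s hs
      unfold PI
      rw [intervalIntegral.integral_of_le zero_le_one]
      refine integral_eq_zero_of_ae ?_
      filter_upwards [ae_Ioo] with x hx
      simp [hs x hx]
    rw [p0 _ (hup j), p0 _ (hlo j), sub_self] at h
    have h2 := (mul_eq_zero.1 h).resolve_left (by simp [Real.pi_ne_zero])
    rw [← h2]
    congr 1; funext x; ring
  have hg2 : Integrable (fun t => g t * cj (g t)) ν := (CS hgm (memLp_conj hgm)).1
  have hi := D.int_eq hg2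
  have h0 : nrm ν g ^ 2 = 0 := by
    have e : ((nrm ν g ^ 2 : ℝ) : ℂ) = 0 := by
      rw [nrm_sq, hi]
      refine Finset.sum_eq_zero fun j _ => ?_
      rw [intervalIntegral.integral_of_le zero_le_one]
      refine integral_eq_zero_of_ae ?_
      filter_upwards [ae_mono (Measure.restrict_mono Ioc_subset_Icc_self le_rfl) (hz j)] with x hx
      rw [← mul_assoc, hx, zero_mul]; rfl
    exact_mod_cast e
  have hI : ∫ t, ‖g t‖ ^ 2 ∂ν = 0 := by
    rw [nrm, Real.sq_sqrt (integral_nonneg fun t => by positivity)] at h0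
    exact h0
  rw [integral_eq_zero_iff_of_nonneg (fun t => by positivity) ((memLp_two_iff_integrable_sq_norm hgm.1).1 hgm)] at hI
  filter_upwards [hI, D.σ_norm] with t ht hs
  have h3 : g t = 0 := by simpa using ht
  have h4 : D.σ t ≠ 0 := norm_ne_zero_iff.1 (by rw [hs]; norm_num)
  have h5 : (k t - D.RR k ζ t) * D.σ t = 0 := by rw [← h3, hg]; ring
  exact sub_eq_zero.1 ((mul_eq_zero.1 h5).resolve_right h4)
lemma nt_ae (hl0 : 0 < lam) (hl2 : lam < 2) (hφ : ON ν φ) (hk : D.IsK φ ζ k) (hζ : ζ ∈ F) :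
    ∀ᵐ t ∂ν, ∀ (g : ℂ → ℂ) (v a : ℂ), (∀ z ∈ G, g z = a * ∑' k, cj ((φ k).eval ζ) * (φ k).eval z) →
      (∀ M : ℝ, 1 < M → Tendsto g (𝓝[{z | z ∈ G ∧ ‖z - t‖ ≤ M * infDist z (frontier G)}] t) (𝓝 v)) → v = a * k t := by
  filter_upwards [D.K_ae hl0 hl2 hφ hk hζ, D.ae_nc] with t ht hnc g v a hg hv
  obtain ⟨j, x, hx, rfl⟩ := hnc
  have hgR : ∀ z ∈ G, g z = a * D.RR k ζ z := by
    intro z hz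
    rw [hg z hz, D.tsum_k hφ hk (D.F_sub hζ) hz, D.K_eq hl0 hl2 hφ hk hζ hz, inv_mul_cancel_left₀ (by simp [Real.pi_ne_zero])]
  rw [ht]
  have hxI := Ioo_subset_Icc_self hx
  have hL := D.onL j x hxI
  have hc : ContinuousAt (D.RR k ζ) (D.τ j x) := by
    refine (D.RR_diff hl0 hl2 hφ hk hζ fun i y hy h => ?_).continuousAt
    have key : ∀ e : ℝ, (e = 0 ∨ e = 1) → D.τ j x ≠ D.τ i e := by
      intro e he h
      have heI : e ∈ IcU := by rcases he with rfl | rfl <;> simp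
      obtain rfl := D.disj j i x hx e heI h
      have := D.inj (D.real_mem hxI) (D.real_mem heI) h
      rw [ofReal_inj] at this
      rcases he with rfl | rfl
      · exact hx.1.ne' this
      · exact hx.2.ne this
    rcases D.bb_ends i hy with h1 | ⟨-, h1 | h1⟩
    · exact h1 (h ▸ frontier_subset_closure hL)
    · exact key 0 (Or.inl rfl) (by rw [← h, h1]; simp)
    · exact key 1 (Or.inr rfl) (by rw [← h, h1]; simp)
  set M : ℝ := D.C / D.c + 2 with hM
  have hM1 : 1 < M := by have := div_pos D.C_pos D.c_pos; linarith
  set q : ℝ → ℂ := fun y => (x : ℂ) + y * I with hq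
  have hqim : ∀ y, (q y).im = y := by intro y; simp [hq]
  have hqre : ∀ y, (q y).re = x := by intro y; simp [hq]
  have hpos : 0 < D.η * qd(x) := mul_pos D.η_pos (qpos hx)
  have hql : ∀ y ∈ Ioo 0 (D.η * qd(x)), q y ∈ lens D.η := by
    intro y hy
    change |(q y).im| ≤ D.η * ((q y).re * (1 - (q y).re))
    rw [hqim, hqre, abs_of_pos hy.1]; exact hy.2.le
  have hev : ∀ᶠ y in nhR, y ∈ Ioo 0 (D.η * qd(x)) := Ioo_mem_nhdsGT hpos
  have hq0 : Tendsto (fun y => D.τ j (q y)) nhR (𝓝 (D.τ j x)) := by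
    have h1 : ContinuousAt (D.τ j) (q 0) := by
      have : q 0 = x := by simp [hq]
      rw [this]
      exact ((D.hol j).differentiableAt (D.N_open.mem_nhds (D.real_mem hxI))).continuousAt
    have h2 : ContinuousAt (fun y => D.τ j (q y)) 0 := ContinuousAt.comp h1 (by fun_prop)
    have := h2.tendsto
    rw [show q 0 = x by simp [hq]] at this
    exact this.mono_left nhdsWithin_le_nhds
  have hcone : ∀ᶠ y in nhR, D.τ j (q y) ∈ {z | z ∈ G ∧ ‖z - D.τ j x‖ ≤ M * infDist z (frontier G)} := by
    filter_upwards [hev] with y hy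
    have hl := hql y hy
    refine ⟨D.up j _ hl (by rw [hqim]; exact hy.1), ?_⟩
    have h1 : D.c * y ≤ infDist (D.τ j (q y)) (frontier G) := by
      rw [le_infDist ⟨_, hL⟩]
      intro t ht
      have := D.sep j _ hl t ht
      rwa [hqim, abs_of_pos hy.1, ← dist_eq_norm, dist_comm] at this
    have h2 := D.lens_lip j hl (ofReal_mem_lens D.η_pos.le hxI)
    have h3 : ‖q y - x‖ = y := by simp [hq, abs_of_pos hy.1]
    rw [h3] at h2
    refine h2.trans ((?_ : D.C * y ≤ M * (D.c * y)).trans (mul_le_mul_of_nonneg_left h1 (by linarith)))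
    have h4 : D.C = D.C / D.c * D.c := (div_mul_cancel₀ _ D.c_pos.ne').symm
    have : M * (D.c * y) = D.C * y + 2 * D.c * y := by rw [hM]; linear_combination (-y) * h4
    rw [this]
    nlinarith [mul_pos D.c_pos hy.1]
  have hT := (hv M hM1).comp (tendsto_nhdsWithin_iff.2 ⟨hq0, hcone⟩)
  have hT2 : Tendsto (fun y => a * D.RR k ζ (D.τ j (q y))) nhR (𝓝 (a * D.RR k ζ (D.τ j x))) :=
    (hc.tendsto.comp hq0).const_mul a
  refine tendsto_nhds_unique hT (hT2.congr' ?_)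
  filter_upwards [hcone] with y hy
  exact (hgR _ hy.1).symm
end Dat
structure Ort (ν : Measure ℂ) (n : ℕ) (E : ℂ → ℂ) : Prop where
  mem : MemLp E 2 ν
  orth : ∀ P : Polynomial ℂ, P.degree < (n + 1 : ℕ) → ∫ t, P.eval t * E t ∂ν = 0
def Dec (ν : Measure ℂ) (K : Set ℂ) : Prop := ∃ C > 0, ∃ c > 0, ∀ n E, Ort ν n E → ∀ z ∈ K,
  ‖Cau ν E z‖ ≤ C * nrm ν E * expR (-(c * n))
lemma geo_poly (z : ℂ) (P : Polynomial ℂ) (j : ℕ) : ∃ Q : Polynomial ℂ, (Q.degree < (j * (P.natDegree + 1) : ℕ) ∨ Q = 0) ∧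
    ∀ t, 1 - (1 - (t - z) * P.eval t) ^ j = (t - z) * Q.eval t := by
  refine ⟨P * ∑ i ∈ Finset.range j, (1 - (Polynomial.X - Polynomial.C z) * P) ^ i, ?_, fun t => ?_⟩
  · rcases j with _ | j
    · right; simp
    left
    refine (Polynomial.degree_le_natDegree.trans ?_).trans_lt (WithBot.coe_lt_coe.2 (Nat.lt_of_lt_of_le (Nat.lt_succ_self (P.natDegree + j * (P.natDegree + 1))) (le_of_eq (by simp only [Nat.cast_id, Nat.succ_eq_add_one]; ring))))
    refine WithBot.coe_le_coe.2 (Polynomial.natDegree_mul_le.trans (Nat.add_le_add_left ?_ _))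
    refine Polynomial.natDegree_sum_le_of_forall_le _ _ fun i hi => ?_
    refine Polynomial.natDegree_pow_le.trans (Nat.mul_le_mul (Nat.lt_succ_iff.1 (Finset.mem_range.1 hi)) ?_)
    refine (Polynomial.natDegree_sub_le _ _).trans (max_le (by simp) ?_)
    refine Polynomial.natDegree_mul_le.trans ?_
    rw [Polynomial.natDegree_X_sub_C, add_comm]
  · simp only [Polynomial.eval_mul, Polynomial.eval_finsetSum, Polynomial.eval_pow, Polynomial.eval_sub, Polynomial.eval_one, Polynomial.eval_X, Polynomial.eval_C]
    have := mul_neg_geom_sum (1 - (t - z) * P.eval t) j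
    linear_combination -this
namespace Dat
variable (D : Dat G ν lam F) (j : Fin D.m) {φ : ℕ → Polynomial ℂ} {ζ : ℂ} {k : ℂ → ℂ}
lemma dec_loc (D : Dat G ν lam F) {z0 : ℂ} (hz : z0 ∉ closure G) (hA : PA (closure G) fun z => (z - z0)⁻¹) : ∃ U ∈ 𝓝 z0, Dec ν U := by
  obtain ⟨d, hd, hdL⟩ := D.dist_pos (fun h => hz (frontier_subset_closure h))
  obtain ⟨R, hR⟩ := D.X_bdd.subset_ball z0
  have hR' : ∀ t ∈ closure G, ‖t - z0‖ ≤ |R| + 1 := fun t ht => by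
    have := mem_ball.1 (hR ht); rw [dist_eq_norm] at this; linarith [le_abs_self R]
  have hRp : 0 < |R| + 1 := by positivity
  obtain ⟨P, hP⟩ := hA (1 / (4 * (|R| + 1))) (by positivity)
  obtain ⟨B, hB⟩ := (D.X_bdd.isCompact_closure.image_of_continuousOn (f := fun t => P.eval t) P.continuous.continuousOn).isBounded.subset_ball 0
  have hB' : ∀ t ∈ closure G, ‖P.eval t‖ ≤ |B| + 1 := fun t ht => by
    have := mem_ball_zero_iff.1 (hB ⟨t, subset_closure ht, rfl⟩); linarith [le_abs_self B]
  set ρ := min (d / 2) (1 / (4 * (|B| + 1))) with hρ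
  have hρ0 : 0 < ρ := by positivity
  set N := P.natDegree + 1 with hN
  have hN0 : 0 < (N : ℝ) := by positivity
  set s := √(D.A / (d / 2)) with hs
  refine ⟨ball z0 ρ, ball_mem_nhds _ hρ0, 2 * (s + 1), by positivity, logR 2 / N, div_pos (Real.log_pos one_lt_two) hN0, fun n E hE z hzb => ?_⟩
  rw [mem_ball, dist_eq_norm] at hzb
  have hzd : ∀ t ∈ frontier G, d / 2 ≤ ‖t - z‖ := by
    intro t ht
    have h1 := hdL t ht
    have h2 : ‖t - z0‖ ≤ ‖t - z‖ + ‖z - z0‖ := by simpa using norm_add_le (t - z) (z - z0)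
    have := min_le_left (d / 2) (1 / (4 * (|B| + 1)))
    linarith
  have hsm : ∀ t ∈ frontier G, ‖1 - (t - z) * P.eval t‖ ≤ 1 / 2 := by
    intro t ht
    have htX := frontier_subset_closure ht
    have hne : t - z0 ≠ 0 := norm_pos_iff.1 (hd.trans_le (hdL t ht))
    have e : 1 - (t - z) * P.eval t = (t - z0) * ((t - z0)⁻¹ - P.eval t) + (z - z0) * P.eval t := by
      rw [mul_sub, mul_inv_cancel₀ hne]; ring
    rw [e]
    refine (norm_add_le _ _).trans ?_
    rw [norm_mul, norm_mul]
    have h1 : ‖t - z0‖ * ‖(t - z0)⁻¹ - P.eval t‖ ≤ (|R| + 1) * (1 / (4 * (|R| + 1))) :=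
      mul_le_mul (hR' t htX) (hP t htX) (norm_nonneg _) hRp.le
    have h2 : ‖z - z0‖ * ‖P.eval t‖ ≤ (1 / (4 * (|B| + 1))) * (|B| + 1) :=
      mul_le_mul (hzb.le.trans (min_le_right _ _)) (hB' t htX) (norm_nonneg _) (by positivity)
    have e1 : (|R| + 1) * (1 / (4 * (|R| + 1))) = 1 / 4 := by field_simp
    have e2 : (1 / (4 * (|B| + 1))) * (|B| + 1) = 1 / 4 := by field_simp
    linarith
  have hzL : z ∉ frontier G := fun h => by have := hzd z h; simp at this; linarith
  set j := (n + 1) / N with hj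
  obtain ⟨Q, hQd, hQ⟩ := geo_poly z P j
  have hQ0 : ∫ t, Q.eval t * E t ∂ν = 0 := by
    rcases hQd with h | h
    · exact hE.orth Q (h.trans_le (WithBot.coe_le_coe.2 (Nat.div_mul_le_self _ _)))
    · simp [h]
  have hI := (CS hE.mem (D.inv_int hzL)).1
  have hIQ := (CS (D.pL Q) hE.mem).1
  have e1 : Cau ν E z = ∫ t, E t * (t - z)⁻¹ * (1 - (t - z) * P.eval t) ^ j ∂ν := by
    rw [← sub_zero (Cau ν E z), ← hQ0, Cau, ← integral_sub hI hIQ]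
    refine integral_congr_ae ?_
    filter_upwards [D.ae_L] with t ht
    have hne : t - z ≠ 0 := sub_ne_zero.2 fun h => hzL (h ▸ ht)
    have := hQ t
    have e3 : (1 - (t - z) * P.eval t) ^ j = 1 - (t - z) * Q.eval t := by linear_combination -this
    rw [e3]; field_simp
  have hb := D.cau_bd hE.mem (by positivity : 0 < d / 2) hzd
  have e2 : ‖Cau ν E z‖ ≤ (nrm ν E * s) * (1 / 2) ^ j := by
    rw [e1]
    refine (norm_integral_le_of_norm_le (hb.1.norm.mul_const ((1 / 2) ^ j)) ?_).trans ?_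
    · filter_upwards [D.ae_L] with t ht
      rw [norm_mul, norm_pow]
      exact mul_le_mul_of_nonneg_left (pow_le_pow_left₀ (norm_nonneg _) (hsm t ht) _) (norm_nonneg _)
    · rw [integral_mul_const]
      exact mul_le_mul_of_nonneg_right hb.2 (by positivity)
  have e3 : ((1:ℝ) / 2) ^ j ≤ 2 * expR (-(logR 2 / N * n)) := by
    have h1 : (n + 1 : ℕ) < N * (j + 1) := by
      have := Nat.div_add_mod (n + 1) N; have h2 := Nat.mod_lt (n + 1) (by omega : 0 < N)
      rw [Nat.mul_add, hj]; omega
    have h2 : (n : ℝ) ≤ N * (j + 1) := by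
      have : ((n + 1 : ℕ) : ℝ) < ((N * (j + 1) : ℕ) : ℝ) := by exact_mod_cast h1
      push_cast at this; linarith
    have h3 : ((1:ℝ) / 2) ^ j = expR (-(logR 2 * j)) := by
      rw [Real.exp_neg, mul_comm, Real.exp_nat_mul, Real.exp_log two_pos]; simp
    have h4 : (2:ℝ) = expR (logR 2) := (Real.exp_log two_pos).symm
    rw [h3]; nth_rw 2 [h4]; rw [← Real.exp_add]
    refine Real.exp_le_exp.2 ?_
    have h5 : logR 2 / N * n ≤ logR 2 * (j + 1) := by
      rw [div_mul_eq_mul_div, div_le_iff₀ hN0]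
      have := Real.log_pos one_lt_two
      nlinarith
    linarith
  have hn := nrm_nonneg ν E
  calc ‖Cau ν E z‖ ≤ (nrm ν E * s) * (2 * expR (-(logR 2 / N * n))) := e2.trans (mul_le_mul_of_nonneg_left e3 (by positivity))
    _ ≤ _ := by
      have : 0 ≤ nrm ν E * expR (-(logR 2 / N * n)) := by positivity
      nlinarith
lemma dec_cpt (D : Dat G ν lam F) {K : Set ℂ} (hK : IsCompact K) (h : ∀ z ∈ K, z ∉ closure G ∧ PA (closure G) fun t => (t - z)⁻¹) : Dec ν K := by
  refine hK.induction_on (p := Dec ν) ⟨1, one_pos, 1, one_pos, fun _ _ _ _ h => h.elim⟩ ?_ ?_ fun z hz => ?_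
  · rintro s t hst ⟨C, hC, c, hc, H⟩
    exact ⟨C, hC, c, hc, fun n E hE z hz => H n E hE z (hst hz)⟩
  · rintro s t ⟨C, hC, c, hc, H⟩ ⟨C', hC', c', hc', H'⟩
    refine ⟨max C C', by positivity, min c c', by positivity, fun n E hE z hz => ?_⟩
    have hn := nrm_nonneg ν E
    rcases hz with hz | hz
    · refine (H n E hE z hz).trans ?_
      gcongr
      · exact le_max_left _ _
      · exact min_le_left _ _
    · refine (H' n E hE z hz).trans ?_
      gcongr
      · exact le_max_right _ _
      · exact min_le_right _ _
  · obtain ⟨U, hU, hd⟩ := D.dec_loc (h z hz).1 (h z hz).2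
    exact ⟨U, mem_nhdsWithin_of_mem_nhds hU, hd⟩
end Dat
lemma Cor.low2 (H : Cor X lam c0 u b) {v : ℂ} (hw : w ≠ 0) (haw : |arg w| < lam * π / 2)
    (hv : ‖v‖ * cosR (bet lam) ≤ v.re) :
    ‖w‖ * ((lam * π / 2 - |arg w|) / π) ≤ ‖v + w‖ := by
  set γ := lam * π / 2 - |arg w| with hγ
  have hπ := Real.pi_pos
  have hγ0 : 0 < γ := by linarith
  have hγπ : γ < π := by
    have := abs_nonneg (arg w); have := H.l2; nlinarith
  have hγ1 : γ / π ≤ 1 := (div_le_one hπ).2 hγπ.le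
  rcases eq_or_ne v 0 with rfl | hv0
  · rw [zero_add]; exact mul_le_of_le_one_right (norm_nonneg _) hγ1
  have hav := arg_le H.betI hv0 hv
  have hcos : -cosR γ ≤ cosR (arg w - arg v) := by
    rw [← Real.cos_abs (arg w - arg v), ← Real.cos_pi_sub]
    refine Real.cos_le_cos_of_nonneg_of_le_pi (abs_nonneg _) (by linarith) ?_
    have := abs_sub (arg w) (arg v)
    rw [bet] at hav; linarith
  have e : ‖v + w‖ ^ 2 = ‖v‖ ^ 2 + ‖w‖ ^ 2 + 2 * (‖w‖ * ‖v‖) * cosR (arg w - arg v) := by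
    rw [Real.cos_sub, ← normSq_eq_norm_sq, normSq_apply, add_re, add_im]
    have h1 := norm_mul_cos_arg w
    have h2 := norm_mul_sin_arg w
    have h3 := norm_mul_cos_arg v
    have h4 := norm_mul_sin_arg v
    have h5 : ‖w‖ ^ 2 = w.re ^ 2 + w.im ^ 2 := by rw [← normSq_eq_norm_sq, normSq_apply]; ring
    have h6 : ‖v‖ ^ 2 = v.re ^ 2 + v.im ^ 2 := by rw [← normSq_eq_norm_sq, normSq_apply]; ring
    rw [h5, h6, ← h1, ← h2, ← h3, ← h4]; ring
  have e2 : ‖v‖ ^ 2 + ‖w‖ ^ 2 - 2 * (‖w‖ * ‖v‖) * cosR γ ≤ ‖v + w‖ ^ 2 := by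
    rw [e]; nlinarith [mul_nonneg (norm_nonneg w) (norm_nonneg v)]
  refine le_of_sq_le_sq ?_ (norm_nonneg _) |>.trans le_rfl
  refine le_trans ?_ e2
  rcases le_total γ (π / 2) with h | h
  · have h1 : γ / π ≤ sinR γ := by
      refine le_trans ?_ (Real.mul_le_sin hγ0.le h)
      rw [div_mul_eq_mul_div]; exact div_le_div_of_nonneg_right (by linarith) hπ.le
    have h2 := Real.sin_sq_add_cos_sq γ
    have h3 : (γ / π) ^ 2 ≤ sinR γ ^ 2 := pow_le_pow_left₀ (by positivity) h1 2
    have h4 : (‖w‖ * (γ / π)) ^ 2 ≤ ‖w‖ ^ 2 * sinR γ ^ 2 := by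
      rw [mul_pow]; exact mul_le_mul_of_nonneg_left h3 (by positivity)
    nlinarith [sq_nonneg (‖v‖ - ‖w‖ * cosR γ)]
  · have h1 : cosR γ ≤ 0 := Real.cos_nonpos_of_pi_div_two_le_of_le h (by linarith)
    have h4 : (‖w‖ * (γ / π)) ^ 2 ≤ ‖w‖ ^ 2 :=
      pow_le_pow_left₀ (by positivity) (mul_le_of_le_one_right (norm_nonneg _) hγ1) 2
    nlinarith [mul_nonneg (norm_nonneg w) (norm_nonneg v), sq_nonneg ‖v‖, mul_nonneg (mul_nonneg (norm_nonneg w) (norm_nonneg v)) (neg_nonneg.2 h1)]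
def yl (a : ℝ) (y : ℂ) : ℂ := exp (a * log y)
lemma yl_norm {a : ℝ} {y : ℂ} (hy : y ≠ 0) : ‖yl a y‖ = ‖y‖ ^ a := by
  rw [yl, norm_exp, re_ofReal_mul, log_re, Real.rpow_def_of_pos (norm_pos_iff.2 hy), mul_comm]
lemma yl_arg {a : ℝ} {y : ℂ} (h : |a * arg y| < π) : arg (yl a y) = a * arg y := by
  have h1 : ((a : ℂ) * log y).im = a * arg y := by rw [im_ofReal_mul, log_im]
  rw [← log_im, yl, log_exp, h1]
  · rw [h1]; exact (abs_lt.1 h).1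
  · rw [h1]; exact (abs_lt.1 h).2.le
lemma yl_diff {a : ℝ} {y : ℂ} (hy : 0 < y.re) : DifferentiableAt ℂ (yl a) y := by
  refine DifferentiableAt.cexp (DifferentiableAt.const_mul ?_ _)
  exact differentiableAt_log (Or.inl hy)
lemma yl_yl {a : ℝ} (ha : a ≠ 0) (hw : w ≠ 0) (h : |a⁻¹ * arg w| < π) : yl a (yl a⁻¹ w) = w := by
  have h1 : (((a⁻¹ : ℝ) : ℂ) * log w).im = a⁻¹ * arg w := by rw [im_ofReal_mul, log_im]
  have ha' : (a : ℂ) ≠ 0 := by exact_mod_cast ha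
  rw [yl, yl, log_exp (by rw [h1]; exact (abs_lt.1 h).1) (by rw [h1]; exact (abs_lt.1 h).2.le), ofReal_inv, mul_inv_cancel_left₀ ha', exp_log hw]
lemma Cor.yl_sec (H : Cor X lam c0 u b) {y : ℂ} (hy : 0 < y.re) :
    yl lam y ∈ Sec lam ∧ arg (yl lam y) = lam * arg y ∧ |arg y| < π / 2 := by
  have h1 : |arg y| < π / 2 := abs_arg_lt_pi_div_two_iff.2 (Or.inl hy)
  have h2 : |lam * arg y| < lam * π / 2 := by
    rw [abs_mul, abs_of_pos H.l0]; have := H.l0; nlinarith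
  have h3 : arg (yl lam y) = lam * arg y := yl_arg (h2.trans (by have := H.l2; nlinarith [Real.pi_pos]))
  exact ⟨⟨exp_ne_zero _, by rw [h3]; exact h2⟩, h3, h1⟩
lemma Cor.bw (H : Cor X lam c0 u b) (hw : w ∈ Sec lam) : (b : ℂ) + w ≠ 0 := by
  intro h
  have : w = ((-b : ℝ) : ℂ) := by push_cast; linear_combination h
  have h2 := hw.2
  rw [this, arg_ofReal_of_neg (by linarith [H.b0]), abs_of_pos Real.pi_pos] at h2
  have := H.l2; nlinarith [Real.pi_pos]
lemma Cor.zl_diff (H : Cor X lam c0 u b) (hw : w ∈ Sec lam) : DifferentiableAt ℂ (Zl c0 u b) w := by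
  have hb : (b : ℂ) ≠ 0 := by exact_mod_cast H.b0.ne'
  have : 1 + w / b ≠ 0 := by
    have e : 1 + w / b = (b + w) / b := by field_simp
    rw [e]; exact div_ne_zero (H.bw hw) hb
  unfold Zl
  fun_prop (disch := assumption)
lemma Cor.zl_sub (H : Cor X lam c0 u b) (hw : w ∈ Sec lam) (ht : t ∈ X) :
    (t - Zl c0 u b w) * (b + w) = (vv c0 u b t + w) * (t - (c0 + u * b)) := by
  have hb : (b : ℂ) ≠ 0 := by exact_mod_cast H.b0.ne'
  have hz := H.zne ht
  have hbw := H.bw hw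
  have e : Zl c0 u b w = c0 + u * (w * b / (b + w)) := by
    unfold Zl; congr 2
    have e : 1 + w / b = (b + w) / b := by field_simp
    rw [e]; field_simp
  rw [H.vv_eq ht, e, add_mul (_ * _) w, inv_mul_cancel_right₀ hz]
  field_simp
  ring
lemma Cor.zdist (H : Cor X lam c0 u b) (hX : IsClosed X) : ∃ c > 0, ∀ y : ℂ, 0 < y.re → ‖y‖ ≤ 1 → ∀ t ∈ X,
    c * (‖y‖ ^ (lam - 1) * y.re) ≤ ‖t - Zl c0 u b (yl lam y)‖ := by
  obtain ⟨d, hd, hd2⟩ := exists_sep (K := {c0 + u * b}) isCompact_singleton hX (disjoint_singleton_left.2 H.pb)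
  have hb := H.b0; have hl := H.l0; have hπ := Real.pi_pos
  refine ⟨d * (lam / π) / (b + 1), by positivity, fun y hy hy1 t ht => ?_⟩
  have hy0 : y ≠ 0 := by rintro rfl; simp at hy
  have hyp := norm_pos_iff.2 hy0
  obtain ⟨hs, ha, ha2⟩ := H.yl_sec hy
  have h1 := H.low2 hs.1 hs.2 (H.vv_sec ht)
  have h2 := congrArg norm (H.zl_sub hs ht)
  rw [norm_mul, norm_mul] at h2
  have h3 := hd2 _ rfl t ht
  have hn : ‖yl lam y‖ ≤ 1 := by rw [yl_norm hy0]; exact Real.rpow_le_one hyp.le hy1 hl.le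
  have h4 : ‖(b : ℂ) + yl lam y‖ ≤ b + 1 := by
    refine (norm_add_le _ _).trans ?_
    rw [norm_real, Real.norm_eq_abs, abs_of_pos hb]; linarith
  have h5 : y.re ≤ ‖y‖ * (π / 2 - |arg y|) := by
    rw [← norm_mul_cos_arg y, ← Real.cos_abs (arg y), ← Real.sin_pi_div_two_sub]
    exact mul_le_mul_of_nonneg_left (Real.sin_le (by linarith)) hyp.le
  have h6 : lam / π * (‖y‖ ^ (lam - 1) * y.re) ≤ ‖vv c0 u b t + yl lam y‖ := by
    refine le_trans ?_ h1
    rw [yl_norm hy0, ha, abs_mul, abs_of_pos hl]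
    have e : ‖y‖ ^ lam = ‖y‖ ^ (lam - 1) * ‖y‖ := by
      rw [← Real.rpow_add_one hyp.ne']; congr 1; ring
    have h7 : 0 ≤ lam / π * ‖y‖ ^ (lam - 1) := by positivity
    calc _ = lam / π * ‖y‖ ^ (lam - 1) * y.re := by ring
      _ ≤ lam / π * ‖y‖ ^ (lam - 1) * (‖y‖ * (π / 2 - |arg y|)) := mul_le_mul_of_nonneg_left h5 h7
      _ = _ := by rw [e]; field_simp
  rw [div_mul_eq_mul_div, div_le_iff₀ (by positivity)]
  calc _ = (lam / π * (‖y‖ ^ (lam - 1) * y.re)) * d := by ring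
    _ ≤ ‖vv c0 u b t + yl lam y‖ * ‖t - (c0 + u * b)‖ := mul_le_mul h6 h3 hd.le (norm_nonneg _)
    _ = _ := h2.symm
    _ ≤ _ := mul_le_mul_of_nonneg_left h4 (norm_nonneg _)
namespace Dat
variable (D : Dat G ν lam F) (j : Fin D.m) {φ : ℕ → Polynomial ℂ} {ζ : ℂ} {k : ℂ → ℂ}
lemma cor_max (D : Dat G ν lam F) (H : Cor (closure G) lam c0 u b) : ∃ C > 0, ∃ c > 0, ∀ n E, Ort ν n E →
    ∀ y : ℂ, ‖y‖ < 1 → ∀ ε > 0, ε < y.re →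
    ‖Cau ν E (Zl c0 u b (yl lam y))‖ * ‖y‖ ^ ((lam - 1) / 2) * expR (c * n * (y + y ^ 2).re) ≤
      C * nrm ν E * (√ε)⁻¹ * expR (c * n * (2 * ε)) := by
  obtain ⟨c, hc, hcd⟩ := H.zdist isClosed_closure
  have hK : IsCompact ((fun y => Zl c0 u b (yl lam y)) '' {y : ℂ | ‖y‖ = 1 ∧ 1/2 ≤ y.re}) := by
    refine IsCompact.image_of_continuousOn ?_ ?_
    · have : {y : ℂ | ‖y‖ = 1 ∧ 1/2 ≤ y.re} = sphere 0 1 ∩ {y | 1/2 ≤ y.re} := by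
        ext y; simp
      rw [this]
      exact (isCompact_sphere _ _).inter_right (isClosed_le continuous_const continuous_re)
    · intro y hy
      have hy' : 0 < y.re := by linarith [hy.2]
      exact (ContinuousAt.comp (f := yl lam) (g := Zl c0 u b) (H.zl_diff (H.yl_sec hy').1).continuousAt (yl_diff hy').continuousAt).continuousWithinAt
  obtain ⟨C2, hC2, c2, hc2, h2⟩ := D.dec_cpt hK (by
    rintro _ ⟨y, hy, rfl⟩
    exact H.sec _ (H.yl_sec (by linarith [hy.2] : 0 < y.re)).1)
  have hA := Real.sqrt_nonneg (D.A / c)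
  refine ⟨√(D.A / c) + C2, by positivity, c2 / 2, by positivity, fun n E hE y0 hy1 ε hε hεy => ?_⟩
  have hN := nrm_nonneg ν E
  have hε1 : ε < 1 := hεy.trans_le ((re_le_norm _).trans hy1.le)
  have hse : 1 ≤ (√ε)⁻¹ := (one_le_inv₀ (Real.sqrt_pos.2 hε)).2 (Real.sqrt_le_one.2 hε1.le)
  have hex : 1 ≤ expR (c2 / 2 * n * (2 * ε)) := Real.one_le_exp (by positivity)
  set f : ℂ → ℂ := fun y => Cau ν E (Zl c0 u b (yl lam y)) * yl ((lam - 1) / 2) y * exp ((c2 / 2 * n : ℝ) * (y + y ^ 2)) with hf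
  have hfn : ∀ y : ℂ, 0 < y.re → ‖f y‖ = ‖Cau ν E (Zl c0 u b (yl lam y))‖ * ‖y‖ ^ ((lam - 1) / 2) * expR (c2 / 2 * n * (y + y ^ 2).re) := by
    intro y hy
    rw [hf, norm_mul, norm_mul, yl_norm (by rintro rfl; simp at hy), norm_exp, re_ofReal_mul]
  have hq : ∀ y : ℂ, ε ≤ y.re → ‖y‖ ≤ 1 → ‖Cau ν E (Zl c0 u b (yl lam y))‖ * ‖y‖ ^ ((lam - 1) / 2) ≤ nrm ν E * √(D.A / c) * (√ε)⁻¹ := by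
    intro y hy hyn
    have hy0 : 0 < y.re := hε.trans_le hy
    have hyp : 0 < ‖y‖ := hy0.trans_le (re_le_norm _)
    have h1 := D.cau_norm hE.mem (z := Zl c0 u b (yl lam y)) (d := c * (‖y‖ ^ (lam - 1) * y.re)) (by positivity) fun t ht => hcd y hy0 hyn t (frontier_subset_closure ht)
    have e : ‖y‖ ^ ((lam - 1) / 2) = √(‖y‖ ^ (lam - 1)) := by
      rw [Real.sqrt_eq_rpow, ← Real.rpow_mul hyp.le]; congr 1; ring
    rw [e]
    refine (mul_le_mul_of_nonneg_right h1 (Real.sqrt_nonneg _)).trans ?_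
    rw [mul_assoc, mul_assoc, ← Real.sqrt_mul (div_nonneg D.A_nonneg (by positivity)), ← Real.sqrt_inv, ← Real.sqrt_mul (div_nonneg D.A_nonneg hc.le)]
    refine mul_le_mul_of_nonneg_left (Real.sqrt_le_sqrt ?_) hN
    have : D.A / (c * (‖y‖ ^ (lam - 1) * y.re)) * ‖y‖ ^ (lam - 1) = D.A / c * (y.re)⁻¹ := by field_simp
    rw [this]
    exact mul_le_mul_of_nonneg_left (inv_anti₀ hε hy) (div_nonneg D.A_nonneg hc.le)
  have hd : ∀ y : ℂ, 0 < y.re → DifferentiableAt ℂ f y := by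
    intro y hy
    have := D.ν_fin
    have h1 : DifferentiableAt ℂ (fun y => Cau ν E (Zl c0 u b (yl lam y))) y :=
      DifferentiableAt.comp (g := Cau ν E) (f := fun y => Zl c0 u b (yl lam y)) y (D.cau_diff (hE.mem.integrable (by norm_num)) fun h => (H.sec _ (H.yl_sec hy).1).1 (frontier_subset_closure h)).differentiableAt
        ((H.zl_diff (H.yl_sec hy).1).comp y (yl_diff hy))
    exact (h1.mul (yl_diff hy)).mul (by fun_prop)
  set Ω : Set ℂ := {y | ε < y.re} ∩ ball 0 1 with hΩ
  have hcl : closure Ω ⊆ {y | ε ≤ y.re} ∩ closedBall 0 1 := by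
    refine closure_minimal (fun y hy => ⟨(show ε ≤ y.re from le_of_lt hy.1), ball_subset_closedBall hy.2⟩) ((isClosed_le continuous_const continuous_re).inter isClosed_closedBall)
  have hop : IsOpen Ω := (isOpen_lt continuous_const continuous_re).inter isOpen_ball
  have hdc : DiffContOnCl ℂ f Ω := DifferentiableOn.diffContOnCl fun y hy => (hd y (hε.trans_le (hcl hy).1)).differentiableWithinAt
  rw [← hfn y0 (hε.trans hεy)]
  refine norm_le_of_forall_mem_frontier_norm_le (U := Ω) (isBounded_ball.subset inter_subset_right) hdc ?_ (subset_closure ⟨hεy, by simpa using hy1⟩)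
  intro y hy
  obtain ⟨ha, hb⟩ := hcl hy.1
  rw [mem_closedBall, dist_zero_right] at hb
  have ha : ε ≤ y.re := ha
  have hy0 := hε.trans_le ha
  rw [hfn y hy0]
  have hno : ¬ (ε < y.re ∧ ‖y‖ < 1) := fun h => by
    have := hy.2; rw [hop.interior_eq] at this; exact this ⟨h.1, by simpa using h.2⟩
  have hns : ‖y‖ ^ 2 = y.re ^ 2 + y.im ^ 2 := by rw [← normSq_eq_norm_sq, normSq_apply]; ring
  have hre : (y + y ^ 2).re = y.re + (y.re ^ 2 - y.im ^ 2) := by simp [pow_two]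
  have hcn : 0 ≤ c2 / 2 * n := by positivity
  have hS := hq y ha hb
  by_cases hc3 : ‖y‖ = 1 ∧ 1 / 2 ≤ y.re
  · have h3 := h2 n E hE _ ⟨y, hc3, rfl⟩
    have h4 : expR (c2 / 2 * n * (y + y ^ 2).re) ≤ expR (c2 * n) := by
      refine Real.exp_le_exp.2 ?_
      have : (y + y ^ 2).re ≤ 2 := by
        rw [hre]; have := re_le_norm y; nlinarith [hc3.1]
      nlinarith
    rw [hc3.1, Real.one_rpow, mul_one]
    calc _ ≤ (C2 * nrm ν E * expR (-(c2 * n))) * expR (c2 * n) := by gcongr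
      _ = C2 * nrm ν E := by rw [mul_assoc, ← Real.exp_add]; simp
      _ ≤ (√(D.A / c) + C2) * nrm ν E := by nlinarith [mul_nonneg hA hN]
      _ ≤ (√(D.A / c) + C2) * nrm ν E * (√ε)⁻¹ := le_mul_of_one_le_right (by positivity) hse
      _ ≤ _ := le_mul_of_one_le_right (by positivity) hex
  · have h5 : (y + y ^ 2).re ≤ 2 * ε := by
      rw [hre]
      rcases eq_or_lt_of_le ha with h | h
      · rw [← h]; nlinarith [sq_nonneg y.im]
      · have h6 : ‖y‖ = 1 := le_antisymm hb (not_lt.1 fun h' => hno ⟨h, h'⟩)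
        have h7 : y.re < 1 / 2 := not_le.1 fun h' => hc3 ⟨h6, h'⟩
        rw [h6] at hns; nlinarith
    calc _ ≤ (nrm ν E * √(D.A / c) * (√ε)⁻¹) * expR (c2 / 2 * n * (2 * ε)) := by gcongr
      _ ≤ _ := by
        refine mul_le_mul_of_nonneg_right (mul_le_mul_of_nonneg_right ?_ (by positivity)) (by positivity)
        nlinarith [mul_nonneg hC2.le hN]
lemma cor_dec (D : Dat G ν lam F) (H : Cor (closure G) lam c0 u b) {δ : ℝ} (hδ : 0 < δ) : ∃ C > 0, ∃ c > 0, ∃ r0 > 0, ∀ n E, Ort ν n E →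
    ∀ w : ℂ, w ≠ 0 → ‖w‖ ≤ r0 → |arg w| ≤ lam * π / 2 - δ →
    ‖Cau ν E (Zl c0 u b w)‖ ≤ C * nrm ν E * ‖w‖ ^ mhR * expR (-(c * n * ‖w‖ ^ (1 / lam))) := by
  have hl := H.l0
  have hπ := Real.pi_pos
  obtain ⟨C, hC, c, hc, h⟩ := cor_max D H
  set s := sinR (min (δ / lam) (π / 2)) with hs
  have hm : 0 < min (δ / lam) (π / 2) := lt_min (by positivity) (by positivity)
  have hs0 : 0 < s := Real.sin_pos_of_pos_of_lt_pi hm ((min_le_right _ _).trans_lt (by linarith))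
  have hs1 : s ≤ 1 := Real.sin_le_one _
  refine ⟨C * (√(s / 8))⁻¹, by positivity, c * (s / 4), by positivity, (s / 2) ^ lam, by positivity, fun n E hE w hw hwr ha => ?_⟩
  have ha2 : |lam⁻¹ * arg w| ≤ π / 2 - δ / lam := by
    rw [abs_mul, abs_of_pos (inv_pos.2 hl), inv_mul_le_iff₀ hl]
    rw [mul_sub, mul_div_cancel₀ _ hl.ne', ← mul_div_assoc]; exact ha
  have hdl : 0 < δ / lam := by positivity
  have hδ2 : δ / lam ≤ π / 2 := by linarith [abs_nonneg (lam⁻¹ * arg w)]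
  rw [min_eq_left hδ2] at hs
  set y := yl lam⁻¹ w with hy
  have hya : arg y = lam⁻¹ * arg w := yl_arg (ha2.trans_lt (by linarith))
  have hyw : yl lam y = w := yl_yl hl.ne' hw (ha2.trans_lt (by linarith))
  have hyn : ‖y‖ = ‖w‖ ^ (1 / lam) := by rw [hy, yl_norm hw, one_div]
  have hyp : 0 < ‖y‖ := by rw [hyn]; positivity
  have hwn : ‖y‖ ^ lam = ‖w‖ := by rw [← yl_norm (norm_pos_iff.1 hyp), hyw]
  have hyr : ‖y‖ ≤ s / 2 := by
    rw [← hwn] at hwr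
    exact (Real.rpow_le_rpow_iff hyp.le (by positivity) hl).1 hwr
  have hre : s * ‖y‖ ≤ y.re := by
    rw [← norm_mul_cos_arg y, ← Real.cos_abs (arg y), mul_comm, hs, ← Real.cos_pi_div_two_sub, hya]
    exact mul_le_mul_of_nonneg_left (Real.cos_le_cos_of_nonneg_of_le_pi (abs_nonneg _) (by linarith) ha2) hyp.le
  have hrp : 0 < y.re := by nlinarith
  have hre2 : y.re / 2 ≤ (y + y ^ 2).re := by
    have h1 : -‖y‖ ^ 2 ≤ (y ^ 2).re := by
      rw [← norm_pow]; exact neg_le_of_abs_le (abs_re_le_norm _)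
    rw [add_re]; nlinarith
  have h1 := h n E hE y (by linarith) (s * ‖y‖ / 8) (by positivity) (by nlinarith)
  rw [hyw] at h1
  have e1 : ‖w‖ ^ mhR = (Real.sqrt ‖y‖)⁻¹ * (‖y‖ ^ ((lam - 1) / 2))⁻¹ := by
    rw [← hwn, Real.sqrt_eq_rpow, ← Real.rpow_neg hyp.le, ← Real.rpow_neg hyp.le, ← Real.rpow_add hyp, ← Real.rpow_mul hyp.le]
    congr 1; ring
  have hp : 0 < ‖y‖ ^ ((lam - 1) / 2) := Real.rpow_pos_of_pos hyp _
  rw [e1, ← hyn]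
  have h2 : expR (c * n * (2 * (s * ‖y‖ / 8))) = expR (-(c * (s / 4) * n * ‖y‖)) * expR (c * n * (s * ‖y‖ / 2)) := by
    rw [← Real.exp_add]; congr 1; ring
  have h3 : expR (c * n * (s * ‖y‖ / 2)) ≤ expR (c * n * (y + y ^ 2).re) := by
    refine Real.exp_le_exp.2 (mul_le_mul_of_nonneg_left (by linarith) (by positivity))
  have h4 := (mul_le_mul_of_nonneg_left h3 (by positivity)).trans h1
  rw [h2, ← mul_assoc] at h4
  have h5 := le_of_mul_le_mul_right h4 (Real.exp_pos _)
  rw [← le_div_iff₀ hp] at h5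
  refine h5.trans (le_of_eq ?_)
  have e3 : √(s * ‖y‖ / 8) = √(s / 8) * Real.sqrt ‖y‖ := by
    rw [← Real.sqrt_mul (by positivity)]; congr 1; ring
  rw [e3, mul_inv]; ring
end Dat
namespace Dat
variable (D : Dat G ν lam F) (j : Fin D.m) {φ : ℕ → Polynomial ℂ} {ζ : ℂ} {k : ℂ → ℂ}
lemma half_dec (hl0 : 0 < lam) (hl2 : lam < 2) (j : Fin D.m) {e : ℝ} (he : e = 0 ∨ e = 1) : ∃ C > 0, ∃ c > 0, ∀ n E, Ort ν n E →
    ∀ x ∈ Ioc (0:ℝ) (1/2), ‖Cau ν E (D.bb j |e - x|)‖ ≤ C * nrm ν E * x ^ mhR * expR (-(c * n * x ^ (1 / lam))) := by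
  obtain ⟨u, b, hu, hb, hs, hp, hpa, δ, c1, C1, x1, hδ, hc1, hC1, hx1, hx1', h⟩ := D.corner j e he
  have H : Cor (closure G) lam (D.τ j e) u b := ⟨hl0, hl2, D.G_bdd.closure, hu, hb, hs, hp, hpa⟩
  obtain ⟨C2, hC2, c2, hc2, r0, hr0, h2⟩ := cor_dec D H hδ
  set x2 := min (x1 / 2) (r0 / C1)
  have hx2 : 0 < x2 := lt_min (by positivity) (by positivity)
  have hmem : ∀ x ∈ Icc x2 (1/2), |e - x| ∈ IoU := by
    intro x hx
    have := hx.1; have := hx.2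
    rcases he with rfl | rfl
    · rw [zero_sub, abs_neg, abs_of_pos (by linarith)]; constructor <;> linarith
    · rw [abs_of_pos (by linarith)]; constructor <;> linarith
  obtain ⟨C3, hC3, c3, hc3, h3⟩ := D.dec_cpt (K := (fun x => D.bb j |e - x|) '' Icc x2 (1/2))
    (isCompact_Icc.image_of_continuousOn ((D.bb_cont j).comp (by fun_prop) fun x hx => Ioo_subset_Icc_self (hmem x hx))) (by
    rintro _ ⟨x, hx, rfl⟩
    exact ⟨D.lo_mem j (hmem x hx), D.ext j _ (pth_mem (by rw [etan']) (Ioo_subset_Icc_self (hmem x hx))) (D.pth_lo (hmem x hx))⟩)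
  refine ⟨C2 * c1 ^ mhR + C3, by positivity, min (c2 * c1 ^ (1 / lam)) c3, lt_min (by positivity) hc3, fun n E hE x hx => ?_⟩
  have hx0 := hx.1
  have hN := nrm_nonneg ν E
  rcases lt_or_ge x x2 with hlt | hge
  · obtain ⟨w, hw1, hw2, hw3, hw4⟩ := h x ⟨hx0, hlt.trans_le ((min_le_left _ _).trans (by linarith))⟩
    have hwp : 0 < ‖w‖ := lt_of_lt_of_le (by positivity) hw1
    have h4 := h2 n E hE w (norm_pos_iff.1 hwp) (hw2.trans (by
      have := hlt.le.trans (min_le_right _ _); rw [le_div_iff₀ hC1] at this; linarith)) hw3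
    rw [hw4] at h4
    refine h4.trans ?_
    have h5 : ‖w‖ ^ mhR ≤ c1 ^ mhR * x ^ mhR := by
      rw [← Real.mul_rpow hc1.le hx0.le]
      exact Real.rpow_le_rpow_of_nonpos (by positivity) hw1 (by norm_num)
    have h6 : c1 ^ (1 / lam) * x ^ (1 / lam) ≤ ‖w‖ ^ (1 / lam) := by
      rw [← Real.mul_rpow hc1.le hx0.le]
      exact Real.rpow_le_rpow (by positivity) hw1 (by positivity)
    have h7 : min (c2 * c1 ^ (1 / lam)) c3 * n * x ^ (1 / lam) ≤ c2 * n * ‖w‖ ^ (1 / lam) := by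
      calc _ ≤ (c2 * c1 ^ (1 / lam)) * n * x ^ (1 / lam) := by gcongr; exact min_le_left _ _
        _ = c2 * n * (c1 ^ (1 / lam) * x ^ (1 / lam)) := by ring
        _ ≤ _ := by gcongr
    refine mul_le_mul ?_ (Real.exp_le_exp.2 (neg_le_neg h7)) (Real.exp_pos _).le (by positivity)
    calc _ ≤ C2 * nrm ν E * (c1 ^ mhR * x ^ mhR) := by gcongr
      _ = (C2 * c1 ^ mhR) * nrm ν E * x ^ mhR := by ring
      _ ≤ _ := by gcongr; linarith
  · have h4 := h3 n E hE _ ⟨x, ⟨hge, hx.2⟩, rfl⟩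
    refine h4.trans ?_
    have h5 : 1 ≤ x ^ mhR := Real.one_le_rpow_of_pos_of_le_one_of_nonpos hx0 (by linarith [hx.2]) (by norm_num)
    have h6 : x ^ (1 / lam) ≤ 1 := Real.rpow_le_one hx0.le (by linarith [hx.2]) (by positivity)
    refine mul_le_mul ?_ (Real.exp_le_exp.2 (neg_le_neg ?_)) (Real.exp_pos _).le (by positivity)
    · refine le_trans ?_ (le_mul_of_one_le_right (by positivity) h5)
      gcongr
      have : 0 < C2 * c1 ^ mhR := by positivity
      linarith
    · calc _ ≤ c3 * n * 1 := by gcongr; exact min_le_right _ _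
        _ = _ := mul_one _
lemma model {p lam c : ℝ} (hl0 : 0 < lam) (hp : -1 < p) (hc : 0 < c) : ∃ K > 0, ∀ n : ℕ, 0 < n →
    IntegrableOn (fun x : ℝ => x ^ p * expR (-(c * n * x ^ (1 / lam)))) (Ioi 0) ∧
    ∫ x in Ioi (0:ℝ), x ^ p * expR (-(c * n * x ^ (1 / lam))) = K * (n : ℝ) ^ (-(lam * (p + 1))) := by
  have hpl : 0 < (p + 1) / (1 / lam) := by have : 0 < p + 1 := by linarith
                                           positivity
  refine ⟨c ^ (-(lam * (p + 1))) * (1 / (1 / lam)) * Real.Gamma ((p + 1) / (1 / lam)), by positivity, fun n hn => ?_⟩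
  have hn' : (0:ℝ) < n := by exact_mod_cast hn
  have h := integral_rpow_mul_exp_neg_mul_rpow (p := 1 / lam) (q := p) (b := c * n) (by positivity) hp (by positivity)
  have e : ∀ x : ℝ, -(c * n) * x ^ (1 / lam) = -(c * n * x ^ (1 / lam)) := fun x => by ring
  simp only [e] at h
  have h2 : ∫ x in Ioi (0:ℝ), x ^ p * expR (-(c * n * x ^ (1 / lam))) = c ^ (-(lam * (p + 1))) * (1 / (1 / lam)) * Real.Gamma ((p + 1) / (1 / lam)) * (n : ℝ) ^ (-(lam * (p + 1))) := by
    rw [h, Real.mul_rpow hc.le hn'.le]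
    have : -((p + 1) / (1 / lam)) = -(lam * (p + 1)) := by field_simp
    rw [← neg_div] at this
    first | rw [this] | rw [← neg_div, this]
    ring
  refine ⟨?_, h2⟩
  by_contra hni
  rw [integral_undef hni] at h2
  have : 0 < c ^ (-(lam * (p + 1))) * (1 / (1 / lam)) * Real.Gamma ((p + 1) / (1 / lam)) * (n : ℝ) ^ (-(lam * (p + 1))) := by positivity
  linarith
lemma prod_le {p : ℝ} (hx : 0 < x) (hx2 : x ≤ 1 / 2) : qd(x) ^ p ≤ 2 ^ |p| * x ^ p := by
  rw [Real.mul_rpow hx.le (by linarith), mul_comm]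
  refine mul_le_mul_of_nonneg_right ?_ (Real.rpow_pos_of_pos hx _).le
  rcases le_total 0 p with h | h
  · exact (Real.rpow_le_one (by linarith) (by linarith) h).trans (Real.one_le_rpow (by norm_num) (abs_nonneg _))
  · rw [abs_of_nonpos h, Real.rpow_neg (by norm_num), ← Real.inv_rpow (by norm_num)]
    exact Real.rpow_le_rpow_of_nonpos (by norm_num) (by linarith) h
lemma piece_rate (hl0 : 0 < lam) (hl2 : lam < 2) (j : Fin D.m) : ∃ C > 0, ∀ φ, ON ν φ → ∀ ζ ∈ F, ∀ k, D.IsK φ ζ k → ∀ n : ℕ, 0 < n → ∀ E, Ort ν n E →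
    ‖∫ x in IqU, D.hh k ζ j x * Cau ν E (D.bb j x)‖ ≤ C * nrm ν E * (n : ℝ) ^ (-(lam / (4 - 2 * lam))) := by
  obtain ⟨C1, hC1, h1⟩ := D.hh_bd hl0 hl2
  obtain ⟨C2, hC2, c2, hc2, h2⟩ := D.half_dec hl0 hl2 j (e := 0) (Or.inl rfl)
  obtain ⟨C3, hC3, c3, hc3, h3⟩ := D.half_dec hl0 hl2 j (e := 1) (Or.inr rfl)
  set p := (1 / (2 - lam)) / 2 - 1 / 2 with hp
  have h2l : 0 < 2 - lam := by linarith
  have hp1 : -1 < p - 1 / 2 := by have : 0 < 1 / (2 - lam) / 2 := by positivity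
                                  linarith
  have he : lam * (p - 1 / 2 + 1) = lam / (4 - 2 * lam) := by
    have : 4 - 2 * lam ≠ 0 := by linarith
    have := h2l.ne'
    rw [hp, show 4 - 2 * lam = 2 * (2 - lam) by ring]; field_simp; ring
  obtain ⟨K2, hK2, hm2⟩ := model hl0 hp1 hc2
  obtain ⟨K3, hK3, hm3⟩ := model hl0 hp1 hc3
  rw [he] at hm2 hm3
  refine ⟨C1 * 2 ^ |p| * (C2 * K2 + C3 * K3), by positivity, fun φ hφ ζ hζ k hk n hn E hE => ?_⟩
  have hN := nrm_nonneg ν E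
  obtain ⟨i2, e2⟩ := hm2 n hn
  obtain ⟨i3, e3⟩ := hm3 n hn
  set B2 : ℝ → ℝ := fun x => x ^ (p - 1 / 2) * expR (-(c2 * n * x ^ (1 / lam))) with hB2
  set B3 : ℝ → ℝ := fun x => x ^ (p - 1 / 2) * expR (-(c3 * n * x ^ (1 / lam))) with hB3
  set M := C1 * 2 ^ |p| * nrm ν E with hM
  have hM0 : 0 ≤ M := by positivity
  have key : ∀ {C c : ℝ}, 0 < C → ∀ {x y : ℝ}, x ∈ Ioc (0:ℝ) (1/2) → ∀ {a q : ℂ}, ‖a‖ ≤ C1 * qd(x) ^ p →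
      ‖q‖ ≤ C * nrm ν E * x ^ mhR * expR (-(c * n * x ^ (1 / lam))) → ‖a * q‖ ≤ M * (C * (x ^ (p - 1 / 2) * expR (-(c * n * x ^ (1 / lam))))) := by
    intro C c hC x y hx a q ha hq
    have hx0 := hx.1
    rw [norm_mul]
    have ha' : ‖a‖ ≤ C1 * (2 ^ |p| * x ^ p) := ha.trans (mul_le_mul_of_nonneg_left (prod_le hx.1 hx.2) hC1.le)
    refine (mul_le_mul ha' hq (norm_nonneg _) (by positivity)).trans (le_of_eq ?_)
    rw [sub_eq_add_neg, Real.rpow_add hx0, hM]; ring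
  have i3' : IntegrableOn (fun x => B3 (1 - x)) (Ioc 0 1) := by
    have : IntervalIntegrable B3 volume 0 1 := (intervalIntegrable_iff_integrableOn_Ioc_of_le zero_le_one).2 (i3.mono_set fun x hx => hx.1)
    have := (this.comp_sub_left 1).symm
    simp only [sub_zero, sub_self] at this
    exact (intervalIntegrable_iff_integrableOn_Ioc_of_le zero_le_one).1 this
  have i2' : IntegrableOn B2 (Ioc 0 1) := i2.mono_set fun x hx => hx.1
  have e3' : ∫ x in IqU, B3 (1 - x) ≤ K3 * (n : ℝ) ^ (-(lam / (4 - 2 * lam))) := by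
    rw [← intervalIntegral.integral_of_le zero_le_one, intervalIntegral.integral_comp_sub_left (fun x => B3 x), sub_self, sub_zero, intervalIntegral.integral_of_le zero_le_one, ← e3]
    refine setIntegral_mono_set i3 ?_ (Ioc_subset_Ioi_self.eventuallyLE)
    filter_upwards [ae_restrict_mem measurableSet_Ioi] with x hx
    have : (0:ℝ) < x := hx
    simp only [hB3, Pi.zero_apply]; positivity
  have e2' : ∫ x in IqU, B2 x ≤ K2 * (n : ℝ) ^ (-(lam / (4 - 2 * lam))) := by
    rw [← e2]
    refine setIntegral_mono_set i2 ?_ (Ioc_subset_Ioi_self.eventuallyLE)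
    filter_upwards [ae_restrict_mem measurableSet_Ioi] with x hx
    have : (0:ℝ) < x := hx
    simp only [hB2, Pi.zero_apply]; positivity
  have ib : IntegrableOn (fun x => M * (C2 * B2 x + C3 * B3 (1 - x))) (Ioc 0 1) := ((i2'.const_mul C2).add (i3'.const_mul C3)).const_mul M
  refine (norm_integral_le_of_norm_le ib ?_).trans ?_
  · filter_upwards [ae_Ioo] with x hx
    have hx0 := hx.1; have hx1 : 0 < 1 - x := by linarith [hx.2]
    have b2 : 0 ≤ B2 x := by simp only [hB2]; positivity
    have b3 : 0 ≤ B3 (1 - x) := by simp only [hB3]; positivity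
    have ha := h1 φ hφ ζ hζ k hk j x hx
    rcases le_total x (1/2) with hc | hc
    · have := key hC2 (y := 0) ⟨hx0, hc⟩ ha (by
        have := h2 n E hE x ⟨hx0, hc⟩
        rwa [zero_sub, abs_neg, abs_of_pos hx0] at this)
      refine this.trans (mul_le_mul_of_nonneg_left ?_ hM0)
      have := mul_nonneg hC3.le b3
      linarith
    · have := key hC3 (y := 0) (x := 1 - x) ⟨hx1, by linarith⟩ (by rwa [sub_sub_cancel, mul_comm (1 - x)]) (by
        have := h3 n E hE (1 - x) ⟨hx1, by linarith⟩
        rwa [sub_sub_cancel, abs_of_pos hx0] at this)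
      refine this.trans (mul_le_mul_of_nonneg_left ?_ hM0)
      have := mul_nonneg hC2.le b2
      linarith
  · rw [integral_const_mul, integral_add (i2'.const_mul C2) (i3'.const_mul C3), integral_const_mul, integral_const_mul]
    calc _ ≤ M * (C2 * (K2 * (n : ℝ) ^ (-(lam / (4 - 2 * lam)))) + C3 * (K3 * (n : ℝ) ^ (-(lam / (4 - 2 * lam))))) := by gcongr
      _ = _ := by rw [hM]; ring
theorem rate (hl0 : 0 < lam) (hl2 : lam < 2) : ∃ C > 0, ∀ φ, ON ν φ → ∀ ζ ∈ F, ∀ k, D.IsK φ ζ k → ∀ n : ℕ, 0 < n →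
    nrm ν (fun t => k t - (SN φ ζ n).eval t) ≤ C * (n : ℝ) ^ (-(lam / (4 - 2 * lam))) := by
  choose C hC h using D.piece_rate hl0 hl2
  refine ⟨∑ j, C j + 1, add_pos_of_nonneg_of_pos (Finset.sum_nonneg fun j _ => (hC j).le) one_pos, fun φ hφ ζ hζ k hk n hn => ?_⟩
  set e : ℂ → ℂ := fun t => k t - (SN φ ζ n).eval t with he
  have hem : MemLp e 2 ν := hk.mem.sub (D.pL _)
  have hE : Ort ν n (fun t => cj (e t)) := ⟨memLp_conj hem, fun P hP => D.err_orth hφ hk hP⟩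
  have h1 := D.err_sq hφ hk n
  have h2 : ∫ t, k t * cj (e t) ∂ν = ∫ t, cj (e t) * D.RR k ζ t ∂ν := by
    refine integral_congr_ae ?_
    filter_upwards [D.K_ae hl0 hl2 hφ hk hζ] with t ht
    rw [mul_comm]; congr 1
  rw [h2, (D.RR_fub hl0 hl2 hφ hk hζ hE.mem).2] at h1
  have hnr : 0 < (n : ℝ) ^ (-(lam / (4 - 2 * lam))) := Real.rpow_pos_of_pos (by exact_mod_cast hn) _
  have h3 := congrArg norm h1
  rw [norm_real, Real.norm_eq_abs, abs_of_nonneg (by positivity), norm_neg] at h3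
  have h4 : nrm ν e ^ 2 ≤ (∑ j, C j) * nrm ν e * (n : ℝ) ^ (-(lam / (4 - 2 * lam))) := by
    rw [h3, Finset.sum_mul, Finset.sum_mul]
    refine (norm_sum_le _ _).trans (Finset.sum_le_sum fun j _ => ?_)
    have := h j φ hφ ζ hζ k hk n hn _ hE
    rwa [nrm_conj] at this
  rcases (nrm_nonneg ν e).eq_or_lt with h0 | h0
  · rw [← h0]
    have : 0 ≤ ∑ j, C j := Finset.sum_nonneg fun j _ => (hC j).le
    positivity
  · have h5 : nrm ν e ≤ (∑ j, C j) * (n : ℝ) ^ (-(lam / (4 - 2 * lam))) := by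
      refine le_of_mul_le_mul_right ?_ h0
      calc _ = nrm ν e ^ 2 := by ring
        _ ≤ _ := h4
        _ = _ := by ring
    linarith
end Dat
def nuJ (J : JordanDomain) : Measure ℂ := Measure.map J.γ (volume.restrict (Ioc 0 J.l))
theorem transfer (J : JordanDomain) {lam : ℝ} (hl0 : 0 < lam) (hl2 : lam < 2) (p : ℕ → Polynomial ℂ) (hp : J.IsONPolys p)
    {F : Set ℂ} (D : Dat J.G (nuJ J) lam F) (Kb : ℂ → ℝ → ℂ)
    (hKb : ∀ ζ ∈ F, ∀ᵐ s ∂(volume.restrict (Ioc (0 : ℝ) J.l)), NTLim J.G (szegoKernel p ζ) (J.γ s) (Kb ζ s)) :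
    ∃ C : ℝ, 0 < C ∧ ∀ ζ ∈ F, ∀ n : ℕ, 0 < n →
      J.bnorm (fun s => Kb ζ s - partialSum p ζ n (J.γ s)) ≤ C * (n : ℝ) ^ (-(lam / (4 - 2 * lam))) := by
  have hl := J.l_pos
  have hlc : (J.l : ℂ) ≠ 0 := by exact_mod_cast hl.ne'
  obtain ⟨C, hC, h⟩ := D.rate hl0 hl2
  have hγm : AEMeasurable J.γ (volume.restrict (Ioc 0 J.l)) := J.γ_cont.measurable.aemeasurable
  set r : ℂ := (((√J.l)⁻¹ : ℝ) : ℂ) with hr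
  have hr0 : r ≠ 0 := by rw [hr]; exact_mod_cast (inv_pos.2 (Real.sqrt_pos.2 hl)).ne'
  have hrr : r * r = (J.l : ℂ)⁻¹ := by
    rw [hr, ← ofReal_mul, ← mul_inv, Real.mul_self_sqrt hl.le, ofReal_inv]
  have hrc : cj r = r := conj_ofReal _
  set φ : ℕ → Polynomial ℂ := fun k => Polynomial.C r * p k with hφd
  have hev : ∀ k z, (φ k).eval z = r * (p k).eval z := fun k z => by simp [hφd]
  have hcc : ∀ k ζ z, cj ((φ k).eval ζ) * (φ k).eval z = (J.l : ℂ)⁻¹ * (cj ((p k).eval ζ) * (p k).eval z) := by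
    intro k ζ z
    rw [hev, hev, map_mul, hrc, ← hrr]; ring
  have hφ : ON (nuJ J) φ := by
    constructor
    · intro k; rw [hφd]; simp only; rw [Polynomial.natDegree_C_mul hr0]; exact hp.1 k
    · intro i j
      rw [nuJ, integral_map hγm (by
        have := ((φ i).continuous.mul (continuous_conj.comp (φ j).continuous)); exact this.aestronglyMeasurable)]
      have e := hp.2.2 i j
      rw [intervalIntegral.integral_of_le hl.le] at e
      rw [← e, ← integral_const_mul]
      refine integral_congr_ae (Eventually.of_forall fun s => ?_)
      simp only
      rw [hev, hev, map_mul, hrc, one_div, ← hrr]; ring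
  refine ⟨√J.l * C, by positivity, fun ζ hζ n hn => ?_⟩
  obtain ⟨k, hk⟩ := D.exists_K hφ (D.F_sub hζ)
  have h1 := h φ hφ ζ hζ k hk n hn
  have h2 := ae_of_ae_map hγm (D.nt_ae hl0 hl2 hφ hk hζ)
  have h3 : ∀ᵐ s ∂(volume.restrict (Ioc (0 : ℝ) J.l)), Kb ζ s = J.l * k (J.γ s) := by
    filter_upwards [h2, hKb ζ hζ] with s hs hs2
    refine hs (szegoKernel p ζ) (Kb ζ s) J.l (fun z hz => ?_) hs2
    simp only [hcc]
    rw [tsum_mul_left, mul_inv_cancel_left₀ hlc]; rfl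
  have hps : ∀ t, partialSum p ζ n t = J.l * (SN φ ζ n).eval t := by
    intro t
    rw [SN_eval]; simp only [hcc]
    rw [← Finset.mul_sum, mul_inv_cancel_left₀ hlc]; rfl
  have h4 : ∫ s in (0:ℝ)..J.l, ‖Kb ζ s - partialSum p ζ n (J.γ s)‖ ^ 2 = J.l ^ 2 * ∫ t, ‖k t - (SN φ ζ n).eval t‖ ^ 2 ∂(nuJ J) := by
    rw [intervalIntegral.integral_of_le hl.le, nuJ, integral_map hγm (by
      exact (((hk.mem.sub (D.pL _)).aestronglyMeasurable).norm.pow 2)), ← integral_const_mul]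
    refine integral_congr_ae ?_
    filter_upwards [h3] with s hs
    rw [hs, hps, ← mul_sub, norm_mul, mul_pow, norm_real, Real.norm_eq_abs, sq_abs]
  unfold JordanDomain.bnorm
  rw [h4]
  have e5 : 1 / J.l * (J.l ^ 2 * ∫ t, ‖k t - (SN φ ζ n).eval t‖ ^ 2 ∂(nuJ J)) = J.l * ∫ t, ‖k t - (SN φ ζ n).eval t‖ ^ 2 ∂(nuJ J) := by
    field_simp
  rw [e5, Real.sqrt_mul hl.le, mul_assoc]
  exact mul_le_mul_of_nonneg_left h1 (Real.sqrt_nonneg _)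
lemma deriv_ne {U : Set ℂ} (hU : IsOpen U) (hf : DifferentiableOn ℂ f U) (hi : InjOn f U)
    {z0 : ℂ} (h0 : z0 ∈ U) : deriv f z0 ≠ 0 := by
  intro hd
  have hUn := hU.mem_nhds h0
  have ha : AnalyticAt ℂ f z0 := hf.analyticAt hUn
  obtain ⟨n, g, hg, hg0, hfg⟩ := (ha.sub (analyticAt_const (v := f z0))).exists_eventuallyEq_pow_smul_nonzero_iff.2 (by
    intro hc
    have h1 : ∀ᶠ z in 𝓝 z0, z = z0 := by
      filter_upwards [hc, hUn] with z hz hzU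
      exact hi hzU h0 (sub_eq_zero.1 hz)
    have : ({z0}ᶜ : Set ℂ) ∩ {z | z = z0} ∈ 𝓝[≠] z0 := inter_mem self_mem_nhdsWithin (nhdsWithin_le_nhds h1)
    obtain ⟨z, h2, h3⟩ := Filter.nonempty_of_mem this
    exact h2 h3)
  have hn0 : n ≠ 0 := by
    rintro rfl
    have := hfg.self_of_nhds
    simp at this
    exact hg0 this.symm
  have hn1 : n ≠ 1 := by
    rintro rfl
    have h1 : HasDerivAt (fun z => f z0 + (z - z0) ^ 1 • g z) (g z0) z0 := by
      have := ((hasDerivAt_id z0).sub_const z0).mul hg.differentiableAt.hasDerivAt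
      simpa using this.const_add (f z0)
    have h2 : deriv f z0 = g z0 := by
      refine (h1.congr_of_eventuallyEq ?_).deriv
      filter_upwards [hfg] with z hz
      rw [← hz]; simp
    exact hg0 (h2 ▸ hd)
  have hgc : HasStrictDerivAt (fun z => (z - z0) * (g z / g z0) ^ ((n : ℂ)⁻¹)) 1 z0 := by
    have h1 : AnalyticAt ℂ (fun z => (z - z0) * (g z / g z0) ^ ((n : ℂ)⁻¹)) z0 := by
      refine (analyticAt_id.sub analyticAt_const).mul ?_
      refine (hg.div analyticAt_const hg0).cpow analyticAt_const ?_
      simp [hg0]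
    have h2 := h1.hasStrictDerivAt
    have h3 : HasDerivAt (fun z => (z - z0) * (g z / g z0) ^ ((n : ℂ)⁻¹)) 1 z0 := by
      have h4 : AnalyticAt ℂ (fun z => (g z / g z0) ^ ((n : ℂ)⁻¹)) z0 :=
        (hg.div analyticAt_const hg0).cpow analyticAt_const (by simp [hg0])
      have := ((hasDerivAt_id z0).sub_const z0).mul h4.differentiableAt.hasDerivAt
      refine this.congr_deriv ?_
      simp [hg0]
    rwa [h3.deriv] at h2
  have hm := hgc.map_nhds_eq one_ne_zero
  simp only [sub_self, zero_mul] at hm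
  set k : ℂ → ℂ := fun z => (z - z0) * (g z / g z0) ^ ((n : ℂ)⁻¹) with hk
  have hev : ∀ᶠ z in 𝓝 z0, z ∈ U ∧ f z = f z0 + g z0 * k z ^ n := by
    filter_upwards [hfg, hUn] with z hz hzU
    refine ⟨hzU, ?_⟩
    rw [hk]
    simp only [mul_pow]
    rw [cpow_nat_inv_pow _ hn0, mul_left_comm, mul_div_cancel₀ _ hg0, ← smul_eq_mul, ← hz]; simp
  have hw : ∀ᶠ w in 𝓝 (0:ℂ), ∃ z ∈ U, k z = w ∧ f z = f z0 + g z0 * w ^ n := by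
    rw [← hm, eventually_map]
    filter_upwards [hev] with z hz
    exact ⟨z, hz.1, rfl, hz.2⟩
  obtain ⟨ζ, hζ⟩ : ∃ ζ : ℂ, IsPrimitiveRoot ζ n := ⟨_, Complex.isPrimitiveRoot_exp n hn0⟩
  have hw2 : ∀ᶠ w in 𝓝 (0:ℂ), ∃ z ∈ U, k z = ζ * w ∧ f z = f z0 + g z0 * (ζ * w) ^ n := by
    have : Tendsto (fun w : ℂ => ζ * w) (𝓝 0) (𝓝 0) := by
      have := (continuous_const_mul ζ).tendsto 0
      rwa [mul_zero] at this
    exact this.eventually hw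
  obtain ⟨w, ⟨⟨z, hz, hz1, hz2⟩, ⟨z', hz', hz1', hz2'⟩⟩, hw0⟩ :=
    (((hw.and hw2).filter_mono (nhdsWithin_le_nhds (s := {(0:ℂ)}ᶜ))).and self_mem_nhdsWithin).exists
  have : z = z' := hi hz hz' (by rw [hz2, hz2', mul_pow, hζ.pow_eq_one, one_mul])
  rw [← this, hz1] at hz1'
  have h1 : ζ = 1 := by
    have := mul_right_cancel₀ hw0 (show (1:ℂ) * w = ζ * w by rw [one_mul]; exact hz1')
    exact this.symm
  exact hn1 (hζ.eq_orderOf.trans (by rw [h1, orderOf_one]))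
lemma bil_nhd {U K : Set ℂ} (hU : IsOpen U) (hf : DifferentiableOn ℂ f U) (hi : InjOn f U)
    (hK : IsCompact K) (hKU : K ⊆ U) : ∃ c : ℝ, 0 < c ∧ ∃ V, IsOpen V ∧ K ⊆ V ∧ V ⊆ U ∧
      ∀ z ∈ V, ∀ w ∈ V, c * ‖z - w‖ ≤ ‖f z - f w‖ := by
  have key : ∃ c : ℝ, 0 < c ∧ ∀ᶠ x : ℂ × ℂ in 𝓝ˢ (K ×ˢ K), c * ‖x.1 - x.2‖ ≤ ‖f x.1 - f x.2‖ := by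
    refine (hK.prod hK).induction_on (p := fun s => ∃ c : ℝ, 0 < c ∧ ∀ᶠ x : ℂ × ℂ in 𝓝ˢ s, c * ‖x.1 - x.2‖ ≤ ‖f x.1 - f x.2‖)
      ⟨1, one_pos, by simp⟩ (fun s t hst ⟨c, h, h'⟩ => ⟨c, h, h'.filter_mono (nhdsSet_mono hst)⟩) ?_ ?_
    · rintro s t ⟨c, hc, h⟩ ⟨d, hd, h'⟩
      refine ⟨min c d, lt_min hc hd, ?_⟩
      rw [nhdsSet_union]
      refine eventually_sup.2 ⟨h.mono fun x hx => ?_, h'.mono fun x hx => ?_⟩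
      · exact (mul_le_mul_of_nonneg_right (min_le_left _ _) (norm_nonneg _)).trans hx
      · exact (mul_le_mul_of_nonneg_right (min_le_right _ _) (norm_nonneg _)).trans hx
    · rintro ⟨a, b⟩ ⟨ha, hb⟩
      suffices h : ∃ c : ℝ, 0 < c ∧ ∀ᶠ x : ℂ × ℂ in 𝓝 (a, b), c * ‖x.1 - x.2‖ ≤ ‖f x.1 - f x.2‖ by
        obtain ⟨c, hc, h⟩ := h
        refine ⟨{x | ∀ᶠ y : ℂ × ℂ in 𝓝 x, c * ‖y.1 - y.2‖ ≤ ‖f y.1 - f y.2‖}, nhdsWithin_le_nhds h.eventually_nhds, c, hc, ?_⟩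
        rw [eventually_nhdsSet_iff_forall]
        exact fun x hx => hx
      simp only at ha hb
      have da := hf.differentiableAt (hU.mem_nhds (hKU ha))
      have db := hf.differentiableAt (hU.mem_nhds (hKU hb))
      by_cases hab : a = b
      · subst hab
        have hs := (hf.analyticAt (hU.mem_nhds (hKU ha))).hasStrictDerivAt
        have hne := norm_pos_iff.2 (deriv_ne hU hf hi (hKU ha))
        refine ⟨‖deriv f a‖ / 2, by positivity, ?_⟩
        filter_upwards [hs.isLittleO.bound (half_pos hne)] with x hx
        have h2 : ‖deriv f a‖ * ‖x.1 - x.2‖ = ‖f x.1 - f x.2 - (f x.1 - f x.2 - (x.1 - x.2) * deriv f a)‖ := by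
          rw [sub_sub_cancel, norm_mul, mul_comm]
        have h3 := norm_sub_le (f x.1 - f x.2) (f x.1 - f x.2 - (x.1 - x.2) * deriv f a)
        have h4 : ‖f x.1 - f x.2 - (x.1 - x.2) * deriv f a‖ ≤ ‖deriv f a‖ / 2 * ‖x.1 - x.2‖ := by simpa using hx
        linarith
      · have hne : 0 < ‖f a - f b‖ := norm_pos_iff.2 (sub_ne_zero.2 fun h => hab (hi (hKU ha) (hKU hb) h))
        have hab' : 0 < ‖a - b‖ := norm_pos_iff.2 (sub_ne_zero.2 hab)
        have c1 : ContinuousAt (fun x : ℂ × ℂ => ‖f a - f b‖ / ‖a - b‖ / 2 * ‖x.1 - x.2‖) (a, b) := by fun_prop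
        have c2 : ContinuousAt (fun x : ℂ × ℂ => ‖f x.1 - f x.2‖) (a, b) :=
          ((ContinuousAt.comp (f := Prod.fst) da.continuousAt continuousAt_fst).sub
            (ContinuousAt.comp (f := Prod.snd) db.continuousAt continuousAt_snd)).norm
        refine ⟨_, by positivity, (c1.eventually_lt c2 ?_).mono fun x hx => hx.le⟩
        simp only
        field_simp
        linarith
  obtain ⟨c, hc, h⟩ := key
  rw [hK.nhdsSet_prod_eq hK, eventually_prod_self_iff'] at h
  obtain ⟨t, ht, h⟩ := h
  obtain ⟨V, hV, hKV, hVt⟩ := mem_nhdsSet_iff_exists.1 (inter_mem ht (hU.mem_nhdsSet.2 hKU))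
  exact ⟨c, hc, V, hV, hKV, fun z hz => (hVt hz).2, fun z hz w hw => h z (hVt hz).1 w (hVt hw).1⟩
def seg : Set ℂ := Complex.ofReal '' IcU
lemma seg_compact : IsCompact seg := isCompact_Icc.image continuous_ofReal
lemma seg_convex : Convex ℝ seg := (convex_Icc (0:ℝ) 1).linear_image ofRealCLM.toLinearMap
lemma mem_seg (h : x ∈ IcU) : (x : ℂ) ∈ seg := ⟨x, h, rfl⟩
lemma quad {N : Set ℂ} (hN : IsOpen N) (hs : seg ⊆ N) (hf : DifferentiableOn ℂ f N) {a : ℂ} (ha : a ∈ seg) :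
    ∃ K : ℝ, 0 < K ∧ ∀ y ∈ seg, ‖f y - f a - deriv f a * (y - a)‖ ≤ K * ‖y - a‖ ^ 2 := by
  have hg : DifferentiableOn ℂ (dslope f a) N := (differentiableOn_dslope (hN.mem_nhds (hs ha))).2 hf
  obtain ⟨K, hK⟩ := seg_compact.exists_bound_of_continuousOn ((hg.deriv hN).continuousOn.mono hs)
  refine ⟨|K| + 1, by positivity, fun y hy => ?_⟩
  have h1 := seg_convex.norm_image_sub_le_of_norm_deriv_le (f := dslope f a) (C := |K| + 1)
    (fun x hx => hg.differentiableAt (hN.mem_nhds (hs hx))) (fun x hx => (hK x hx).trans (by linarith [le_abs_self K])) ha hy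
  have h2 : f y - f a = (y - a) * dslope f a y := by simpa using (sub_smul_dslope f a y).symm
  rw [dslope_same] at h1
  rw [h2, mul_comm (deriv f a), ← mul_sub, norm_mul]
  nlinarith [norm_nonneg (y - a)]
def CSc (q p : ℂ) (E C r : ℝ) : Set ℂ :=
  {z | ∃ ρ θ : ℝ, 0 < ρ ∧ ρ < r ∧ C * ρ < θ ∧ θ < E - C * ρ ∧ z = q + p * (ρ * exp (θ * I))}
lemma CSc_conn (q p : ℂ) (E C r : ℝ) : IsPreconnected (CSc q p E C r) := by
  have hc : Convex ℝ {x : ℝ × ℝ | 0 < x.1 ∧ x.1 < r ∧ C * x.1 < x.2 ∧ x.2 < E - C * x.1} := by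
    intro x ⟨h1, h2, h3, h4⟩ y ⟨k1, k2, k3, k4⟩ a b ha hb hab
    rcases ha.eq_or_lt with rfl | ha
    · obtain rfl : b = 1 := by linarith
      simpa using ⟨k1, k2, k3, k4⟩
    · obtain rfl : b = 1 - a := by linarith
      simp only [mem_ofPred_eq, Prod.fst_add, Prod.smul_fst, smul_eq_mul, Prod.snd_add, Prod.smul_snd]
      refine ⟨?_, ?_, ?_, ?_⟩ <;> nlinarith
  convert hc.isPreconnected.image (fun x : ℝ × ℝ => q + p * ((x.1:ℂ) * exp ((x.2:ℂ) * I))) (by fun_prop) using 1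
  ext z
  symm
  constructor
  · rintro ⟨x, ⟨h1, h2, h3, h4⟩, rfl⟩
    exact ⟨x.1, x.2, h1, h2, h3, h4, rfl⟩
  · rintro ⟨ρ, θ, h1, h2, h3, h4, rfl⟩
    exact ⟨(ρ, θ), ⟨h1, h2, h3, h4⟩, rfl⟩
lemma dich {G S : Set ℂ} (hS : IsPreconnected S) (h : ∀ z ∈ S, z ∉ frontier G) (hG : IsOpen G) :
    S ⊆ G ∨ ∀ z ∈ S, z ∉ closure G := by
  by_cases h1 : (S ∩ G).Nonempty
  · left
    refine hS.subset_left_of_subset_union hG (isClosed_closure (s := G)).isOpen_compl ?_ ?_ h1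
    · exact disjoint_compl_right.mono_left subset_closure |>.mono_right (fun _ h => h)
    · intro z hz
      by_contra h2
      simp only [mem_union, mem_compl_iff, not_or, not_not] at h2
      exact h z hz (by rw [hG.frontier_eq]; exact ⟨h2.2, h2.1⟩)
  · right
    intro z hz hc
    exact h z hz (by rw [hG.frontier_eq]; exact ⟨hc, fun h2 => h1 ⟨z, hz, h2⟩⟩)
lemma ray_dist {ρ s φ κ : ℝ} (hρ : 0 ≤ ρ) (hs : 0 ≤ s) (hκ : 0 ≤ κ) (h1 : κ ≤ |φ|) (h2 : |φ| ≤ 2 * π - κ) :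
    ρ * κ / π ≤ ‖(ρ:ℂ) * exp (φ * I) - s‖ := by
  have hn : ‖exp (φ * I)‖ = 1 := norm_exp_ofReal_mul_I φ
  have a1 : |ρ - s| ≤ ‖(ρ:ℂ) * exp (φ * I) - s‖ := by
    have := abs_norm_sub_norm_le ((ρ:ℂ) * exp (φ * I)) s
    rwa [norm_mul, hn, mul_one, norm_real, norm_real, Real.norm_of_nonneg hρ, Real.norm_of_nonneg hs] at this
  have a2 : ρ * ‖exp (I * φ) - 1‖ ≤ ‖(ρ:ℂ) * exp (φ * I) - s‖ + |ρ - s| := by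
    have : (ρ:ℂ) * (exp (φ * I) - 1) = ((ρ:ℂ) * exp (φ * I) - s) - ((ρ - s : ℝ) : ℂ) := by push_cast; ring
    calc _ = ‖(ρ:ℂ) * (exp (φ * I) - 1)‖ := by rw [norm_mul, norm_real, Real.norm_of_nonneg hρ, mul_comm I]
      _ ≤ _ := by rw [this]; refine (norm_sub_le _ _).trans (by rw [norm_real, Real.norm_eq_abs])
  have a3 : 2 / π * κ ≤ ‖exp (I * φ) - 1‖ := by
    rw [norm_exp_I_mul_ofReal_sub_one, Real.norm_eq_abs, abs_mul, abs_two]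
    have e1 : |sinR (φ / 2)| = |sinR (|φ| / 2)| := by
      rcases abs_cases φ with ⟨h, _⟩ | ⟨h, _⟩ <;> rw [h]
      rw [neg_div, Real.sin_neg, abs_neg]
    rw [e1]
    have e2 : κ / π ≤ sinR (|φ| / 2) := by
      rcases le_total (|φ| / 2) (π / 2) with h | h
      · refine le_trans ?_ (Real.mul_le_sin (by positivity) h)
        rw [div_mul_eq_mul_div]; gcongr; linarith
      · rw [← Real.sin_pi_sub]
        refine le_trans ?_ (Real.mul_le_sin (by linarith) (by linarith))
        rw [div_mul_eq_mul_div]; gcongr; linarith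
    have := le_abs_self (sinR (|φ| / 2))
    have e3 : 2 / π * κ = 2 * (κ / π) := by ring
    rw [e3]; linarith
  have a4 := mul_le_mul_of_nonneg_left a3 hρ
  have e4 : ρ * κ / π = ρ * (2 / π * κ) / 2 := by ring
  rw [e4]; linarith
def Rays (G : Set ℂ) (q p p' : ℂ) (C r : ℝ) : Prop := ∀ t ∈ frontier G, ‖t - q‖ < r → ∃ s : ℝ, 0 ≤ s ∧
  (‖t - q - s * p‖ ≤ C * ‖t - q‖ ^ 2 ∨ ‖t - q - s * p'‖ ≤ C * ‖t - q‖ ^ 2)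
lemma CSc_front {G : Set ℂ} {q p p' : ℂ} {C E : ℝ} (hC : 0 < C) (hp : ‖p‖ = 1) (hp' : p' = p * exp (E * I))
    (hE : E ≤ 2 * π) (h : Rays G q p p' C r) :
    ∀ z ∈ CSc q p E (π * (C + 1)) r, z ∉ frontier G := by
  rintro z ⟨ρ, θ, h1, h2, h3, h4, rfl⟩ hf
  have hn : ∀ θ : ℝ, ‖exp (θ * I)‖ = 1 := norm_exp_ofReal_mul_I
  have e0 : ‖q + p * (ρ * exp (θ * I)) - q‖ = ρ := by
    rw [add_sub_cancel_left, norm_mul, hp, norm_mul, hn, norm_real, Real.norm_of_nonneg h1.le]; ring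
  have hκ : 0 < π * (C + 1) * ρ := by positivity
  obtain ⟨s, hs, h5⟩ := h _ hf (by rw [e0]; exact h2)
  rw [e0, add_sub_cancel_left] at h5
  have e5 : C * ρ ^ 2 < ρ * (π * (C + 1) * ρ) / π := by
    rw [show ρ * (π * (C + 1) * ρ) / π = (C + 1) * ρ ^ 2 by field_simp]; nlinarith
  rcases h5 with h5 | h5
  · have := ray_dist h1.le hs hκ.le (φ := θ) (by rw [abs_of_pos (hκ.trans h3)]; exact h3.le)
      (by rw [abs_of_pos (hκ.trans h3)]; linarith)
    rw [show p * (ρ * exp (θ * I)) - s * p = p * ((ρ:ℂ) * exp (θ * I) - s) by ring, norm_mul, hp, one_mul] at h5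
    linarith
  · have hneg : θ - E < 0 := by linarith
    have := ray_dist h1.le hs hκ.le (φ := θ - E) (by rw [abs_of_neg hneg]; linarith)
      (by rw [abs_of_neg hneg]; linarith)
    have e6 : p * (ρ * exp (θ * I)) - s * p' = p * exp (E * I) * ((ρ:ℂ) * exp (((θ - E : ℝ):ℂ) * I) - s) := by
      rw [hp', mul_sub, mul_left_comm (p * exp (E * I)), mul_assoc p, ← Complex.exp_add]
      push_cast; ring_nf
    rw [e6, norm_mul, norm_mul, hp, hn, one_mul, one_mul] at h5
    linarith
lemma corner_dich {G : Set ℂ} (hG : IsOpen G) {q p p' : ℂ} {C E : ℝ} (hC : 0 < C) (hr : 0 < r) (hp : ‖p‖ = 1) (hp' : ‖p'‖ = 1)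
    (h : Rays G q p p' C r) (hE0 : 0 < E) (hE : E < 2 * π) (ha : HasCornerAngle G q (2 * π - E)) :
    ((p' = p * exp (E * I) ∧ ∀ z ∈ CSc q p E (π * (C + 1)) r, z ∉ closure G) ∨
     (p = p' * exp (E * I) ∧ ∀ z ∈ CSc q p' E (π * (C + 1)) r, z ∉ closure G)) := by
  obtain ⟨μ, ⟨hμ0, hμ⟩, hpp⟩ : ∃ μ : ℝ, μ ∈ Ico 0 (2 * π) ∧ p' = p * exp (μ * I) := by
    have hpn : p ≠ 0 := norm_pos_iff.1 (by rw [hp]; exact one_pos)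
    refine ⟨toIcoMod Real.two_pi_pos 0 (arg (p' / p)), by simpa using toIcoMod_mem_Ico Real.two_pi_pos 0 (arg (p' / p)), ?_⟩
    have h1 : exp ((toIcoMod Real.two_pi_pos 0 (arg (p' / p)) : ℝ) * I) = exp (arg (p' / p) * I) := by
      rw [toIcoMod]
      simp only [zsmul_eq_mul]; push_cast
      rw [sub_mul, Complex.exp_sub]
      rw [show ((toIcoDiv Real.two_pi_pos 0 (arg (p' / p)) : ℤ) : ℂ) * (2 * π) * I
        = (toIcoDiv Real.two_pi_pos 0 (arg (p' / p)) : ℤ) * (2 * π * I) by ring, Complex.exp_int_mul_two_pi_mul_I, div_one]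
    have h2 := norm_mul_exp_arg_mul_I (p' / p)
    rw [norm_div, hp, hp', div_one, ofReal_one, one_mul] at h2
    rw [h1, h2, mul_div_cancel₀ _ hpn]
  have hpp2 : p = p' * exp ((2 * π - μ : ℝ) * I) := by
    rw [hpp, mul_assoc, ← Complex.exp_add]; push_cast
    rw [← add_mul, add_sub_cancel, Complex.exp_two_pi_mul_I, mul_one]
  have h' : Rays G q p' p C r := fun t ht htr => by
    obtain ⟨s, hs, h⟩ := h t ht htr; exact ⟨s, hs, h.symm⟩
  have d1 := dich (CSc_conn q p μ (π * (C + 1)) r) (CSc_front hC hp hpp hμ.le h) hG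
  have d2 := dich (CSc_conn q p' (2 * π - μ) (π * (C + 1)) r) (CSc_front hC hp' hpp2 (by linarith) h') hG
  classical
  set g : ℝ → ℝ → ℝ := fun ρ θ => if q + (ρ:ℂ) * exp (θ * I) ∈ G then 1 else 0 with hg
  have gm : ∀ ρ, Measurable (g ρ) := fun ρ => by
    refine Measurable.ite ?_ measurable_const measurable_const
    exact (hG.preimage (f := fun θ : ℝ => q + (ρ:ℂ) * exp (θ * I)) (by fun_prop)).measurableSet
  have gb : ∀ ρ θ, ‖g ρ θ‖ ≤ 1 := fun ρ θ => by simp only [hg]; split_ifs <;> simp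
  have gi : ∀ ρ a b, IntervalIntegrable (g ρ) volume a b := fun ρ a b => by
    refine (intervalIntegrable_const (c := (1:ℝ))).mono_fun' (gm ρ).aestronglyMeasurable ?_
    exact Eventually.of_forall fun θ => gb ρ θ
  have piece : ∀ (φ e v : ℝ) (p : ℂ), 0 ≤ e → p = exp (φ * I) →
      (∀ z ∈ CSc q p e (π * (C + 1)) r, (if z ∈ G then (1:ℝ) else 0) = v) →
      Tendsto (fun ρ : ℝ => ∫ θ in φ..(φ + e), g ρ θ) nhR (𝓝 (e * v)) := by
    intro φ e v p he hpe hv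
    have : e * v = ∫ θ in φ..(φ + e), v := by simp
    rw [this]
    refine intervalIntegral.tendsto_integral_filter_of_dominated_convergence (fun _ => 1)
      (Eventually.of_forall fun ρ => (gm ρ).aestronglyMeasurable)
      (Eventually.of_forall fun ρ => Eventually.of_forall fun θ _ => gb ρ θ) intervalIntegrable_const ?_
    have hne : ∀ᵐ θ : ℝ, θ ≠ φ + e := by simp [ae_iff]
    filter_upwards [hne] with θ hθ hm
    rw [uIoc_of_le (by linarith)] at hm
    have h2 : θ < φ + e := lt_of_le_of_ne hm.2 hθ
    have t0 : Tendsto (fun ρ : ℝ => π * (C + 1) * ρ) nhR (𝓝 0) := by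
      have := ((continuous_const_mul (π * (C + 1))).tendsto 0).mono_left (nhdsWithin_le_nhds (s := Ioi 0))
      rwa [mul_zero] at this
    refine tendsto_const_nhds.congr' ?_
    filter_upwards [self_mem_nhdsWithin, nhdsWithin_le_nhds (Iio_mem_nhds hr),
      t0.eventually_lt_const (show 0 < θ - φ by linarith [hm.1]), t0.eventually_lt_const (show 0 < φ + e - θ by linarith)] with ρ k1 k2 k3 k4
    symm
    refine hv _ ⟨ρ, θ - φ, k1, k2, k3, by linarith, ?_⟩
    rw [hpe, mul_left_comm, ← Complex.exp_add]; push_cast; ring_nf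
  obtain ⟨φ, hφ⟩ : ∃ φ : ℝ, p = exp (φ * I) := ⟨arg p, by
    have := norm_mul_exp_arg_mul_I p; rw [hp, ofReal_one, one_mul] at this; exact this.symm⟩
  have hφ' : p' = exp ((φ + μ : ℝ) * I) := by rw [hpp, hφ, ← Complex.exp_add]; push_cast; ring_nf
  have tot : ∀ ρ : ℝ, (volume {θ : ℝ | θ ∈ Ico 0 (2 * π) ∧ q + (ρ : ℂ) * exp ((θ : ℂ) * I) ∈ G}).toReal =
      (∫ θ in φ..(φ + μ), g ρ θ) + ∫ θ in (φ + μ)..(φ + μ + (2 * π - μ)), g ρ θ := by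
    intro ρ
    rw [intervalIntegral.integral_add_adjacent_intervals (gi _ _ _) (gi _ _ _)]
    have per : Function.Periodic (g ρ) (2 * π) := fun θ => by
      simp only [hg]; push_cast; rw [add_mul, Complex.exp_add, Complex.exp_two_pi_mul_I, mul_one]
    rw [show φ + μ + (2 * π - μ) = φ + 2 * π by ring, per.intervalIntegral_add_eq φ 0, zero_add,
      intervalIntegral.integral_of_le (by linarith), ← integral_Ico_eq_integral_Ioc]
    have hms : MeasurableSet {θ : ℝ | q + (ρ:ℂ) * exp (θ * I) ∈ G} :=
      (hG.preimage (f := fun θ : ℝ => q + (ρ:ℂ) * exp (θ * I)) (by fun_prop)).measurableSet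
    have : g ρ = {θ : ℝ | q + (ρ:ℂ) * exp (θ * I) ∈ G}.indicator 1 := by
      ext θ; simp [hg, indicator_apply]
    rw [this, integral_indicator_one hms, measureReal_restrict_apply hms, inter_comm]
    rfl
  have fin : ∀ v1 v2 : ℝ, (∀ z ∈ CSc q p μ (π * (C + 1)) r, (if z ∈ G then (1:ℝ) else 0) = v1) →
      (∀ z ∈ CSc q p' (2 * π - μ) (π * (C + 1)) r, (if z ∈ G then (1:ℝ) else 0) = v2) →
      2 * π - E = μ * v1 + (2 * π - μ) * v2 := fun v1 v2 k1 k2 => by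
    refine tendsto_nhds_unique (ha.congr fun ρ => tot ρ) ((piece φ μ v1 p hμ0 hφ k1).add (piece _ _ v2 p' (by linarith) hφ' k2))
  have i1 : ∀ {S : Set ℂ}, S ⊆ G → ∀ z ∈ S, (if z ∈ G then (1:ℝ) else 0) = 1 := fun h z hz => if_pos (h hz)
  have i0 : ∀ {S : Set ℂ}, (∀ z ∈ S, z ∉ closure G) → ∀ z ∈ S, (if z ∈ G then (1:ℝ) else 0) = 0 :=
    fun h z hz => if_neg fun hh => h z hz (subset_closure hh)
  rcases d1 with d1 | d1 <;> rcases d2 with d2 | d2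
  · have := fin _ _ (i1 d1) (i1 d2); linarith
  · have := fin _ _ (i1 d1) (i0 d2)
    obtain rfl : E = 2 * π - μ := by linarith
    exact Or.inr ⟨hpp2, d2⟩
  · have := fin _ _ (i0 d1) (i1 d2)
    obtain rfl : E = μ := by linarith
    exact Or.inl ⟨hpp, d1⟩
  · have := fin _ _ (i0 d1) (i0 d2); linarith
lemma branch {q p : ℂ} {E C s θ : ℝ} {Z : ℝ → ℂ} (hr : 0 < r) (hs : 0 < s) (h0 : 0 < θ) (hE : θ < E) (hp : p ≠ 0)
    (hZ : Tendsto (fun x : ℝ => (Z x - q) / x) nhR (𝓝 (p * (s * exp (θ * I))))) :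
    ∀ᶠ x in nhR, Z x ∈ CSc q p E C r := by
  have hd : p * (s * exp (θ * I)) ≠ 0 := mul_ne_zero hp (mul_ne_zero (by exact_mod_cast hs.ne') (Complex.exp_ne_zero _))
  have hv : Tendsto (fun x : ℝ => (Z x - q) / x / (p * (s * exp (θ * I)))) nhR (𝓝 1) := by
    have := hZ.div_const (p * (s * exp (θ * I))); rwa [div_self hd] at this
  set v := fun x : ℝ => (Z x - q) / x / (p * (s * exp (θ * I))) with hvd
  have harg : Tendsto (fun x => θ + arg (v x)) nhR (𝓝 θ) := by
    have := ((continuousAt_arg (x := 1) (by simp)).tendsto.comp hv).const_add θ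
    simpa using this
  have hx : Tendsto (fun x : ℝ => x) nhR (𝓝 0) := tendsto_id.mono_left nhdsWithin_le_nhds
  have hρ : Tendsto (fun x : ℝ => x * s * ‖v x‖) nhR (𝓝 0) := by
    have := (hx.mul_const s).mul hv.norm; simpa using this
  have hC := hρ.const_mul C
  rw [mul_zero] at hC
  have l1 : ∀ᶠ x in nhR, C * (x * s * ‖v x‖) < θ + arg (v x) := hC.eventually_lt harg h0
  have l2 : ∀ᶠ x in nhR, θ + arg (v x) < E - C * (x * s * ‖v x‖) :=
    harg.eventually_lt (by simpa using hC.const_sub E) hE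
  filter_upwards [l1, l2, hρ.eventually_lt_const hr, self_mem_nhdsWithin, hv.eventually_ne one_ne_zero] with x k1 k2 k3 k4 k5
  have k4' : (0:ℝ) < x := k4
  refine ⟨x * s * ‖v x‖, θ + arg (v x), by have := norm_pos_iff.2 k5; positivity, k3, k1, k2, ?_⟩
  have e1 : v x * (x * (p * (s * exp (θ * I)))) = Z x - q := by
    simp only [hvd]; have : (x:ℂ) ≠ 0 := by exact_mod_cast k4'.ne'
    rw [div_div, div_mul_cancel₀ _ (mul_ne_zero this hd)]
  have e2 := norm_mul_exp_arg_mul_I (v x)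
  push_cast
  rw [add_mul, Complex.exp_add]
  rw [← e2] at e1
  linear_combination (-1:ℂ) * e1
lemma lens_CSc {q p : ℂ} {E C θ b : ℝ} (hl0 : 0 < lam) (hl2 : lam < 2) (hb : 0 < b)
    (hb1 : C < sinR (lam * π / 2) / b) (hb2 : b < r * sinR (lam * π / 2))
    (h1 : lam * π / 2 ≤ θ) (h2 : θ ≤ E - lam * π / 2) :
    ∀ w ∈ Sec lam, Zl q (p * exp (θ * I)) b w ∈ CSc q p E C r := by
  rintro w ⟨w0, hw⟩
  have H : Cor ∅ (2 - lam) 0 1 1 := ⟨by linarith, by linarith, Bornology.isBounded_empty, by simp, one_pos,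
    fun _ _ => ⟨id, fun ε _ => ⟨0, fun z hz => hz.elim⟩⟩, id, fun ε _ => ⟨0, fun z hz => hz.elim⟩⟩
  have hbe : bet (2 - lam) = lam * π / 2 := by unfold bet; ring
  have s0 := H.sinpos
  have hpi := Real.pi_pos
  rw [hbe] at s0
  have hv : ‖w⁻¹‖ * cosR (bet (2 - lam)) ≤ (w⁻¹).re := by
    rw [← norm_mul_cos_arg w⁻¹, hbe]
    refine mul_le_mul_of_nonneg_left ?_ (norm_nonneg _)
    have h3 : |arg w⁻¹| = |arg w| := by
      rw [arg_inv]; split_ifs with h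
      · rw [h, abs_of_pos hpi]
      · rw [abs_neg]
    rw [← Real.cos_abs (arg _), h3]
    exact Real.cos_le_cos_of_nonneg_of_le_pi (abs_nonneg _) (by nlinarith) hw.le
  have hb' := inv_pos.2 hb
  have hne := H.vr_ne hb' hv
  have key := H.sin_low hb' hv
  rw [hbe] at key
  set V := w⁻¹ + ((b⁻¹ : ℝ) : ℂ) with hV
  have hVp := norm_pos_iff.2 hne
  have e0 : w / (1 + w / b) = V⁻¹ := by
    have : 1 + w / b = w * V := by rw [hV, mul_add, mul_inv_cancel₀ w0]; push_cast; rw [div_eq_mul_inv]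
    rw [this, div_mul_cancel_left₀ w0]
  set ψ := arg V with hψ
  have e1 : V⁻¹ = (‖V‖⁻¹ : ℝ) * exp ((-ψ : ℝ) * I) := by
    conv_lhs => rw [← norm_mul_exp_arg_mul_I V, mul_inv, ← Complex.exp_neg]
    push_cast; rw [neg_mul]
  have hψ1 : |ψ| ≤ lam * π / 2 := by have := H.vr_arg hb' hv; rwa [hbe] at this
  have hψ2 : sinR (lam * π / 2) / b * ‖V‖⁻¹ ≤ lam * π / 2 - |ψ| := by
    refine le_trans ?_ (Real.sin_le (by linarith))
    rw [← div_eq_mul_inv, div_le_iff₀ hVp, div_eq_mul_inv, mul_comm, mul_comm (sinR (_ - _))]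
    exact key
  have hρ : ‖V‖⁻¹ ≤ b / sinR (lam * π / 2) := by
    have := mul_le_mul_of_nonneg_left (Real.sin_le_one (lam * π / 2 - |ψ|)) hVp.le
    rw [inv_le_comm₀ hVp (by positivity), inv_div, div_eq_mul_inv, mul_comm]
    linarith
  have hρ0 := inv_pos.2 hVp
  have hk : C * ‖V‖⁻¹ < lam * π / 2 - |ψ| := lt_of_lt_of_le (by gcongr) hψ2
  have := abs_le.1 (le_refl |ψ|)
  refine ⟨‖V‖⁻¹, θ - ψ, hρ0, hρ.trans_lt (by rwa [div_lt_iff₀ s0]), by linarith, by linarith, ?_⟩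
  rw [Zl, e0, e1, mul_assoc, ← mul_assoc (exp (θ * I)), mul_comm (exp (θ * I)), mul_assoc ((‖V‖⁻¹ : ℝ):ℂ), ← Complex.exp_add]
  push_cast; ring_nf
lemma path_w {q p : ℂ} {β θ θ1 s b : ℝ} {Z : ℝ → ℂ} (hβ : β < π) (hs : 0 < s) (hb : 0 < b) (hp : p ≠ 0)
    (hθ : |θ1 - θ| < β) (hZ : Tendsto (fun x : ℝ => (Z x - q) / x) nhR (𝓝 (p * (s * exp (θ1 * I))))) :
    ∃ δ c1 C1 x1 : ℝ, 0 < δ ∧ 0 < c1 ∧ 0 < C1 ∧ 0 < x1 ∧ x1 < 1 ∧ ∀ x ∈ Ioo 0 x1, ∃ w : ℂ,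
      c1 * x ≤ ‖w‖ ∧ ‖w‖ ≤ C1 * x ∧ |arg w| ≤ β - δ ∧ Zl q (p * exp (θ * I)) b w = Z x := by
  set u := p * exp (θ * I) with hu
  have hu0 : u ≠ 0 := mul_ne_zero hp (Complex.exp_ne_zero _)
  set ξ : ℝ → ℂ := fun x => (Z x - q) / u with hξ
  have hL : Tendsto (fun x : ℝ => ξ x / x) nhR (𝓝 (s * exp ((θ1 - θ : ℝ) * I))) := by
    have := hZ.div_const u
    have e : p * (s * exp (θ1 * I)) / u = s * exp ((θ1 - θ : ℝ) * I) := by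
      have e3 : exp ((θ1 - θ : ℝ) * I) * exp (θ * I) = exp (θ1 * I) := by
        rw [← Complex.exp_add]; push_cast; ring_nf
      rw [div_eq_iff hu0, hu, ← e3]; ring
    rw [e] at this
    exact this.congr fun x => by simp only [hξ]; ring
  have hx : Tendsto (fun x : ℝ => (x:ℂ)) nhR (𝓝 0) :=
    (continuous_ofReal.tendsto' 0 0 (by simp)).mono_left nhdsWithin_le_nhds
  have hξ0 : Tendsto (fun x => 1 - ξ x / b) nhR (𝓝 1) := by
    have : Tendsto ξ nhR (𝓝 0) := by
      have := hL.mul hx; rw [mul_zero] at this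
      refine this.congr' ?_
      filter_upwards [self_mem_nhdsWithin] with x hx
      exact div_mul_cancel₀ _ (by exact_mod_cast (ne_of_gt hx))
    simpa using (this.div_const (b:ℂ)).const_sub 1
  set w : ℝ → ℂ := fun x => ξ x / (1 - ξ x / b) with hw
  have hwL : Tendsto (fun x : ℝ => w x / x) nhR (𝓝 (s * exp ((θ1 - θ : ℝ) * I))) := by
    have := hL.div hξ0 one_ne_zero
    rw [div_one] at this
    exact this.congr fun x => by simp only [hw, Pi.div_apply]; rw [div_right_comm]
  have hI : θ1 - θ ∈ Ioc (-π) π := ⟨by linarith [(abs_lt.1 hθ).1], by linarith [(abs_lt.1 hθ).2]⟩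
  have ha : arg (s * exp ((θ1 - θ : ℝ) * I)) = θ1 - θ := by
    rw [arg_real_mul _ hs, arg_exp_mul_I]
    exact (toIocMod_eq_self _).2 (by rwa [show -π + 2 * π = π by ring])
  have hsl : s * exp ((θ1 - θ : ℝ) * I) ∈ slitPlane := by
    rw [mem_slitPlane_iff_arg, ha]
    exact ⟨by have := (abs_lt.1 hθ).2; linarith, mul_ne_zero (by exact_mod_cast hs.ne') (Complex.exp_ne_zero _)⟩
  have harg : Tendsto (fun x : ℝ => |arg (w x / x)|) nhR (𝓝 |θ1 - θ|) := by
    have := ((continuousAt_arg hsl).tendsto.comp hwL).abs; rw [ha] at this; exact this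
  have hnm : Tendsto (fun x : ℝ => ‖w x / x‖) nhR (𝓝 s) := by
    have := hwL.norm; rwa [norm_mul, norm_exp_ofReal_mul_I, mul_one, norm_real, Real.norm_of_nonneg hs.le] at this
  have ev := (((harg.eventually_lt_const (show |θ1 - θ| < β - (β - |θ1 - θ|) / 2 by linarith)).and
    (hnm.eventually_lt_const (show s < 2 * s by linarith))).and
    (hnm.eventually_const_lt (show s / 2 < s by linarith))).and (hξ0.eventually_ne one_ne_zero)
  obtain ⟨x0, hx0, hsub⟩ := mem_nhdsGT_iff_exists_Ioo_subset.1 ev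
  refine ⟨(β - |θ1 - θ|) / 2, s / 2, 2 * s, min x0 (1 / 2), by linarith, by linarith, by linarith,
    lt_min hx0 (by norm_num), (min_le_right _ _).trans_lt (by norm_num), fun x hx => ⟨w x, ?_⟩⟩
  obtain ⟨⟨⟨k1, k2⟩, k3⟩, k4⟩ := hsub ⟨hx.1, hx.2.trans_le (min_le_left _ _)⟩
  have hx0 := hx.1
  rw [norm_div, norm_real, Real.norm_of_nonneg hx0.le] at k2 k3
  rw [div_lt_iff₀ hx0] at k2
  rw [lt_div_iff₀ hx0] at k3
  refine ⟨k3.le, k2.le, ?_, ?_⟩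
  · have e : w x = (x:ℝ) * (w x / x) := by rw [mul_div_cancel₀]; exact_mod_cast hx0.ne'
    rw [e, arg_real_mul _ hx0]; exact k1.le
  · have hbc : (b:ℂ) ≠ 0 := by exact_mod_cast hb.ne'
    have e : w x / (1 + w x / b) = ξ x := by
      have e2 : 1 + w x / b = (1 - ξ x / b)⁻¹ := by
        have hk : (b:ℂ) - ξ x ≠ 0 := fun h => k4 (by field_simp; rw [h, mul_zero])
        simp only [hw]; field_simp; ring
      rw [e2, div_inv_eq_mul]; exact div_mul_cancel₀ _ k4
    rw [Zl, e]; simp only [hξ]; rw [mul_div_cancel₀ _ hu0]; ring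
lemma pa_step (hX : Bornology.IsBounded X) {b b' : ℂ} (hd : 0 < d) (h : ∀ z ∈ X, d ≤ ‖z - b‖) (hb : ‖b' - b‖ ≤ d / 2)
    (hp : PA X fun z => (z - b)⁻¹) : PA X fun z => (z - b')⁻¹ := by
  have h1 := hp
  have hg : PA X fun z => (b' - b) * (z - b)⁻¹ := (PA.const (b' - b)).mul hX hp
  have hn : ∀ z ∈ X, ‖(b' - b) * (z - b)⁻¹‖ ≤ 1 / 2 := fun z hz => by
    have h2 := h z hz
    rw [norm_mul, norm_inv, ← div_eq_mul_inv, div_le_iff₀ (by linarith)]; linarith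
  have h2 := PA.comp hX hg hn (φ := fun w => (1 - w)⁻¹) (by
    intro w hw
    refine (DifferentiableAt.inv (by fun_prop) ?_).differentiableWithinAt
    intro h0
    rw [sub_eq_zero] at h0
    rw [← h0] at hw; simp at hw)
  refine (h1.mul hX h2).congr fun z hz => ?_
  have hzb : z - b ≠ 0 := fun h0 => by have := h z hz; rw [h0, norm_zero] at this; linarith
  rw [← mul_inv, mul_sub, mul_one, mul_left_comm, mul_inv_cancel₀ hzb]; ring_nf
lemma pa_conn (hX : Bornology.IsBounded X) (hXc : IsClosed X) {S : Set ℂ} (hS : IsPreconnected S) (hSX : ∀ z ∈ S, z ∉ X)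
    {s0 : ℂ} (h0 : s0 ∈ S) (hg : PA X fun z => (z - s0)⁻¹) : ∀ s ∈ S, PA X fun z => (z - s)⁻¹ := by
  have loc : ∀ b ∉ X, ∃ δ > 0, ∀ b' ∈ ball b δ, b' ∉ X ∧ ((PA X fun z => (z - b)⁻¹) ↔ PA X fun z => (z - b')⁻¹) := by
    intro b hb
    obtain ⟨d, hd, h⟩ := exists_sep (K := {b}) isCompact_singleton hXc (disjoint_singleton_left.2 hb)
    have h : ∀ z ∈ X, d ≤ ‖z - b‖ := fun z hz => h b rfl z hz
    refine ⟨d / 4, by positivity, fun b' hb' => ?_⟩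
    rw [mem_ball, dist_eq_norm] at hb'
    have h' : ∀ z ∈ X, d / 2 ≤ ‖z - b'‖ := fun z hz => by
      have := norm_sub_le_norm_sub_add_norm_sub z b' b
      linarith [h z hz]
    refine ⟨fun hx => by have := h' _ hx; simp at this; linarith, fun k => pa_step hX hd h (by linarith) k,
      fun k => pa_step hX (half_pos hd) h' ?_ k⟩
    rw [norm_sub_rev]; linarith
  have ho : ∀ Q : Prop → Prop, IsOpen {b | b ∉ X ∧ Q (PA X fun z => (z - b)⁻¹)} := by
    intro Q
    rw [Metric.isOpen_iff]
    rintro b ⟨h1, h2⟩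
    obtain ⟨δ, hδ, h⟩ := loc b h1
    exact ⟨δ, hδ, fun b' hb' => ⟨(h b' hb').1, by rw [← propext (h b' hb').2]; exact h2⟩⟩
  have := hS.subset_left_of_subset_union (ho id) (ho Not) (disjoint_left.2 fun x h1 h2 => h2.2 h1.2)
    (fun z hz => by by_cases h : PA X fun w => (w - z)⁻¹
                    · exact Or.inl ⟨hSX z hz, h⟩
                    · exact Or.inr ⟨hSX z hz, h⟩) ⟨s0, h0, hSX _ h0, hg⟩
  exact fun s hs => (this hs).2
lemma pa_far (hX : Bornology.IsBounded X) : ∃ R : ℝ, ∀ b : ℂ, R ≤ ‖b‖ → PA X fun z => (z - b)⁻¹ := by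
  obtain ⟨M, hM, h⟩ := hX.exists_pos_norm_le
  refine ⟨2 * M, fun b hb => ?_⟩
  have hb0 : b ≠ 0 := norm_pos_iff.1 (by linarith)
  have hg : PA X fun z => z / b := (PA.poly (Polynomial.C b⁻¹ * Polynomial.X)).congr fun z _ => by simp; ring
  have h2 := PA.comp hX hg (fun z hz => by
    rw [norm_div, div_le_iff₀ (norm_pos_iff.2 hb0)]; linarith [h z hz]) (φ := fun w => -b⁻¹ * (1 - w)⁻¹) (by
    intro w hw
    refine (DifferentiableAt.const_mul (DifferentiableAt.inv (by fun_prop) ?_) _).differentiableWithinAt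
    intro h0
    rw [sub_eq_zero] at h0
    rw [← h0] at hw; simp at hw)
  refine h2.congr fun z hz => ?_
  rw [neg_mul, ← mul_inv, ← inv_neg]
  congr 1; field_simp; ring
structure Pre (G : Set ℂ) (ν : Measure ℂ) (lam : ℝ) where
  n : ℕ
  T : Fin (n + 1) → ℂ → ℂ
  N : Set ℂ
  c : ℝ
  l0 : 0 < lam
  l2 : lam < 2
  G_open : IsOpen G
  G_conn : IsPreconnected G
  G_ne : G.Nonempty
  G_bdd : Bornology.IsBounded G
  N_open : IsOpen N
  seg_sub : seg ⊆ N
  c_pos : 0 < c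
  hol : ∀ j, DifferentiableOn ℂ (T j) N
  bil : ∀ j, ∀ ω ∈ N, ∀ ω' ∈ N, c * ‖ω - ω'‖ ≤ ‖T j ω - T j ω'‖
  join : ∀ j, T j 1 = T (j + 1) 0
  disj : ∀ i j, ∀ x ∈ IoU, ∀ y ∈ IcU, T i x = T j y → i = j
  start : ∀ i j, T i 0 = T j 0 → i = j
  onL : ∀ j, ∀ x ∈ IcU, T j x ∈ frontier G
  cov : ∀ t ∈ frontier G, ∃ j, ∃ x ∈ IcU, T j x = t
  ang : ∀ j, ∃ E : ℝ, lam * π ≤ E ∧ E < 2 * π ∧ HasCornerAngle G (T j 0) (2 * π - E)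
  meas : ν = ∑ j, Measure.map (fun x : ℝ => T j x)
    ((voU).withDensity (fun x => ‖deriv (T j) x‖ₑ))
lemma zero_seg : (0:ℂ) ∈ seg := ⟨0, by simp, by simp⟩
lemma one_seg : (1:ℂ) ∈ seg := ⟨1, by simp, by simp⟩
lemma lens_ev {V : Set ℂ} (hV : V ∈ 𝓝ˢ seg) : ∀ᶠ η in nhR, lens η ⊆ V := by
  obtain ⟨O, hO, h1, h2⟩ := mem_nhdsSet_iff_exists.1 hV
  obtain ⟨δ, hδ, h3⟩ := seg_compact.exists_thickening_subset_open hO h1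
  filter_upwards [self_mem_nhdsWithin, nhdsWithin_le_nhds (Iio_mem_nhds hδ)] with η h4 h5 ω hω
  have hre := lens_re h4 hω
  refine h2 (h3 (mem_thickening_iff.2 ⟨ω.re, mem_seg hre, ?_⟩))
  have e : ω - (ω.re : ℂ) = (ω.im : ℂ) * I := by apply Complex.ext <;> simp
  rw [dist_eq_norm, e, norm_mul, norm_I, mul_one, norm_real, Real.norm_eq_abs]
  have h6 : |ω.im| ≤ η * (ω.re * (1 - ω.re)) := hω
  have h4' : 0 < η := h4
  have h5' : η < δ := h5
  have h7 : ω.re * (1 - ω.re) ≤ 1 := by nlinarith [hre.1, hre.2, sq_nonneg ω.re]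
  have := mul_le_mul_of_nonneg_left h7 h4'.le
  linarith
namespace Pre
variable (P : Pre G ν lam) (j : Fin (P.n + 1))
lemma dAt {j} (hω : ω ∈ P.N) : DifferentiableAt ℂ (P.T j) ω := (P.hol j).differentiableAt (P.N_open.mem_nhds hω)
lemma dne {j} (hω : ω ∈ P.N) : P.c ≤ ‖deriv (P.T j) ω‖ := by
  have h1 := (P.dAt (j := j) hω).hasDerivAt.tendsto_slope.norm
  refine ge_of_tendsto h1 ?_
  filter_upwards [self_mem_nhdsWithin, nhdsWithin_le_nhds (P.N_open.mem_nhds hω)] with w hw hw'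
  have h0 : 0 < ‖w - ω‖ := norm_pos_iff.2 (sub_ne_zero.2 hw)
  rw [slope_def_field, norm_div, le_div_iff₀ h0]
  exact P.bil j w hw' ω hω
lemma inj {j} {ω' : ℂ} (h : ω ∈ P.N) (h' : ω' ∈ P.N) (he : P.T j ω = P.T j ω') : ω = ω' := by
  have := P.bil j ω h ω' h'
  rw [he, sub_self, norm_zero] at this
  have h2 : ‖ω - ω'‖ ≤ 0 := by by_contra h3; push Not at h3; nlinarith [P.c_pos]
  exact sub_eq_zero.1 (norm_le_zero_iff.1 h2)
lemma dpos {j} (hω : ω ∈ P.N) : 0 < ‖deriv (P.T j) ω‖ := P.c_pos.trans_le (P.dne hω)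
def Ah : ℂ := deriv (P.T j) 0 / ‖deriv (P.T j) 0‖
def Bh : ℂ := -deriv (P.T j) 1 / ‖deriv (P.T j) 1‖
lemma N0 : (0:ℂ) ∈ P.N := P.seg_sub zero_seg
lemma N1 : (1:ℂ) ∈ P.N := P.seg_sub one_seg
lemma Nx (hx : x ∈ IcU) : (x:ℂ) ∈ P.N := P.seg_sub (mem_seg hx)
lemma Ah_mul : deriv (P.T j) 0 = P.Ah j * ‖deriv (P.T j) 0‖ := by
  rw [Ah, div_mul_cancel₀]; exact_mod_cast (P.dpos P.N0).ne'
lemma Bh_mul : -deriv (P.T j) 1 = P.Bh j * ‖deriv (P.T j) 1‖ := by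
  rw [Bh, div_mul_cancel₀]; exact_mod_cast (P.dpos P.N1).ne'
lemma Ah1 : ‖P.Ah j‖ = 1 := by rw [Ah, norm_div, norm_real, norm_norm, div_self (P.dpos P.N0).ne']
lemma Bh1 : ‖P.Bh j‖ = 1 := by rw [Bh, norm_div, norm_neg, norm_real, norm_norm, div_self (P.dpos P.N1).ne']
lemma endq {a : ℂ} (ha : a ∈ seg) : ∃ K : ℝ, 0 < K ∧ ∀ y ∈ seg,
    ‖P.T j y - P.T j a - deriv (P.T j) a * (y - a)‖ ≤ K * ‖P.T j y - P.T j a‖ ^ 2 := by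
  obtain ⟨K, hK, h⟩ := quad P.N_open P.seg_sub (P.hol j) ha
  have hc := P.c_pos
  refine ⟨K / P.c ^ 2, by positivity, fun y hy => (h y hy).trans ?_⟩
  have h2 := P.bil j y (P.seg_sub hy) a (P.seg_sub ha)
  have h3 : (P.c * ‖y - a‖) ^ 2 ≤ ‖P.T j y - P.T j a‖ ^ 2 := by gcongr
  rw [div_mul_eq_mul_div, le_div_iff₀ (by positivity)]
  nlinarith
lemma eq_corner {i j} {y : ℝ} (hy : y ∈ IcU) (h : P.T i y = P.T j 0) : (i = j ∧ y = 0) ∨ (i + 1 = j ∧ y = 1) := by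
  rcases hy.1.eq_or_lt with h0 | h0
  · subst h0; left; exact ⟨P.start _ _ (by simpa using h), rfl⟩
  · rcases hy.2.eq_or_lt with h1 | h1
    · subst h1; right
      refine ⟨P.start _ _ ?_, rfl⟩
      rw [← P.join, ← h]; simp
    · have := P.disj i j y ⟨h0, h1⟩ 0 (by simp) (by simpa using h)
      subst this
      have := P.inj (P.Nx hy) P.N0 h
      exact absurd (by exact_mod_cast this) h0.ne'
lemma rays : ∃ C r : ℝ, 0 < C ∧ 0 < r ∧ Rays G (P.T (j + 1) 0) (P.Ah (j + 1)) (P.Bh j) C r := by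
  obtain ⟨K, hK, h⟩ := P.endq (j + 1) zero_seg
  obtain ⟨K', hK', h'⟩ := P.endq j one_seg
  have hcl : IsClosed (⋃ i : {i : Fin (P.n + 1) // i ≠ j ∧ i ≠ j + 1}, P.T i '' seg) := by
    refine isClosed_iUnion_of_finite fun i => (seg_compact.image_of_continuousOn ?_).isClosed
    exact (P.hol i).continuousOn.mono P.seg_sub
  obtain ⟨d, hd, hs⟩ := exists_sep (K := {P.T (j + 1) 0}) isCompact_singleton hcl (by
    rw [disjoint_singleton_left, mem_iUnion]
    rintro ⟨⟨i, h1, h2⟩, _, ⟨y, hy, rfl⟩, h3⟩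
    rcases P.eq_corner hy h3 with ⟨h4, _⟩ | ⟨h4, _⟩
    · exact h2 h4
    · exact h1 (add_right_cancel h4))
  refine ⟨K + K', d, by positivity, hd, fun t ht htd => ?_⟩
  obtain ⟨i, y, hy, rfl⟩ := P.cov t ht
  by_cases h1 : i = j + 1
  · subst h1
    refine ⟨‖deriv (P.T (j + 1)) 0‖ * y, mul_nonneg (norm_nonneg _) hy.1, Or.inl ?_⟩
    have e : ((‖deriv (P.T (j + 1)) 0‖ * y : ℝ) : ℂ) * P.Ah (j + 1) = deriv (P.T (j + 1)) 0 * (y - 0) := by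
      conv_rhs => rw [P.Ah_mul]
      push_cast; ring
    rw [e]
    exact (h _ (mem_seg hy)).trans (by gcongr; linarith)
  by_cases h2 : i = j
  · subst h2
    refine ⟨‖deriv (P.T i) 1‖ * (1 - y), mul_nonneg (norm_nonneg _) (by linarith [hy.2]), Or.inr ?_⟩
    have e : ((‖deriv (P.T i) 1‖ * (1 - y) : ℝ) : ℂ) * P.Bh i = deriv (P.T i) 1 * (y - 1) := by
      have := P.Bh_mul i
      push_cast; linear_combination (y - 1 : ℂ) * this
    rw [e, ← P.join]
    exact (h' _ (mem_seg hy)).trans (by gcongr; linarith)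
  · exact absurd (hs _ rfl _ (mem_iUnion.2 ⟨⟨i, h2, h1⟩, _, mem_seg hy, rfl⟩)) (not_le.2 htd)
lemma corner : ∃ E C r : ℝ, 0 < C ∧ 0 < r ∧ lam * π ≤ E ∧ E < 2 * π ∧
    ((P.Bh j = P.Ah (j + 1) * exp (E * I) ∧ ∀ z ∈ CSc (P.T (j + 1) 0) (P.Ah (j + 1)) E C r, z ∉ closure G) ∨
     (P.Ah (j + 1) = P.Bh j * exp (E * I) ∧ ∀ z ∈ CSc (P.T (j + 1) 0) (P.Bh j) E C r, z ∉ closure G)) := by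
  obtain ⟨C, r, hC, hr, h⟩ := P.rays j
  obtain ⟨E, h1, h2, h3⟩ := P.ang (j + 1)
  have := Real.pi_pos
  exact ⟨E, π * (C + 1), r, by positivity, hr, h1, h2,
    corner_dich P.G_open hC hr (P.Ah1 _) (P.Bh1 _) h (lt_of_lt_of_le (mul_pos P.l0 this) h1) h2 h3⟩
lemma AB_ne : P.Ah (j + 1) ≠ P.Bh j := by
  obtain ⟨E, C, r, hC, hr, h1, h2, h3⟩ := P.corner j
  have hE : 0 < E := lt_of_lt_of_le (mul_pos P.l0 Real.pi_pos) h1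
  intro h
  have key : ∀ p : ℂ, ‖p‖ = 1 → p = p * exp (E * I) → False := fun p hp hpe => by
    have hp0 : p ≠ 0 := norm_pos_iff.1 (by rw [hp]; exact one_pos)
    have := (mul_right_eq_self₀.1 hpe.symm).resolve_right hp0
    obtain ⟨k, hk⟩ := Complex.exp_eq_one_iff.1 this
    have h4 : E = k * (2 * π) := by
      have := congrArg Complex.im hk; simpa using this
    rw [h4] at hE h2
    have k0 : (0:ℝ) < k := by by_contra hh; push Not at hh; nlinarith
    have k1 : (k:ℝ) < 1 := by by_contra hh; push Not at hh; nlinarith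
    have : 0 < k := by exact_mod_cast k0
    have : k < 1 := by exact_mod_cast k1
    omega
  rcases h3 with ⟨h3, _⟩ | ⟨h3, _⟩
  · rw [← h] at h3; exact key _ (P.Ah1 _) h3
  · rw [h] at h3; exact key _ (P.Bh1 _) h3
lemma corner_sep : ∃ ε c : ℝ, 0 < ε ∧ 0 < c ∧ ∀ x ∈ IcU, ∀ y ∈ IcU, x ≤ ε → 1 - y ≤ ε →
    c * (x + (1 - y)) ≤ ‖P.T (j + 1) x - P.T j y‖ := by
  obtain ⟨K, hK, h⟩ := quad P.N_open P.seg_sub (P.hol (j + 1)) zero_seg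
  obtain ⟨K', hK', h'⟩ := quad P.N_open P.seg_sub (P.hol j) one_seg
  have hc := P.c_pos
  set κ := ‖P.Ah (j + 1) - P.Bh j‖ with hκ
  have hκ0 : 0 < κ := norm_pos_iff.2 (sub_ne_zero.2 (P.AB_ne j))
  refine ⟨κ * P.c / (8 * (K + K')), κ * P.c / 8, by positivity, by positivity, fun x hx y hy hxe hye => ?_⟩
  rw [le_div_iff₀ (by positivity)] at hxe hye
  have q1 := h x (mem_seg hx)
  have q2 := h' y (mem_seg hy)
  rw [sub_zero, norm_real, Real.norm_of_nonneg hx.1] at q1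
  have ey : ‖(y:ℂ) - 1‖ = 1 - y := by
    rw [← norm_neg, show -((y:ℂ) - 1) = ((1 - y : ℝ) : ℂ) by push_cast; ring, norm_real, Real.norm_of_nonneg (by linarith [hy.2])]
  rw [ey, P.join] at q2
  set A := deriv (P.T (j + 1)) 0 with hA
  set B := deriv (P.T j) 1 with hB
  set s := ‖A‖ * x with hs
  set t := ‖B‖ * (1 - y) with ht
  have hs0 : P.c * x ≤ s := mul_le_mul_of_nonneg_right (P.dne P.N0) hx.1
  have ht0 : P.c * (1 - y) ≤ t := mul_le_mul_of_nonneg_right (P.dne P.N1) (by linarith [hy.2])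
  have hs1 : 0 ≤ s := mul_nonneg (norm_nonneg _) hx.1
  have ht1 : 0 ≤ t := mul_nonneg (norm_nonneg _) (by linarith [hy.2])
  set W := P.Ah (j + 1) * s - P.Bh j * t with hW
  have w1 : |s - t| ≤ ‖W‖ := by
    have := abs_norm_sub_norm_le (P.Ah (j + 1) * (s:ℂ)) (P.Bh j * t)
    rwa [norm_mul, norm_mul, P.Ah1, P.Bh1, norm_real, norm_real, Real.norm_of_nonneg hs1, Real.norm_of_nonneg ht1, one_mul, one_mul] at this
  have w2 : s * κ ≤ ‖W‖ + |s - t| := by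
    have e : (P.Ah (j + 1) - P.Bh j) * s = W - P.Bh j * ((s - t : ℝ) : ℂ) := by rw [hW]; push_cast; ring
    have := norm_sub_le W (P.Bh j * ((s - t : ℝ) : ℂ))
    rw [← e, norm_mul, norm_mul, P.Bh1, norm_real, norm_real, Real.norm_of_nonneg hs1, one_mul, Real.norm_eq_abs] at this
    linarith
  have w3 : t * κ ≤ ‖W‖ + |s - t| := by
    have e : (P.Ah (j + 1) - P.Bh j) * t = W - P.Ah (j + 1) * ((s - t : ℝ) : ℂ) := by rw [hW]; push_cast; ring
    have := norm_sub_le W (P.Ah (j + 1) * ((s - t : ℝ) : ℂ))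
    rw [← e, norm_mul, norm_mul, P.Ah1, norm_real, norm_real, Real.norm_of_nonneg ht1, one_mul, Real.norm_eq_abs] at this
    linarith
  have eW : W = A * x + B * (1 - y) := by
    have e1 := P.Ah_mul (j + 1)
    have e2 := P.Bh_mul j
    rw [hW, hs, ht]; push_cast
    linear_combination (-(x:ℂ)) * e1 + (1 - y : ℂ) * e2
  have w4 : ‖W‖ ≤ ‖P.T (j + 1) x - P.T j y‖ + K * x ^ 2 + K' * (1 - y) ^ 2 := by
    have e : W = (P.T (j + 1) x - P.T j y) - (P.T (j + 1) x - P.T (j + 1) 0 - A * x)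
      + (P.T j y - P.T (j + 1) 0 - B * (y - 1)) := by rw [eW]; ring
    rw [e]
    refine (norm_add_le _ _).trans (add_le_add ((norm_sub_le _ _).trans (by gcongr)) q2)
  have hy0 : 0 ≤ 1 - y := by linarith [hy.2]
  have hx0 := hx.1
  have z1 : κ * P.c * x ≤ s * κ := by nlinarith
  have z2 : κ * P.c * (1 - y) ≤ t * κ := by nlinarith
  have z3 : 8 * (K * x ^ 2) ≤ κ * P.c * x := by nlinarith [mul_nonneg hK'.le hx0, mul_nonneg hx0 hx0]
  have z4 : 8 * (K' * (1 - y) ^ 2) ≤ κ * P.c * (1 - y) := by nlinarith [mul_nonneg hK.le hy0, mul_nonneg hy0 hy0]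
  nlinarith
lemma cont_real : ContinuousOn (fun x : ℝ => P.T j x) (Icc 0 1) :=
  (P.hol j).continuousOn.comp continuous_ofReal.continuousOn fun _ hx => P.Nx hx
lemma sep0 {i j} (hij : i ≠ j) : ∃ c : ℝ, 0 < c ∧ ∀ x ∈ IcU, ∀ y ∈ IcU,
    c * qd(x) ≤ ‖P.T j x - P.T i y‖ := by
  suffices h : ∃ c : ℝ, 0 < c ∧ ∀ z ∈ IcU ×ˢ IcU, z.1 ∈ IcU → z.2 ∈ IcU →
      c * (z.1 * (1 - z.1)) ≤ ‖P.T j z.1 - P.T i z.2‖ by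
    obtain ⟨c, hc, h⟩ := h
    exact ⟨c, hc, fun x hx y hy => h (x, y) ⟨hx, hy⟩ hx hy⟩
  refine (isCompact_Icc.prod isCompact_Icc).induction_on (p := fun s => ∃ c : ℝ, 0 < c ∧ ∀ z ∈ s, z.1 ∈ IcU →
    z.2 ∈ IcU → c * (z.1 * (1 - z.1)) ≤ ‖P.T j z.1 - P.T i z.2‖) ⟨1, one_pos, by simp⟩ ?_ ?_ ?_
  · rintro s t hst ⟨c, hc, h⟩; exact ⟨c, hc, fun z hz => h z (hst hz)⟩
  · rintro s t ⟨c, hc, h⟩ ⟨c', hc', h'⟩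
    refine ⟨min c c', lt_min hc hc', fun z hz h1 h2 => ?_⟩
    have h0 : 0 ≤ z.1 * (1 - z.1) := mul_nonneg h1.1 (by linarith [h1.2])
    rcases hz with hz | hz
    · exact (mul_le_mul_of_nonneg_right (min_le_left _ _) h0).trans (h z hz h1 h2)
    · exact (mul_le_mul_of_nonneg_right (min_le_right _ _) h0).trans (h' z hz h1 h2)
  rintro ⟨x, y⟩ ⟨hx, hy⟩
  simp only at hx hy
  by_cases he : P.T j x = P.T i y
  · rcases hx.1.eq_or_lt with h0 | h0
    · subst h0
      rcases P.eq_corner (j := j) hy (he.symm.trans (by simp)) with ⟨h, _⟩ | ⟨rfl, rfl⟩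
      · exact absurd h hij
      obtain ⟨ε, c, hε, hc, h⟩ := P.corner_sep i
      refine ⟨_, mem_nhdsWithin_of_mem_nhds (prod_mem_nhds (Iio_mem_nhds hε) (Ioi_mem_nhds (by linarith : 1 - ε < 1))), c, hc, ?_⟩
      rintro ⟨u, v⟩ ⟨hu, hv⟩ h1 h2
      simp only [mem_Iio, mem_Ioi] at hu hv h1 h2 ⊢
      refine le_trans ?_ (h u h1 v h2 hu.le (by linarith))
      gcongr; nlinarith [h1.1, h2.2]
    rcases hx.2.eq_or_lt with h1 | h1
    · subst h1
      have he' : P.T i y = P.T (j + 1) 0 := by rw [← P.join, ← he]; simp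
      rcases P.eq_corner hy he' with ⟨rfl, rfl⟩ | ⟨h, _⟩
      · obtain ⟨ε, c, hε, hc, h⟩ := P.corner_sep j
        refine ⟨_, mem_nhdsWithin_of_mem_nhds (prod_mem_nhds (Ioi_mem_nhds (by linarith : 1 - ε < 1)) (Iio_mem_nhds hε)), c, hc, ?_⟩
        rintro ⟨u, v⟩ ⟨hu, hv⟩ h1 h2
        simp only [mem_Iio, mem_Ioi] at hu hv h1 h2 ⊢
        rw [norm_sub_rev]
        refine le_trans ?_ (h v h2 u h1 hv.le (by linarith))
        gcongr; nlinarith [h1.1, h1.2, h2.1]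
      · exact absurd (add_right_cancel h) hij
    · exact absurd (P.disj j i x ⟨h0, h1⟩ y hy he) hij.symm
  · have h0 : 0 < ‖P.T j x - P.T i y‖ := norm_pos_iff.2 (sub_ne_zero.2 he)
    have hcont : ContinuousOn (fun z : ℝ × ℝ => ‖P.T j z.1 - P.T i z.2‖) (Icc 0 1 ×ˢ Icc 0 1) :=
      (((P.cont_real j).comp continuousOn_fst fun z hz => hz.1).sub ((P.cont_real i).comp continuousOn_snd fun z hz => hz.2)).norm
    refine ⟨_, (hcont (x, y) ⟨hx, hy⟩).eventually (lt_mem_nhds (half_lt_self h0)), _, half_pos h0, ?_⟩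
    rintro z hz h1 h2
    have hz' : ‖P.T j x - P.T i y‖ / 2 < ‖P.T j z.1 - P.T i z.2‖ := hz
    refine le_trans ?_ hz'.le
    refine mul_le_of_le_one_right (by positivity) ?_
    nlinarith [h1.1, h1.2]
lemma dcont : ContinuousOn (deriv (P.T j)) P.N := ((P.hol j).deriv P.N_open).continuousOn
lemma dbd : ∃ C : ℝ, 0 < C ∧ ∀ᶠ η in nhR, ∀ j, ∀ ω ∈ lens η, ω ∈ P.N ∧ ‖deriv (P.T j) ω‖ ≤ C := by
  have h1 : ∀ j, ∃ C : ℝ, ∀ ω ∈ seg, ‖deriv (P.T j) ω‖ ≤ C := fun j =>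
    seg_compact.exists_bound_of_continuousOn ((P.dcont j).mono P.seg_sub)
  choose C hC using h1
  obtain ⟨M, hM⟩ := (Set.finite_range C).bddAbove
  refine ⟨max M 0 + 1, by positivity, eventually_all.2 fun j => ?_⟩
  have hO : IsOpen (P.N ∩ deriv (P.T j) ⁻¹' (ball 0 (max M 0 + 1))) := (P.dcont j).isOpen_inter_preimage P.N_open isOpen_ball
  have hs : seg ⊆ P.N ∩ deriv (P.T j) ⁻¹' (ball 0 (max M 0 + 1)) := fun ω hω => ⟨P.seg_sub hω, by
    rw [mem_preimage, mem_ball_zero_iff]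
    linarith [hC j ω hω, hM (mem_range_self j), le_max_left M 0]⟩
  filter_upwards [lens_ev (hO.mem_nhdsSet.2 hs)] with η h ω hω
  have := h hω
  exact ⟨this.1, (mem_ball_zero_iff.1 this.2).le⟩
lemma fsep : ∀ᶠ η in nhR, ∀ j, ∀ ω ∈ lens η, ∀ t ∈ frontier G, P.c * |ω.im| ≤ ‖t - P.T j ω‖ := by
  obtain ⟨C, hC, h1⟩ := P.dbd
  have hc := P.c_pos
  have h2 : ∀ j i, ∃ c : ℝ, 0 < c ∧ (i ≠ j → ∀ x ∈ IcU, ∀ y ∈ IcU, c * qd(x) ≤ ‖P.T j x - P.T i y‖) := fun j i => by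
    by_cases h : i = j
    · exact ⟨1, one_pos, fun h' => absurd h h'⟩
    · obtain ⟨c, hc, h'⟩ := P.sep0 h; exact ⟨c, hc, fun _ => h'⟩
  choose d hd h2 using h2
  have h3 : ∀ᶠ η in nhR, ∀ j i, (P.c + C) * η < d j i := by
    refine eventually_all.2 fun j => eventually_all.2 fun i => ?_
    filter_upwards [nhdsWithin_le_nhds (Iio_mem_nhds (show 0 < d j i / (P.c + C) from div_pos (hd _ _) (by positivity)))] with η h
    have : η < d j i / (P.c + C) := h
    rw [lt_div_iff₀ (by positivity)] at this; linarith
  filter_upwards [h1, h3, self_mem_nhdsWithin] with η h4 h5 hη j ω hω t ht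
  have hη : 0 < η := hη
  have hre := lens_re hη hω
  obtain ⟨i, y, hy, rfl⟩ := P.cov t ht
  have e : ω - (ω.re : ℂ) = (ω.im : ℂ) * I := by apply Complex.ext <;> simp
  by_cases hij : i = j
  · subst hij
    refine le_trans ?_ (P.bil i y (P.Nx hy) ω (h4 i ω hω).1)
    gcongr
    rw [norm_sub_rev]
    simpa using abs_im_le_norm (ω - (y:ℂ))
  · have a1 := h2 j i hij ω.re hre y hy
    have a2 : ‖P.T j ω - P.T j ω.re‖ ≤ C * |ω.im| := by
      have := (lens_convex hη).norm_image_sub_le_of_norm_deriv_le (f := P.T j) (C := C) (fun w hw => P.dAt (h4 j w hw).1) (fun w hw => (h4 j w hw).2)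
        (ofReal_mem_lens hη.le hre) hω
      rwa [e, norm_mul, norm_I, mul_one, norm_real, Real.norm_eq_abs] at this
    have a3 : ‖P.T j ω.re - P.T i y‖ ≤ ‖P.T i y - P.T j ω‖ + ‖P.T j ω - P.T j ω.re‖ := by
      rw [norm_sub_rev]; exact norm_sub_le_norm_sub_add_norm_sub _ _ _
    have a4 : |ω.im| ≤ η * (ω.re * (1 - ω.re)) := hω
    have a5 : 0 ≤ ω.re * (1 - ω.re) := mul_nonneg hre.1 (by linarith [hre.2])
    have a6 := mul_le_mul_of_nonneg_left a4 (by positivity : 0 ≤ P.c + C)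
    have a7 := mul_le_mul_of_nonneg_right (h5 j i).le a5
    linarith
def half (s η : ℝ) : Set ℂ := {ω | ω ∈ lens η ∧ 0 < s * ω.im}
lemma half_convex (s : ℝ) (hη : 0 < η) : Convex ℝ (half s η) := by
  refine (lens_convex hη).inter ?_
  exact (convex_Ioi (0:ℝ)).linear_preimage (s • Complex.imLm)
lemma half_dich (s : ℝ) : ∀ᶠ η in nhR, ∀ j, P.T j '' half s η ⊆ G ∨ ∀ ω ∈ half s η, P.T j ω ∉ closure G := by
  obtain ⟨C, hC, h1⟩ := P.dbd
  filter_upwards [h1, P.fsep, self_mem_nhdsWithin] with η h1 h2 hη j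
  have hS : IsPreconnected (P.T j '' half s η) := ((half_convex s hη).isPreconnected).image _
    ((P.hol j).continuousOn.mono fun ω hω => (h1 j ω hω.1).1)
  rcases dich hS (by
    rintro _ ⟨ω, hω, rfl⟩ hf
    have := h2 j ω hω.1 _ hf
    rw [sub_self, norm_zero] at this
    have h0 : ω.im ≠ 0 := fun h => by have := hω.2; simp [h] at this
    have := mul_pos P.c_pos (abs_pos.2 h0)
    linarith) P.G_open with h | h
  · exact Or.inl h
  · exact Or.inr fun ω hω => h _ ⟨ω, hω, rfl⟩
end Pre
lemma polar (η : ℝ) : (1 + η * I : ℂ) = (√(1 + η ^ 2) : ℝ) * exp ((arctanR η : ℝ) * I) := by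
  have h : (√(1 + η ^ 2) : ℂ) ≠ 0 := by exact_mod_cast (Real.sqrt_pos.2 (by positivity)).ne'
  rw [exp_mul_I, ← ofReal_cos, ← ofReal_sin, Real.cos_arctan, Real.sin_arctan]
  push_cast
  field_simp
lemma slope_tend {f : ℝ → ℂ} {p d : ℂ} {k t : ℝ} (hf : HasDerivAt f (d * (1 + t * I)) 0) (hd : d = p * k) :
    Tendsto (fun x : ℝ => (f x - f 0) / x) nhR (𝓝 (p * ((k * √(1 + t ^ 2) : ℝ) * exp ((arctanR t : ℝ) * I)))) := by
  have h := hf.tendsto_slope.mono_left (nhdsWithin_mono 0 fun x (hx : 0 < x) => hx.ne')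
  have e : d * (1 + t * I) = p * ((k * √(1 + t ^ 2) : ℝ) * exp ((arctanR t : ℝ) * I)) := by
    rw [polar, hd]; push_cast; ring
  rw [← e]
  refine h.congr fun x => ?_
  rw [slope_def_module, sub_zero, real_smul, div_eq_inv_mul]; push_cast; rfl
lemma corner_item {q p : ℂ} {E C θ θ1 s : ℝ} {Z : ℝ → ℂ} (l0 : 0 < lam) (l2 : lam < 2) (hr : 0 < r) (hC : 0 < C) (hp : ‖p‖ = 1) (hs : 0 < s)
    (h1 : lam * π / 2 ≤ θ) (h2 : θ ≤ E - lam * π / 2) (h3 : |θ1 - θ| < lam * π / 2)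
    (hZ : Tendsto (fun x : ℝ => (Z x - q) / x) nhR (𝓝 (p * (s * exp (θ1 * I)))))
    {Q : ℂ → Prop} (hQ : ∀ z ∈ CSc q p E C r, Q z) : ∃ (u : ℂ) (b : ℝ), ‖u‖ = 1 ∧ 0 < b ∧ (∀ w ∈ Sec lam, Q (Zl q u b w)) ∧ Q (q + u * b) ∧
    ∃ δ c1 C1 x1 : ℝ, 0 < δ ∧ 0 < c1 ∧ 0 < C1 ∧ 0 < x1 ∧ x1 < 1 ∧ ∀ x ∈ Ioo 0 x1, ∃ w : ℂ,
      c1 * x ≤ ‖w‖ ∧ ‖w‖ ≤ C1 * x ∧ |arg w| ≤ lam * π / 2 - δ ∧ Zl q u b w = Z x := by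
  have hπ := Real.pi_pos
  have hl : 0 < lam * π / 2 := by positivity
  have hlp : lam * π / 2 < π := by nlinarith
  have hsin := Real.sin_pos_of_pos_of_lt_pi hl hlp
  have hp0 : p ≠ 0 := norm_pos_iff.1 (by rw [hp]; exact one_pos)
  have b1 : ∀ᶠ b : ℝ in nhR, q + p * exp (θ * I) * (b:ℂ) ∈ CSc q p E C r := by
    refine branch (Z := fun b : ℝ => q + p * exp (θ * I) * (b:ℂ)) (s := 1) (θ := θ) hr one_pos (by linarith) (by linarith) hp0 ?_
    refine tendsto_const_nhds.congr' ?_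
    filter_upwards [self_mem_nhdsWithin] with x hx
    have : (x:ℂ) ≠ 0 := by exact_mod_cast (ne_of_gt hx)
    field_simp; simp
  have b2 : ∀ᶠ b in nhR, b < sinR (lam * π / 2) / C := nhdsWithin_le_nhds (Iio_mem_nhds (by positivity))
  have b3 : ∀ᶠ b in nhR, b < r * sinR (lam * π / 2) := nhdsWithin_le_nhds (Iio_mem_nhds (by positivity))
  have b4 : ∀ᶠ b in nhR, 0 < b := self_mem_nhdsWithin
  obtain ⟨b, b1, b2, b3, b4⟩ := (b1.and (b2.and (b3.and b4))).exists
  rw [lt_div_iff₀ hC] at b2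
  refine ⟨p * exp (θ * I), b, by rw [norm_mul, hp, norm_exp_ofReal_mul_I]; norm_num, b4, fun w hw => hQ _ (lens_CSc l0 l2 b4 (by rw [lt_div_iff₀ b4]; linarith) b3 h1 h2 w hw),
    hQ _ b1, path_w hlp hs b4 hp0 h3 hZ⟩
namespace Pre
variable (P : Pre G ν lam) (j : Fin (P.n + 1))
lemma startT (t : ℝ) : ∃ s : ℝ, 0 < s ∧ Tendsto (fun x : ℝ => (P.T j (pth t x) - P.T j 0) / x) nhR (𝓝 (P.Ah j * (s * exp ((arctanR t : ℝ) * I)))) := by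
  refine ⟨‖deriv (P.T j) 0‖ * √(1 + t ^ 2), mul_pos (P.dpos P.N0) (Real.sqrt_pos.2 (by positivity)), ?_⟩
  have h : HasDerivAt (P.T j) (deriv (P.T j) 0) (pth t 0) := by rw [pth_at0]; exact (P.dAt P.N0).hasDerivAt
  have := slope_tend ((h.comp (𝕜 := ℝ) (0:ℝ) (pth_deriv t 0)).congr_deriv (g' := deriv (P.T j) 0 * (1 + t * I)) (by rw [dpth_eq]; simp)) (P.Ah_mul j)
  simpa [pth_at0] using this
lemma endT (t : ℝ) : ∃ s : ℝ, 0 < s ∧ Tendsto (fun x : ℝ => (P.T j (pth t (1 - x)) - P.T j 1) / x) nhR (𝓝 (P.Bh j * (s * exp ((arctanR (-t) : ℝ) * I)))) := by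
  refine ⟨‖deriv (P.T j) 1‖ * √(1 + (-t) ^ 2), mul_pos (P.dpos P.N1) (Real.sqrt_pos.2 (by positivity)), ?_⟩
  have h : HasDerivAt (P.T j) (deriv (P.T j) 1) (pth t (1 - 0)) := by rw [sub_zero, pth_at1]; exact (P.dAt P.N1).hasDerivAt
  have h2 : HasDerivAt (fun x : ℝ => pth t (1 - x)) (-dpth t (1 - 0)) 0 :=
    ((pth_deriv t (1 - 0)).scomp (0:ℝ) ((hasDerivAt_id (0:ℝ)).const_sub 1)).congr_deriv (by simp)
  have := slope_tend ((h.comp (𝕜 := ℝ) (0:ℝ) h2).congr_deriv (f' := _) (g' := -deriv (P.T j) 1 * (1 + (-t : ℝ) * I)) (by rw [dpth_eq]; push_cast; ring)) (P.Bh_mul j)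
  simpa [pth_at1] using this
lemma two {q p p' : ℂ} {E C a s s' : ℝ} {Z Z' : ℝ → ℂ} (hr : 0 < r) (ha : 0 < a) (haE : a < E) (hp : ‖p‖ = 1) (hp' : p' = p * exp (E * I)) (hs : 0 < s) (hs' : 0 < s')
    (hZ : Tendsto (fun x : ℝ => (Z x - q) / x) nhR (𝓝 (p * (s * exp (a * I)))))
    (hZ' : Tendsto (fun x : ℝ => (Z' x - q) / x) nhR (𝓝 (p' * (s' * exp ((-a : ℝ) * I))))) :
    (∀ᶠ x in nhR, Z x ∈ CSc q p E C r ∧ Z' x ∈ CSc q p E C r) ∧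
    Tendsto (fun x : ℝ => (Z' x - q) / x) nhR (𝓝 (p * (s' * exp ((E - a : ℝ) * I)))) := by
  have hp0 : p ≠ 0 := norm_pos_iff.1 (by rw [hp]; exact one_pos)
  have e : p' * (s' * exp ((-a : ℝ) * I)) = p * (s' * exp ((E - a : ℝ) * I)) := by
    rw [hp', show ((E - a : ℝ) : ℂ) * I = E * I + (-a : ℝ) * I by push_cast; ring, exp_add]; ring
  rw [e] at hZ'
  exact ⟨(branch hr hs ha haE hp0 hZ).and (branch hr hs' (by linarith) (by linarith) hp0 hZ'), hZ'⟩
def Cor (E C r : ℝ) : Prop := 0 < C ∧ 0 < r ∧ lam * π ≤ E ∧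
  P.Ah (j + 1) = P.Bh j * exp (E * I) ∧ ∀ z ∈ CSc (P.T (j + 1) 0) (P.Bh j) E C r, z ∉ closure G
lemma cor_two {j} {E C : ℝ} (h : P.Cor j E C r) (hη : 0 < η) (ha : arctanR η < lam * π) : ∃ s s' : ℝ, 0 < s ∧ 0 < s' ∧
    (∀ᶠ x in nhR, P.T j (pth (-η) (1 - x)) ∈ CSc (P.T (j + 1) 0) (P.Bh j) E C r ∧ P.T (j + 1) (pth (-η) x) ∈ CSc (P.T (j + 1) 0) (P.Bh j) E C r) ∧
    Tendsto (fun x : ℝ => (P.T j (pth (-η) (1 - x)) - P.T (j + 1) 0) / x) nhR (𝓝 (P.Bh j * (s * exp ((arctanR η : ℝ) * I)))) ∧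
    Tendsto (fun x : ℝ => (P.T (j + 1) (pth (-η) x) - P.T (j + 1) 0) / x) nhR (𝓝 (P.Bh j * (s' * exp ((E - arctanR η : ℝ) * I)))) := by
  obtain ⟨hC, hr, hE, h1, h2⟩ := h
  obtain ⟨s, hs, hZ⟩ := P.endT j (-η)
  obtain ⟨s', hs', hZ'⟩ := P.startT (j + 1) (-η)
  rw [neg_neg, P.join] at hZ
  rw [Real.arctan_neg] at hZ'
  obtain ⟨h3, h4⟩ := two (C := C) hr (Real.arctan_pos.2 hη) (ha.trans_le hE) (P.Bh1 j) h1 hs hs' hZ hZ'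
  exact ⟨s, s', hs, hs', h3, hZ, h4⟩
def Low (η : ℝ) (j : Fin (P.n + 1)) (s : ℝ) : Prop := ∀ ω ∈ half s η, P.T j ω ∉ closure G
def Or (η : ℝ) : Prop := ∀ j, P.Low η j (-1) ∧ P.T j '' half 1 η ⊆ G ∧ ∃ E C r, P.Cor j E C r
lemma pth_half {s : ℝ} (hη : 0 < η) (hs : s ^ 2 = 1) (hx : x ∈ IoU) : pth (s * η) x ∈ half s η := by
  have hs' : |s| = 1 := by rw [← abs_one]; exact sq_eq_sq_iff_abs_eq_abs _ _ |>.1 (by rw [hs, one_pow])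
  refine ⟨pth_mem (by rw [abs_mul, hs', one_mul, abs_of_pos hη]) ⟨hx.1.le, hx.2.le⟩, ?_⟩
  have : 0 < η * qd(x) := mul_pos hη (mul_pos hx.1 (by linarith [hx.2]))
  simp only [pth]; nlinarith
lemma ev01 : ∀ᶠ x in nhR, x ∈ IoU := Ioo_mem_nhdsGT one_pos
lemma lens_nhd (hη : 0 < η) (hx : x ∈ IoU) : lens η ∈ 𝓝 (x:ℂ) := by
  have : ∀ᶠ ω in 𝓝 (x:ℂ), |ω.im| < η * (ω.re * (1 - ω.re)) :=
    (by fun_prop : Continuous fun ω : ℂ => |ω.im|).continuousAt.eventually_lt (by fun_prop : Continuous fun ω : ℂ => η * (ω.re * (1 - ω.re))).continuousAt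
      (by simpa using mul_pos hη (qpos hx))
  exact this.mono fun ω h => h.le
lemma img_nhd (hη : 0 < η) (hx : x ∈ IoU) : P.T j '' lens η ∈ 𝓝 (P.T j x) := by
  have hN := P.Nx ⟨hx.1.le, hx.2.le⟩
  have h := ((P.hol j).analyticAt (P.N_open.mem_nhds hN)).hasStrictDerivAt
  rw [← h.map_nhds_eq (norm_pos_iff.1 (P.dpos hN))]
  exact image_mem_map (lens_nhd hη hx)
lemma tri (hη : 0 < η) (hω : ω ∈ lens η) : P.T j ω ∈ frontier G ∨ ω ∈ half 1 η ∨ ω ∈ half (-1) η := by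
  rcases lt_trichotomy ω.im 0 with h | h | h
  · exact Or.inr (Or.inr ⟨hω, by linarith⟩)
  · left
    have e : ω = (ω.re : ℂ) := by apply Complex.ext <;> simp [h]
    rw [e]; exact P.onL j _ (lens_re hη hω)
  · exact Or.inr (Or.inl ⟨hω, by linarith⟩)
lemma not_both (hη : 0 < η) (j) : ¬ (P.Low η j 1 ∧ P.Low η j (-1)) := by
  rintro ⟨h1, h2⟩
  have hx : (1/2 : ℝ) ∈ IoU := by norm_num
  obtain ⟨_, ⟨ω, hω, rfl⟩, hG⟩ := mem_closure_iff_nhds.1 (frontier_subset_closure (P.onL j _ ⟨hx.1.le, hx.2.le⟩)) _ (P.img_nhd j hη hx)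
  rcases P.tri j hη hω with h | h | h
  · exact (P.G_open.frontier_eq ▸ h).2 hG
  · exact h1 _ h (subset_closure hG)
  · exact h2 _ h (subset_closure hG)
open Fin.CommRing in
lemma fin_all {n : ℕ} {Q : Fin (n + 1) → Prop} (j0) (h0 : Q j0) (h : ∀ j, Q j → Q (j + 1)) (j) : Q j := by
  have : ∀ k : ℕ, Q (j0 + (k : Fin (n + 1))) := fun k => by
    induction k with
    | zero => simpa using h0
    | succ k ih => have := h _ ih; rwa [add_assoc, ← Nat.cast_succ] at this
  simpa using this (j - j0).val
lemma or_dich : ∀ᶠ η in nhR, P.Or η ∨ ∀ j, P.Low η j 1 := by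
  have ha : ∀ᶠ η in nhR, arctanR η < lam * π := nhdsWithin_le_nhds
    (Real.continuous_arctan.continuousAt.eventually_lt continuousAt_const (by simpa using mul_pos P.l0 Real.pi_pos))
  filter_upwards [P.half_dich 1, P.half_dich (-1), ha, self_mem_nhdsWithin] with η d1 d2 ha hη
  have hη : 0 < η := hη
  have o : ∀ {s : ℝ}, s ^ 2 = 1 → (∀ j, P.T j '' half s η ⊆ G ∨ P.Low η j s) → ∀ {j} {x : ℝ}, x ∈ IoU → P.T j (pth (s * η) x) ∉ closure G → P.Low η j s :=
    fun hs d j x hx h => (d j).resolve_left fun h' => h (subset_closure (h' ⟨_, pth_half hη hs hx, rfl⟩))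
  have key : ∀ j, (P.Low η j 1 ∧ P.Low η (j + 1) 1) ∨ (P.Low η j (-1) ∧ P.Low η (j + 1) (-1) ∧ ∃ E C r, P.Cor j E C r) := fun j => by
    obtain ⟨E, C, r, hC, hr, hE, -, h | h⟩ := P.corner j
    · left
      obtain ⟨s, hs, hZ⟩ := P.startT (j + 1) η
      obtain ⟨s', hs', hZ'⟩ := P.endT j η
      rw [P.join, Real.arctan_neg] at hZ'
      obtain ⟨h3, -⟩ := two (C := C) hr (Real.arctan_pos.2 hη) (ha.trans_le hE) (P.Ah1 _) h.1 hs hs' hZ hZ'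
      obtain ⟨x, ⟨h4, h5⟩, hx⟩ := (h3.and ev01).exists
      exact ⟨o (by norm_num) d1 (x := 1 - x) ⟨by linarith [hx.2], by linarith [hx.1]⟩ (by rw [one_mul]; exact h.2 _ h5), o (by norm_num) d1 hx (by rw [one_mul]; exact h.2 _ h4)⟩
    · right
      have hc : P.Cor j E C r := ⟨hC, hr, hE, h⟩
      obtain ⟨s, s', -, -, h3, -⟩ := P.cor_two hc hη ha
      obtain ⟨x, ⟨h4, h5⟩, hx⟩ := (h3.and ev01).exists
      exact ⟨o (by norm_num) d2 (x := 1 - x) ⟨by linarith [hx.2], by linarith [hx.1]⟩ (by rw [neg_one_mul]; exact h.2 _ h4), o (by norm_num) d2 hx (by rw [neg_one_mul]; exact h.2 _ h5), _, _, _, hc⟩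
  rcases key 0 with h0 | h0
  · right
    exact fin_all 0 h0.1 fun j hj => (key j).elim (fun h => h.2) fun h => absurd ⟨hj, h.1⟩ (P.not_both hη j)
  · left
    have := fin_all (Q := fun j => P.Low η j (-1)) 0 h0.1 fun j hj => (key j).elim (fun h => absurd ⟨h.1, hj⟩ (P.not_both hη j)) fun h => h.2.1
    refine fun j => ⟨this j, (d1 j).resolve_right fun h => P.not_both hη j ⟨h, this j⟩, ?_⟩
    exact (key j).elim (fun h => absurd ⟨h.1, this j⟩ (P.not_both hη j)) fun h => h.2.2
lemma seed (hη : 0 < η) (ho : P.Or η) : ∃ j, ∃ ω ∈ half (-1) η, PA (closure G) fun z => (z - P.T j ω)⁻¹ := by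
  obtain ⟨g, hg⟩ := P.G_ne
  have hinf : (im '' G).Infinite := infinite_of_mem_nhds g.im ((Complex.isOpenMap_im _ P.G_open).mem_nhds ⟨g, hg, rfl⟩)
  obtain ⟨y, ⟨g, hg, rfl⟩, hy⟩ := hinf.exists_notMem_finite (Set.finite_range fun j => (P.T j 0).im)
  have hK : IsCompact (closure G ∩ {z | z.im = g.im}) := P.G_bdd.isCompact_closure.inter_right (isClosed_eq continuous_im continuous_const)
  obtain ⟨z, ⟨hz1, hz2⟩, hz3⟩ := hK.exists_isMaxOn ⟨g, subset_closure hg, rfl⟩ continuous_re.continuousOn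
  have hout : ∀ t : ℝ, 0 < t → z + t ∉ closure G := fun t ht h => by
    have := hz3 (a := z + t) ⟨h, by simpa using hz2⟩
    simp at this; linarith
  have hc : Tendsto (fun t : ℝ => z + t) nhR (𝓝 z) := by
    have : Continuous fun t : ℝ => z + t := by fun_prop
    have := this.tendsto 0
    simp only [ofReal_zero, add_zero] at this
    exact this.mono_left nhdsWithin_le_nhds
  have hfr : z ∈ frontier G := by
    rw [P.G_open.frontier_eq]
    refine ⟨hz1, fun h => ?_⟩
    obtain ⟨t, h1, h2⟩ := ((hc.eventually (P.G_open.mem_nhds h)).and self_mem_nhdsWithin).exists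
    exact hout t h2 (subset_closure h1)
  obtain ⟨j, x, hx, hzx⟩ := P.cov z hfr
  have hx0 : x ∈ IoU := by
    refine ⟨lt_of_le_of_ne hx.1 ?_, lt_of_le_of_ne hx.2 ?_⟩
    · rintro rfl; exact hy ⟨j, by simp only; rw [← hz2, ← hzx]; simp⟩
    · rintro rfl; exact hy ⟨j + 1, by simp only; rw [← hz2, ← hzx, ← P.join]; simp⟩
  have hn := P.img_nhd j hη hx0
  rw [hzx] at hn
  obtain ⟨t, ⟨ω, hω, ht1⟩, ht2⟩ := ((hc.eventually hn).and self_mem_nhdsWithin).exists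
  have ht0 : 0 < t := ht2
  have hl : ω ∈ half (-1) η := by
    rcases P.tri j hη hω with h | h | h
    · exact absurd (frontier_subset_closure h) (by rw [ht1]; exact hout t ht0)
    · exact absurd (subset_closure ((ho j).2.1 ⟨ω, h, rfl⟩)) (by rw [ht1]; exact hout t ht0)
    · exact h
  refine ⟨j, ω, hl, ?_⟩
  rw [ht1]
  obtain ⟨R, hR⟩ := pa_far P.G_bdd.closure
  have hS : IsPreconnected ((fun t : ℝ => z + t) '' Ioi 0) := isPreconnected_Ioi.image _ (by fun_prop)
  refine pa_conn P.G_bdd.closure isClosed_closure hS (by rintro _ ⟨t, ht, rfl⟩; exact hout t ht) (s0 := z + ((|R| + ‖z‖ + 1 : ℝ) : ℂ))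
    ⟨_, by simp only [mem_Ioi]; positivity, rfl⟩ (hR _ ?_) _ ⟨t, ht0, rfl⟩
  have := norm_sub_le_norm_add ((|R| + ‖z‖ + 1 : ℝ) : ℂ) z
  rw [norm_real, Real.norm_of_nonneg (by positivity), add_comm (_ : ℂ) z] at this
  linarith [le_abs_self R]
lemma pa_all (hη : 0 < η) (ho : P.Or η) (hN : lens η ⊆ P.N) (ha : arctanR η < lam * π) :
    (∀ j, ∀ ω ∈ half (-1) η, PA (closure G) fun z => (z - P.T j ω)⁻¹) ∧
    ∀ j E C r, P.Cor j E C r → ∀ b ∈ CSc (P.T (j + 1) 0) (P.Bh j) E C r, PA (closure G) fun z => (z - b)⁻¹ := by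
  have hb := P.G_bdd.closure
  have c1 : ∀ j, ∀ ω0 ∈ half (-1) η, (PA (closure G) fun z => (z - P.T j ω0)⁻¹) → ∀ ω ∈ half (-1) η, PA (closure G) fun z => (z - P.T j ω)⁻¹ := fun j ω0 h0 hp ω hω =>
    pa_conn hb isClosed_closure (((half_convex (-1) hη).isPreconnected).image (P.T j) ((P.hol j).continuousOn.mono fun ω hω => hN hω.1))
      (by rintro _ ⟨ω, hω, rfl⟩; exact (ho j).1 ω hω) ⟨ω0, h0, rfl⟩ hp _ ⟨ω, hω, rfl⟩
  have c2 : ∀ j E C r, P.Cor j E C r → (∀ ω ∈ half (-1) η, PA (closure G) fun z => (z - P.T j ω)⁻¹) →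
      (∀ b ∈ CSc (P.T (j + 1) 0) (P.Bh j) E C r, PA (closure G) fun z => (z - b)⁻¹) ∧ ∀ ω ∈ half (-1) η, PA (closure G) fun z => (z - P.T (j + 1) ω)⁻¹ := fun j E C r hc hj => by
    obtain ⟨s, s', -, -, h3, -⟩ := P.cor_two hc hη ha
    obtain ⟨x, ⟨h4, h5⟩, hx⟩ := (h3.and ev01).exists
    have e := pth_half (s := -1) hη (by norm_num) hx
    have e' := pth_half (s := -1) (x := 1 - x) hη (by norm_num) ⟨by linarith [hx.2], by linarith [hx.1]⟩
    rw [neg_one_mul] at e e'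
    have h6 := pa_conn hb isClosed_closure (CSc_conn _ _ _ _ _) hc.2.2.2.2 h4 (hj _ e')
    exact ⟨h6, c1 _ _ e (h6 _ h5)⟩
  obtain ⟨j0, ω0, h0, hp⟩ := P.seed hη ho
  have all := fin_all (Q := fun j => ∀ ω ∈ half (-1) η, PA (closure G) fun z => (z - P.T j ω)⁻¹) j0 (c1 j0 ω0 h0 hp) fun j hj => by
    obtain ⟨E, C, r, h⟩ := (ho j).2.2
    exact (c2 j E C r h hj).2
  exact ⟨all, fun j E C r h => (c2 j E C r h (all j)).1⟩
lemma sq_ev : ∀ᶠ η in nhR, ∀ j, ∀ ω ∈ lens η, 0 < (deriv (P.T j) ω * (starRingEnd ℂ) (deriv (P.T j) ((starRingEnd ℂ) ω))).re := by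
  refine eventually_all.2 fun j => ?_
  have hM : IsOpen (P.N ∩ (starRingEnd ℂ) ⁻¹' P.N) := P.N_open.inter (P.N_open.preimage continuous_conj)
  have hc : ContinuousOn (fun ω => (deriv (P.T j) ω * (starRingEnd ℂ) (deriv (P.T j) ((starRingEnd ℂ) ω))).re) (P.N ∩ (starRingEnd ℂ) ⁻¹' P.N) :=
    continuous_re.comp_continuousOn (((P.dcont j).mono inter_subset_left).mul
      (continuous_conj.comp_continuousOn ((P.dcont j).comp continuous_conj.continuousOn fun ω h => h.2)))
  have hO := hc.isOpen_inter_preimage hM isOpen_Ioi (t := Ioi 0)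
  have hs : seg ⊆ (P.N ∩ (starRingEnd ℂ) ⁻¹' P.N) ∩ (fun ω => (deriv (P.T j) ω * (starRingEnd ℂ) (deriv (P.T j) ((starRingEnd ℂ) ω))).re) ⁻¹' Ioi 0 := by
    rintro _ ⟨x, hx, rfl⟩
    have h := P.Nx hx
    refine ⟨⟨h, by simpa using h⟩, ?_⟩
    simp only [mem_preimage, conj_ofReal, mul_conj, ofReal_re, mem_Ioi]
    exact normSq_pos.2 (norm_pos_iff.1 (P.dpos h))
  filter_upwards [lens_ev (hO.mem_nhdsSet.2 hs)] with η h ω hω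
  exact (h hω).2
lemma av_ev (hF : IsCompact F) (hFG : F ⊆ G) : ∀ᶠ η in nhR, ∀ j, ∀ ω ∈ lens η, P.T j ω ∉ F := by
  refine eventually_all.2 fun j => ?_
  have hO := (P.hol j).continuousOn.isOpen_inter_preimage P.N_open hF.isClosed.isOpen_compl
  have hs : seg ⊆ P.N ∩ P.T j ⁻¹' Fᶜ := by
    rintro _ ⟨x, hx, rfl⟩
    exact ⟨P.Nx hx, fun h => (P.G_open.frontier_eq ▸ P.onL j x hx).2 (hFG h)⟩
  filter_upwards [lens_ev (hO.mem_nhdsSet.2 hs)] with η h ω hω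
  exact (h hω).2
theorem toDat (ho : ∃ᶠ η in nhR, P.Or η) (hF : IsCompact F) (hFG : F ⊆ G) : Nonempty (Dat G ν lam F) := by
  obtain ⟨C, hC, hb⟩ := P.dbd
  have ha : ∀ᶠ η in nhR, arctanR η < lam * π := nhdsWithin_le_nhds
    (Real.continuous_arctan.continuousAt.eventually_lt continuousAt_const (by simpa using mul_pos P.l0 Real.pi_pos))
  have hp : ∀ᶠ η in nhR, η ∈ IoU := ev01
  obtain ⟨η, ho, hb, ha, hsep, hsq, hav, hη, hη1⟩ := (ho.and_eventually (hb.and (ha.and (P.fsep.and (P.sq_ev.and ((P.av_ev hF hFG).and hp)))))).exists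
  have hN : lens η ⊆ P.N := fun ω hω => (hb 0 ω hω).1
  obtain ⟨hpa1, hpa2⟩ := P.pa_all hη ho hN ha
  have l0 := P.l0
  have hat := Real.arctan_pos.2 hη
  refine ⟨{ m := P.n + 1, m_pos := Nat.succ_pos _, τ := P.T, N := P.N, η := η, c := P.c, C := C, G_open := P.G_open, G_conn := P.G_conn, G_bdd := P.G_bdd,
            N_open := P.N_open, η_pos := hη, η_le := hη1.le, c_pos := P.c_pos, C_pos := hC, lens_sub := hN, hol := P.hol, bil := P.bil,
            dbd := fun j ω hω => (hb j ω hω).2, up := fun j ω hω h => (ho j).2.1 ⟨ω, ⟨hω, by linarith⟩, rfl⟩,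
            lo := fun j ω hω h => (ho j).1 ω ⟨hω, by linarith⟩, ext := fun j ω hω h => hpa1 j ω ⟨hω, by linarith⟩,
            sep := hsep, onL := P.onL, disj := P.disj, meas := P.meas, chain := fun f => ?_, sq := hsq, F_sub := hFG, F_comp := hF, avoid := hav, corner := ?_ }⟩
  · rw [Finset.sum_sub_distrib, sub_eq_zero]
    simp_rw [P.join]
    exact Equiv.sum_comp (Equiv.addRight (1 : Fin (P.n + 1))) fun j => f (P.T j 0)
  · have key : ∀ j, ∃ E C r, P.Cor j E C r := fun j => (ho j).2.2
    rintro j e (rfl | rfl)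
    · obtain ⟨k, rfl⟩ : ∃ k, j = k + 1 := ⟨j - 1, by simp⟩
      obtain ⟨E, C, r, h⟩ := key k
      obtain ⟨s, s', hs, hs', -, -, hZ⟩ := P.cor_two h hη ha
      obtain ⟨u, b, h1, h2, h3, h4, δ, c1, C1, x1, g1, g2, g3, g4, g5, g6⟩ := corner_item (θ := E - lam * π / 2) (Q := fun b => b ∉ closure G ∧ PA (closure G) fun z => (z - b)⁻¹) l0 P.l2 h.2.1 h.1 (P.Bh1 k) hs'
        (by linarith [h.2.2.1]) le_rfl (by rw [abs_lt]; constructor <;> linarith) hZ fun z hz => ⟨h.2.2.2.2 z hz, hpa2 k E C r h z hz⟩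
      refine ⟨u, b, h1, h2, by simpa using h3, by simpa using h4.1, by simpa using h4.2, δ, c1, C1, x1, g1, g2, g3, g4, g5, fun x hx => ?_⟩
      simpa [abs_of_pos hx.1] using g6 x hx
    · obtain ⟨E, C, r, h⟩ := key j
      obtain ⟨s, s', hs, hs', -, hZ, -⟩ := P.cor_two h hη ha
      obtain ⟨u, b, h1, h2, h3, h4, δ, c1, C1, x1, g1, g2, g3, g4, g5, g6⟩ := corner_item (θ := lam * π / 2) (Q := fun b => b ∉ closure G ∧ PA (closure G) fun z => (z - b)⁻¹) l0 P.l2 h.2.1 h.1 (P.Bh1 j) hs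
        le_rfl (by linarith [h.2.2.1]) (by rw [abs_lt]; constructor <;> linarith) hZ fun z hz => ⟨h.2.2.2.2 z hz, hpa2 j E C r h z hz⟩
      rw [← P.join] at h3 h4 g6
      refine ⟨u, b, h1, h2, by simpa using h3, by simpa using h4.1, by simpa using h4.2, δ, c1, C1, x1, g1, g2, g3, g4, g5, fun x hx => ?_⟩
      rw [abs_of_pos (by linarith [hx.2])]
      simpa using g6 x hx
lemma map_dens {f : ℝ → ℂ} (hf : ContinuousOn f (Icc 0 1)) (d : ℝ → ENNReal) {s : Set ℂ} (hs : MeasurableSet s) :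
    Measure.map f ((voU).withDensity d) s = ∫⁻ x in IcU, (f ⁻¹' s).indicator d x := by
  have hm : AEMeasurable f voU := hf.aemeasurable measurableSet_Icc
  rw [Measure.map_apply_of_aemeasurable (hm.mono_ac (withDensity_absolutelyContinuous _ _)) hs, withDensity_apply', lintegral_indicator₀ (hm.nullMeasurableSet_preimage hs)]
lemma map_rev {T : ℂ → ℂ} {N : Set ℂ} (hs : seg ⊆ N) (hT : DifferentiableOn ℂ T N) :
    Measure.map (fun x : ℝ => T (1 - x)) ((voU).withDensity (fun x => ‖deriv (fun ω => T (1 - ω)) x‖ₑ)) =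
    Measure.map (fun x : ℝ => T x) ((voU).withDensity (fun x => ‖deriv T x‖ₑ)) := by
  have hc : ContinuousOn (fun x : ℝ => T x) (Icc 0 1) := hT.continuousOn.comp continuous_ofReal.continuousOn fun _ hx => hs (mem_seg hx)
  have hc' : ContinuousOn (fun x : ℝ => T (1 - x)) (Icc 0 1) := by
    have := hc.comp (f := fun x : ℝ => 1 - x) (by fun_prop) (s := Icc 0 1) fun x hx => ⟨by linarith [hx.2], by linarith [hx.1]⟩
    simpa [Function.comp_def] using this
  ext s hs
  rw [map_dens hc' _ hs, map_dens hc _ hs]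
  have h := lintegral_image_eq_lintegral_abs_deriv_mul (s := IcU) (f := fun x => 1 - x) (f' := fun _ => -1) measurableSet_Icc (fun x _ => ((hasDerivAt_id x).const_sub 1).hasDerivWithinAt)
    (fun x _ y _ h => by simpa using h) (((fun x : ℝ => T x) ⁻¹' s).indicator fun x : ℝ => ‖deriv T x‖ₑ)
  rw [image_const_sub_Icc, sub_self, sub_zero] at h
  rw [h]
  refine lintegral_congr fun x => ?_
  have e : (x ∈ (fun x : ℝ => T (1 - x)) ⁻¹' s) = (1 - x ∈ (fun x : ℝ => T x) ⁻¹' s) := by simp only [mem_preimage]; push_cast; rfl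
  simp only [indicator, deriv_comp_const_sub, enorm_neg, abs_neg, abs_one, ENNReal.ofReal_one, one_mul]
  by_cases h : 1 - x ∈ (fun x : ℝ => T x) ⁻¹' s
  · rw [if_pos h, if_pos (e ▸ h)]; push_cast; rfl
  · rw [if_neg h, if_neg (e ▸ h)]
def rev : Pre G ν lam where
  n := P.n
  T j ω := P.T (-j) (1 - ω)
  N := (fun ω => 1 - ω) ⁻¹' P.N
  c := P.c
  l0 := P.l0
  l2 := P.l2
  G_open := P.G_open
  G_conn := P.G_conn
  G_ne := P.G_ne
  G_bdd := P.G_bdd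
  N_open := P.N_open.preimage (by fun_prop)
  seg_sub := by
    rintro _ ⟨x, hx, rfl⟩
    have := P.Nx (x := 1 - x) ⟨by linarith [hx.2], by linarith [hx.1]⟩
    simpa using this
  c_pos := P.c_pos
  hol j := (P.hol (-j)).comp (by fun_prop) fun ω h => h
  bil j ω h ω' h' := by
    have := P.bil (-j) _ h _ h'
    rwa [show 1 - ω - (1 - ω') = -(ω - ω') by ring, norm_neg] at this
  join j := by
    have := P.join (-(j + 1))
    simp only [sub_self, sub_zero]
    rw [this]; congr 2; abel
  disj i j x hx y hy h := by
    have := P.disj (-i) (-j) (1 - x) ⟨by linarith [hx.2], by linarith [hx.1]⟩ (1 - y) ⟨by linarith [hy.2], by linarith [hy.1]⟩ (by push_cast; exact h)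
    exact neg_injective this
  start i j h := by
    simp only [sub_zero, P.join] at h
    exact neg_injective (add_right_cancel (P.start _ _ h))
  onL j x hx := by
    have := P.onL (-j) (1 - x) ⟨by linarith [hx.2], by linarith [hx.1]⟩
    simpa using this
  cov t ht := by
    obtain ⟨j, x, hx, h⟩ := P.cov t ht
    exact ⟨-j, 1 - x, ⟨by linarith [hx.2], by linarith [hx.1]⟩, by simpa using h⟩
  ang j := by
    have := P.ang (-j + 1)
    rw [← P.join] at this
    simpa using this
  meas := by
    refine P.meas.trans ?_
    rw [← Equiv.sum_comp (Equiv.neg (Fin (P.n + 1)))]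
    exact Finset.sum_congr rfl fun j _ => (map_rev P.seg_sub (P.hol (-j))).symm
theorem toDat' (P : Pre G ν lam) (hF : IsCompact F) (hFG : F ⊆ G) : Nonempty (Dat G ν lam F) := by
  by_cases h : ∃ᶠ η in nhR, P.Or η
  · exact P.toDat h hF hFG
  · refine P.rev.toDat (Eventually.frequently ?_) hF hFG
    rw [not_frequently] at h
    filter_upwards [h, P.or_dich, P.rev.or_dich, self_mem_nhdsWithin] with η h1 h2 h3 hη
    refine h3.resolve_right fun h4 => P.not_both hη (-0) ⟨h2.resolve_left h1 _, fun ω hω => ?_⟩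
    have h5 := h4 0 (1 - ω) ⟨?_, ?_⟩
    · have e : P.rev.T 0 (1 - ω) = P.T (-0) ω := by simp only [rev, sub_sub_cancel]; rfl
      rwa [e] at h5
    · have := hω.1
      simp only [lens, mem_ofPred_eq] at this ⊢
      simpa [mul_comm] using this
    · simpa using hω.2
end Pre
structure Arc (γ : ℝ → ℂ) (a b : ℝ) (T : ℂ → ℂ) (ℓ : ℝ → ℝ) (N : Set ℂ) : Prop where
  op : IsOpen N
  sub : seg ⊆ N
  hol : DifferentiableOn ℂ T N
  inj : InjOn T N
  cont : ContinuousOn ℓ (Icc 0 1)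
  mono : StrictMonoOn ℓ (Icc 0 1)
  l0 : ℓ 0 = a
  l1 : ℓ 1 = b
  eq : ∀ x ∈ IcU, T x = γ (ℓ x)
variable {γ : ℝ → ℂ} {a b : ℝ} {T : ℂ → ℂ} {ℓ : ℝ → ℝ} {N : Set ℂ}
namespace Arc
variable (A : Arc γ a b T ℓ N)
lemma img {y : ℝ} (A : Arc γ a b T ℓ N) (hx : x ∈ IcU) (hy : y ∈ IcU) (hxy : x ≤ y) : ℓ '' Icc x y = Icc (ℓ x) (ℓ y) := by
  have hs : Icc x y ⊆ Icc 0 1 := Icc_subset_Icc hx.1 hy.2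
  refine Subset.antisymm ?_ (intermediate_value_Icc hxy (A.cont.mono hs))
  rintro _ ⟨u, hu, rfl⟩
  exact ⟨A.mono.monotoneOn hx (hs hu) hu.1, A.mono.monotoneOn (hs hu) hy hu.2⟩
lemma maps (A : Arc γ a b T ℓ N) (hx : x ∈ IcU) : ℓ x ∈ Icc a b := by
  rw [← A.l0, ← A.l1]
  exact ⟨A.mono.monotoneOn (by simp) hx hx.1, A.mono.monotoneOn hx (by simp) hx.2⟩
lemma lower (A : Arc γ a b T ℓ N) (hv : ∀ s t, a ≤ s → s ≤ t → t ≤ b → eVariationOn γ (Icc s t) = eoR (t - s))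
    {y : ℝ} (hx : x ∈ IcU) (hy : y ∈ IcU) (hxy : x ≤ y) : ‖T y - T x‖ ≤ ℓ y - ℓ x := by
  have hl := A.mono.monotoneOn hx hy hxy
  have h1 := eVariationOn.edist_le γ (s := Icc (ℓ x) (ℓ y)) (x := ℓ y) (y := ℓ x) ⟨hl, le_rfl⟩ ⟨le_rfl, hl⟩
  rw [hv _ _ (A.maps hx).1 hl (A.maps hy).2, ← A.eq x hx, ← A.eq y hy, edist_dist, dist_eq_norm] at h1
  exact (ENNReal.ofReal_le_ofReal_iff (by linarith)).1 h1
lemma upper (A : Arc γ a b T ℓ N) (hv : ∀ s t, a ≤ s → s ≤ t → t ≤ b → eVariationOn γ (Icc s t) = eoR (t - s))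
    {y M : ℝ} (hx : x ∈ IcU) (hy : y ∈ IcU) (hxy : x ≤ y) (hM0 : 0 ≤ M) (hM : ∀ u ∈ Icc x y, ‖deriv T u‖ ≤ M) : ℓ y - ℓ x ≤ M * (y - x) := by
  have hl := A.mono.monotoneOn hx hy hxy
  have hs : Icc x y ⊆ Icc 0 1 := Icc_subset_Icc hx.1 hy.2
  have hd : ∀ u ∈ Icc x y, HasDerivWithinAt (fun x : ℝ => T x) (deriv T u) (Icc x y) u := fun u hu =>
    ((A.hol.differentiableAt (A.op.mem_nhds (A.sub (mem_seg (hs hu))))).hasDerivAt.comp_ofReal).hasDerivWithinAt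
  have hL : LipschitzOnWith M.toNNReal (fun x : ℝ => T x) (Icc x y) := (convex_Icc x y).lipschitzOnWith_of_nnnorm_hasDerivWithin_le hd fun u hu => by
    rw [← NNReal.coe_le_coe, coe_nnnorm, Real.coe_toNNReal _ hM0]; exact hM u hu
  have h1 := hL.comp_eVariationOn_le (g := id) (mapsTo_id _)
  have h2 : eVariationOn (id : ℝ → ℝ) (Icc x y) ≤ eoR (y - x) := by
    have := (monotone_id.monotoneOn (Icc x y)).eVariationOn_le (left_mem_Icc.2 hxy) (right_mem_Icc.2 hxy)
    simpa using this
  have h3 : eVariationOn (fun x : ℝ => T x) (Icc x y) = eoR (ℓ y - ℓ x) := by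
    rw [← hv _ _ (A.maps hx).1 hl (A.maps hy).2, ← A.img hx hy hxy, ← eVariationOn.comp_eq_of_monotoneOn γ ℓ (A.mono.monotoneOn.mono hs)]
    exact eVariationOn.eq_of_eqOn fun u hu => A.eq u (hs hu)
  rw [Function.comp_id, h3] at h1
  have h4 := h1.trans (mul_le_mul_right h2 _)
  rw [← ENNReal.ofReal, ← ENNReal.ofReal_mul hM0] at h4
  exact (ENNReal.ofReal_le_ofReal_iff (mul_nonneg hM0 (by linarith))).1 h4
lemma deriv (A : Arc γ a b T ℓ N) (hv : ∀ s t, a ≤ s → s ≤ t → t ≤ b → eVariationOn γ (Icc s t) = eoR (t - s)) (hx : x ∈ IcU) : HasDerivWithinAt ℓ ‖_root_.deriv T x‖ (Icc 0 1) x := by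
  have lo : ∀ y ∈ IcU, y ≠ x → ‖slope (fun x : ℝ => T x) x y‖ ≤ slope ℓ x y := fun y hy hne => by
    rw [slope_def_module, slope_def_field, norm_smul, norm_inv, Real.norm_eq_abs, ← div_eq_inv_mul]
    rcases lt_or_gt_of_ne hne with h | h
    · rw [abs_of_neg (by linarith), ← neg_div_neg_eq (ℓ y - ℓ x), norm_sub_rev]
      gcongr
      · linarith
      · have := A.lower hv hy hx h.le; linarith
    · rw [abs_of_pos (by linarith)]
      gcongr
      exact A.lower hv hx hy h.le
  have hN := A.sub (mem_seg hx)
  have hT := (A.hol.differentiableAt (A.op.mem_nhds hN)).hasDerivAt.comp_ofReal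
  rw [hasDerivWithinAt_iff_tendsto_slope]
  have hmem : ∀ᶠ y in 𝓝[Icc 0 1 \ {x}] x, y ∈ IcU \ {x} := self_mem_nhdsWithin
  refine tendsto_order.2 ⟨fun c hc => ?_, fun c hc => ?_⟩
  · have h1 := hT.tendsto_slope.norm.mono_left (nhdsWithin_mono x (fun y (hy : y ∈ IcU \ {x}) => hy.2))
    filter_upwards [h1.eventually (lt_mem_nhds hc), hmem] with y h2 h3
    exact h2.trans_le (lo y h3.1 h3.2)
  · obtain ⟨c', h1, h2⟩ := exists_between hc
    have hc' : 0 ≤ c' := (norm_nonneg _).trans h1.le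
    have hcont : ContinuousAt (fun u : ℝ => ‖_root_.deriv T u‖) x :=
      ((((A.hol.deriv A.op).continuousOn.continuousAt (A.op.mem_nhds hN))).comp continuous_ofReal.continuousAt).norm
    obtain ⟨ε, hε, hb⟩ := Metric.eventually_nhds_iff_ball.1 (hcont.eventually (gt_mem_nhds h1))
    filter_upwards [nhdsWithin_le_nhds (ball_mem_nhds x hε), hmem] with y h3 h4
    refine lt_of_le_of_lt ?_ h2
    have hconv := (convex_ball x ε).ordConnected
    rw [slope_def_field]
    rcases lt_or_gt_of_ne h4.2 with h | h
    · have := A.upper hv h4.1 hx h.le hc' fun u hu => (hb u (hconv.out h3 (mem_ball_self hε) hu)).le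
      rw [div_le_iff_of_neg (by linarith)]; linarith
    · have := A.upper hv hx h4.1 h.le hc' fun u hu => (hb u (hconv.out (mem_ball_self hε) h3 hu)).le
      rw [div_le_iff₀ (by linarith)]; linarith
lemma meas (A : Arc γ a b T ℓ N) (hγ : Continuous γ) (hv : ∀ s t, a ≤ s → s ≤ t → t ≤ b → eVariationOn γ (Icc s t) = eoR (t - s)) :
    Measure.map (fun x : ℝ => T x) ((voU).withDensity (fun x => ‖_root_.deriv T x‖ₑ)) = Measure.map γ (volume.restrict (Ioc a b)) := by
  have h := map_withDensity_abs_det_fderiv_eq_addHaar volume (measurableSet_Icc (a := (0:ℝ)) (b := 1)).nullMeasurableSet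
    (fun x hx => (A.deriv hv hx).hasFDerivWithinAt) A.mono.injOn
  rw [A.img (by simp) (by simp) zero_le_one, A.l0, A.l1] at h
  have e : (fun x : ℝ => eoR |(ContinuousLinearMap.toSpanSingleton ℝ ‖_root_.deriv T x‖).det|) = fun x : ℝ => ‖_root_.deriv T x‖ₑ := by
    funext x
    rw [ContinuousLinearMap.det_toSpanSingleton, abs_norm, ofReal_norm]
  rw [e] at h
  have hac := withDensity_absolutelyContinuous voU (fun x : ℝ => ‖_root_.deriv T x‖ₑ)
  rw [Measure.restrict_congr_set Ioc_ae_eq_Icc, ← h, AEMeasurable.map_map_of_aemeasurable hγ.measurable.aemeasurable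
    ((A.cont.aemeasurable measurableSet_Icc).mono_ac hac)]
  refine Measure.map_congr (hac.ae_le ?_)
  filter_upwards [ae_restrict_mem measurableSet_Icc] with x hx
  exact A.eq x hx
end Arc
lemma J_inj (J : JordanDomain) {s t : ℝ} (h : J.γ s = J.γ t) (hd : |s - t| < J.l) : s = t := by
  have e : ∀ s, J.γ (toIcoMod J.l_pos 0 s) = J.γ s := fun s => J.γ_periodic.sub_zsmul_eq _
  have m : ∀ s, toIcoMod J.l_pos 0 s ∈ Ico 0 J.l := fun s => by simpa using toIcoMod_mem_Ico J.l_pos 0 s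
  have h1 := J.γ_injOn (m s) (m t) (by rw [e, e, h])
  obtain ⟨k, hk⟩ := (toIcoMod_eq_toIcoMod J.l_pos).1 h1
  rw [zsmul_eq_mul] at hk
  rw [abs_sub_comm, hk, abs_mul, abs_of_pos J.l_pos] at hd
  have h2 : |(k:ℝ)| < 1 := by
    by_contra h3; push Not at h3; nlinarith [J.l_pos]
  have h3 : |k| < 1 := by exact_mod_cast h2
  rw [Int.abs_lt_one_iff.1 h3] at hk
  simp at hk; linarith
lemma J_mem (J : JordanDomain) (s : ℝ) : J.γ s ∈ frontier J.G := by
  rw [← J.γ_boundary]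
  exact ⟨toIcoMod J.l_pos 0 s, by simpa using toIcoMod_mem_Ico J.l_pos 0 s, J.γ_periodic.sub_zsmul_eq _⟩
lemma J_surj (J : JordanDomain) (t₀ : ℝ) (hz : z ∈ frontier J.G) : ∃ s ∈ Ico t₀ (t₀ + J.l), J.γ s = z := by
  rw [← J.γ_boundary] at hz
  obtain ⟨s, -, rfl⟩ := hz
  exact ⟨toIcoMod J.l_pos t₀ s, toIcoMod_mem_Ico J.l_pos t₀ s, J.γ_periodic.sub_zsmul_eq _⟩
lemma gap1 (J : JordanDomain) {E : Set ℂ} (hE : E.Finite) {τ : ℂ → ℂ} {U : Set ℂ} (hU : IsOpen U) (hsU : seg ⊆ U)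
    (hol : DifferentiableOn ℂ τ U) (inj : InjOn τ U) (hL : ∀ x ∈ IcU, τ x ∈ frontier J.G)
    (h0 : τ 0 ∈ E) (h1 : τ 1 ∈ E) {a₀ b₀ : ℝ} (hab : b₀ < a₀ + J.l) (ha : J.γ a₀ ∈ E) (hb : J.γ b₀ ∈ E)
    (hgap : ∀ s ∈ Ioo a₀ b₀, J.γ s ∉ E) {s x₀ : ℝ} (hs : s ∈ Ioo a₀ b₀) (hx₀ : x₀ ∈ IcU) (hsx : J.γ s = τ x₀) :
    ∃ T ℓ N, Arc J.γ a₀ b₀ T ℓ N := by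
  have hτi : InjOn (fun x : ℝ => τ x) (Icc 0 1) := fun x hx y hy h => by
    exact_mod_cast inj (hsU (mem_seg hx)) (hsU (mem_seg hy)) h
  have hτc : ContinuousOn (fun x : ℝ => τ x) (Icc 0 1) :=
    hol.continuousOn.comp continuous_ofReal.continuousOn fun x hx => hsU (mem_seg hx)
  have hZ : {x ∈ IcU | τ x ∈ E}.Finite :=
    Finite.of_finite_image (f := fun x : ℝ => τ x) (hE.subset (by rintro _ ⟨x, hx, rfl⟩; exact hx.2)) (hτi.mono fun x hx => hx.1)
  have hx0E : τ x₀ ∉ E := hsx ▸ hgap s hs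
  obtain ⟨a, ⟨⟨haI, haE⟩, hax⟩, hamax⟩ := (hZ.inter_of_left (Iic x₀)).exists_maximal (show ({x ∈ IcU | τ x ∈ E} ∩ Iic x₀).Nonempty from ⟨0, ⟨by simp, by simpa using h0⟩, hx₀.1⟩)
  obtain ⟨b, ⟨⟨hbI, hbE⟩, hbx⟩, hbmin⟩ := (hZ.inter_of_left (Ici x₀)).exists_minimal (show ({x ∈ IcU | τ x ∈ E} ∩ Ici x₀).Nonempty from ⟨1, ⟨by simp, by simpa using h1⟩, hx₀.2⟩)
  have hax' : a < x₀ := lt_of_le_of_ne hax (by rintro rfl; exact hx0E haE)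
  have hbx' : x₀ < b := lt_of_le_of_ne hbx (by rintro rfl; exact hx0E hbE)
  have hablt := hax'.trans hbx'
  have hI : Icc a b ⊆ Icc 0 1 := Icc_subset_Icc haI.1 hbI.2
  have hno : ∀ x ∈ Ioo a b, τ x ∉ E := fun x hx hxE => by
    have hxI := hI (Ioo_subset_Icc_self hx)
    rcases le_total x x₀ with h | h
    · exact absurd (hamax ⟨⟨hxI, hxE⟩, h⟩ hx.1.le) (not_le.2 hx.1)
    · exact absurd (hbmin ⟨⟨hxI, hxE⟩, h⟩ hx.2.le) (not_le.2 hx.2)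
  have hc1 : IsClosed (J.γ '' Icc a₀ b₀) := (isCompact_Icc.image J.γ_cont).isClosed
  have hc2 : IsClosed (J.γ '' Icc b₀ (a₀ + J.l)) := (isCompact_Icc.image J.γ_cont).isClosed
  have hper : J.γ (a₀ + J.l) = J.γ a₀ := J.γ_periodic a₀
  have hint : ∀ u ∈ Icc a₀ b₀, ∀ v ∈ Icc b₀ (a₀ + J.l), J.γ u = J.γ v → J.γ u ∈ E := fun u hu v hv h => by
    by_contra hu'
    have e1 : u ≠ a₀ := by rintro rfl; exact hu' ha
    have e2 : u ≠ b₀ := by rintro rfl; exact hu' hb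
    have e3 : a₀ < u := lt_of_le_of_ne hu.1 e1.symm
    have e4 : u < b₀ := lt_of_le_of_ne hu.2 e2
    have := J_inj J h (by rw [abs_lt]; constructor <;> linarith [hv.1, hv.2])
    linarith [hv.1]
  have hpc : IsPreconnected ((fun x : ℝ => τ x) '' Ioo a b) := isPreconnected_Ioo.image _ (hτc.mono (Ioo_subset_Icc_self.trans hI))
  have hsub : (fun x : ℝ => τ x) '' Ioo a b ⊆ J.γ '' Icc a₀ b₀ := by
    refine (isPreconnected_iff_subset_of_disjoint_closed.1 hpc _ _ hc1 hc2 ?_ ?_).resolve_right fun h => ?_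
    · rintro _ ⟨x, hx, rfl⟩
      obtain ⟨u, hu, hux⟩ := J_surj J a₀ (hL x (hI (Ioo_subset_Icc_self hx)))
      rcases le_total u b₀ with h | h
      · exact Or.inl ⟨u, ⟨hu.1, h⟩, hux⟩
      · exact Or.inr ⟨u, ⟨h, hu.2.le⟩, hux⟩
    · rw [eq_empty_iff_forall_notMem]
      rintro _ ⟨⟨x, hx, rfl⟩, ⟨u, hu, h1⟩, v, hv, h2⟩
      exact hno x hx ((show J.γ u = τ x from h1) ▸ hint u hu v hv (h1.trans h2.symm))
    · obtain ⟨v, hv, h2⟩ := h ⟨x₀, ⟨hax', hbx'⟩, rfl⟩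
      exact hx0E (hsx ▸ hint s (Ioo_subset_Icc_self hs) v hv (hsx.trans h2.symm))
  have hsub' : ∀ x ∈ Icc a b, ∃ u ∈ Icc a₀ b₀, J.γ u = τ x := by
    have h2 : MapsTo (fun x : ℝ => τ x) (closure (Ioo a b)) (closure (J.γ '' Icc a₀ b₀)) :=
      MapsTo.closure_of_continuousOn (fun x hx => hsub ⟨x, hx, rfl⟩) (by rw [closure_Ioo hablt.ne]; exact hτc.mono hI)
    rw [closure_Ioo hablt.ne, hc1.closure_eq] at h2
    exact fun x hx => h2 hx
  choose! ψ hψ hψe using hsub'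
  have hγi : InjOn J.γ (Icc a₀ b₀) := fun u hu v hv h => J_inj J h (by rw [abs_lt]; constructor <;> linarith [hu.1, hu.2, hv.1, hv.2])
  have hψc : ContinuousOn ψ (Icc a b) := by
    have hem : IsClosedEmbedding ((Icc a₀ b₀).domRestrict J.γ) :=
      Continuous.isClosedEmbedding (J.γ_cont.comp continuous_subtype_val) (injOn_iff_injective.1 hγi)
    have : Continuous (fun x : Icc a b => (⟨ψ x, hψ x x.2⟩ : Icc a₀ b₀)) := by
      rw [hem.isInducing.continuous_iff]
      refine (continuousOn_iff_continuous_domRestrict.1 (hτc.mono hI)).congr fun x => ?_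
      exact (hψe x x.2).symm
    exact continuousOn_iff_continuous_domRestrict.2 (continuous_subtype_val.comp this)
  have hψi : InjOn ψ (Icc a b) := fun x hx y hy h => hτi (hI hx) (hI hy) (by
    show τ x = τ y
    rw [← hψe x hx, ← hψe y hy, h])
  have hend : ∀ x ∈ Icc a b, τ x ∈ E → ψ x = a₀ ∨ ψ x = b₀ := fun x hx hxE => by
    by_contra h; push Not at h
    have := hψ x hx
    exact hgap (ψ x) ⟨lt_of_le_of_ne this.1 h.1.symm, lt_of_le_of_ne this.2 h.2⟩ (by rw [hψe x hx]; exact hxE)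
  have hla : a ∈ Icc a b := left_mem_Icc.2 hablt.le
  have hrb : b ∈ Icc a b := right_mem_Icc.2 hablt.le
  have ea := hend a hla haE
  have eb := hend b hrb hbE
  have fin : ∀ p q : ℝ, p ∈ Icc a b → q ∈ Icc a b → p ≠ q → ψ p = a₀ → ψ q = b₀ →
      StrictMonoOn (fun x => ψ (p + (q - p) * x)) (Icc 0 1) → ∃ T ℓ N, Arc J.γ a₀ b₀ T ℓ N := fun p q hp hq hpq h1 h2 h3 => by
    have hm : ∀ x ∈ IcU, p + (q - p) * x ∈ Icc a b := fun x hx =>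
      ⟨by nlinarith [hp.1, hq.1, hx.1, hx.2], by nlinarith [hp.2, hq.2, hx.1, hx.2]⟩
    have hqp : (q:ℂ) - p ≠ 0 := by rw [sub_ne_zero]; exact_mod_cast hpq.symm
    have hcont : Continuous fun ω : ℂ => (p:ℂ) + (q - p) * ω := by fun_prop
    have hd : Differentiable ℂ fun ω : ℂ => (p:ℂ) + (q - p) * ω := by fun_prop
    refine ⟨fun ω => τ (p + (q - p) * ω), fun x => ψ (p + (q - p) * x), (fun ω : ℂ => (p:ℂ) + (q - p) * ω) ⁻¹' U,
      hU.preimage hcont, ?_, ?_, ?_, ?_, h3, by simpa using h1, by simpa using h2, ?_⟩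
    · rintro _ ⟨x, hx, rfl⟩
      have := hsU (mem_seg (hI (hm x hx)))
      push_cast at this; exact this
    · exact hol.comp hd.differentiableOn fun ω hω => hω
    · intro ω hω ω' hω' h
      have := inj hω hω' h
      exact mul_left_cancel₀ hqp (by simpa using this)
    · exact hψc.comp (by fun_prop) hm
    · intro x hx
      have := hψe _ (hm x hx)
      push_cast at this
      exact this.symm
  rcases hψc.strictMonoOn_of_injOn_Icc' hablt.le hψi with hm | hm
  · have h2 := hm hla hrb hablt
    have e1 : ψ a = a₀ := ea.resolve_right fun h => by rw [h] at h2; linarith [(hψ b hrb).2]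
    have e2 : ψ b = b₀ := eb.resolve_left fun h => by rw [h] at h2; linarith [(hψ a hla).1]
    refine fin a b hla hrb hablt.ne e1 e2 fun x hx y hy hxy => hm ⟨?_, ?_⟩ ⟨?_, ?_⟩ ?_ <;> nlinarith [hx.1, hx.2, hy.1, hy.2]
  · have h2 := hm hla hrb hablt
    have e1 : ψ a = b₀ := ea.resolve_left fun h => by rw [h] at h2; linarith [(hψ b hrb).1]
    have e2 : ψ b = a₀ := eb.resolve_right fun h => by rw [h] at h2; linarith [(hψ a hla).2]
    refine fin b a hrb hla hablt.ne' e2 e1 fun x hx y hy hxy => hm ⟨?_, ?_⟩ ⟨?_, ?_⟩ ?_ <;> nlinarith [hx.1, hx.2, hy.1, hy.2]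
lemma exists_part (S : Finset ℝ) {t₀ t₁ : ℝ} (h0 : t₀ ∈ S) (hS : ∀ s ∈ S, s ∈ Ico t₀ t₁) : ∃ (n : ℕ) (σ : ℕ → ℝ), n + 1 = S.card ∧ σ 0 = t₀ ∧ σ (n + 1) = t₁ ∧
    StrictMonoOn σ (Iic (n + 1)) ∧ (∀ k ≤ n, σ k ∈ S) ∧ ∀ s ∈ S, ∃ k ≤ n, σ k = s := by
  obtain ⟨n, hn⟩ : ∃ n, n + 1 = S.card := ⟨S.card - 1, by have := Finset.card_pos.2 ⟨_, h0⟩; omega⟩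
  let e := S.orderEmbOfFin hn.symm
  let σ : ℕ → ℝ := fun k => if h : k < n + 1 then e ⟨k, h⟩ else t₁
  have hσ : ∀ k (h : k < n + 1), σ k = e ⟨k, h⟩ := fun k h => by simp only [σ, dif_pos h]
  have hσl : σ (n + 1) = t₁ := by simp [σ]
  have hmem : ∀ k ≤ n, σ k ∈ S := fun k hk => by rw [hσ k (by omega)]; exact S.orderEmbOfFin_mem hn.symm _
  have hall : ∀ s ∈ S, ∃ k ≤ n, σ k = s := fun s hs => by
    have : s ∈ range e := by rw [Finset.range_orderEmbOfFin]; exact hs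
    obtain ⟨k, hk⟩ := this
    exact ⟨k, by omega, by rw [hσ k k.2]; exact hk⟩
  have hmono : StrictMonoOn σ (Iic (n + 1)) := fun i hi j hj hij => by
    have hj' : j ≤ n + 1 := hj
    rcases hj'.lt_or_eq with h | h
    · rw [hσ i (hij.trans h), hσ j h]
      exact e.strictMono hij
    · subst h; rw [hσl]; exact (hS _ (hmem i (by omega))).2
  refine ⟨n, σ, hn, ?_, hσl, hmono, hmem, hall⟩
  obtain ⟨k, hk, hk'⟩ := hall _ h0
  have h1 := hmono.monotoneOn (a := 0) (b := k) (by simp) (by simp; omega) (Nat.zero_le _)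
  exact le_antisymm (h1.trans hk'.le) (hS _ (hmem 0 (Nat.zero_le _))).1
lemma meas_shift (J : JordanDomain) (t₀ : ℝ) : nuJ J = Measure.map J.γ (volume.restrict (Ioc t₀ (t₀ + J.l))) := by
  have : Fact (0 < J.l) := ⟨J.l_pos⟩
  have key : ∀ a, Measure.map J.γ (volume.restrict (Ioc a (a + J.l))) = Measure.map (J.γ_periodic.lift : AddCircle J.l → ℂ) volume := fun a => by
    have hc : Continuous (J.γ_periodic.lift : AddCircle J.l → ℂ) := continuous_coinduced_dom.2 (by
      refine J.γ_cont.congr fun x => ?_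
      exact (J.γ_periodic.lift_coe x).symm)
    rw [← (AddCircle.measurePreserving_mk J.l a).map_eq, Measure.map_map hc.measurable (AddCircle.measurePreserving_mk J.l a).measurable]
    congr 1
  rw [key, ← key 0, zero_add, nuJ]
lemma meas_split {γ : ℝ → ℂ} (hγ : Continuous γ) {σ : ℕ → ℝ} {n : ℕ} (hσ : StrictMonoOn σ (Iic n)) :
    ∀ k ≤ n, Measure.map γ (volume.restrict (Ioc (σ 0) (σ k))) = ∑ j ∈ Finset.range k, Measure.map γ (volume.restrict (Ioc (σ j) (σ (j + 1)))) := by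
  intro k
  induction k with
  | zero => simp
  | succ k ih =>
    intro hk
    have h1 : σ 0 ≤ σ k := hσ.monotoneOn (by simp) (by simp; omega) (Nat.zero_le _)
    have h2 : σ k ≤ σ (k + 1) := hσ.monotoneOn (by simp; omega) (by simpa using hk) (by omega)
    rw [Finset.sum_range_succ, ← ih (by omega), ← Measure.map_add _ _ hγ.measurable, ← Measure.restrict_union (Ioc_disjoint_Ioc_of_le le_rfl) measurableSet_Ioc,
      Ioc_union_Ioc_eq_Ioc h1 h2]
lemma part_cov {σ : ℕ → ℝ} {s : ℝ} : ∀ k, s ∈ Ico (σ 0) (σ k) → ∃ j < k, s ∈ Ico (σ j) (σ (j + 1)) := by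
  intro k
  induction k with
  | zero => simp
  | succ k ih =>
    intro h
    rcases lt_or_ge s (σ k) with h1 | h1
    · obtain ⟨j, hj, h2⟩ := ih ⟨h.1, h1⟩
      exact ⟨j, by omega, h2⟩
    · exact ⟨k, by omega, h1, h.2⟩
open Fin.CommRing in
theorem geom (J : JordanDomain) (B : PiecewiseAnalyticBoundary J) {lam : ℝ} (hl0 : 0 < lam) (hl2 : lam < 2)
    (hmin : ∀ i, lam ≤ B.extAngle i) {F : Set ℂ} (hF : IsCompact F) (hFG : F ⊆ J.G) : Nonempty (Dat J.G (nuJ J) lam F) := by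
  have hlp := J.l_pos
  let E : Set ℂ := range fun i => B.τ i 1
  have hE : E.Finite := finite_range _
  have h1E : ∀ i, B.τ i 1 ∈ E := fun i => ⟨i, rfl⟩
  have h0E : ∀ i, B.τ i 0 ∈ E := fun i => by
    refine ⟨⟨(i.val + (B.m - 1)) % B.m, Nat.mod_lt _ B.m_pos⟩, ?_⟩
    simp only
    rw [B.junction]
    congr 2
    have := i.2
    simp only [Nat.mod_add_mod]
    rw [show i.val + (B.m - 1) + 1 = i.val + B.m by omega, Nat.add_mod_right, Nat.mod_eq_of_lt this]
  have hL : ∀ i, ∀ x ∈ IcU, B.τ i x ∈ frontier J.G := fun i x hx => by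
    rw [← B.cover]; exact mem_iUnion.2 ⟨i, x, mem_seg hx, rfl⟩
  have hEL : ∀ z ∈ E, z ∈ frontier J.G := by
    rintro _ ⟨i, rfl⟩; simpa using hL i 1 (by simp)
  let i₀ : Fin B.m := ⟨0, B.m_pos⟩
  obtain ⟨t₀, -, ht₀⟩ := J_surj J 0 (hEL _ (h1E i₀))
  have hper : J.γ (t₀ + J.l) = J.γ t₀ := J.γ_periodic t₀
  have hinj : InjOn J.γ (Ico t₀ (t₀ + J.l)) := fun u hu v hv h => J_inj J h (by rw [abs_lt]; constructor <;> linarith [hu.1, hu.2, hv.1, hv.2])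
  have hSf : {s ∈ Ico t₀ (t₀ + J.l) | J.γ s ∈ E}.Finite :=
    Finite.of_finite_image (f := J.γ) (hE.subset (by rintro _ ⟨x, hx, rfl⟩; exact hx.2)) (hinj.mono fun x hx => hx.1)
  have hS : ∀ s, s ∈ hSf.toFinset ↔ s ∈ Ico t₀ (t₀ + J.l) ∧ J.γ s ∈ E := fun s => by rw [Finite.mem_toFinset]; rfl
  have ht₀S : t₀ ∈ hSf.toFinset := (hS _).2 ⟨⟨le_rfl, by linarith⟩, ht₀ ▸ h1E i₀⟩
  obtain ⟨n, σ, hn, hσ0, hσl, hσm, hσS, hσc⟩ := exists_part hSf.toFinset ht₀S (fun s hs => ((hS s).1 hs).1)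
  have hn1 : 1 ≤ n := by
    obtain ⟨u, hu, hu'⟩ := J_surj J t₀ (hEL _ (h0E i₀))
    have huS : u ∈ hSf.toFinset := (hS _).2 ⟨hu, hu' ▸ h0E i₀⟩
    have hne : u ≠ t₀ := fun h => by
      have h2 : B.τ i₀ 0 = B.τ i₀ 1 := by rw [← hu', ← ht₀, h]
      exact zero_ne_one (B.inj i₀ (B.seg_sub i₀ zero_seg) (B.seg_sub i₀ one_seg) h2)
    have := Finset.one_lt_card.2 ⟨u, huS, t₀, ht₀S, hne⟩
    omega
  have hlt : ∀ i j, j ≤ n + 1 → i < j → σ i < σ j := fun i j hj hij => hσm (by simp; omega) (by simpa using hj) hij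
  have hle : ∀ i j, j ≤ n + 1 → i ≤ j → σ i ≤ σ j := fun i j hj hij => hσm.monotoneOn (by simp; omega) (by simpa using hj) hij
  have hσE : ∀ k ≤ n + 1, J.γ (σ k) ∈ E := fun k hk => by
    rcases hk.lt_or_eq with h | h
    · exact ((hS _).1 (hσS k (by omega))).2
    · rw [h, hσl, hper, ht₀]; exact h1E i₀
  have hgl : ∀ k ≤ n, σ (k + 1) < σ k + J.l := fun k hk => by
    rcases Nat.eq_zero_or_pos k with h | h
    · have := hlt 1 (n + 1) le_rfl (by omega)
      rw [h, hσ0]; linarith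
    · have := hlt 0 k (by omega) h
      have := hle (k + 1) (n + 1) le_rfl (by omega)
      linarith
  have harc : ∀ j : Fin (n + 1), ∃ T ℓ N, Arc J.γ (σ j) (σ (j + 1 : ℕ)) T ℓ N := fun j => by
    have hj := j.2
    have hj1 := hlt j (j + 1) (by omega) (by omega)
    have hgap : ∀ s ∈ Ioo (σ j) (σ (j + 1 : ℕ)), J.γ s ∉ E := fun s hs hsE => by
      have hs' : s ∈ Ico t₀ (t₀ + J.l) := ⟨by linarith [hle 0 j (by omega) (by omega), hs.1], by linarith [hle (j + 1) (n + 1) le_rfl (by omega), hs.2]⟩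
      obtain ⟨k, hk, rfl⟩ := hσc s ((hS s).2 ⟨hs', hsE⟩)
      rcases Nat.lt_or_ge (j : ℕ) k with h | h
      · linarith [hle (j + 1) k (by omega) h, hs.2]
      · linarith [hle k j (by omega) h, hs.1]
    obtain ⟨s, hs⟩ := exists_between hj1
    have := J_mem J s
    rw [← B.cover] at this
    obtain ⟨i, _, ⟨x₀, hx₀, rfl⟩, hx⟩ := mem_iUnion.1 this
    exact gap1 J hE (B.U_open i) (B.seg_sub i) (B.analytic i) (B.inj i) (hL i) (h0E i) (h1E i) (hgl j (by omega))
      (hσE _ (by omega)) (hσE _ (by omega)) hgap hs hx₀ hx.symm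
  choose T ℓ N A using harc
  choose c hc V hVo hVs hVN hbil using fun j => bil_nhd (A j).op (A j).hol (A j).inj seg_compact (A j).sub
  have hT0 : ∀ j, T j 0 = J.γ (σ j) := fun j => by rw [← (A j).l0, ← (A j).eq 0 (by simp)]; simp
  have hT1 : ∀ j, T j 1 = J.γ (σ (j + 1 : ℕ)) := fun j => by rw [← (A j).l1, ← (A j).eq 1 (by simp)]; simp
  obtain ⟨c', hc', hcc⟩ : ∃ c' > 0, ∀ j, c' ≤ c j := by
    obtain ⟨i, hi⟩ := Finite.exists_min c
    exact ⟨c i, hc i, hi⟩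
  refine Pre.toDat' (lam := lam) ⟨n, T, ⋂ j, V j, c', hl0, hl2, J.isOpen, J.connected.isPreconnected, J.nonempty, J.bounded,
    isOpen_iInter_of_finite hVo, subset_iInter hVs, hc', ?_, ?_, ?_, ?_, ?_, ?_, ?_, ?_, ?_⟩ hF hFG
  · exact fun j => (A j).hol.mono ((iInter_subset _ j).trans (hVN j))
  · exact fun j ω hω ω' hω' => (mul_le_mul_of_nonneg_right (hcc j) (norm_nonneg _)).trans (hbil j ω (mem_iInter.1 hω j) ω' (mem_iInter.1 hω' j))
  · intro j
    rw [hT0, hT1, Fin.val_add_one]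
    split_ifs with h
    · rw [h, Fin.val_last, hσl, hσ0, hper]
    · rfl
  · intro i j x hx y hy h
    have hi := i.2
    have hj := j.2
    rw [(A i).eq x (Ioo_subset_Icc_self hx), (A j).eq y hy] at h
    have h1 := (A i).mono (show (0:ℝ) ∈ Icc 0 1 by simp) (Ioo_subset_Icc_self hx) hx.1
    have h2 := (A i).mono (Ioo_subset_Icc_self hx) (show (1:ℝ) ∈ Icc 0 1 by simp) hx.2
    rw [(A i).l0] at h1; rw [(A i).l1] at h2
    have h3 := (A j).maps hy
    have h4 := hle 0 i (by omega) (by omega)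
    have h5 := hle 0 j (by omega) (by omega)
    have h6 := hle (i + 1) (n + 1) le_rfl (by omega)
    have h7 := hle (j + 1) (n + 1) le_rfl (by omega)
    have h8 := J_inj J h (by rw [abs_lt]; constructor <;> linarith [h3.1, h3.2])
    by_contra hne
    rcases lt_or_gt_of_ne hne with hlt' | hlt'
    · have := hle (i + 1) j (by omega) hlt'; linarith [h3.1]
    · have := hle (j + 1) i (by omega) hlt'; linarith [h3.2]
  · intro i j h
    have hi := i.2
    have hj := j.2
    rw [hT0, hT0] at h
    have := hinj ((hS _).1 (hσS i (by omega))).1 ((hS _).1 (hσS j (by omega))).1 h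
    exact Fin.ext (hσm.injOn (by simp) (by simp) this)
  · intro j x hx
    rw [(A j).eq x hx]; exact J_mem J _
  · intro z hz
    obtain ⟨s, hs, rfl⟩ := J_surj J t₀ hz
    obtain ⟨j, hj, h1⟩ := part_cov (σ := σ) (n + 1) (by rw [hσ0, hσl]; exact hs)
    have h2 : s ∈ ℓ ⟨j, hj⟩ '' Icc 0 1 := by
      rw [(A ⟨j, hj⟩).img (by simp) (by simp) zero_le_one, (A _).l0, (A _).l1]
      exact Ico_subset_Icc_self h1
    obtain ⟨x, hx, rfl⟩ := h2
    exact ⟨⟨j, hj⟩, x, hx, (A _).eq x hx⟩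
  · intro j
    have hj := j.2
    obtain ⟨i, hi⟩ := hσE j (by omega)
    refine ⟨B.extAngle i * π, mul_le_mul_of_nonneg_right (hmin i) Real.pi_pos.le, mul_lt_mul_of_pos_right (B.extAngle_mem i).2 Real.pi_pos, ?_⟩
    rw [hT0, ← hi, ← sub_mul]
    exact B.extAngle_spec i
  · rw [meas_shift J t₀, ← hσl, ← hσ0, meas_split J.γ_cont hσm (n + 1) le_rfl, Finset.sum_range]
    refine Finset.sum_congr rfl fun j _ => ?_
    have hj := j.2
    have := hgl j (by omega)
    exact ((A j).meas J.γ_cont fun s t h1 h2 h3 => J.γ_unitSpeed s t h2 (by linarith)).symm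
end SZ
end
/-- Theorem 1.2. Let `∂G` be piecewise analytic with smallest exterior
angle `λπ`, `0 < λ < 2`, and let `F ⊆ G` be compact. Then there is `C₁(G,F) > 0` such
that for all `ζ ∈ F` and all `n ≥ 1`,
`‖K(·,ζ) - Σ_{k=0}^n conj(p_k(ζ))p_k(·)‖₂ ≤ C₁(G,F)·n^{-λ/(4-2λ)}`.
Here `Kb ζ` is the nontangential boundary trace of the Szegő kernel `K(·,ζ)`. -/
theorem szegoKernel_partialSum_rate
    (D : JordanDomain) (B : PiecewiseAnalyticBoundary D)
    (lam : ℝ) (hlam0 : 0 < lam) (hlam2 : lam < 2)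
    (hmin : ∀ i, lam ≤ B.extAngle i) (hattained : ∃ i, B.extAngle i = lam)
    (p : ℕ → Polynomial ℂ) (hp : D.IsONPolys p)
    (F : Set ℂ) (hF : IsCompact F) (hFG : F ⊆ D.G)
    (Kb : ℂ → ℝ → ℂ)
    (hKb : ∀ ζ ∈ F, ∀ᵐ s ∂(volume.restrict (Ioc (0 : ℝ) D.l)),
      NTLim D.G (szegoKernel p ζ) (D.γ s) (Kb ζ s)) :
    ∃ C : ℝ, 0 < C ∧ ∀ ζ ∈ F, ∀ n : ℕ, 0 < n →
      D.bnorm (fun s => Kb ζ s - partialSum p ζ n (D.γ s)) ≤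
        C * (n : ℝ) ^ (-(lam / (4 - 2 * lam))) := by
  obtain ⟨Dt⟩ := SZ.geom D B hlam0 hlam2 hmin hF hFG
  exact SZ.transfer D hlam0 hlam2 p hp Dt Kb hKb
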